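/- Stability for separated boundary data (Corollary 4.2). Let B ⊂ ℝ^n and Ω be bounded domains with C^4 boundaries such that closure(Ω) ⊂ B; set S = ∂B, Γ = ∂Ω, Q = (0,T) × B, Σ = (0,T) × S and Σ₀ = (0,T) × Γ, where T > 0. Fix α, β > 0 and 𝔤₀ ∈ C^1([0,T]). Then there exists a constant C > 0 (depending only on g, T, B, Ω, α, β and 𝔤₀) such that: for every 𝔤₁ on S that is the restriction to S of a C^1 function, such that the function 𝔤(t,x) := 𝔤₀(t)𝔤₁(x) satisfies |𝔤| ≥ α and |∂_t 𝔤| + |∇_τ 𝔤| ≤ β everywhere on Σ, and for every function u on [0,T] × closure(B) which together with ∂_t u and all spatial derivatives up to order 2 is continuous on [0,T] × closure(B), solves ∂_t u − Δ_g u = 0 in Q and equals 𝔤 on Σ, one has (∫_S (|𝔤₁|^2 + |∇_τ 𝔤₁|^2) dH^{n−1})^{1/2} ≤ C [ (∫_{Σ₀} (|u|^2 + |∂_t u|^2 + |∇_τ u|^2) dH^{n−1} dt)^{1/2} + (∫_{Σ₀} |∂_ν u|^2 dH^{n−1} dt)^{1/2} ], where ν is the outward unit normal to Γ. -/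

import Mathlib

open MeasureTheory Set
open scoped Topology RealInnerProductSpace

noncomputable section

/-- Euclidean space `ℝ^n`. -/
abbrev Eucl (n : ℕ) : Type := EuclideanSpace ℝ (Fin n)

variable {n : ℕ}

/-- `i`-th partial derivative `∂_i u`. -/
def pd (u : Eucl n → ℝ) (i : Fin n) (x : Eucl n) : ℝ :=
  fderiv ℝ u x (EuclideanSpace.single i 1)

/-- Laplace–Beltrami operator
`Δ_g u = |g|^{-1/2} ∂_i (|g|^{1/2} g^{ij} ∂_j u)` (with `(g^{ij}) = (g_{ij})⁻¹`). -/
def LapBel (g : Eucl n → Matrix (Fin n) (Fin n) ℝ) (u : Eucl n → ℝ) (x : Eucl n) : ℝ :=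
  (Real.sqrt (g x).det)⁻¹ *
    ∑ i, pd (fun y => Real.sqrt (g y).det * ∑ j, (g y)⁻¹ i j * pd u j y) i x

/-- `⟨∇_g w, ∇_g z⟩_g = g^{ij} ∂_i w ∂_j z`. -/
def gInnerGrad (g : Eucl n → Matrix (Fin n) (Fin n) ℝ) (w z : Eucl n → ℝ) (x : Eucl n) : ℝ :=
  ∑ i, ∑ j, (g x)⁻¹ i j * pd w i x * pd z j x

/-- Uniform ellipticity: `g_{ij}(x) ξ^i ξ^j ≥ θ |ξ|²` for all `x, ξ`. -/
def UniformlyElliptic (g : Eucl n → Matrix (Fin n) (Fin n) ℝ) (θ : ℝ) : Prop :=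
  ∀ (x : Eucl n) (ξ : Fin n → ℝ), θ * ∑ i, (ξ i) ^ 2 ≤ ∑ i, ∑ j, g x i j * ξ i * ξ j

/-- Symmetric matrix-valued metric with `C³` entries having bounded derivatives up to order 3. -/
def MetricC3Bounded (g : Eucl n → Matrix (Fin n) (Fin n) ℝ) : Prop :=
  (∀ x, (g x).IsSymm) ∧ (∀ i j, ContDiff ℝ 3 fun x => g x i j) ∧
    ∃ M : ℝ, ∀ (i j : Fin n) (k : ℕ), k ≤ 3 → ∀ x,
      ‖iteratedFDeriv ℝ k (fun y => g y i j) x‖ ≤ M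

/-- Symmetric matrix-valued metric with `C¹` entries. -/
def MetricC1 (g : Eucl n → Matrix (Fin n) (Fin n) ℝ) : Prop :=
  (∀ x, (g x).IsSymm) ∧ ∀ i j, ContDiff ℝ 1 fun x => g x i j

/-- A bounded open set has `C⁴` boundary: near each boundary point there is a `C⁴` defining
function `ρ` with nonvanishing gradient, `D = {ρ < 0}` and `∂D = {ρ = 0}` locally. -/
def HasC4Boundary (D : Set (Eucl n)) : Prop :=
  ∀ x ∈ frontier D, ∃ (V : Set (Eucl n)) (ρ : Eucl n → ℝ),
    IsOpen V ∧ x ∈ V ∧ ContDiffOn ℝ 4 ρ V ∧ (∀ y ∈ V, gradient ρ y ≠ 0) ∧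
    D ∩ V = {y | y ∈ V ∧ ρ y < 0} ∧ frontier D ∩ V = {y | y ∈ V ∧ ρ y = 0}

/-- `ν` is the outward unit normal field of `D` on `∂D`: `ν = ∇ρ/|∇ρ|` for local `C⁴`
defining functions `ρ`. -/
def IsOutwardNormalField (D : Set (Eucl n)) (ν : Eucl n → Eucl n) : Prop :=
  ∀ x ∈ frontier D, ∃ (V : Set (Eucl n)) (ρ : Eucl n → ℝ),
    IsOpen V ∧ x ∈ V ∧ ContDiffOn ℝ 4 ρ V ∧ (∀ y ∈ V, gradient ρ y ≠ 0) ∧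
    D ∩ V = {y | y ∈ V ∧ ρ y < 0} ∧ frontier D ∩ V = {y | y ∈ V ∧ ρ y = 0} ∧
    ν x = ‖gradient ρ x‖⁻¹ • gradient ρ x

/-- Normal derivative `∂_ν w = ∇w · ν`. -/
def normalDeriv (ν : Eucl n → Eucl n) (w : Eucl n → ℝ) (x : Eucl n) : ℝ :=
  ⟪gradient w x, ν x⟫

/-- Tangential gradient `∇_τ w = ∇w − (∂_ν w) ν`. -/
def tangGrad (ν : Eucl n → Eucl n) (w : Eucl n → ℝ) (x : Eucl n) : Eucl n :=
  gradient w x - (normalDeriv ν w x) • ν x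

/-- `g`-normal derivative `∂_{ν_g} w = g^{ij} ν_i ∂_j w / √(g^{kℓ} ν_k ν_ℓ)`. -/
def gNormalDeriv (g : Eucl n → Matrix (Fin n) (Fin n) ℝ) (ν : Eucl n → Eucl n)
    (w : Eucl n → ℝ) (x : Eucl n) : ℝ :=
  (∑ i, ∑ j, (g x)⁻¹ i j * ν x i * pd w j x) /
    Real.sqrt (∑ k, ∑ l, (g x)⁻¹ k l * ν x k * ν x l)

/-- `u`, `∂_t u`, and all spatial derivatives of `u` up to order 2 are continuous on
`[0,T] × K`. -/
def ParabolicReg (T : ℝ) (K : Set (Eucl n)) (u : ℝ → Eucl n → ℝ) : Prop :=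
  (∀ t ∈ Icc (0 : ℝ) T, ContDiffOn ℝ 2 (u t) K) ∧
  ContinuousOn (fun q : ℝ × Eucl n => u q.1 q.2) (Icc 0 T ×ˢ K) ∧
  ContinuousOn (fun q : ℝ × Eucl n => deriv (fun s => u s q.2) q.1) (Icc 0 T ×ˢ K) ∧
  ContinuousOn (fun q : ℝ × Eucl n => gradient (u q.1) q.2) (Icc 0 T ×ˢ K) ∧
  ContinuousOn (fun q : ℝ × Eucl n => iteratedFDeriv ℝ 2 (u q.1) q.2) (Icc 0 T ×ˢ K)

/-! ### Divergence and product rules -/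

/-- Divergence of a vector field. -/
def dv (V : Eucl n → Eucl n) (x : Eucl n) : ℝ :=
  ∑ i, fderiv ℝ V x (EuclideanSpace.single i 1) i

lemma eucl_sum_single (v : Eucl n) : ∑ i, v i • EuclideanSpace.single i (1 : ℝ) = v := by
  ext j
  simp [Finset.sum_apply, Pi.single_apply]

lemma dv_smul {f : Eucl n → ℝ} {V : Eucl n → Eucl n} {x : Eucl n}
    (hf : DifferentiableAt ℝ f x) (hV : DifferentiableAt ℝ V x) :
    dv (fun y => f y • V y) x = f x * dv V x + fderiv ℝ f x (V x) := by
  unfold dv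
  rw [fderiv_fun_smul hf hV]
  have h : fderiv ℝ f x (V x) = ∑ i, V x i * fderiv ℝ f x (EuclideanSpace.single i 1) := by
    conv_lhs => rw [← eucl_sum_single (V x)]
    simp [map_sum]
  rw [h, Finset.mul_sum, ← Finset.sum_add_distrib]
  refine Finset.sum_congr rfl fun i _ => ?_
  simp
  ring

lemma dv_add {U V : Eucl n → Eucl n} {x : Eucl n}
    (hU : DifferentiableAt ℝ U x) (hV : DifferentiableAt ℝ V x) :
    dv (fun y => U y + V y) x = dv U x + dv V x := by
  unfold dv
  rw [fderiv_fun_add hU hV, ← Finset.sum_add_distrib]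
  simp

lemma dv_congr {U V : Eucl n → Eucl n} {x : Eucl n} (h : U =ᶠ[𝓝 x] V) : dv U x = dv V x := by
  unfold dv; rw [h.fderiv_eq]

lemma dv_eq_pd {V : Eucl n → Eucl n} {x : Eucl n} (hV : DifferentiableAt ℝ V x) :
    dv V x = ∑ i, pd (fun y => V y i) i x := by
  unfold dv pd
  refine Finset.sum_congr rfl fun i _ => ?_
  have : HasFDerivAt (fun y => V y i) ((EuclideanSpace.proj i).comp (fderiv ℝ V x)) x :=
    (EuclideanSpace.proj (𝕜 := ℝ) i).hasFDerivAt.comp x hV.hasFDerivAt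
  rw [this.fderiv]; rfl

lemma integral_dv_zero {Φ : Eucl n → Eucl n} (h1 : ContDiff ℝ 1 Φ) (h2 : HasCompactSupport Φ) :
    ∫ x, dv Φ x = 0 := by
  unfold dv
  have hd : Differentiable ℝ Φ := h1.differentiable one_ne_zero
  have hc : ∀ i : Fin n, Continuous fun x => fderiv ℝ Φ x (EuclideanSpace.single i 1) i := by
    intro i
    have h3 : Continuous fun x => fderiv ℝ Φ x (EuclideanSpace.single i 1) :=
      (h1.continuous_fderiv one_ne_zero).clm_apply continuous_const
    exact (EuclideanSpace.proj (𝕜 := ℝ) i).continuous.comp h3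
  have hsup : ∀ i : Fin n,
      HasCompactSupport fun x => fderiv ℝ Φ x (EuclideanSpace.single i 1) i := by
    intro i
    refine (h2.fderiv (𝕜 := ℝ)).mono ?_
    intro x hx
    simp only [Function.mem_support] at hx ⊢
    intro h; apply hx; simp [h]
  rw [integral_finsetSum _ (fun i _ => (hc i).integrable_of_hasCompactSupport (hsup i))]
  refine Finset.sum_eq_zero fun i _ => ?_
  have hgi : ∀ x, HasFDerivAt (fun y => Φ y i)
      ((EuclideanSpace.proj i).comp (fderiv ℝ Φ x)) x := fun x =>
    (EuclideanSpace.proj (𝕜 := ℝ) i).hasFDerivAt.comp x (hd x).hasFDerivAt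
  have hgc : HasCompactSupport fun y => Φ y i := by
    refine h2.mono ?_
    intro x hx
    simp only [Function.mem_support] at hx ⊢
    intro h; apply hx; simp [h]
  have hgcont : Continuous fun y => Φ y i :=
    (EuclideanSpace.proj (𝕜 := ℝ) i).continuous.comp h1.continuous
  have := integral_mul_fderiv_eq_neg_fderiv_mul_of_integrable (μ := (volume : Measure (Eucl n)))
    (f := fun _ => (1 : ℝ)) (g := fun y => Φ y i) (v := EuclideanSpace.single i 1)
    (by simp) (by
      simp only [one_mul, (hgi _).fderiv]
      exact (hc i).integrable_of_hasCompactSupport (hsup i)) (by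
      simp only [one_mul]
      exact hgcont.integrable_of_hasCompactSupport hgc) (fun _ _ => differentiableAt_const _)
      (fun x _ => (hgi x).differentiableAt)
  simp only [one_mul, (hgi _).fderiv] at this
  simpa using this

/-- Integration by parts with a compactly supported cutoff in an open set. -/
lemma integral_cutoff_dv {B : Set (Eucl n)} (hB : IsOpen B) {η : Eucl n → ℝ} (h1 : ContDiff ℝ 1 η)
    (h2 : HasCompactSupport η) (h3 : tsupport η ⊆ B) {F : Eucl n → Eucl n}
    (hF : ContDiffOn ℝ 1 F B) :
    ∫ x, (η x * dv F x + fderiv ℝ η x (F x)) = 0 := by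
  have hΦ : ContDiff ℝ 1 (fun x => η x • F x) := by
    rw [contDiff_iff_contDiffAt]
    intro x
    by_cases hx : x ∈ tsupport η
    · exact h1.contDiffAt.smul (hF.contDiffAt (hB.mem_nhds (h3 hx)))
    · have : (fun x => η x • F x) =ᶠ[𝓝 x] fun _ => 0 := by
        filter_upwards [(isClosed_tsupport η).isOpen_compl.mem_nhds hx] with y hy
        rw [image_eq_zero_of_notMem_tsupport hy, zero_smul]
      exact contDiffAt_const.congr_of_eventuallyEq this
  have hc : HasCompactSupport (fun x => η x • F x) := h2.smul_right
  rw [← integral_dv_zero hΦ hc]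
  congr 1
  ext x
  by_cases hx : x ∈ tsupport η
  · rw [dv_smul (h1.differentiable one_ne_zero x)
      ((hF.contDiffAt (hB.mem_nhds (h3 hx))).differentiableAt one_ne_zero)]
  · have h0 : η =ᶠ[𝓝 x] fun _ => 0 := notMem_tsupport_iff_eventuallyEq.1 hx
    have : (fun x => η x • F x) =ᶠ[𝓝 x] fun _ => 0 := by
      filter_upwards [h0] with y hy
      rw [hy, zero_smul]
    rw [dv_congr this, h0.fderiv_eq, h0.eq_of_nhds]
    simp [dv]

/-! ### Gradients -/

lemma gradient_contDiffAt {f : Eucl n → ℝ} {x : Eucl n} (h : ContDiffAt ℝ 2 f x) :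
    ContDiffAt ℝ 1 (gradient f) x := by
  have h1 : ContDiffAt ℝ 1 (fderiv ℝ f) x := h.fderiv_right (by norm_num)
  exact (InnerProductSpace.toDual ℝ (Eucl n)).symm.contDiff.contDiffAt.comp x h1

lemma gradient_contDiff {f : Eucl n → ℝ} (h : ContDiff ℝ 2 f) :
    ContDiff ℝ 1 (gradient f) :=
  contDiff_iff_contDiffAt.2 fun _ => gradient_contDiffAt h.contDiffAt

lemma gradient_contDiffOn {B : Set (Eucl n)} (hB : IsOpen B) {f : Eucl n → ℝ}
    (h : ContDiffOn ℝ 2 f B) : ContDiffOn ℝ 1 (gradient f) B := fun _ hx =>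
  (gradient_contDiffAt (h.contDiffAt (hB.mem_nhds hx))).contDiffWithinAt

lemma inner_grad (f : Eucl n → ℝ) (x v : Eucl n) : ⟪gradient f x, v⟫ = fderiv ℝ f x v :=
  inner_gradient_left

lemma fderiv_gradient_symm {f : Eucl n → ℝ} {x : Eucl n} (h : ContDiffAt ℝ 2 f x) (v w : Eucl n) :
    ⟪fderiv ℝ (gradient f) x v, w⟫ = ⟪fderiv ℝ (gradient f) x w, v⟫ := by
  have hs : IsSymmSndFDerivAt ℝ f x := h.isSymmSndFDerivAt (by simp)
  have h1 : DifferentiableAt ℝ (fderiv ℝ f) x :=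
    (h.fderiv_right (m := 1) (by norm_num)).differentiableAt one_ne_zero
  have key : ∀ v w : Eucl n, ⟪fderiv ℝ (gradient f) x v, w⟫ = fderiv ℝ (fderiv ℝ f) x v w := by
    intro v w
    have h2 : HasFDerivAt (gradient f)
        (((InnerProductSpace.toDual ℝ (Eucl n)).symm.toContinuousLinearEquiv.toContinuousLinearMap
          : StrongDual ℝ (Eucl n) →L[ℝ] Eucl n).comp
          (fderiv ℝ (fderiv ℝ f) x)) x :=
      ((InnerProductSpace.toDual ℝ (Eucl n)).symm.toContinuousLinearEquiv.toContinuousLinearMap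
        : StrongDual ℝ (Eucl n) →L[ℝ] Eucl n).hasFDerivAt.comp x h1.hasFDerivAt
    rw [h2.fderiv]
    exact InnerProductSpace.toDual_symm_apply
  rw [key, key]
  exact hs v w

/-! ### Coefficients and the elliptic operator -/

/-- Coefficients of a divergence form operator. -/
structure Coef (n : ℕ) where
  /-- density -/
  ω : Eucl n → ℝ
  /-- the matrix -/
  A : Eucl n → Eucl n →L[ℝ] Eucl n
  hω : ContDiff ℝ 1 ω
  hA : ContDiff ℝ 1 A
  ωpos : ∀ x, 0 < ω x
  symm : ∀ x v w, ⟪A x v, w⟫ = ⟪v, A x w⟫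
  pos : ∀ x v, v ≠ 0 → 0 < ⟪v, A x v⟫

namespace Coef

variable (c : Coef n)

/-- The operator `L f = ω⁻¹ div (ω A ∇f)`. -/
def L (f : Eucl n → ℝ) (x : Eucl n) : ℝ :=
  (c.ω x)⁻¹ * dv (fun y => c.ω y • c.A y (gradient f y)) x

/-- The field `A ∇P`. -/
def Z (P : Eucl n → ℝ) (x : Eucl n) : Eucl n := c.A x (gradient P x)

/-- `⟪∇P, A∇P⟫`. -/
def Gm (P : Eucl n → ℝ) (x : Eucl n) : ℝ := ⟪gradient P x, c.Z P x⟫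

lemma A_diff (x : Eucl n) : DifferentiableAt ℝ c.A x := c.hA.differentiable one_ne_zero x
lemma ω_diff (x : Eucl n) : DifferentiableAt ℝ c.ω x := c.hω.differentiable one_ne_zero x

lemma Z_contDiffAt {P : Eucl n → ℝ} {x : Eucl n} (h : ContDiffAt ℝ 2 P x) :
    ContDiffAt ℝ 1 (c.Z P) x := c.hA.contDiffAt.clm_apply (gradient_contDiffAt h)

lemma Z_contDiff {P : Eucl n → ℝ} (h : ContDiff ℝ 2 P) : ContDiff ℝ 1 (c.Z P) :=
  c.hA.clm_apply (gradient_contDiff h)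

lemma Gm_contDiff {P : Eucl n → ℝ} (h : ContDiff ℝ 2 P) : ContDiff ℝ 1 (c.Gm P) :=
  (gradient_contDiff h).inner ℝ (c.Z_contDiff h)

lemma L_mul (f : Eucl n → ℝ) (x : Eucl n) :
    dv (fun y => c.ω y • c.Z f y) x = c.ω x * c.L f x := by
  unfold L Z
  rw [mul_inv_cancel_left₀ (c.ωpos x).ne']

lemma L_cont {P : Eucl n → ℝ} (h : ContDiff ℝ 2 P) : Continuous (c.L P) := by
  unfold L dv
  refine (c.hω.continuous.inv₀ fun x => (c.ωpos x).ne').mul ?_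
  refine continuous_finsetSum _ fun i _ => ?_
  have h1 : ContDiff ℝ 1 fun y => c.ω y • c.A y (gradient P y) := c.hω.smul (c.Z_contDiff h)
  exact (EuclideanSpace.proj (𝕜 := ℝ) i).continuous.comp
    ((h1.continuous_fderiv one_ne_zero).clm_apply continuous_const)

lemma symm' (x v w : Eucl n) : ⟪v, c.A x w⟫ = ⟪w, c.A x v⟫ := by
  rw [← c.symm, real_inner_comm]

lemma nonneg (x v : Eucl n) : 0 ≤ ⟪v, c.A x v⟫ := by
  by_cases h : v = 0
  · simp [h]
  · exact (c.pos x v h).le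

/-- The flux field. -/
def Fl (S : ℝ) (P b q w : Eucl n → ℝ) (x : Eucl n) : Eucl n :=
  (-4 * (S * ⟪gradient w x, c.Z P x⟫) - 2 * (S * b x) * w x) • (c.ω x • c.Z w x) +
    (2 * ⟪gradient w x, c.Z w x⟫ - 2 * q x * w x ^ 2) • (S • (c.ω x • c.Z P x))

lemma dv_Fl (S : ℝ) {P b q w : Eucl n → ℝ} {x : Eucl n} (hP : ContDiffAt ℝ 2 P x)
    (hw : ContDiffAt ℝ 2 w x) (hb : DifferentiableAt ℝ b x) (hq : DifferentiableAt ℝ q x) :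
    -dv (c.Fl S P b q w) x = c.ω x *
      (2 * (2 * (S * ⟪gradient w x, c.Z P x⟫) + S * b x * w x) * (c.L w x + q x * w x) +
      (4 * (S * ⟪gradient w x, fderiv ℝ (c.Z P) x (c.Z w x)⟫) -
        2 * (S * ⟪gradient w x, fderiv ℝ c.A x (c.Z P x) (gradient w x)⟫) -
        2 * (S * c.L P x) * ⟪gradient w x, c.Z w x⟫ +
        2 * (S * b x) * ⟪gradient w x, c.Z w x⟫ +
        2 * w x * (S * fderiv ℝ b x (c.Z w x)) +
        2 * w x ^ 2 * (S * fderiv ℝ q x (c.Z P x) + q x * (S * c.L P x)) -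
        2 * (S * b x) * q x * w x ^ 2)) := by
  have dw : DifferentiableAt ℝ w x := hw.differentiableAt two_ne_zero
  have dg : DifferentiableAt ℝ (gradient w) x := (gradient_contDiffAt hw).differentiableAt one_ne_zero
  have dZP : DifferentiableAt ℝ (c.Z P) x := (c.Z_contDiffAt hP).differentiableAt one_ne_zero
  have dZw : DifferentiableAt ℝ (c.Z w) x := (c.Z_contDiffAt hw).differentiableAt one_ne_zero
  have dA := c.A_diff x
  have dω := c.ω_diff x
  have i1 : HasFDerivAt (fun y => ⟪gradient w y, c.Z P y⟫) _ x :=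
    dg.hasFDerivAt.inner ℝ dZP.hasFDerivAt
  have i2 : HasFDerivAt (fun y => ⟪gradient w y, c.Z w y⟫) _ x :=
    dg.hasFDerivAt.inner ℝ dZw.hasFDerivAt
  have φ1 : HasFDerivAt (fun y => -4 * (S * ⟪gradient w y, c.Z P y⟫) - 2 * (S * b y) * w y) _ x :=
    ((i1.const_mul S).const_mul (-4)).sub
      (((hb.hasFDerivAt.const_mul S).const_mul 2).mul dw.hasFDerivAt)
  have φ2 : HasFDerivAt (fun y => 2 * ⟪gradient w y, c.Z w y⟫ - 2 * q y * w y ^ 2) _ x :=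
    (i2.const_mul 2).sub ((hq.hasFDerivAt.const_mul 2).mul (dw.hasFDerivAt.pow 2))
  have hZw : fderiv ℝ (c.Z w) x (c.Z P x) = fderiv ℝ c.A x (c.Z P x) (gradient w x) +
      c.A x (fderiv ℝ (gradient w) x (c.Z P x)) := by
    have : HasFDerivAt (c.Z w) _ x := dA.hasFDerivAt.clm_apply dg.hasFDerivAt
    rw [this.fderiv]
    simp [add_comm]
  have e1 : dv (c.Fl S P b q w) x = _ := dv_add
    (U := fun x => (-4 * (S * ⟪gradient w x, c.Z P x⟫) - 2 * (S * b x) * w x) • (c.ω x • c.Z w x))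
    (V := fun x => (2 * ⟪gradient w x, c.Z w x⟫ - 2 * q x * w x ^ 2) • (S • (c.ω x • c.Z P x)))
    (φ1.differentiableAt.smul (dω.smul dZw))
    (φ2.differentiableAt.smul ((dω.smul dZP).const_smul S))
  have e3 : dv (fun y => S • (c.ω y • c.Z P y)) x = S * (c.ω x * c.L P x) := by
    have := dv_smul (f := fun _ => S) (V := fun y => c.ω y • c.Z P y) (x := x)
      (by fun_prop) (dω.smul dZP)
    rw [this, L_mul]
    simp
  rw [e1, dv_smul (V := fun y => c.ω y • c.Z w y) φ1.differentiableAt (dω.smul dZw),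
    dv_smul (V := fun y => S • (c.ω y • c.Z P y)) φ2.differentiableAt
      ((dω.smul dZP).const_smul S), e3, L_mul, φ1.fderiv, φ2.fderiv]
  have hsy : ⟪fderiv ℝ (gradient w) x (c.Z w x), c.Z P x⟫ =
      ⟪fderiv ℝ (gradient w) x (c.Z P x), c.Z w x⟫ := fderiv_gradient_symm hw _ _
  have hAA : ⟪gradient w x, c.A x (fderiv ℝ (gradient w) x (c.Z P x))⟫ =
      ⟪fderiv ℝ (gradient w) x (c.Z P x), c.Z w x⟫ := by
    rw [c.symm']; rfl
  have hgw : fderiv ℝ w x (c.Z w x) = ⟪gradient w x, c.Z w x⟫ := (inner_grad _ _ _).symm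
  have hgw2 : fderiv ℝ w x (c.Z P x) = ⟪gradient w x, c.Z P x⟫ := (inner_grad _ _ _).symm
  simp only [ContinuousLinearMap.sub_apply, ContinuousLinearMap.add_apply,
    ContinuousLinearMap.smul_apply, ContinuousLinearMap.comp_apply, fderivInnerCLM_apply,
    ContinuousLinearMap.prod_apply, map_smul, smul_eq_mul, hgw, hgw2, hZw, inner_add_right, hAA,
    hsy, nsmul_eq_mul, Nat.cast_ofNat]
  ring

end Coef

/-! ### Algebraic lower bound for the Carleman quadratic form -/

lemma sq_sub3_le (x y z : ℝ) : (x - y - z) ^ 2 ≤ 3 * (x ^ 2 + y ^ 2 + z ^ 2) := by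
  nlinarith [sq_nonneg (x + y), sq_nonneg (x + z), sq_nonneg (y - z)]

set_option maxHeartbeats 1000000 in
lemma alg_lower (M c k : ℝ) (hM : 1 ≤ M) (hc : 0 < c) (hk : 0 < k) :
    ∃ s0 : ℝ, 1 ≤ s0 ∧ ∃ c' : ℝ, 0 < c' ∧
      ∀ s S m m2 nv w wt X Y zv dbW b LP PR Γ G1 G2 : ℝ, s0 ≤ s → s ≤ k * S →
        |m| ≤ M * (S ^ 2 / s) → |m2| ≤ M * (S ^ 3 / s) → 0 ≤ nv → |zv| ≤ M * nv →
        |dbW| ≤ M * nv → |b| ≤ M → |LP| ≤ M → |PR| ≤ M → |Γ| ≤ M → c * nv ^ 2 ≤ G1 → c ≤ G2 →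
        X = wt + 2 * (S * zv) + S * b * w → X - Y = S * (b - LP) * w →
        c' * (wt ^ 2 / S + S * nv ^ 2 + S ^ 3 * w ^ 2) ≤
          2 * X * Y + (S * G1 + 2 * w * (S * dbW) + S ^ 3 * w ^ 2 * G2 +
            2 * w ^ 2 * (S * m) * (Γ + PR * (LP - b)) + (2 * S * m * Γ + m2 * PR) * w ^ 2) := by
  set K0 : ℝ := 4 * M ^ 2 * k + 2 / c * M ^ 2 * k ^ 2 + 2 * M * (M + 2 * M ^ 2) + 3 * M ^ 2 with hK0
  have hK0p : 0 < K0 := by positivity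
  set Q : ℝ := 3 * k + 2 / c * (12 * M ^ 2 + 1) + 2 / c * (3 * M ^ 2 * k ^ 2 + 1) with hQ
  have hQp : 0 < Q := by positivity
  refine ⟨max 1 (2 * K0 / c), le_max_left _ _, 1 / Q, by positivity, ?_⟩
  intro s S m m2 nv w wt X Y zv dbW b LP PR Γ G1 G2 hs hsS hm hm2 hnv hzv hdb hb hLP hPR hΓ hG1 hG2
    hX hXY
  have hM0 : 0 < M := by linarith
  have hs1 : 1 ≤ s := (le_max_left _ _).trans hs
  have hsK : 2 * K0 / c ≤ s := (le_max_right _ _).trans hs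
  have hs0 : 0 < s := by linarith
  have hS : 0 < S := by
    have : 0 < k * S := by linarith
    exact pos_of_mul_pos_right this hk.le
  set a := S * nv ^ 2 with ha
  set h := S ^ 3 * w ^ 2 with hh
  have ha0 : 0 ≤ a := by positivity
  have hh0 : 0 ≤ h := by positivity
  have b1 : S ^ 2 * w ^ 2 ≤ k * (h / s) := by
    rw [hh, ← mul_div_assoc, le_div_iff₀ hs0]
    have : S ^ 2 * w ^ 2 * s ≤ S ^ 2 * w ^ 2 * (k * S) :=
      mul_le_mul_of_nonneg_left hsS (by positivity)
    linarith [this, show S ^ 2 * w ^ 2 * (k * S) = k * (S ^ 3 * w ^ 2) by ring]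
  have hhs : h / s ≤ h := div_le_self hh0 hs1
  have hhs0 : 0 ≤ h / s := by positivity
  have b2 : S * w ^ 2 ≤ k ^ 2 * (h / s) := by
    have h1 : S * w ^ 2 * s ≤ S * w ^ 2 * (k * S) :=
      mul_le_mul_of_nonneg_left hsS (by positivity)
    have h2 : S * w ^ 2 ≤ S * w ^ 2 * s := le_mul_of_one_le_right (by positivity) hs1
    have h3 : S * w ^ 2 ≤ k * (S ^ 2 * w ^ 2) := by
      calc _ ≤ _ := h2.trans h1
        _ = _ := by ring
    calc _ ≤ _ := h3
      _ ≤ k * (k * (h / s)) := by gcongr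
      _ = _ := by ring
  -- individual terms
  have t1 : (X - Y) ^ 2 ≤ 4 * M ^ 2 * k * (h / s) := by
    have : (b - LP) ^ 2 ≤ (2 * M) ^ 2 := by
      apply sq_le_sq'
      · linarith [abs_le.1 hb, abs_le.1 hLP]
      · linarith [abs_le.1 hb, abs_le.1 hLP]
    calc (X - Y) ^ 2 = (b - LP) ^ 2 * (S ^ 2 * w ^ 2) := by rw [hXY]; ring
      _ ≤ (2 * M) ^ 2 * (k * (h / s)) := by gcongr
      _ = _ := by ring
  have t2 : -(c / 2 * a + 2 / c * M ^ 2 * k ^ 2 * (h / s)) ≤ 2 * w * (S * dbW) := by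
    have e1 : |2 * w * (S * dbW)| ≤ 2 * S * (|w| * (M * nv)) := by
      rw [show 2 * w * (S * dbW) = 2 * S * (w * dbW) by ring, abs_mul, abs_mul w,
        abs_of_pos (by positivity : 0 < 2 * S)]
      gcongr
    have e2 : 2 * S * (|w| * (M * nv)) ≤ c / 2 * a + 2 / c * M ^ 2 * (S * w ^ 2) := by
      have : 0 ≤ S * (c / 2) * (nv - 2 / c * M * |w|) ^ 2 := by positivity
      have e3 : S * (c / 2) * (nv - 2 / c * M * |w|) ^ 2 =
          c / 2 * a + 2 / c * M ^ 2 * (S * w ^ 2) - 2 * S * (|w| * (M * nv)) := by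
        rw [ha, ← sq_abs w]; field_simp; ring
      linarith
    have e4 : 2 / c * M ^ 2 * (S * w ^ 2) ≤ 2 / c * M ^ 2 * (k ^ 2 * (h / s)) := by gcongr
    have := neg_abs_le (2 * w * (S * dbW))
    linarith [show 2 / c * M ^ 2 * (k ^ 2 * (h / s)) = 2 / c * M ^ 2 * k ^ 2 * (h / s) by ring]
  have t3 : -(2 * M * (M + 2 * M ^ 2) * (h / s)) ≤ 2 * w ^ 2 * (S * m) * (Γ + PR * (LP - b)) := by
    have e0 : |Γ + PR * (LP - b)| ≤ M + 2 * M ^ 2 := by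
      calc |Γ + PR * (LP - b)| ≤ |Γ| + |PR| * |LP - b| := by
            rw [← abs_mul]; exact abs_add_le _ _
        _ ≤ M + M * (M + M) := by
            gcongr
            exact (abs_sub _ _).trans (by linarith)
        _ = _ := by ring
    have e1 : |2 * w ^ 2 * (S * m) * (Γ + PR * (LP - b))| ≤
        2 * w ^ 2 * (S * (M * (S ^ 2 / s))) * (M + 2 * M ^ 2) := by
      rw [abs_mul, abs_mul, abs_mul S, abs_of_pos hS, abs_of_nonneg (by positivity : 0 ≤ 2 * w ^ 2)]
      gcongr
    have := neg_abs_le (2 * w ^ 2 * (S * m) * (Γ + PR * (LP - b)))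
    have e2 : 2 * w ^ 2 * (S * (M * (S ^ 2 / s))) * (M + 2 * M ^ 2) =
      2 * M * (M + 2 * M ^ 2) * (h / s) := by rw [hh]; ring
    linarith
  have t4 : -(3 * M ^ 2 * (h / s)) ≤ (2 * S * m * Γ + m2 * PR) * w ^ 2 := by
    have e1 : |(2 * S * m * Γ + m2 * PR) * w ^ 2| ≤
        (2 * S * (M * (S ^ 2 / s)) * M + M * (S ^ 3 / s) * M) * w ^ 2 := by
      rw [abs_mul, abs_of_nonneg (by positivity : 0 ≤ w ^ 2)]
      gcongr
      refine (abs_add_le _ _).trans ?_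
      rw [abs_mul, abs_mul, abs_mul m2, abs_of_pos (by positivity : 0 < 2 * S)]
      gcongr
    have := neg_abs_le ((2 * S * m * Γ + m2 * PR) * w ^ 2)
    have e2 : (2 * S * (M * (S ^ 2 / s)) * M + M * (S ^ 3 / s) * M) * w ^ 2 =
      3 * M ^ 2 * (h / s) := by rw [hh]; ring
    linarith
  have t5 : K0 * (h / s) ≤ c / 2 * h := by
    rw [div_le_iff₀ hc] at hsK
    rw [← mul_div_assoc, div_le_iff₀ hs0]
    calc K0 * h = (2 * K0) * (h / 2) := by ring
      _ ≤ (s * c) * (h / 2) := by gcongr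
      _ = _ := by ring
  have t6 : 2 * X * Y = X ^ 2 - (X - Y) ^ 2 + Y ^ 2 := by ring
  have g1 : c * a ≤ S * G1 := by
    calc c * a = S * (c * nv ^ 2) := by rw [ha]; ring
      _ ≤ _ := by gcongr
  have g2 : c * h ≤ h * G2 := by rw [mul_comm]; gcongr
  have main : X ^ 2 + c / 2 * a + c / 2 * h ≤ 2 * X * Y + (S * G1 + 2 * w * (S * dbW) + h * G2 +
            2 * w ^ 2 * (S * m) * (Γ + PR * (LP - b)) + (2 * S * m * Γ + m2 * PR) * w ^ 2) := by
    have := sq_nonneg Y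
    have hK : K0 * (h / s) = 4 * M ^ 2 * k * (h / s) + 2 / c * M ^ 2 * k ^ 2 * (h / s) +
      2 * M * (M + 2 * M ^ 2) * (h / s) + 3 * M ^ 2 * (h / s) := by rw [hK0]; ring
    linarith
  refine le_trans ?_ main
  have w1 : wt ^ 2 / S ≤ 3 * k * X ^ 2 + 12 * M ^ 2 * a + 3 * M ^ 2 * k ^ 2 * h := by
    have e1 : wt ^ 2 ≤ 3 * (X ^ 2 + 4 * (S ^ 2 * (M * nv) ^ 2) + S ^ 2 * M ^ 2 * w ^ 2) := by
      have hw : wt = X - 2 * (S * zv) - S * b * w := by rw [hX]; ring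
      have q1 : zv ^ 2 ≤ (M * nv) ^ 2 := sq_le_sq' (by linarith [abs_le.1 hzv]) (abs_le.1 hzv).2
      have q2 : b ^ 2 ≤ M ^ 2 := sq_le_sq' (by linarith [abs_le.1 hb]) (abs_le.1 hb).2
      calc wt ^ 2 ≤ 3 * (X ^ 2 + 4 * (S ^ 2 * zv ^ 2) + S ^ 2 * b ^ 2 * w ^ 2) := by
            rw [hw]
            refine (sq_sub3_le _ _ _).trans (le_of_eq ?_)
            ring
        _ ≤ _ := by gcongr
    have e2 : X ^ 2 / S ≤ k * X ^ 2 := by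
      rw [div_le_iff₀ hS]
      have : X ^ 2 * 1 ≤ X ^ 2 * (k * S) := by gcongr; linarith
      linarith
    have e3 : S * w ^ 2 ≤ k ^ 2 * h := b2.trans (by gcongr)
    calc wt ^ 2 / S ≤ 3 * (X ^ 2 + 4 * (S ^ 2 * (M * nv) ^ 2) + S ^ 2 * M ^ 2 * w ^ 2) / S := by
          gcongr
      _ = 3 * (X ^ 2 / S) + 12 * M ^ 2 * a + 3 * M ^ 2 * (S * w ^ 2) := by
          rw [ha]; field_simp; ring
      _ ≤ 3 * (k * X ^ 2) + 12 * M ^ 2 * a + 3 * M ^ 2 * (k ^ 2 * h) := by gcongr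
      _ = _ := by ring
  rw [one_div, inv_mul_le_iff₀ hQp]
  have hX0 := sq_nonneg X
  have i1 : 0 ≤ 2 / c := by positivity
  have i2 : 2 / c * (c / 2) = 1 := by field_simp
  have j1 : 3 * k * X ^ 2 ≤ Q * X ^ 2 := by
    gcongr
    rw [hQ]
    have : 0 ≤ 2 / c * (12 * M ^ 2 + 1) := by positivity
    have : 0 ≤ 2 / c * (3 * M ^ 2 * k ^ 2 + 1) := by positivity
    linarith
  have j2 : (12 * M ^ 2 + 1) * a ≤ Q * (c / 2 * a) := by
    have : 2 / c * (12 * M ^ 2 + 1) ≤ Q := by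
      have : 0 ≤ 2 / c * (3 * M ^ 2 * k ^ 2 + 1) := by positivity
      linarith
    calc (12 * M ^ 2 + 1) * a = (2 / c * (12 * M ^ 2 + 1)) * (c / 2 * a) := by field_simp
      _ ≤ _ := by gcongr
  have j3 : (3 * M ^ 2 * k ^ 2 + 1) * h ≤ Q * (c / 2 * h) := by
    have : 2 / c * (3 * M ^ 2 * k ^ 2 + 1) ≤ Q := by
      have : 0 ≤ 2 / c * (12 * M ^ 2 + 1) := by positivity
      linarith
    calc (3 * M ^ 2 * k ^ 2 + 1) * h = (2 / c * (3 * M ^ 2 * k ^ 2 + 1)) * (c / 2 * h) := by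
          field_simp
      _ ≤ _ := by gcongr
  linarith

/-! ### The Carleman inequality on a time slice -/

lemma cutoff_cont {B : Set (Eucl n)} (hB : IsOpen B) {η f : Eucl n → ℝ} (h1 : Continuous η)
    (h3 : tsupport η ⊆ B) (hf : ContinuousOn f B) : Continuous fun x => η x * f x := by
  rw [continuous_iff_continuousAt]
  intro x
  by_cases hx : x ∈ tsupport η
  · exact h1.continuousAt.mul (hf.continuousAt (hB.mem_nhds (h3 hx)))
  · have : (fun x => η x * f x) =ᶠ[𝓝 x] fun _ => 0 := by
      filter_upwards [(isClosed_tsupport η).isOpen_compl.mem_nhds hx] with y hy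
      rw [image_eq_zero_of_notMem_tsupport hy, zero_mul]
    exact continuousAt_const.congr this.symm

lemma cutoff_integrable {B : Set (Eucl n)} (hB : IsOpen B) {η f : Eucl n → ℝ} (h1 : Continuous η)
    (h2 : HasCompactSupport η) (h3 : tsupport η ⊆ B) (hf : ContinuousOn f B) :
    Integrable fun x => η x * f x :=
  (cutoff_cont hB h1 h3 hf).integrable_of_hasCompactSupport h2.mul_right

lemma cutoff_fderiv_cont {B : Set (Eucl n)} (hB : IsOpen B) {η : Eucl n → ℝ}
    {F : Eucl n → Eucl n} (h1 : ContDiff ℝ 1 η) (h3 : tsupport η ⊆ B) (hF : ContinuousOn F B) :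
    Continuous fun x => fderiv ℝ η x (F x) := by
  rw [continuous_iff_continuousAt]
  intro x
  by_cases hx : x ∈ tsupport η
  · exact (h1.continuous_fderiv one_ne_zero).continuousAt.clm_apply
      (hF.continuousAt (hB.mem_nhds (h3 hx)))
  · have : (fun x => fderiv ℝ η x (F x)) =ᶠ[𝓝 x] fun _ => 0 := by
      filter_upwards [(isClosed_tsupport η).isOpen_compl.mem_nhds hx] with y hy
      have h0 : η =ᶠ[𝓝 y] fun _ => 0 := notMem_tsupport_iff_eventuallyEq.1 hy
      rw [h0.fderiv_eq]; simp
    exact continuousAt_const.congr this.symm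

lemma cutoff_fderiv_integrable {B : Set (Eucl n)} (hB : IsOpen B) {η : Eucl n → ℝ}
    {F : Eucl n → Eucl n} (h1 : ContDiff ℝ 1 η) (h2 : HasCompactSupport η) (h3 : tsupport η ⊆ B)
    (hF : ContinuousOn F B) : Integrable fun x => fderiv ℝ η x (F x) := by
  refine (cutoff_fderiv_cont hB h1 h3 hF).integrable_of_hasCompactSupport ?_
  refine (h2.fderiv (𝕜 := ℝ)).mono ?_
  intro x hx
  simp only [Function.mem_support] at hx ⊢
  intro h; apply hx; simp [h]

namespace Coef

variable (c : Coef n)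

/-- zeroth order coefficient -/
def qf (S m R : ℝ) (P : Eucl n → ℝ) (x : Eucl n) : ℝ := S ^ 2 * c.Gm P x + m * (P x - R)

/-- time derivative of the zeroth order coefficient -/
def qt (S m m2 R : ℝ) (P : Eucl n → ℝ) (x : Eucl n) : ℝ := 2 * S * m * c.Gm P x + m2 * (P x - R)

/-- full flux -/
def Bfl (S m R : ℝ) (P b w wt : Eucl n → ℝ) (x : Eucl n) : Eucl n :=
  c.Fl S P b (c.qf S m R P) w x - (2 * (c.ω x * wt x)) • c.Z w x

/-- derivative of the energy functional `J` -/
def Jd (η : Eucl n → ℝ) (S m m2 R : ℝ) (P w wt : Eucl n → ℝ) : ℝ :=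
  -2 * (∫ x, (η x * (c.ω x * wt x * c.L w x) + fderiv ℝ η x ((c.ω x * wt x) • c.Z w x))) -
    ∫ x, η x * (c.ω x * (c.qt S m m2 R P x * w x ^ 2 + 2 * c.qf S m R P x * w x * wt x))

/-- Pseudoconvexity condition. -/
def PC (P b : Eucl n → ℝ) (K : Set (Eucl n)) (c0 : ℝ) : Prop :=
  ∀ x ∈ K, (∀ v : Eucl n, c0 * ‖v‖ ^ 2 ≤ 4 * ⟪v, fderiv ℝ (c.Z P) x (c.A x v)⟫ -
    2 * ⟪v, fderiv ℝ c.A x (c.Z P x) v⟫ + 2 * (b x - c.L P x) * ⟪v, c.A x v⟫) ∧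
    c0 ≤ 2 * fderiv ℝ (c.Gm P) x (c.Z P x) + 2 * (c.L P x - b x) * c.Gm P x

end Coef

/-- energy density -/
def en (S : ℝ) (w wt : Eucl n → ℝ) (x : Eucl n) : ℝ :=
  wt x ^ 2 / S + S * ‖gradient w x‖ ^ 2 + S ^ 3 * w x ^ 2

lemma exists_bound_on {K : Set (Eucl n)} (hK : IsCompact K) {f : Eucl n → ℝ}
    (hf : ContinuousOn f K) : ∃ M : ℝ, 0 ≤ M ∧ ∀ x ∈ K, |f x| ≤ M := by
  obtain ⟨M, hM⟩ := hK.exists_bound_of_continuousOn hf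
  exact ⟨max M 0, le_max_right _ _, fun x hx => (hM x hx).trans (le_max_left _ _)⟩

lemma L_contOn (c : Coef n) {B : Set (Eucl n)} (hB : IsOpen B) {w : Eucl n → ℝ}
    (hw : ContDiffOn ℝ 2 w B) : ContinuousOn (c.L w) B := by
  unfold Coef.L dv
  refine ContinuousOn.mul (c.hω.continuous.inv₀ fun x => (c.ωpos x).ne').continuousOn ?_
  refine continuousOn_finsetSum _ fun i _ => ?_
  have h1 : ContDiffOn ℝ 1 (fun y => c.ω y • c.A y (gradient w y)) B :=
    c.hω.contDiffOn.smul (c.hA.contDiffOn.clm_apply (gradient_contDiffOn hB hw))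
  exact (EuclideanSpace.proj (𝕜 := ℝ) i).continuous.comp_continuousOn
    ((h1.continuousOn_fderiv_of_isOpen hB le_rfl).clm_apply continuousOn_const)

set_option maxHeartbeats 800000 in
lemma slice_carleman (c : Coef n) {P b : Eucl n → ℝ} (hP : ContDiff ℝ 2 P) (hb : ContDiff ℝ 1 b)
    {K : Set (Eucl n)} (hK : IsCompact K) {c0 : ℝ} (hc0 : 0 < c0) (hPC : c.PC P b K c0)
    (R k M0 : ℝ) (hk : 0 < k) :
    ∃ s0 : ℝ, 1 ≤ s0 ∧ ∃ c' : ℝ, 0 < c' ∧ ∀ s S m m2 : ℝ, s0 ≤ s → s ≤ k * S →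
      |m| ≤ M0 * (S ^ 2 / s) → |m2| ≤ M0 * (S ^ 3 / s) →
      ∀ B : Set (Eucl n), IsOpen B → ∀ w wt : Eucl n → ℝ, ContDiffOn ℝ 2 w B → ContinuousOn wt B →
      (∀ x ∈ B, wt x = c.L w x - 2 * (S * ⟪gradient w x, c.Z P x⟫) +
        (c.qf S m R P x - S * c.L P x) * w x) →
      ∀ η : Eucl n → ℝ, ContDiff ℝ 1 η → HasCompactSupport η → tsupport η ⊆ B → tsupport η ⊆ K →
      (∀ x, 0 ≤ η x) →
      c.Jd η S m m2 R P w wt + c' * ∫ x, η x * (c.ω x * en S w wt x) ≤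
        ∫ x, fderiv ℝ η x (c.Bfl S m R P b w wt x) := by
  have hZ := c.Z_contDiff hP
  have hG := c.Gm_contDiff hP
  have hL := c.L_cont hP
  obtain ⟨M1, hM1, h1⟩ := exists_bound_on hK (f := fun x => ‖c.Z P x‖)
    hZ.continuous.norm.continuousOn
  obtain ⟨M2, hM2, h2⟩ := exists_bound_on hK (f := fun x => ‖fderiv ℝ b x‖ * ‖c.A x‖)
    ((hb.continuous_fderiv one_ne_zero).norm.mul c.hA.continuous.norm).continuousOn
  obtain ⟨M3, hM3, h3⟩ := exists_bound_on hK hb.continuous.continuousOn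
  obtain ⟨M4, hM4, h4⟩ := exists_bound_on hK hL.continuousOn
  obtain ⟨M5, hM5, h5⟩ := exists_bound_on hK (f := fun x => P x - R)
    (hP.continuous.sub continuous_const).continuousOn
  obtain ⟨M6, hM6, h6⟩ := exists_bound_on hK hG.continuous.continuousOn
  set M : ℝ := 1 + |M0| + M1 + M2 + M3 + M4 + M5 + M6 with hM
  have hM0 := abs_nonneg M0
  obtain ⟨s0, hs0, c', hc', key⟩ := alg_lower M c0 k (by linarith) hc0 hk
  refine ⟨s0, hs0, c', hc', ?_⟩
  intro s S m m2 hs hsS hm hm2 B hB w wt hw hwt hpde η η1 η2 η3 η4 η5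
  have hs1 : 0 < s := by linarith
  have hS : 0 < S := pos_of_mul_pos_right (lt_of_lt_of_le hs1 hsS) hk.le
  have hM0M : M0 ≤ M := by have := le_abs_self M0; linarith
  have hm' : |m| ≤ M * (S ^ 2 / s) := hm.trans (by gcongr)
  have hm2' : |m2| ≤ M * (S ^ 3 / s) := hm2.trans (by gcongr)
  set q := c.qf S m R P with hq
  have hqC : ContDiff ℝ 1 q := by
    have hP1 : ContDiff ℝ 1 P := hP.of_le (by norm_num)
    exact (contDiff_const.mul hG).add (contDiff_const.mul (hP1.sub contDiff_const))
  have hgw : ContDiffOn ℝ 1 (gradient w) B := gradient_contDiffOn hB hw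
  have hZw : ContDiffOn ℝ 1 (c.Z w) B := c.hA.contDiffOn.clm_apply hgw
  have hw1 : ContDiffOn ℝ 1 w B := hw.of_le (by norm_num)
  have hFl : ContDiffOn ℝ 1 (c.Fl S P b q w) B := by
    have hSZ0 : ContDiff ℝ 1 (fun x => c.ω x • c.Z P x) := c.hω.smul hZ
    have hSZ : ContDiffOn ℝ 1 (fun x => S • (c.ω x • c.Z P x)) B :=
      (hSZ0.const_smul S).contDiffOn
    have hωZ : ContDiffOn ℝ 1 (fun x => c.ω x • c.Z w x) B := c.hω.contDiffOn.smul hZw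
    have c1 : ContDiffOn ℝ 1 (fun x => -4 * (S * ⟪gradient w x, c.Z P x⟫) -
        2 * (S * b x) * w x) B :=
      (contDiffOn_const.mul (contDiffOn_const.mul (hgw.inner ℝ hZ.contDiffOn))).sub
        ((contDiffOn_const.mul (contDiffOn_const.mul hb.contDiffOn)).mul hw1)
    have c2 : ContDiffOn ℝ 1 (fun x => 2 * ⟪gradient w x, c.Z w x⟫ - 2 * q x * w x ^ 2) B :=
      (contDiffOn_const.mul (hgw.inner ℝ hZw)).sub
        ((contDiffOn_const.mul hqC.contDiffOn).mul (hw1.pow 2))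
    exact (c1.smul hωZ).add (c2.smul hSZ)
  have hωwt : ContinuousOn (fun x => c.ω x * wt x) B := c.hω.continuous.continuousOn.mul hwt
  have hLw := L_contOn c hB hw
  have hwc := hw.continuousOn
  have hen : ContinuousOn (en S w wt) B := by
    unfold en
    exact (((hwt.pow 2).div_const S).add (continuousOn_const.mul (hgw.continuousOn.norm.pow 2))).add
      (continuousOn_const.mul (hwc.pow 2))
  have hqt : Continuous (c.qt S m m2 R P) :=
    (continuous_const.mul hG.continuous).add
      (continuous_const.mul (hP.continuous.sub continuous_const))
  -- integrability
  have I1 : Integrable fun x => η x * (c.ω x * en S w wt x) :=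
    cutoff_integrable hB η1.continuous η2 η3 (c.hω.continuous.continuousOn.mul hen)
  have I2 : Integrable fun x => η x * (c.ω x * wt x * c.L w x) :=
    cutoff_integrable hB η1.continuous η2 η3 (hωwt.mul hLw)
  have I3 : Integrable fun x => fderiv ℝ η x ((c.ω x * wt x) • c.Z w x) :=
    cutoff_fderiv_integrable hB η1 η2 η3 (hωwt.smul hZw.continuousOn)
  have I4 : Integrable fun x =>
      η x * (c.ω x * (c.qt S m m2 R P x * w x ^ 2 + 2 * q x * w x * wt x)) := by
    refine cutoff_integrable hB η1.continuous η2 η3 (c.hω.continuous.continuousOn.mul ?_)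
    exact (hqt.continuousOn.mul (hwc.pow 2)).add
      (((continuousOn_const.mul hqC.continuous.continuousOn).mul hwc).mul hwt)
  have I5 : Integrable fun x => fderiv ℝ η x (c.Fl S P b q w x) :=
    cutoff_fderiv_integrable hB η1 η2 η3 hFl.continuousOn
  have hdvc : ContinuousOn (dv (c.Fl S P b q w)) B := by
    unfold dv
    refine continuousOn_finsetSum _ fun i _ => ?_
    exact (EuclideanSpace.proj (𝕜 := ℝ) i).continuous.comp_continuousOn
      ((hFl.continuousOn_fderiv_of_isOpen hB le_rfl).clm_apply continuousOn_const)
  have I6 : Integrable fun x => η x * dv (c.Fl S P b q w) x :=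
    cutoff_integrable hB η1.continuous η2 η3 hdvc
  have ibp := integral_cutoff_dv hB η1 η2 η3 hFl
  rw [integral_add I6 I5] at ibp
  have hB1 : ∫ x, fderiv ℝ η x (c.Bfl S m R P b w wt x) =
      (∫ x, fderiv ℝ η x (c.Fl S P b q w x)) -
        2 * ∫ x, fderiv ℝ η x ((c.ω x * wt x) • c.Z w x) := by
    rw [← integral_const_mul, ← integral_sub I5 (I3.const_mul 2)]
    congr 1
    ext x
    simp only [Coef.Bfl, map_sub, map_smul, smul_eq_mul, ← hq]
    ring
  -- pointwise inequality
  have pw : ∀ x, c' * (η x * (c.ω x * en S w wt x)) ≤ -(η x * dv (c.Fl S P b q w) x) +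
      2 * (η x * (c.ω x * wt x * c.L w x)) +
      η x * (c.ω x * (c.qt S m m2 R P x * w x ^ 2 + 2 * q x * w x * wt x)) := by
    intro x
    by_cases hx : x ∈ tsupport η
    swap
    · simp [image_eq_zero_of_notMem_tsupport hx]
    have hxB := η3 hx
    have hxK := η4 hx
    have hwx : ContDiffAt ℝ 2 w x := hw.contDiffAt (hB.mem_nhds hxB)
    have hdv := c.dv_Fl S hP.contDiffAt hwx (hb.differentiable one_ne_zero x)
      (hqC.differentiable one_ne_zero x)
    obtain ⟨pc1, pc2⟩ := hPC x hxK
    have hDq : fderiv ℝ q x (c.Z P x) = S ^ 2 * fderiv ℝ (c.Gm P) x (c.Z P x) + m * c.Gm P x := by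
      have d1 : HasFDerivAt q _ x :=
        ((hG.differentiable one_ne_zero x).hasFDerivAt.const_mul (S ^ 2)).add
        (((hP.differentiable two_ne_zero x).hasFDerivAt.sub_const R).const_mul m)
      rw [d1.fderiv]
      simp only [add_apply, smul_apply, smul_eq_mul, ← inner_grad]
      rfl
    have k1 := key s S m m2 ‖gradient w x‖ (w x) (wt x)
      (wt x + 2 * (S * ⟪gradient w x, c.Z P x⟫) + S * b x * w x) (c.L w x + q x * w x)
      ⟪gradient w x, c.Z P x⟫ (fderiv ℝ b x (c.Z w x)) (b x) (c.L P x) (P x - R) (c.Gm P x)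
      (4 * ⟪gradient w x, fderiv ℝ (c.Z P) x (c.A x (gradient w x))⟫ -
        2 * ⟪gradient w x, fderiv ℝ c.A x (c.Z P x) (gradient w x)⟫ +
        2 * (b x - c.L P x) * ⟪gradient w x, c.A x (gradient w x)⟫)
      (2 * fderiv ℝ (c.Gm P) x (c.Z P x) + 2 * (c.L P x - b x) * c.Gm P x)
      hs hsS hm' hm2' (norm_nonneg _) ?_ ?_ ?_ ?_ ?_ ?_ (pc1 _) pc2 rfl ?_
    · have k2 : η x * (c.ω x * (c' * en S w wt x)) ≤ η x * (c.ω x * _) :=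
        mul_le_mul_of_nonneg_left (mul_le_mul_of_nonneg_left k1 (c.ωpos x).le) (η5 x)
      have e1 : c' * (η x * (c.ω x * en S w wt x)) = η x * (c.ω x * (c' * en S w wt x)) := by ring
      rw [e1]
      refine k2.trans (le_of_eq ?_)
      have e2 : -(η x * dv (c.Fl S P b q w) x) = η x * (-dv (c.Fl S P b q w) x) := by ring
      rw [e2, hdv, hDq]
      simp only [hq, Coef.qf, Coef.qt, Coef.Z]
      ring
    · have a1 := abs_real_inner_le_norm (gradient w x) (c.Z P x)
      have a2 := h1 x hxK
      rw [abs_of_nonneg (norm_nonneg _)] at a2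
      calc _ ≤ _ := a1
        _ ≤ ‖gradient w x‖ * M := by gcongr; linarith
        _ = _ := mul_comm _ _
    · have a2 := h2 x hxK
      rw [abs_of_nonneg (by positivity)] at a2
      calc |fderiv ℝ b x (c.Z w x)| ≤ ‖fderiv ℝ b x‖ * ‖c.Z w x‖ :=
            (fderiv ℝ b x).le_opNorm _
        _ ≤ ‖fderiv ℝ b x‖ * (‖c.A x‖ * ‖gradient w x‖) := by
            gcongr; exact (c.A x).le_opNorm _
        _ = (‖fderiv ℝ b x‖ * ‖c.A x‖) * ‖gradient w x‖ := by ring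
        _ ≤ _ := by gcongr; linarith
    · exact (h3 x hxK).trans (by linarith)
    · exact (h4 x hxK).trans (by linarith)
    · exact (h5 x hxK).trans (by linarith)
    · exact (h6 x hxK).trans (by linarith)
    · rw [hpde x hxB]; ring
  have hintg := integral_mono (I1.const_mul c') ((I6.neg.add (I2.const_mul 2)).add I4) pw
  rw [integral_const_mul, integral_add' (I6.neg.add (I2.const_mul 2)) I4,
    integral_add' I6.neg (I2.const_mul 2), integral_neg', integral_const_mul] at hintg
  rw [hB1, Coef.Jd, integral_add I2 I3]
  linarith

/-! ### Construction of pseudoconvex weights -/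

lemma Coef.elliptic_on (c : Coef n) {K : Set (Eucl n)} (hK : IsCompact K) :
    ∃ a0 : ℝ, 0 < a0 ∧ ∀ x ∈ K, ∀ v, a0 * ‖v‖ ^ 2 ≤ ⟪v, c.A x v⟫ := by
  by_cases hne : (K ×ˢ Metric.sphere (0 : Eucl n) 1).Nonempty
  · have hcomp : IsCompact (K ×ˢ Metric.sphere (0 : Eucl n) 1) := hK.prod (isCompact_sphere _ _)
    have hcont : ContinuousOn (fun q : Eucl n × Eucl n => ⟪q.2, c.A q.1 q.2⟫)
        (K ×ˢ Metric.sphere (0 : Eucl n) 1) := by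
      apply Continuous.continuousOn
      exact continuous_snd.inner ((c.hA.continuous.comp continuous_fst).clm_apply continuous_snd)
    obtain ⟨q, hq, hmin⟩ := hcomp.exists_isMinOn hne hcont
    have hq2 : q.2 ≠ 0 := by
      intro h
      have := hq.2
      simp [h] at this
    refine ⟨_, c.pos q.1 q.2 hq2, fun x hx v => ?_⟩
    by_cases hv : v = 0
    · simp [hv]
    have hvn : 0 < ‖v‖ := norm_pos_iff.2 hv
    have := hmin (a := (x, ‖v‖⁻¹ • v)) ⟨hx, by simp [norm_smul, hvn.ne']⟩
    simp only [mem_ofPred_eq, map_smul, inner_smul_left, inner_smul_right] at this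
    simp only [conj_trivial] at this
    calc _ ≤ (‖v‖⁻¹ * (‖v‖⁻¹ * ⟪v, c.A x v⟫)) * ‖v‖ ^ 2 := by gcongr
      _ = _ := by field_simp
  · refine ⟨1, one_pos, fun x hx v => ?_⟩
    by_cases hv : v = 0
    · simp [hv]
    have hvn : 0 < ‖v‖ := norm_pos_iff.2 hv
    exact absurd ⟨(x, ‖v‖⁻¹ • v), ⟨hx, by simp [norm_smul, hvn.ne']⟩⟩ hne

lemma gradient_exp {ψ : Eucl n → ℝ} (hψ : ContDiff ℝ 2 ψ) (l : ℝ) (x : Eucl n) :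
    gradient (fun y => Real.exp (l * ψ y)) x = (l * Real.exp (l * ψ x)) • gradient ψ x := by
  have h1 : HasFDerivAt (fun y => Real.exp (l * ψ y)) _ x :=
    ((hψ.differentiable two_ne_zero x).hasFDerivAt.const_mul l).exp
  refine ext_inner_right ℝ fun v => ?_
  rw [inner_grad, h1.fderiv, inner_smul_left, inner_grad]
  simp
  ring

set_option maxHeartbeats 800000 in
lemma exists_weight (c : Coef n) {ψ : Eucl n → ℝ} (hψ : ContDiff ℝ 2 ψ) {K : Set (Eucl n)}
    (hK : IsCompact K) (hgr : ∀ x ∈ K, gradient ψ x ≠ 0) :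
    ∃ l : ℝ, 0 < l ∧ ∃ b : Eucl n → ℝ, ContDiff ℝ 1 b ∧ ∃ c0 : ℝ, 0 < c0 ∧
      c.PC (fun x => Real.exp (l * ψ x)) b K c0 := by
  have hZ := c.Z_contDiff hψ
  have hG := c.Gm_contDiff hψ
  have hL := c.L_cont hψ
  obtain ⟨a0, ha0, hell⟩ := c.elliptic_on hK
  obtain ⟨M1, hM1, h1⟩ := exists_bound_on hK (f := fun x => ‖fderiv ℝ (c.Z ψ) x‖ * ‖c.A x‖)
    ((hZ.continuous_fderiv one_ne_zero).norm.mul c.hA.continuous.norm).continuousOn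
  obtain ⟨M2, hM2, h2⟩ := exists_bound_on hK (f := fun x => ‖fderiv ℝ c.A x (c.Z ψ x)‖)
    ((c.hA.continuous_fderiv one_ne_zero).clm_apply hZ.continuous).norm.continuousOn
  obtain ⟨M3, hM3, h3⟩ := exists_bound_on hK hL.continuousOn
  obtain ⟨M4, hM4, h4⟩ := exists_bound_on hK (f := fun x => fderiv ℝ (c.Gm ψ) x (c.Z ψ x))
    ((hG.continuous_fderiv one_ne_zero).clm_apply hZ.continuous).continuousOn
  obtain ⟨M5, hM5, h5⟩ := exists_bound_on hK hG.continuous.continuousOn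
  obtain ⟨M6, hM6, h6⟩ := exists_bound_on hK (f := fun x => ‖gradient ψ x‖⁻¹)
    ((gradient_contDiff hψ).continuous.norm.continuousOn.inv₀ fun x hx => norm_ne_zero_iff.2 (hgr x hx))
  obtain ⟨M7, hM7, h7⟩ := exists_bound_on hK hψ.continuous.continuousOn
  set b0 : ℝ := M3 + (4 * M1 + 2 * M2 + 1) / (2 * a0) with hb0
  have hb0p : 0 ≤ b0 := by positivity
  -- lower bound for Gm ψ
  set γ : ℝ := a0 / (1 + M6) ^ 2 with hγ
  have hγp : 0 < γ := by positivity
  have hγl : ∀ x ∈ K, γ ≤ c.Gm ψ x := by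
    intro x hx
    refine le_trans ?_ (hell x hx (gradient ψ x))
    have hp : 0 < ‖gradient ψ x‖ := norm_pos_iff.2 (hgr x hx)
    have h6' := h6 x hx
    rw [abs_of_pos (by positivity)] at h6'
    rw [hγ, div_eq_mul_inv, ← inv_pow]
    gcongr
    rw [inv_le_comm₀ (by positivity) hp]
    linarith
  set l : ℝ := 1 + (2 * M4 + 2 * (M3 + b0) * M5 + 1) / (4 * γ ^ 2) with hl
  have hlp : 0 < l := by positivity
  set P : Eucl n → ℝ := fun x => Real.exp (l * ψ x) with hPdef
  have hP : ContDiff ℝ 2 P := (contDiff_const.mul hψ).exp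
  have hP1 : ContDiff ℝ 1 P := hP.of_le (by norm_num)
  have hPp : ∀ x, 0 < P x := fun x => Real.exp_pos _
  refine ⟨l, hlp, fun x => l * P x * (b0 + l * c.Gm ψ x),
    (contDiff_const.mul hP1).mul (contDiff_const.add (contDiff_const.mul hG)), ?_⟩
  have hgP : ∀ x, gradient P x = (l * P x) • gradient ψ x := gradient_exp hψ l
  have hDP : ∀ x v, fderiv ℝ P x v = l * P x * fderiv ℝ ψ x v := by
    intro x v
    rw [← inner_grad, hgP, inner_smul_left, inner_grad]; simp
  have hZP : c.Z P = fun x => (l * P x) • c.Z ψ x := by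
    funext x; simp only [Coef.Z, hgP, map_smul]
  have hlP : ∀ x, HasFDerivAt (fun y => l * P y) (l • fderiv ℝ P x) x := fun x =>
    (hP.differentiable two_ne_zero x).hasFDerivAt.const_mul l
  have hGP : c.Gm P = fun x => (l * P x) ^ 2 * c.Gm ψ x := by
    funext x
    simp only [Coef.Gm, hZP, hgP, inner_smul_left, inner_smul_right]
    simp; ring
  have hDZ : ∀ x v, fderiv ℝ (c.Z P) x v =
      (l * P x) • fderiv ℝ (c.Z ψ) x v + (l * (l * P x * fderiv ℝ ψ x v)) • c.Z ψ x := by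
    intro x v
    rw [hZP]
    have := (hlP x).fun_smul (hZ.differentiable one_ne_zero x).hasFDerivAt
    rw [this.fderiv]
    simp [hDP]
  have hLP : ∀ x, c.L P x = l * P x * (c.L ψ x + l * c.Gm ψ x) := by
    intro x
    have e0 : c.ω x * c.L P x = dv (fun y => (l * P y) • (c.ω y • c.Z ψ y)) x := by
      rw [← c.L_mul, hZP]
      congr 1
      funext y
      rw [smul_comm]
    have d1 : DifferentiableAt ℝ (fun y => c.ω y • c.Z ψ y) x :=
      (c.ω_diff x).smul (hZ.differentiable one_ne_zero x)
    rw [dv_smul (hlP x).differentiableAt d1, c.L_mul, (hlP x).fderiv] at e0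
    simp only [smul_apply, map_smul, smul_eq_mul, hDP] at e0
    have e1 : fderiv ℝ ψ x (c.Z ψ x) = c.Gm ψ x := (inner_grad _ _ _).symm
    rw [e1] at e0
    have hω := (c.ωpos x).ne'
    apply mul_left_cancel₀ hω
    rw [e0]; ring
  have hDG : ∀ x, fderiv ℝ (c.Gm P) x (c.Z P x) =
      (l * P x) ^ 3 * (2 * l * c.Gm ψ x ^ 2 + fderiv ℝ (c.Gm ψ) x (c.Z ψ x)) := by
    intro x
    rw [hGP]
    have := ((hlP x).pow 2).mul (hG.differentiable one_ne_zero x).hasFDerivAt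
    have e : (fun x => (l * P x) ^ 2 * c.Gm ψ x) = (fun y => (l * P y) ^ 2) * c.Gm ψ := rfl
    rw [e, this.fderiv, hZP]
    have e1 : fderiv ℝ ψ x (c.Z ψ x) = c.Gm ψ x := (inner_grad _ _ _).symm
    simp [hDP, e1]
    ring
  set p0 : ℝ := l * Real.exp (-(l * M7)) with hp0
  have hp0p : 0 < p0 := by positivity
  have hp0l : ∀ x ∈ K, p0 ≤ l * P x := by
    intro x hx
    have h7' := mul_le_mul_of_nonneg_left (abs_le.1 (h7 x hx)).1 hlp.le
    have h8 : Real.exp (-(l * M7)) ≤ P x := Real.exp_le_exp.2 (by linarith)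
    exact mul_le_mul_of_nonneg_left h8 hlp.le
  refine ⟨min p0 (p0 ^ 3), by positivity, fun x hx => ⟨fun v => ?_, ?_⟩⟩
  · have hlPp : 0 < l * P x := mul_pos hlp (hPp x)
    have e0 : ⟪v, fderiv ℝ (c.Z P) x (c.A x v)⟫ = (l * P x) * ⟪v, fderiv ℝ (c.Z ψ) x (c.A x v)⟫ +
        l * (l * P x) * ⟪v, c.Z ψ x⟫ ^ 2 := by
      rw [hDZ, inner_add_right, inner_smul_right, inner_smul_right, ← inner_grad, c.symm',
        ]
      simp only [Coef.Z]; ring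
    have e1 : ⟪v, fderiv ℝ c.A x (c.Z P x) v⟫ = (l * P x) * ⟪v, fderiv ℝ c.A x (c.Z ψ x) v⟫ := by
      rw [hZP]
      simp [inner_smul_right]
    have i1 : |⟪v, fderiv ℝ (c.Z ψ) x (c.A x v)⟫| ≤ M1 * ‖v‖ ^ 2 := by
      calc _ ≤ ‖v‖ * ‖fderiv ℝ (c.Z ψ) x (c.A x v)‖ := abs_real_inner_le_norm _ _
        _ ≤ ‖v‖ * (‖fderiv ℝ (c.Z ψ) x‖ * (‖c.A x‖ * ‖v‖)) := by
            gcongr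
            exact ((fderiv ℝ (c.Z ψ) x).le_opNorm _).trans (by gcongr; exact (c.A x).le_opNorm _)
        _ = (‖fderiv ℝ (c.Z ψ) x‖ * ‖c.A x‖) * ‖v‖ ^ 2 := by ring
        _ ≤ _ := by gcongr; exact (le_abs_self _).trans (h1 x hx)
    have i2 : |⟪v, fderiv ℝ c.A x (c.Z ψ x) v⟫| ≤ M2 * ‖v‖ ^ 2 := by
      calc _ ≤ ‖v‖ * ‖fderiv ℝ c.A x (c.Z ψ x) v‖ := abs_real_inner_le_norm _ _
        _ ≤ ‖v‖ * (‖fderiv ℝ c.A x (c.Z ψ x)‖ * ‖v‖) := by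
            gcongr
            exact (fderiv ℝ c.A x (c.Z ψ x)).le_opNorm _
        _ = ‖fderiv ℝ c.A x (c.Z ψ x)‖ * ‖v‖ ^ 2 := by ring
        _ ≤ _ := by gcongr; exact (le_abs_self _).trans (h2 x hx)
    have i3 : (4 * M1 + 2 * M2 + 1) * ‖v‖ ^ 2 ≤ 2 * (b0 - c.L ψ x) * ⟪v, c.A x v⟫ := by
      have j1 : (4 * M1 + 2 * M2 + 1) / a0 ≤ 2 * (b0 - c.L ψ x) := by
        have := (abs_le.1 (h3 x hx)).2
        have e : (4 * M1 + 2 * M2 + 1) / a0 = 2 * ((4 * M1 + 2 * M2 + 1) / (2 * a0)) := by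
          field_simp
        rw [e, hb0]; linarith
      calc (4 * M1 + 2 * M2 + 1) * ‖v‖ ^ 2 = (4 * M1 + 2 * M2 + 1) / a0 * (a0 * ‖v‖ ^ 2) := by
            field_simp
        _ ≤ 2 * (b0 - c.L ψ x) * ⟪v, c.A x v⟫ := by
            apply mul_le_mul j1 (hell x hx v) (by positivity)
            exact le_trans (by positivity) j1
    have i4 : 0 ≤ l * (l * P x) * ⟪v, c.Z ψ x⟫ ^ 2 := by positivity
    calc min p0 (p0 ^ 3) * ‖v‖ ^ 2 ≤ (l * P x) * ‖v‖ ^ 2 := by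
          gcongr; exact (min_le_left _ _).trans (hp0l x hx)
      _ ≤ (l * P x) * (4 * ⟪v, fderiv ℝ (c.Z ψ) x (c.A x v)⟫ -
          2 * ⟪v, fderiv ℝ c.A x (c.Z ψ x) v⟫ + 2 * (b0 - c.L ψ x) * ⟪v, c.A x v⟫) := by
          gcongr
          linarith [(abs_le.1 i1).1, (abs_le.1 i2).2]
      _ ≤ _ := by
          rw [e0, e1, hLP]
          linarith
  · have hlPp : 0 < l * P x := mul_pos hlp (hPp x)
    rw [hDG, hLP, hGP]
    have i0 := hγl x hx
    have i1 := (abs_le.1 (h4 x hx)).1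
    have i2 : -(2 * (M3 + b0) * M5) ≤ 2 * (c.L ψ x - b0) * c.Gm ψ x := by
      have k1 : |c.L ψ x - b0| ≤ M3 + b0 :=
        (abs_sub _ _).trans (by rw [abs_of_nonneg hb0p]; linarith [h3 x hx])
      have k2 : |2 * (c.L ψ x - b0) * c.Gm ψ x| ≤ 2 * (M3 + b0) * M5 := by
        rw [abs_mul, abs_mul, abs_two]
        have := h5 x hx
        gcongr
      exact (abs_le.1 k2).1
    have i3 : 2 * M4 + 2 * (M3 + b0) * M5 + 1 ≤ 4 * l * c.Gm ψ x ^ 2 := by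
      calc 2 * M4 + 2 * (M3 + b0) * M5 + 1 =
          4 * ((2 * M4 + 2 * (M3 + b0) * M5 + 1) / (4 * γ ^ 2)) * γ ^ 2 := by field_simp
        _ ≤ 4 * l * c.Gm ψ x ^ 2 := by
          gcongr
          rw [hl]; linarith
    calc min p0 (p0 ^ 3) ≤ (l * P x) ^ 3 * 1 := by
          rw [mul_one]
          exact (min_le_right _ _).trans (by gcongr; exact hp0l x hx)
      _ ≤ (l * P x) ^ 3 * (4 * l * c.Gm ψ x ^ 2 + 2 * fderiv ℝ (c.Gm ψ) x (c.Z ψ x) +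
          2 * (c.L ψ x - b0) * c.Gm ψ x) := by
          gcongr
          linarith
      _ = _ := by ring

/-! ### Time weights and conjugation -/

/-- the singular time weight -/
def sg (T t : ℝ) : ℝ := 1 / (t * (T - t))
/-- its derivative -/
def sg1 (T t : ℝ) : ℝ := (2 * t - T) * sg T t ^ 2
/-- its second derivative -/
def sg2 (T t : ℝ) : ℝ := 2 * sg T t ^ 2 + 2 * (2 * t - T) ^ 2 * sg T t ^ 3

lemma sg_den_pos {T t : ℝ} (ht : t ∈ Ioo 0 T) : 0 < t * (T - t) :=
  mul_pos ht.1 (by linarith [ht.2])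

lemma sg_pos {T t : ℝ} (ht : t ∈ Ioo 0 T) : 0 < sg T t :=
  one_div_pos.2 (sg_den_pos ht)

lemma sg_lower {T t : ℝ} (ht : t ∈ Ioo 0 T) : 4 / T ^ 2 ≤ sg T t := by
  have h := sg_den_pos ht
  have hT : 0 < T := ht.1.trans ht.2
  unfold sg
  rw [div_le_div_iff₀ (by positivity) h]
  nlinarith [sq_nonneg (2 * t - T)]

lemma sg1_le {T t : ℝ} (ht : t ∈ Ioo 0 T) : |sg1 T t| ≤ T * sg T t ^ 2 := by
  unfold sg1
  rw [abs_mul, abs_of_nonneg (sq_nonneg (sg T t))]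
  gcongr
  rw [abs_le]; constructor <;> linarith [ht.1, ht.2]

lemma sg2_le {T t : ℝ} (ht : t ∈ Ioo 0 T) : |sg2 T t| ≤ 3 * T ^ 2 * sg T t ^ 3 := by
  have hs := sg_pos ht
  have hl := sg_lower ht
  have hT : 0 < T := ht.1.trans ht.2
  have h1 : 4 ≤ T ^ 2 * sg T t := by
    rw [div_le_iff₀ (by positivity)] at hl; linarith
  have h2 : (2 * t - T) ^ 2 ≤ T ^ 2 := by nlinarith [ht.1, ht.2]
  unfold sg2
  rw [abs_of_nonneg (by positivity)]
  have h3 : 2 * sg T t ^ 2 ≤ T ^ 2 * sg T t ^ 3 := by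
    have : T ^ 2 * sg T t ^ 3 = (T ^ 2 * sg T t) * sg T t ^ 2 := by ring
    rw [this]; nlinarith [sq_nonneg (sg T t)]
  have h4 : 2 * (2 * t - T) ^ 2 * sg T t ^ 3 ≤ 2 * T ^ 2 * sg T t ^ 3 := by gcongr
  linarith

lemma sg_hasDerivAt {T t : ℝ} (ht : t ∈ Ioo 0 T) : HasDerivAt (sg T) (sg1 T t) t := by
  have h := sg_den_pos ht
  have h1 : HasDerivAt (fun t => t * (T - t)) (1 * (T - t) + t * (-1)) t :=
    (hasDerivAt_id t).mul ((hasDerivAt_id t).const_sub T)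
  have h2 := (hasDerivAt_const t (1 : ℝ)).div h1 h.ne'
  refine h2.congr_deriv ?_
  unfold sg1 sg
  field_simp
  ring

lemma sg1_hasDerivAt {T t : ℝ} (ht : t ∈ Ioo 0 T) : HasDerivAt (sg1 T) (sg2 T t) t := by
  have h1 : HasDerivAt (fun t => 2 * t - T) 2 t := by
    simpa using ((hasDerivAt_id t).const_mul 2).sub_const T
  have h2 := h1.mul ((sg_hasDerivAt ht).pow 2)
  refine h2.congr_deriv ?_
  unfold sg2 sg1
  simp
  ring

lemma sg_cont (T : ℝ) : ContinuousOn (sg T) (Ioo 0 T) := fun _ ht =>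
  (sg_hasDerivAt ht).continuousAt.continuousWithinAt

lemma sg1_cont (T : ℝ) : ContinuousOn (sg1 T) (Ioo 0 T) := fun _ ht =>
  (sg1_hasDerivAt ht).continuousAt.continuousWithinAt

lemma sg_tendsto_zero {T : ℝ} (hT : 0 < T) : Filter.Tendsto (sg T) (𝓝[>] 0) Filter.atTop := by
  have h1 : Filter.Tendsto (fun t => t * (T - t)) (𝓝[>] 0) (𝓝[>] 0) := by
    refine tendsto_nhdsWithin_iff.2 ⟨?_, ?_⟩
    · have : ContinuousAt (fun t : ℝ => t * (T - t)) 0 := by fun_prop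
      simpa using this.tendsto.mono_left nhdsWithin_le_nhds
    · filter_upwards [Ioo_mem_nhdsGT hT] with t ht using sg_den_pos ht
  refine (Filter.Tendsto.inv_tendsto_nhdsGT_zero h1).congr fun t => ?_
  simp [sg]

lemma sg_tendsto_T {T : ℝ} (hT : 0 < T) : Filter.Tendsto (sg T) (𝓝[<] T) Filter.atTop := by
  have h1 : Filter.Tendsto (fun t => t * (T - t)) (𝓝[<] T) (𝓝[>] 0) := by
    refine tendsto_nhdsWithin_iff.2 ⟨?_, ?_⟩
    · have : ContinuousAt (fun t : ℝ => t * (T - t)) T := by fun_prop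
      simpa using this.tendsto.mono_left nhdsWithin_le_nhds
    · filter_upwards [Ioo_mem_nhdsLT hT] with t ht using sg_den_pos ht
  refine (Filter.Tendsto.inv_tendsto_nhdsGT_zero h1).congr fun t => ?_
  simp [sg]

/-- Classical solutions. -/
structure CSol (c : Coef n) (T : ℝ) (B : Set (Eucl n)) (u ut : ℝ → Eucl n → ℝ) : Prop where
  cu : ContinuousOn (fun q : ℝ × Eucl n => u q.1 q.2) (Icc 0 T ×ˢ closure B)
  cg : ContinuousOn (fun q : ℝ × Eucl n => gradient (u q.1) q.2) (Icc 0 T ×ˢ closure B)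
  ct : ContinuousOn (fun q : ℝ × Eucl n => ut q.1 q.2) (Icc 0 T ×ˢ closure B)
  c2 : ∀ t ∈ Ioo 0 T, ContDiffOn ℝ 2 (u t) B
  hd : ∀ t ∈ Ioo 0 T, ∀ x ∈ B, HasDerivAt (fun s => u s x) (ut t x) t
  pde : ∀ t ∈ Ioo 0 T, ∀ x ∈ B, ut t x = c.L (u t) x

/-- conjugated gradient -/
def cgr (S : ℝ) (P : Eucl n → ℝ) (x : Eucl n) (U : ℝ) (p : Eucl n) : Eucl n :=
  p + (S * U) • gradient P x

/-- conjugated time derivative -/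
def cqt (m R : ℝ) (P : Eucl n → ℝ) (x : Eucl n) (U Ut : ℝ) : ℝ := Ut + m * (P x - R) * U

/-- the conjugation factor -/
def cex (S R : ℝ) (P : Eucl n → ℝ) (x : Eucl n) : ℝ := Real.exp (S * (P x - R))

section conj
variable (c : Coef n) {P U : Eucl n → ℝ} {x : Eucl n} (S R : ℝ)

lemma cex_contDiff (hP : ContDiff ℝ 2 P) : ContDiff ℝ 2 (cex S R P) := by
  have : ContDiff ℝ 2 fun x => Real.exp (S * (P x - R)) :=
    (contDiff_const.mul (hP.sub contDiff_const)).exp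
  exact this

lemma gradient_cex (hP : ContDiff ℝ 2 P) (x : Eucl n) :
    gradient (cex S R P) x = (S * cex S R P x) • gradient P x := by
  have h1 : HasFDerivAt (fun y => Real.exp (S * (P y - R))) _ x :=
    (((hP.differentiable two_ne_zero x).hasFDerivAt.sub_const R).const_mul S).exp
  refine ext_inner_right ℝ fun v => ?_
  rw [inner_grad]
  change fderiv ℝ (fun y => Real.exp (S * (P y - R))) x v = _
  rw [h1.fderiv, inner_smul_left, inner_grad]
  simp [cex]
  ring

lemma gradient_mul {f g : Eucl n → ℝ} (hf : DifferentiableAt ℝ f x) (hg : DifferentiableAt ℝ g x) :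
    gradient (fun y => f y * g y) x = f x • gradient g x + g x • gradient f x := by
  refine ext_inner_right ℝ fun v => ?_
  rw [inner_grad, fderiv_fun_mul hf hg, inner_add_left, inner_smul_left, inner_smul_left,
    inner_grad, inner_grad]
  simp

lemma gradient_conj (hP : ContDiff ℝ 2 P) (hU : DifferentiableAt ℝ U x) :
    gradient (fun y => cex S R P y * U y) x =
      cex S R P x • cgr S P x (U x) (gradient U x) := by
  rw [gradient_mul ((cex_contDiff S R hP).differentiable two_ne_zero x) hU, gradient_cex S R hP]
  unfold cgr
  rw [smul_add, smul_smul, smul_smul]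
  congr 2
  ring

lemma L_mul_fun {f g : Eucl n → ℝ} (hf : ContDiffAt ℝ 2 f x) (hg : ContDiffAt ℝ 2 g x) :
    c.L (fun y => f y * g y) x = f x * c.L g x + g x * c.L f x + 2 * ⟪gradient f x, c.Z g x⟫ := by
  have df := hf.differentiableAt two_ne_zero
  have dg := hg.differentiableAt two_ne_zero
  have dZf : DifferentiableAt ℝ (fun y => c.ω y • c.Z f y) x :=
    (c.ω_diff x).smul ((c.Z_contDiffAt hf).differentiableAt one_ne_zero)
  have dZg : DifferentiableAt ℝ (fun y => c.ω y • c.Z g y) x :=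
    (c.ω_diff x).smul ((c.Z_contDiffAt hg).differentiableAt one_ne_zero)
  have hev : (fun y => c.ω y • c.Z (fun y => f y * g y) y) =ᶠ[𝓝 x]
      fun y => f y • (c.ω y • c.Z g y) + g y • (c.ω y • c.Z f y) := by
    filter_upwards [hf.eventually (by simp), hg.eventually (by simp)] with y h1 h2
    unfold Coef.Z
    rw [gradient_mul (h1.differentiableAt two_ne_zero) (h2.differentiableAt two_ne_zero)]
    simp only [map_add, map_smul, smul_add]
    rw [smul_comm (c.ω y) (f y), smul_comm (c.ω y) (g y)]
  have h0 := c.L_mul (fun y => f y * g y) x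
  have e1 : DifferentiableAt ℝ (fun y => f y • (c.ω y • c.Z g y)) x := df.smul dZg
  have e2 : DifferentiableAt ℝ (fun y => g y • (c.ω y • c.Z f y)) x := dg.smul dZf
  rw [dv_congr hev, dv_add e1 e2, dv_smul df dZg, dv_smul dg dZf, c.L_mul,
    c.L_mul, map_smul, map_smul, ← inner_grad, ← inner_grad] at h0
  have h3 : ⟪gradient g x, c.Z f x⟫ = ⟪gradient f x, c.Z g x⟫ := c.symm' x _ _
  rw [h3, smul_eq_mul] at h0
  have hω := (c.ωpos x).ne'
  apply mul_left_cancel₀ hω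
  rw [← h0]; ring

lemma L_cex (hP : ContDiff ℝ 2 P) (x : Eucl n) :
    c.L (cex S R P) x = cex S R P x * (S * c.L P x + S ^ 2 * c.Gm P x) := by
  have h0 := c.L_mul (cex S R P) x
  have he : (fun y => c.ω y • c.Z (cex S R P) y) =
      fun y => (S * cex S R P y) • (c.ω y • c.Z P y) := by
    funext y
    unfold Coef.Z
    rw [gradient_cex S R hP, map_smul, smul_comm]
  have d1 : DifferentiableAt ℝ (cex S R P) x := (cex_contDiff S R hP).differentiable two_ne_zero x
  have dZ : DifferentiableAt ℝ (fun y => c.ω y • c.Z P y) x :=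
    (c.ω_diff x).smul ((c.Z_contDiff hP).differentiable one_ne_zero x)
  rw [he, dv_smul (d1.const_mul S) dZ, c.L_mul, fderiv_const_mul d1, smul_apply, map_smul,
    ← inner_grad, gradient_cex S R hP, inner_smul_left] at h0
  have hω := (c.ωpos x).ne'
  apply mul_left_cancel₀ hω
  rw [← h0]
  simp only [smul_eq_mul, conj_trivial, Coef.Gm]
  ring

/-- the conjugated equation -/
lemma conj_pde (m : ℝ) (hP : ContDiff ℝ 2 P) (hU : ContDiffAt ℝ 2 U x) {Ut : ℝ}
    (h : Ut = c.L U x) :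
    cex S R P x * cqt m R P x (U x) Ut = c.L (fun y => cex S R P y * U y) x -
      2 * (S * ⟪gradient (fun y => cex S R P y * U y) x, c.Z P x⟫) +
      (c.qf S m R P x - S * c.L P x) * (cex S R P x * U x) := by
  rw [L_mul_fun c (cex_contDiff S R hP).contDiffAt hU, L_cex c S R hP, gradient_cex S R hP,
    gradient_conj S R hP (hU.differentiableAt two_ne_zero), ← h]
  have h3 : ⟪gradient P x, c.Z U x⟫ = ⟪gradient U x, c.Z P x⟫ := c.symm' x _ _
  unfold cgr cqt Coef.qf
  simp only [inner_smul_left, inner_add_left, conj_trivial]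
  rw [h3]
  have h4 : ⟪gradient P x, c.Z P x⟫ = c.Gm P x := rfl
  rw [h4]
  ring

end conj

lemma J_lemma {T : ℝ} (hT : 0 < T) {J J' φ : ℝ → ℝ} (hJ : ∀ t ∈ Ioo 0 T, HasDerivAt J (J' t) t)
    (hle : ∀ t ∈ Ioo 0 T, J' t ≤ φ t) (hφ : IntegrableOn φ (Ioo 0 T))
    (h0 : Filter.Tendsto J (𝓝[>] 0) (𝓝 0)) (h1 : Filter.Tendsto J (𝓝[<] T) (𝓝 0)) :
    0 ≤ ∫ t in Ioo 0 T, φ t := by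
  set g : ℝ → ℝ := (Ioo 0 T).indicator J with hg
  have g0 : g 0 = 0 := by simp [hg]
  have gT : g T = 0 := by simp [hg]
  have hd : ∀ t ∈ Ioo 0 T, HasDerivAt g (J' t) t := by
    intro t ht
    refine (hJ t ht).congr_of_eventuallyEq ?_
    filter_upwards [isOpen_Ioo.mem_nhds ht] with y hy
    simp [hg, hy]
  have hc : ContinuousOn g (Icc 0 T) := by
    intro t ht
    rcases eq_or_lt_of_le ht.1 with h | h
    · subst h
      have : ContinuousWithinAt g (Ioi 0) 0 := by
        unfold ContinuousWithinAt
        rw [g0]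
        refine h0.congr' ?_
        filter_upwards [Ioo_mem_nhdsGT hT] with y hy
        simp [hg, hy]
      exact (continuousWithinAt_Ioi_iff_Ici.1 this).mono Icc_subset_Ici_self
    · rcases eq_or_lt_of_le ht.2 with h' | h'
      · subst h'
        have : ContinuousWithinAt g (Iio t) t := by
          unfold ContinuousWithinAt
          rw [gT]
          refine h1.congr' ?_
          filter_upwards [Ioo_mem_nhdsLT hT] with y hy
          simp [hg, hy]
        exact (continuousWithinAt_Iio_iff_Iic.1 this).mono Icc_subset_Iic_self
      · exact (hd t ⟨h, h'⟩).continuousAt.continuousWithinAt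
  have := intervalIntegral.sub_le_integral_of_hasDeriv_right_of_le (a := 0) (b := T) hT.le hc
    (fun t ht => (hd t ht).hasDerivWithinAt)
    (by rw [integrableOn_Icc_iff_integrableOn_Ioo]; exact hφ) hle
  rw [g0, gT, sub_zero, intervalIntegral.integral_of_le hT.le, integral_Ioc_eq_integral_Ioo] at this
  exact this

lemma slice_integrable {T : ℝ} {A : Set (Eucl n)} (hA : MeasurableSet A) (hA' : volume A ≠ ⊤)
    {f : ℝ → Eucl n → ℝ} {M : ℝ}
    (hf : ContinuousOn (fun q : ℝ × Eucl n => f q.1 q.2) (Ioo 0 T ×ˢ A))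
    (hM : ∀ t ∈ Ioo 0 T, ∀ x ∈ A, |f t x| ≤ M) :
    IntegrableOn (fun t => ∫ x in A, f t x) (Ioo 0 T) := by
  have hm : MeasurableSet (Ioo 0 T ×ˢ A) := measurableSet_Ioo.prod hA
  have h1 : IntegrableOn (fun q : ℝ × Eucl n => f q.1 q.2) (Ioo 0 T ×ˢ A) := by
    refine IntegrableOn.of_bound (C := M) ?_ (hf.aestronglyMeasurable hm) ?_
    · rw [Measure.volume_eq_prod, Measure.prod_prod]
      exact (ENNReal.mul_ne_top (by simp) hA').lt_top
    · filter_upwards [ae_restrict_mem hm] with q hq using hM _ hq.1 _ hq.2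
  unfold IntegrableOn at h1
  rw [Measure.volume_eq_prod, ← Measure.prod_restrict] at h1
  exact h1.integral_prod_left

/-! ### Differentiating the energy functional in time -/

lemma energy_diff (c : Coef n) {B : Set (Eucl n)} (hB : IsOpen B) {η : Eucl n → ℝ}
    (η1 : ContDiff ℝ 1 η) (η2 : HasCompactSupport η) (η3 : tsupport η ⊆ B)
    {w1 w2 : Eucl n → ℝ} (h1 : ContDiffOn ℝ 2 w1 B) (h2 : ContDiffOn ℝ 2 w2 B) :
    (∫ x, η x * (c.ω x * ⟪gradient w1 x, c.Z w1 x⟫)) -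
      (∫ x, η x * (c.ω x * ⟪gradient w2 x, c.Z w2 x⟫)) =
    ∫ x, -((w1 x - w2 x) * (η x * (c.ω x * (c.L w1 x + c.L w2 x)) +
      fderiv ℝ η x (c.ω x • (c.Z w1 x + c.Z w2 x)))) := by
  have cω : ContinuousOn c.ω B := c.hω.continuous.continuousOn
  have g1 := gradient_contDiffOn hB h1
  have g2 := gradient_contDiffOn hB h2
  have z1 : ContDiffOn ℝ 1 (c.Z w1) B := c.hA.contDiffOn.clm_apply g1
  have z2 : ContDiffOn ℝ 1 (c.Z w2) B := c.hA.contDiffOn.clm_apply g2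
  have i1 : Integrable fun x => η x * (c.ω x * ⟪gradient w1 x, c.Z w1 x⟫) :=
    cutoff_integrable hB η1.continuous η2 η3
      (cω.mul (g1.continuousOn.inner z1.continuousOn))
  have i2 : Integrable fun x => η x * (c.ω x * ⟪gradient w2 x, c.Z w2 x⟫) :=
    cutoff_integrable hB η1.continuous η2 η3
      (cω.mul (g2.continuousOn.inner z2.continuousOn))
  have hX : ContDiffOn ℝ 1 (fun x => c.ω x • c.Z w1 x + c.ω x • c.Z w2 x) B :=
    (c.hω.contDiffOn.smul z1).add (c.hω.contDiffOn.smul z2)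
  have hf : ContDiffOn ℝ 1 (fun x => w1 x - w2 x) B := (h1.sub h2).of_le (by norm_num)
  have hF : ContDiffOn ℝ 1
      (fun x => (w1 x - w2 x) • (c.ω x • c.Z w1 x + c.ω x • c.Z w2 x)) B := hf.smul hX
  have key := integral_cutoff_dv hB η1 η2 η3 hF
  have l1 := L_contOn c hB h1
  have l2 := L_contOn c hB h2
  have i3 : Integrable fun x => (w1 x - w2 x) * (η x * (c.ω x * (c.L w1 x + c.L w2 x)) +
      fderiv ℝ η x (c.ω x • (c.Z w1 x + c.Z w2 x))) := by
    have a1 : Integrable fun x => η x * ((w1 x - w2 x) * (c.ω x * (c.L w1 x + c.L w2 x))) :=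
      cutoff_integrable hB η1.continuous η2 η3 (hf.continuousOn.mul (cω.mul (l1.add l2)))
    have a2 : Integrable fun x => fderiv ℝ η x ((w1 x - w2 x) • (c.ω x • (c.Z w1 x + c.Z w2 x))) :=
      cutoff_fderiv_integrable hB η1 η2 η3
        (hf.continuousOn.smul (cω.smul (z1.continuousOn.add z2.continuousOn)))
    refine (a1.add a2).congr (Filter.Eventually.of_forall fun x => ?_)
    simp only [Pi.add_apply, map_smul, smul_eq_mul]
    ring
  rw [← integral_sub i1 i2, ← sub_eq_zero]
  have i12 : Integrable fun x => η x * (c.ω x * ⟪gradient w1 x, c.Z w1 x⟫) -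
      η x * (c.ω x * ⟪gradient w2 x, c.Z w2 x⟫) := i1.sub i2
  rw [integral_neg, sub_neg_eq_add, ← integral_add i12 i3, ← key]
  refine integral_congr_ae (Filter.Eventually.of_forall fun x => ?_)
  by_cases hx : x ∈ tsupport η
  · have hxB := hB.mem_nhds (η3 hx)
    have dX := (hX.contDiffAt hxB).differentiableAt one_ne_zero
    have df := (hf.contDiffAt hxB).differentiableAt one_ne_zero
    have d1 : DifferentiableAt ℝ (fun x => c.ω x • c.Z w1 x) x :=
      (c.ω_diff x).smul ((z1.contDiffAt hxB).differentiableAt one_ne_zero)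
    have d2 : DifferentiableAt ℝ (fun x => c.ω x • c.Z w2 x) x :=
      (c.ω_diff x).smul ((z2.contDiffAt hxB).differentiableAt one_ne_zero)
    have e1 : fderiv ℝ (fun x => w1 x - w2 x) x = fderiv ℝ w1 x - fderiv ℝ w2 x :=
      fderiv_fun_sub ((h1.contDiffAt hxB).differentiableAt two_ne_zero)
        ((h2.contDiffAt hxB).differentiableAt two_ne_zero)
    simp only []
    rw [dv_smul df dX, dv_add d1 d2, c.L_mul, c.L_mul, e1]
    simp only [sub_apply, map_add, map_smul, smul_eq_mul, ← inner_grad]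
    have h3 : ⟪gradient w1 x, c.Z w2 x⟫ = ⟪gradient w2 x, c.Z w1 x⟫ := c.symm' x _ _
    rw [h3]
    ring
  · have h0 : η x = 0 := image_eq_zero_of_notMem_tsupport hx
    have h0' : fderiv ℝ η x = 0 := by
      rw [(notMem_tsupport_iff_eventuallyEq.1 hx).fderiv_eq]; simp
    simp [h0, h0']

lemma bound_prod {t0 δ : ℝ} {K : Set (Eucl n)} (hK : IsCompact K) {f : ℝ × Eucl n → ℝ}
    (hf : ContinuousOn f (Icc (t0 - δ) (t0 + δ) ×ˢ K)) :
    ∃ M : ℝ, 0 ≤ M ∧ ∀ t ∈ Icc (t0 - δ) (t0 + δ), ∀ x ∈ K, |f (t, x)| ≤ M := by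
  obtain ⟨M, hM⟩ := (isCompact_Icc.prod hK).exists_bound_of_continuousOn hf
  exact ⟨max M 0, le_max_right _ _, fun t ht x hx => (hM (t, x) ⟨ht, hx⟩).trans (le_max_left _ _)⟩

lemma slice_cont_right {I : Set ℝ} {B : Set (Eucl n)} {E : Type*} [TopologicalSpace E]
    {f : ℝ × Eucl n → E} (hf : ContinuousOn f (I ×ˢ B)) {t : ℝ} (ht : t ∈ I) :
    ContinuousOn (fun x => f (t, x)) B :=
  hf.comp (by fun_prop) fun _ hx => ⟨ht, hx⟩

lemma slice_cont_left {I : Set ℝ} {B : Set (Eucl n)} {E : Type*} [TopologicalSpace E]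
    {f : ℝ × Eucl n → E} (hf : ContinuousOn f (I ×ˢ B)) {x : Eucl n} (hx : x ∈ B) :
    ContinuousOn (fun t => f (t, x)) I :=
  hf.comp (by fun_prop) fun _ ht => ⟨ht, hx⟩

set_option maxHeartbeats 800000 in
lemma energy_hasDerivAt (c : Coef n) {B : Set (Eucl n)} (hB : IsOpen B) {η : Eucl n → ℝ}
    (η1 : ContDiff ℝ 1 η) (η2 : HasCompactSupport η) (η3 : tsupport η ⊆ B) {I : Set ℝ}
    (hI : IsOpen I) {W WT : ℝ → Eucl n → ℝ} (h2 : ∀ t ∈ I, ContDiffOn ℝ 2 (W t) B)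
    (hd : ∀ t ∈ I, ∀ x ∈ B, HasDerivAt (fun s => W s x) (WT t x) t)
    (cT : ContinuousOn (fun q : ℝ × Eucl n => WT q.1 q.2) (I ×ˢ B))
    (cG : ContinuousOn (fun q : ℝ × Eucl n => gradient (W q.1) q.2) (I ×ˢ B))
    (cL : ContinuousOn (fun q : ℝ × Eucl n => c.L (W q.1) q.2) (I ×ˢ B)) {t0 : ℝ} (ht0 : t0 ∈ I) :
    HasDerivAt (fun t => ∫ x, η x * (c.ω x * ⟪gradient (W t) x, c.Z (W t) x⟫))
      (-2 * ∫ x, (η x * (c.ω x * WT t0 x * c.L (W t0) x) +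
        fderiv ℝ η x ((c.ω x * WT t0 x) • c.Z (W t0) x))) t0 := by
  obtain ⟨δ, hδ, hδI⟩ : ∃ δ > 0, Icc (t0 - δ) (t0 + δ) ⊆ I := by
    obtain ⟨δ, hδ, h⟩ := Metric.isOpen_iff.1 hI t0 ht0
    refine ⟨δ / 2, by positivity, fun y hy => h ?_⟩
    rw [Metric.mem_ball, Real.dist_eq, abs_lt]
    constructor <;> linarith [hy.1, hy.2]
  set K := tsupport η with hKdef
  have hK : IsCompact K := η2
  have hsub : Icc (t0 - δ) (t0 + δ) ×ˢ K ⊆ I ×ˢ B := prod_mono hδI η3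
  have t0m : t0 ∈ Icc (t0 - δ) (t0 + δ) := ⟨by linarith, by linarith⟩
  obtain ⟨M1, hM1, b1⟩ := bound_prod hK (cT.mono hsub)
  obtain ⟨M2, hM2, b2⟩ := bound_prod hK (cG.norm.mono hsub)
  obtain ⟨M3, hM3, b3⟩ := bound_prod hK (cL.mono hsub)
  obtain ⟨M4, hM4, b4⟩ := exists_bound_on hK c.hω.continuous.continuousOn
  obtain ⟨M5, hM5, b5⟩ := exists_bound_on hK c.hA.continuous.norm.continuousOn
  obtain ⟨M6, hM6, b6⟩ := exists_bound_on hK η1.continuous.continuousOn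
  obtain ⟨M7, hM7, b7⟩ := exists_bound_on hK (η1.continuous_fderiv one_ne_zero).norm.continuousOn
  have hz : ∀ x ∉ K, η x = 0 ∧ fderiv ℝ η x = 0 := fun x hx =>
    ⟨image_eq_zero_of_notMem_tsupport hx, by
      rw [(notMem_tsupport_iff_eventuallyEq.1 hx).fderiv_eq]; simp⟩
  set C : ℝ := M1 * (M6 * (M4 * (2 * M3)) + M7 * (M4 * (2 * (M5 * M2)))) with hC
  rw [hasDerivAt_iff_tendsto_slope]
  set G : ℝ → Eucl n → ℝ := fun t x => η x * (c.ω x * (c.L (W t) x + c.L (W t0) x)) +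
    fderiv ℝ η x (c.ω x • (c.Z (W t) x + c.Z (W t0) x)) with hG
  have hev : ∀ᶠ t in 𝓝[≠] t0, t ∈ Icc (t0 - δ) (t0 + δ) :=
    nhdsWithin_le_nhds (Icc_mem_nhds (by linarith) (by linarith))
  have hslope : ∀ᶠ t in 𝓝[≠] t0,
      ∫ x, -((t - t0)⁻¹ * (W t x - W t0 x) * G t x) =
      slope (fun t => ∫ x, η x * (c.ω x * ⟪gradient (W t) x, c.Z (W t) x⟫)) t0 t := by
    filter_upwards [hev] with t ht
    rw [slope_def_field, energy_diff c hB η1 η2 η3 (h2 t (hδI ht)) (h2 t0 ht0), div_eq_inv_mul,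
      ← integral_const_mul]
    refine integral_congr_ae (Filter.Eventually.of_forall fun x => ?_)
    simp only [hG]
    ring
  refine Filter.Tendsto.congr' hslope ?_
  have htarget : (-2 * ∫ x, (η x * (c.ω x * WT t0 x * c.L (W t0) x) +
        fderiv ℝ η x ((c.ω x * WT t0 x) • c.Z (W t0) x))) = ∫ x, -(WT t0 x * G t0 x) := by
    rw [← integral_const_mul]
    refine integral_congr_ae (Filter.Eventually.of_forall fun x => ?_)
    simp only [hG, map_smul, smul_eq_mul, map_add]
    ring
  rw [htarget]
  have zc : ∀ t ∈ I, ContinuousOn (c.Z (W t)) B := fun t ht =>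
    c.hA.continuous.continuousOn.clm_apply (gradient_contDiffOn hB (h2 t ht)).continuousOn
  have hGc : ∀ t ∈ I, ∀ f : Eucl n → ℝ, ContinuousOn f B → Continuous fun x => f x * G t x := by
    intro t ht f hf
    have a1 : Continuous fun x => η x * (f x * (c.ω x * (c.L (W t) x + c.L (W t0) x))) :=
      cutoff_cont hB η1.continuous η3 (hf.mul (c.hω.continuous.continuousOn.mul
        ((L_contOn c hB (h2 t ht)).add (L_contOn c hB (h2 t0 ht0)))))
    have a2 : Continuous fun x => fderiv ℝ η x (f x • (c.ω x • (c.Z (W t) x + c.Z (W t0) x))) :=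
      cutoff_fderiv_cont hB η1 η3 (hf.smul (c.hω.continuous.continuousOn.smul
        ((zc t ht).add (zc t0 ht0))))
    refine (a1.add a2).congr fun x => ?_
    simp only [hG, map_smul, smul_eq_mul, Pi.add_apply]
    ring
  refine tendsto_integral_filter_of_dominated_convergence (K.indicator fun _ => C) ?_ ?_ ?_ ?_
  · filter_upwards [hev] with t ht
    have := hGc t (hδI ht) (fun x => (t - t0)⁻¹ * (W t x - W t0 x))
      (continuousOn_const.mul ((h2 t (hδI ht)).continuousOn.sub (h2 t0 ht0).continuousOn))
    exact this.neg.aestronglyMeasurable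
  · filter_upwards [hev, self_mem_nhdsWithin] with t ht htne
    refine Filter.Eventually.of_forall fun x => ?_
    by_cases hx : x ∈ K
    · rw [indicator_of_mem hx, norm_neg, Real.norm_eq_abs, abs_mul]
      have q1 : |(t - t0)⁻¹ * (W t x - W t0 x)| ≤ M1 := by
        have hmv : ‖W t x - W t0 x‖ ≤ M1 * ‖t - t0‖ := by
          refine Convex.norm_image_sub_le_of_norm_hasDerivWithin_le (f := fun s => W s x)
            (s := Icc (t0 - δ) (t0 + δ)) (f' := fun s => WT s x)
            (fun s hs => (hd s (hδI hs) x (η3 hx)).hasDerivWithinAt)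
            (fun s hs => b1 s hs x hx) (convex_Icc _ _) t0m ht
        have hpos : 0 < |t - t0| := abs_pos.2 (sub_ne_zero.2 htne)
        rw [abs_mul, abs_inv, inv_mul_le_iff₀ hpos]
        rw [Real.norm_eq_abs, Real.norm_eq_abs] at hmv
        linarith
      have hZb : ∀ t ∈ Icc (t0 - δ) (t0 + δ), ‖c.Z (W t) x‖ ≤ M5 * M2 := by
        intro t ht
        refine ((c.A x).le_opNorm _).trans ?_
        have e1 := b5 x hx
        have e2 := b2 t ht x hx
        rw [abs_norm] at e1 e2
        gcongr
      have q2 : |G t x| ≤ M6 * (M4 * (2 * M3)) + M7 * (M4 * (2 * (M5 * M2))) := by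
        refine (abs_add_le _ _).trans (add_le_add ?_ ?_)
        · rw [abs_mul, abs_mul]
          have e3 : |c.L (W t) x + c.L (W t0) x| ≤ 2 * M3 :=
            (abs_add_le _ _).trans (by linarith [b3 t ht x hx, b3 t0 t0m x hx])
          have e4 := b4 x hx
          have e6 := b6 x hx
          gcongr
        · rw [← Real.norm_eq_abs]
          refine ((fderiv ℝ η x).le_opNorm _).trans ?_
          rw [norm_smul, Real.norm_eq_abs]
          have e3 : ‖c.Z (W t) x + c.Z (W t0) x‖ ≤ 2 * (M5 * M2) :=
            (norm_add_le _ _).trans (by linarith [hZb t ht, hZb t0 t0m])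
          have e4 := b4 x hx
          have e7 := b7 x hx
          rw [abs_norm] at e7
          gcongr
      rw [hC]
      gcongr
    · obtain ⟨z1, z2⟩ := hz x hx
      simp [hG, z1, z2, hx]
  · exact (integrableOn_const hK.measure_ne_top).integrable_indicator hK.isClosed.measurableSet
  · refine Filter.Eventually.of_forall fun x => ?_
    by_cases hx : x ∈ K
    · have l1 : Filter.Tendsto (fun t => (t - t0)⁻¹ * (W t x - W t0 x)) (𝓝[≠] t0) (𝓝 (WT t0 x)) := by
        have := (hasDerivAt_iff_tendsto_slope.1 (hd t0 ht0 x (η3 hx)))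
        refine this.congr fun t => ?_
        rw [slope_def_field]; ring
      have lL : Filter.Tendsto (fun t => c.L (W t) x) (𝓝[≠] t0) (𝓝 (c.L (W t0) x)) :=
        ((slice_cont_left cL (η3 hx)).continuousAt (hI.mem_nhds ht0)).tendsto.mono_left
          nhdsWithin_le_nhds
      have lG : Filter.Tendsto (fun t => gradient (W t) x) (𝓝[≠] t0) (𝓝 (gradient (W t0) x)) :=
        ((slice_cont_left cG (η3 hx)).continuousAt (hI.mem_nhds ht0)).tendsto.mono_left
          nhdsWithin_le_nhds
      have lZ : Filter.Tendsto (fun t => c.Z (W t) x) (𝓝[≠] t0) (𝓝 (c.Z (W t0) x)) :=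
        ((c.A x).continuous.tendsto _).comp lG
      have lGG : Filter.Tendsto (fun t => G t x) (𝓝[≠] t0) (𝓝 (G t0 x)) := by
        simp only [hG]
        refine ((lL.add_const _).const_mul _ |>.const_mul _).add ?_
        exact ((fderiv ℝ η x).continuous.tendsto _).comp ((lZ.add_const _).const_smul _)
      exact (l1.mul lGG).neg
    · obtain ⟨z1, z2⟩ := hz x hx
      simp [hG, z1, z2]

/-! ### Pointwise densities -/

/-- conjugated energy density -/
def den (S m R : ℝ) (P : Eucl n → ℝ) (x : Eucl n) (U : ℝ) (p : Eucl n) (Ut : ℝ) : ℝ :=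
  cqt m R P x U Ut ^ 2 / S + S * ‖cgr S P x U p‖ ^ 2 + S ^ 3 * U ^ 2

/-- flux as a function of the values -/
def Coef.flx0 (c : Coef n) (S m R : ℝ) (P b : Eucl n → ℝ) (x : Eucl n) (W : ℝ) (v : Eucl n)
    (Wt : ℝ) : Eucl n :=
  (-4 * (S * ⟪v, c.Z P x⟫) - 2 * (S * b x) * W) • (c.ω x • c.A x v) +
    (2 * ⟪v, c.A x v⟫ - 2 * c.qf S m R P x * W ^ 2) • (S • (c.ω x • c.Z P x)) -
    (2 * (c.ω x * Wt)) • c.A x v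

/-- conjugated flux -/
def Coef.flx (c : Coef n) (S m R : ℝ) (P b : Eucl n → ℝ) (x : Eucl n) (U : ℝ) (p : Eucl n)
    (Ut : ℝ) : Eucl n :=
  c.flx0 S m R P b x U (cgr S P x U p) (cqt m R P x U Ut)

lemma Coef.flx0_smul (c : Coef n) (S m R : ℝ) (P b : Eucl n → ℝ) (x : Eucl n) (W : ℝ) (v : Eucl n)
    (Wt e : ℝ) : c.flx0 S m R P b x (e * W) (e • v) (e * Wt) = e ^ 2 • c.flx0 S m R P b x W v Wt := by
  unfold Coef.flx0
  simp only [map_smul, inner_smul_left, inner_smul_right, conj_trivial]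
  module

lemma den_nonneg {S : ℝ} (hS : 0 < S) (m R : ℝ) (P : Eucl n → ℝ) (x : Eucl n) (U : ℝ) (p : Eucl n)
    (Ut : ℝ) : 0 ≤ den S m R P x U p Ut := by unfold den; positivity

/-- plain density -/
def dd (U : ℝ) (p : Eucl n) (Ut : ℝ) : ℝ := U ^ 2 + ‖p‖ ^ 2 + Ut ^ 2

lemma dd_nonneg (U : ℝ) (p : Eucl n) (Ut : ℝ) : 0 ≤ dd U p Ut := by unfold dd; positivity

lemma den_le {P : Eucl n → ℝ} (hP : ContDiff ℝ 2 P) {K : Set (Eucl n)} (hK : IsCompact K)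
    (R k T : ℝ) (hk : 0 < k) (hT : 0 < T) : ∃ C : ℝ, 0 < C ∧ ∀ S m : ℝ, 1 ≤ k * S →
      |m| ≤ T * S ^ 2 → ∀ x ∈ K, ∀ U p Ut,
      den S m R P x U p Ut ≤ C * S ^ 3 * dd U p Ut := by
  obtain ⟨M1, hM1, h1⟩ := exists_bound_on hK (f := fun x => P x - R)
    (hP.continuous.sub continuous_const).continuousOn
  obtain ⟨M2, hM2, h2⟩ := exists_bound_on hK (gradient_contDiff hP).continuous.norm.continuousOn
  refine ⟨2 * k ^ 4 + 2 * T ^ 2 * M1 ^ 2 + 2 * k ^ 2 + 2 * M2 ^ 2 + 1, by positivity, ?_⟩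
  intro S m hS hm x hx U p Ut
  have hS0 : 0 < S := pos_of_mul_pos_right (by linarith) hk.le
  have e1 := h1 x hx
  have e2 := h2 x hx
  rw [abs_norm] at e2
  have f1 : cqt m R P x U Ut ^ 2 / S ≤ (2 * k ^ 4 * Ut ^ 2 + 2 * T ^ 2 * M1 ^ 2 * U ^ 2) * S ^ 3 := by
    rw [div_le_iff₀ hS0]
    have g1 : cqt m R P x U Ut ^ 2 ≤ 2 * Ut ^ 2 + 2 * (m * (P x - R)) ^ 2 * U ^ 2 := by
      unfold cqt
      have := sq_nonneg (Ut - m * (P x - R) * U)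
      nlinarith only [this]
    have g2 : (m * (P x - R)) ^ 2 ≤ (T * S ^ 2 * M1) ^ 2 := by
      rw [← sq_abs, abs_mul]; gcongr
    have g3 : (1 : ℝ) ≤ (k * S) ^ 4 := one_le_pow₀ hS
    have g4 : 2 * Ut ^ 2 * 1 ≤ 2 * Ut ^ 2 * (k * S) ^ 4 := by gcongr
    have g5 : 2 * (m * (P x - R)) ^ 2 * U ^ 2 ≤ 2 * (T * S ^ 2 * M1) ^ 2 * U ^ 2 := by gcongr
    linarith
  have f2 : S * ‖cgr S P x U p‖ ^ 2 ≤ (2 * k ^ 2 * ‖p‖ ^ 2 + 2 * M2 ^ 2 * U ^ 2) * S ^ 3 := by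
    have g1 : ‖cgr S P x U p‖ ≤ ‖p‖ + S * |U| * M2 := by
      unfold cgr
      refine (norm_add_le _ _).trans ?_
      rw [norm_smul, Real.norm_eq_abs, abs_mul, abs_of_pos hS0]
      gcongr
    have g2 : ‖cgr S P x U p‖ ^ 2 ≤ 2 * ‖p‖ ^ 2 + 2 * (S ^ 2 * U ^ 2 * M2 ^ 2) := by
      have a1 : ‖cgr S P x U p‖ ^ 2 ≤ (‖p‖ + S * |U| * M2) ^ 2 := by gcongr
      have a2 : S ^ 2 * U ^ 2 * M2 ^ 2 = (S * |U| * M2) ^ 2 := by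
        rw [mul_pow, mul_pow, sq_abs]
      rw [a2]
      have := sq_nonneg (‖p‖ - S * |U| * M2)
      nlinarith only [a1, this]
    have g3 : (1 : ℝ) ≤ (k * S) ^ 2 := one_le_pow₀ hS
    have g4 : 2 * ‖p‖ ^ 2 * 1 ≤ 2 * ‖p‖ ^ 2 * (k * S) ^ 2 := by gcongr
    calc _ ≤ S * (2 * ‖p‖ ^ 2 * (k * S) ^ 2 + 2 * (S ^ 2 * U ^ 2 * M2 ^ 2)) := by
          gcongr; linarith
      _ = _ := by ring
  have hU := sq_nonneg U
  have hp := sq_nonneg ‖p‖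
  have hUt := sq_nonneg Ut
  unfold den dd
  calc _ ≤ (2 * k ^ 4 * Ut ^ 2 + 2 * T ^ 2 * M1 ^ 2 * U ^ 2) * S ^ 3 +
        (2 * k ^ 2 * ‖p‖ ^ 2 + 2 * M2 ^ 2 * U ^ 2) * S ^ 3 + S ^ 3 * U ^ 2 := by gcongr
    _ = ((2 * T ^ 2 * M1 ^ 2 + 2 * M2 ^ 2 + 1) * U ^ 2 + (2 * k ^ 2) * ‖p‖ ^ 2 +
        (2 * k ^ 4) * Ut ^ 2) * S ^ 3 := by ring
    _ ≤ ((2 * k ^ 4 + 2 * T ^ 2 * M1 ^ 2 + 2 * k ^ 2 + 2 * M2 ^ 2 + 1) * U ^ 2 +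
        (2 * k ^ 4 + 2 * T ^ 2 * M1 ^ 2 + 2 * k ^ 2 + 2 * M2 ^ 2 + 1) * ‖p‖ ^ 2 +
        (2 * k ^ 4 + 2 * T ^ 2 * M1 ^ 2 + 2 * k ^ 2 + 2 * M2 ^ 2 + 1) * Ut ^ 2) * S ^ 3 := by
      have a1 : 0 ≤ k ^ 4 := by positivity
      have a2 : 0 ≤ T ^ 2 * M1 ^ 2 := by positivity
      have a3 : 0 ≤ k ^ 2 := by positivity
      have a4 : 0 ≤ M2 ^ 2 := by positivity
      gcongr <;> linarith
    _ = _ := by ring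

lemma den_ge {P : Eucl n → ℝ} (hP : ContDiff ℝ 2 P) {K : Set (Eucl n)} (hK : IsCompact K)
    (R k T : ℝ) (hk : 0 < k) (hT : 0 < T) : ∃ C : ℝ, 0 < C ∧ ∀ S m : ℝ, 1 ≤ k * S →
      |m| ≤ T * S ^ 2 → ∀ x ∈ K, ∀ U p Ut,
      dd U p Ut ≤ C * S * den S m R P x U p Ut := by
  obtain ⟨M1, hM1, h1⟩ := exists_bound_on hK (f := fun x => P x - R)
    (hP.continuous.sub continuous_const).continuousOn
  obtain ⟨M2, hM2, h2⟩ := exists_bound_on hK (gradient_contDiff hP).continuous.norm.continuousOn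
  refine ⟨k ^ 4 + 2 * k ^ 2 + 2 * M2 ^ 2 * k ^ 2 + 2 + 2 * T ^ 2 * M1 ^ 2, by positivity, ?_⟩
  intro S m hS hm x hx U p Ut
  have hS0 : 0 < S := pos_of_mul_pos_right (by linarith) hk.le
  have e1 := h1 x hx
  have e2 := h2 x hx
  rw [abs_norm] at e2
  set v := cgr S P x U p with hv
  set q := cqt m R P x U Ut with hq
  have f1 : Ut ^ 2 ≤ 2 * q ^ 2 + 2 * T ^ 2 * M1 ^ 2 * (S ^ 4 * U ^ 2) := by
    have g0 : Ut = q - m * (P x - R) * U := by simp [hq, cqt]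
    have g1 : Ut ^ 2 ≤ 2 * q ^ 2 + 2 * (m * (P x - R)) ^ 2 * U ^ 2 := by
      rw [g0]
      have := sq_nonneg (q + m * (P x - R) * U)
      nlinarith only [this]
    have g2 : (m * (P x - R)) ^ 2 ≤ (T * S ^ 2 * M1) ^ 2 := by
      rw [← sq_abs, abs_mul]; gcongr
    have g5 : 2 * (m * (P x - R)) ^ 2 * U ^ 2 ≤ 2 * (T * S ^ 2 * M1) ^ 2 * U ^ 2 := by gcongr
    linarith
  have f2 : ‖p‖ ^ 2 ≤ 2 * ‖v‖ ^ 2 + 2 * M2 ^ 2 * (S ^ 2 * U ^ 2) := by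
    have g0 : p = v - (S * U) • gradient P x := by simp [hv, cgr]
    have g1 : ‖p‖ ≤ ‖v‖ + S * |U| * M2 := by
      rw [g0]
      refine (norm_sub_le _ _).trans ?_
      rw [norm_smul, Real.norm_eq_abs, abs_mul, abs_of_pos hS0]
      gcongr
    have a1 : ‖p‖ ^ 2 ≤ (‖v‖ + S * |U| * M2) ^ 2 := by gcongr
    have a2 : M2 ^ 2 * (S ^ 2 * U ^ 2) = (S * |U| * M2) ^ 2 := by
      rw [mul_pow, mul_pow, sq_abs]; ring
    have := sq_nonneg (‖v‖ - S * |U| * M2)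
    nlinarith only [a1, this, a2]
  have g4 : (1 : ℝ) ≤ (k * S) ^ 4 := one_le_pow₀ hS
  have g2 : (1 : ℝ) ≤ (k * S) ^ 2 := one_le_pow₀ hS
  have hU := sq_nonneg U
  have hden : den S m R P x U p Ut = q ^ 2 / S + S * ‖v‖ ^ 2 + S ^ 3 * U ^ 2 := rfl
  have hden2 : S * den S m R P x U p Ut = q ^ 2 + S ^ 2 * ‖v‖ ^ 2 + S ^ 4 * U ^ 2 := by
    rw [hden]; field_simp
  rw [mul_assoc, hden2]
  set Q := q ^ 2 + S ^ 2 * ‖v‖ ^ 2 + S ^ 4 * U ^ 2 with hQ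
  have q1 : q ^ 2 ≤ Q := by have := sq_nonneg q; rw [hQ]; have : 0 ≤ S ^ 2 * ‖v‖ ^ 2 := by positivity
                            have : 0 ≤ S ^ 4 * U ^ 2 := by positivity
                            linarith
  have q2 : S ^ 2 * ‖v‖ ^ 2 ≤ Q := by
    rw [hQ]; have : 0 ≤ S ^ 4 * U ^ 2 := by positivity
    linarith [sq_nonneg q]
  have q3 : S ^ 4 * U ^ 2 ≤ Q := by
    rw [hQ]; have : 0 ≤ S ^ 2 * ‖v‖ ^ 2 := by positivity
    linarith [sq_nonneg q]
  have r1 : U ^ 2 ≤ k ^ 4 * Q :=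
    calc U ^ 2 = 1 * U ^ 2 := by ring
      _ ≤ (k * S) ^ 4 * U ^ 2 := by gcongr
      _ = k ^ 4 * (S ^ 4 * U ^ 2) := by ring
      _ ≤ _ := by gcongr
  have r2 : ‖v‖ ^ 2 ≤ k ^ 2 * Q :=
    calc ‖v‖ ^ 2 = 1 * ‖v‖ ^ 2 := by ring
      _ ≤ (k * S) ^ 2 * ‖v‖ ^ 2 := by gcongr
      _ = k ^ 2 * (S ^ 2 * ‖v‖ ^ 2) := by ring
      _ ≤ _ := by gcongr
  have r3 : S ^ 2 * U ^ 2 ≤ k ^ 2 * Q :=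
    calc S ^ 2 * U ^ 2 = 1 * (S ^ 2 * U ^ 2) := by ring
      _ ≤ (k * S) ^ 2 * (S ^ 2 * U ^ 2) := by gcongr
      _ = k ^ 2 * (S ^ 4 * U ^ 2) := by ring
      _ ≤ _ := by gcongr
  have r4 : 2 * M2 ^ 2 * (S ^ 2 * U ^ 2) ≤ 2 * M2 ^ 2 * (k ^ 2 * Q) := by gcongr
  have r5 : 2 * T ^ 2 * M1 ^ 2 * (S ^ 4 * U ^ 2) ≤ 2 * T ^ 2 * M1 ^ 2 * Q := by gcongr
  unfold dd
  linarith

lemma flx_le (c : Coef n) {P b : Eucl n → ℝ} (hP : ContDiff ℝ 2 P) (hb : ContDiff ℝ 1 b)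
    {K : Set (Eucl n)} (hK : IsCompact K)
    (R k T : ℝ) (hk : 0 < k) (hT : 0 < T) : ∃ C : ℝ, 0 < C ∧ ∀ S m : ℝ, 1 ≤ k * S →
      |m| ≤ T * S ^ 2 → ∀ x ∈ K, ∀ U p Ut,
      ‖c.flx S m R P b x U p Ut‖ ≤ C * den S m R P x U p Ut ∧
      |⟪cgr S P x U p, c.A x (cgr S P x U p)⟫ - c.qf S m R P x * U ^ 2| ≤
        C * den S m R P x U p Ut := by
  obtain ⟨M1, hM1, h1⟩ := exists_bound_on hK (f := fun x => P x - R)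
    (hP.continuous.sub continuous_const).continuousOn
  obtain ⟨M2, hM2, h2⟩ := exists_bound_on hK (c.Z_contDiff hP).continuous.norm.continuousOn
  obtain ⟨M3, hM3, h3⟩ := exists_bound_on hK c.hA.continuous.norm.continuousOn
  obtain ⟨M4, hM4, h4⟩ := exists_bound_on hK hb.continuous.continuousOn
  obtain ⟨M5, hM5, h5⟩ := exists_bound_on hK (c.Gm_contDiff hP).continuous.continuousOn
  obtain ⟨M6, hM6, h6⟩ := exists_bound_on hK c.hω.continuous.continuousOn
  set Mq := M5 + T * M1 with hMq
  have hMqp : 0 ≤ Mq := by positivity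
  set C1 := 6 * M2 * (M6 * M3) + M4 * (1 + k ^ 2) * (M6 * M3) + 2 * Mq * M6 * M2 + M6 * M3 with hC1
  have hC1p : 0 ≤ C1 := by positivity
  set C2 := k * M3 + k * Mq with hC2
  have hC2p : 0 ≤ C2 := by positivity
  refine ⟨C1 + C2 + 1, by positivity, ?_⟩
  intro S m hS hm x hx U p Ut
  have hS0 : 0 < S := pos_of_mul_pos_right (by linarith) hk.le
  set v := cgr S P x U p with hv
  set q := cqt m R P x U Ut with hq
  have hden : den S m R P x U p Ut = q ^ 2 / S + S * ‖v‖ ^ 2 + S ^ 3 * U ^ 2 := rfl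
  set E := den S m R P x U p Ut with hE
  have p1 : 0 ≤ q ^ 2 / S := by positivity
  have p2 : 0 ≤ S * ‖v‖ ^ 2 := by positivity
  have p3 : 0 ≤ S ^ 3 * U ^ 2 := by positivity
  have E0 : 0 ≤ E := by linarith
  have e1 := h1 x hx
  have e2 := h2 x hx
  rw [abs_norm] at e2
  have e3 := h3 x hx
  rw [abs_norm] at e3
  have e4 := h4 x hx
  have e5 := h5 x hx
  have e6 := h6 x hx
  have eA : ‖c.A x v‖ ≤ M3 * ‖v‖ := ((c.A x).le_opNorm v).trans (by gcongr)
  have eqf : |c.qf S m R P x| ≤ Mq * S ^ 2 := by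
    unfold Coef.qf
    refine (abs_add_le _ _).trans ?_
    rw [abs_mul, abs_mul, abs_of_nonneg (sq_nonneg S)]
    calc S ^ 2 * |c.Gm P x| + |m| * |P x - R| ≤ S ^ 2 * M5 + T * S ^ 2 * M1 := by gcongr
      _ = _ := by rw [hMq]; ring
  have g2 : (1 : ℝ) ≤ (k * S) ^ 2 := one_le_pow₀ hS
  -- products
  have w1 : S * (|U| * ‖v‖) ≤ (1 + k ^ 2) / 2 * E := by
    have a1 : |U| * ‖v‖ ≤ (U ^ 2 + ‖v‖ ^ 2) / 2 := by
      have := sq_nonneg (|U| - ‖v‖)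
      have h := sq_abs U
      nlinarith only [this, h]
    have a2 : S * U ^ 2 ≤ k ^ 2 * (S ^ 3 * U ^ 2) :=
      calc S * U ^ 2 = 1 * (S * U ^ 2) := by ring
        _ ≤ (k * S) ^ 2 * (S * U ^ 2) := by gcongr
        _ = _ := by ring
    have a3 : k ^ 2 * (S ^ 3 * U ^ 2) ≤ k ^ 2 * E := by gcongr; linarith
    have a4 : S * (|U| * ‖v‖) ≤ S * ((U ^ 2 + ‖v‖ ^ 2) / 2) := by gcongr
    linarith
  have w2 : |q| * ‖v‖ ≤ E / 2 := by
    have a1 : |q| * ‖v‖ ≤ (q ^ 2 / S + S * ‖v‖ ^ 2) / 2 := by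
      have h0 := sq_nonneg (|q| - S * ‖v‖)
      have h := sq_abs q
      have : (q ^ 2 / S + S * ‖v‖ ^ 2) / 2 - |q| * ‖v‖ = (|q| - S * ‖v‖) ^ 2 / (2 * S) := by
        rw [← h]; field_simp; ring
      have h2 : 0 ≤ (|q| - S * ‖v‖) ^ 2 / (2 * S) := by positivity
      linarith
    linarith
  have eZ : |⟪v, c.Z P x⟫| ≤ ‖v‖ * M2 := (abs_real_inner_le_norm _ _).trans (by gcongr)
  have eI : |⟪v, c.A x v⟫| ≤ M3 * ‖v‖ ^ 2 := (abs_real_inner_le_norm _ _).trans (by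
    calc ‖v‖ * ‖c.A x v‖ ≤ ‖v‖ * (M3 * ‖v‖) := by gcongr
      _ = _ := by ring)
  constructor
  · have n1 : ‖(-4 * (S * ⟪v, c.Z P x⟫) - 2 * (S * b x) * U) • (c.ω x • c.A x v)‖ ≤
        (4 * M2 * (M6 * M3) + M4 * (1 + k ^ 2) * (M6 * M3)) * E := by
      rw [norm_smul, norm_smul, Real.norm_eq_abs, Real.norm_eq_abs]
      have a1 : |-4 * (S * ⟪v, c.Z P x⟫) - 2 * (S * b x) * U| ≤
          4 * (S * (‖v‖ * M2)) + 2 * (S * M4) * |U| := by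
        refine (abs_sub _ _).trans ?_
        rw [abs_mul, abs_mul, abs_mul, abs_mul, abs_mul, abs_of_pos hS0]
        have : |(-4 : ℝ)| = 4 := by norm_num
        rw [this, abs_two]
        gcongr
      calc _ ≤ (4 * (S * (‖v‖ * M2)) + 2 * (S * M4) * |U|) * (M6 * (M3 * ‖v‖)) := by gcongr
        _ = 4 * M2 * (M6 * M3) * (S * ‖v‖ ^ 2) + 2 * M4 * (M6 * M3) * (S * (|U| * ‖v‖)) := by ring
        _ ≤ 4 * M2 * (M6 * M3) * E + 2 * M4 * (M6 * M3) * ((1 + k ^ 2) / 2 * E) := by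
          gcongr; linarith
        _ = _ := by ring
    have n2 : ‖(2 * ⟪v, c.A x v⟫ - 2 * c.qf S m R P x * U ^ 2) • (S • (c.ω x • c.Z P x))‖ ≤
        (2 * M2 * (M6 * M3) + 2 * Mq * M6 * M2) * E := by
      rw [norm_smul, norm_smul, norm_smul, Real.norm_eq_abs, Real.norm_eq_abs, Real.norm_eq_abs,
        abs_of_pos hS0]
      have a1 : |2 * ⟪v, c.A x v⟫ - 2 * c.qf S m R P x * U ^ 2| ≤
          2 * (M3 * ‖v‖ ^ 2) + 2 * (Mq * S ^ 2) * U ^ 2 := by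
        refine (abs_sub _ _).trans ?_
        rw [abs_mul, abs_mul, abs_mul, abs_two, abs_of_nonneg (sq_nonneg U)]
        gcongr
      calc _ ≤ (2 * (M3 * ‖v‖ ^ 2) + 2 * (Mq * S ^ 2) * U ^ 2) * (S * (M6 * M2)) := by gcongr
        _ = 2 * M2 * (M6 * M3) * (S * ‖v‖ ^ 2) + 2 * Mq * M6 * M2 * (S ^ 3 * U ^ 2) := by ring
        _ ≤ 2 * M2 * (M6 * M3) * E + 2 * Mq * M6 * M2 * E := by
          gcongr <;> linarith
        _ = _ := by ring
    have n3 : ‖(2 * (c.ω x * q)) • c.A x v‖ ≤ (M6 * M3) * E := by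
      rw [norm_smul, Real.norm_eq_abs, abs_mul, abs_mul, abs_two]
      calc _ ≤ 2 * (M6 * |q|) * (M3 * ‖v‖) := by gcongr
        _ = 2 * (M6 * M3) * (|q| * ‖v‖) := by ring
        _ ≤ 2 * (M6 * M3) * (E / 2) := by gcongr
        _ = _ := by ring
    have : ‖c.flx S m R P b x U p Ut‖ ≤ C1 * E := by
      unfold Coef.flx Coef.flx0
      refine (norm_sub_le _ _).trans ((add_le_add ((norm_add_le _ _).trans
        (add_le_add n1 n2)) n3).trans (le_of_eq ?_))
      rw [hC1]; ring
    refine this.trans ?_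
    gcongr
    linarith
  · have a2 : ‖v‖ ^ 2 ≤ k * E :=
      calc ‖v‖ ^ 2 = 1 * ‖v‖ ^ 2 := by ring
        _ ≤ (k * S) * ‖v‖ ^ 2 := by gcongr
        _ = k * (S * ‖v‖ ^ 2) := by ring
        _ ≤ _ := by gcongr; linarith
    have a3 : S ^ 2 * U ^ 2 ≤ k * E :=
      calc S ^ 2 * U ^ 2 = 1 * (S ^ 2 * U ^ 2) := by ring
        _ ≤ (k * S) * (S ^ 2 * U ^ 2) := by gcongr
        _ = k * (S ^ 3 * U ^ 2) := by ring
        _ ≤ _ := by gcongr; linarith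
    have : |⟪v, c.A x v⟫ - c.qf S m R P x * U ^ 2| ≤ C2 * E := by
      refine (abs_sub _ _).trans ?_
      rw [abs_mul, abs_of_nonneg (sq_nonneg U)]
      calc _ ≤ M3 * ‖v‖ ^ 2 + Mq * S ^ 2 * U ^ 2 := by gcongr
        _ = M3 * ‖v‖ ^ 2 + Mq * (S ^ 2 * U ^ 2) := by ring
        _ ≤ M3 * (k * E) + Mq * (k * E) := by gcongr
        _ = _ := by rw [hC2]; ring
    refine this.trans ?_
    gcongr
    linarith

/-! ### The integrated Carleman estimate -/

/-- weighted energy density at `(t,x)` -/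
def wden (T s R : ℝ) (P : Eucl n → ℝ) (u ut : ℝ → Eucl n → ℝ) (t : ℝ) (x : Eucl n) : ℝ :=
  cex (s * sg T t) R P x ^ 2 *
    den (s * sg T t) (s * sg1 T t) R P x (u t x) (gradient (u t) x) (ut t x)

/-- weighted flux at `(t,x)` -/
def Coef.wflx (c : Coef n) (T s R : ℝ) (P b : Eucl n → ℝ) (u ut : ℝ → Eucl n → ℝ) (t : ℝ)
    (x : Eucl n) : Eucl n :=
  cex (s * sg T t) R P x ^ 2 •
    c.flx (s * sg T t) (s * sg1 T t) R P b x (u t x) (gradient (u t) x) (ut t x)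

section cont
variable {c : Coef n} {T : ℝ} {B : Set (Eucl n)} {u ut : ℝ → Eucl n → ℝ} {P b : Eucl n → ℝ}

lemma CSol.cu' (h : CSol c T B u ut) :
    ContinuousOn (fun q : ℝ × Eucl n => u q.1 q.2) (Ioo 0 T ×ˢ closure B) :=
  h.cu.mono (prod_mono Ioo_subset_Icc_self subset_rfl)
lemma CSol.cg' (h : CSol c T B u ut) :
    ContinuousOn (fun q : ℝ × Eucl n => gradient (u q.1) q.2) (Ioo 0 T ×ˢ closure B) :=
  h.cg.mono (prod_mono Ioo_subset_Icc_self subset_rfl)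
lemma CSol.ct' (h : CSol c T B u ut) :
    ContinuousOn (fun q : ℝ × Eucl n => ut q.1 q.2) (Ioo 0 T ×ˢ closure B) :=
  h.ct.mono (prod_mono Ioo_subset_Icc_self subset_rfl)

lemma cont_sgS (T s : ℝ) (A : Set (Eucl n)) :
    ContinuousOn (fun q : ℝ × Eucl n => s * sg T q.1) (Ioo 0 T ×ˢ A) :=
  continuousOn_const.mul ((sg_cont T).comp continuousOn_fst fun _ h => h.1)
lemma cont_sgm (T s : ℝ) (A : Set (Eucl n)) :
    ContinuousOn (fun q : ℝ × Eucl n => s * sg1 T q.1) (Ioo 0 T ×ˢ A) :=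
  continuousOn_const.mul ((sg1_cont T).comp continuousOn_fst fun _ h => h.1)

lemma cont_snd {E : Type*} [TopologicalSpace E] {f : Eucl n → E} (hf : Continuous f)
    (A : Set (ℝ × Eucl n)) : ContinuousOn (fun q : ℝ × Eucl n => f q.2) A :=
  (hf.comp continuous_snd).continuousOn

lemma cont_cex (T s R : ℝ) (A : Set (Eucl n)) (hP : ContDiff ℝ 2 P) :
    ContinuousOn (fun q : ℝ × Eucl n => cex (s * sg T q.1) R P q.2) (Ioo 0 T ×ˢ A) :=
  ((cont_sgS T s A).mul ((cont_snd hP.continuous _).sub continuousOn_const)).rexp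

lemma cont_cqt (h : CSol c T B u ut) (s R : ℝ) (hP : ContDiff ℝ 2 P) :
    ContinuousOn (fun q : ℝ × Eucl n => cqt (s * sg1 T q.1) R P q.2 (u q.1 q.2) (ut q.1 q.2))
      (Ioo 0 T ×ˢ closure B) :=
  h.ct'.add (((cont_sgm T s _).mul ((cont_snd hP.continuous _).sub continuousOn_const)).mul h.cu')

lemma cont_cgr (h : CSol c T B u ut) (s : ℝ) (hP : ContDiff ℝ 2 P) :
    ContinuousOn (fun q : ℝ × Eucl n => cgr (s * sg T q.1) P q.2 (u q.1 q.2)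
      (gradient (u q.1) q.2)) (Ioo 0 T ×ˢ closure B) :=
  h.cg'.add (((cont_sgS T s _).mul h.cu').smul (cont_snd (gradient_contDiff hP).continuous _))

lemma cont_qf (c : Coef n) (T s R : ℝ) (A : Set (Eucl n)) (hP : ContDiff ℝ 2 P) :
    ContinuousOn (fun q : ℝ × Eucl n => c.qf (s * sg T q.1) (s * sg1 T q.1) R P q.2)
      (Ioo 0 T ×ˢ A) :=
  (((cont_sgS T s _).pow 2).mul (cont_snd (c.Gm_contDiff hP).continuous _)).add
    ((cont_sgm T s _).mul ((cont_snd hP.continuous _).sub continuousOn_const))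

lemma cont_wden (h : CSol c T B u ut) {s : ℝ} (hs : 0 < s) (R : ℝ) (hP : ContDiff ℝ 2 P) :
    ContinuousOn (fun q : ℝ × Eucl n => wden T s R P u ut q.1 q.2) (Ioo 0 T ×ˢ closure B) := by
  unfold wden den
  refine ((cont_cex T s R _ hP).pow 2).mul ((((cont_cqt h s R hP).pow 2).div (cont_sgS T s _) ?_).add
    ((cont_sgS T s _).mul ((cont_cgr h s hP).norm.pow 2)) |>.add
      (((cont_sgS T s _).pow 3).mul (h.cu'.pow 2)))
  intro q hq
  exact (mul_pos hs (sg_pos hq.1)).ne'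

lemma cont_wflx (h : CSol c T B u ut) (s R : ℝ) (hP : ContDiff ℝ 2 P)
    (hb : ContDiff ℝ 1 b) :
    ContinuousOn (fun q : ℝ × Eucl n => c.wflx T s R P b u ut q.1 q.2) (Ioo 0 T ×ˢ closure B) := by
  unfold Coef.wflx Coef.flx Coef.flx0
  have a1 := cont_cgr h s hP
  have a2 : ContinuousOn (fun q : ℝ × Eucl n => c.A q.2 (cgr (s * sg T q.1) P q.2 (u q.1 q.2)
      (gradient (u q.1) q.2))) (Ioo 0 T ×ˢ closure B) := (cont_snd c.hA.continuous _).clm_apply a1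
  have a3 := cont_snd (c.Z_contDiff hP).continuous (Ioo 0 T ×ˢ closure B)
  have a4 := cont_sgS T s (closure B)
  have a5 := cont_snd hb.continuous (Ioo 0 T ×ˢ closure B)
  have a6 := cont_snd c.hω.continuous (Ioo 0 T ×ˢ closure B)
  refine ((cont_cex T s R _ hP).pow 2).smul ((ContinuousOn.add ?_ ?_).sub ?_)
  · exact ((continuousOn_const.mul (a4.mul (a1.inner a3))).sub
      ((continuousOn_const.mul (a4.mul a5)).mul h.cu')).smul (a6.smul a2)
  · exact ((continuousOn_const.mul (a1.inner a2)).sub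
      ((continuousOn_const.mul (cont_qf c T s R _ hP)).mul (h.cu'.pow 2))).smul (a4.smul (a6.smul a3))
  · exact (continuousOn_const.mul (a6.mul (cont_cqt h s R hP))).smul a2

lemma wden_nonneg {s : ℝ} (hs : 0 < s) (R : ℝ) {t : ℝ} (ht : t ∈ Ioo 0 T) (x : Eucl n) :
    0 ≤ wden T s R P u ut t x :=
  mul_nonneg (sq_nonneg _) (den_nonneg (mul_pos hs (sg_pos ht)) _ _ _ _ _ _ _)

end cont

lemma pow3_exp (δ S : ℝ) (hδ : 0 < δ) (hS : 0 ≤ S) : S ^ 3 ≤ 6 / δ ^ 3 * Real.exp (δ * S) := by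
  have h := Real.pow_div_factorial_le_exp (δ * S) (by positivity) 3
  have h2 : (Nat.factorial 3 : ℝ) = 6 := by norm_num [Nat.factorial]
  rw [h2, mul_pow] at h
  calc S ^ 3 = 6 / δ ^ 3 * (δ ^ 3 * S ^ 3 / 6) := by field_simp
    _ ≤ _ := by gcongr

lemma sS_bounds {T s t : ℝ} (hs : 1 ≤ s) (ht : t ∈ Ioo 0 T) :
    s ≤ T ^ 2 / 4 * (s * sg T t) ∧ 1 ≤ T ^ 2 / 4 * (s * sg T t) ∧
    |s * sg1 T t| ≤ T * ((s * sg T t) ^ 2 / s) ∧ |s * sg1 T t| ≤ T * (s * sg T t) ^ 2 ∧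
    |s * sg2 T t| ≤ 3 * T ^ 2 * ((s * sg T t) ^ 3 / s) ∧ 0 < s * sg T t := by
  have hT : 0 < T := ht.1.trans ht.2
  have hσ := sg_pos ht
  have hs0 : 0 < s := by linarith
  have h1 : 1 ≤ T ^ 2 / 4 * sg T t := by
    have := sg_lower ht
    calc (1 : ℝ) = T ^ 2 / 4 * (4 / T ^ 2) := by field_simp
      _ ≤ _ := by gcongr
  have h2 : s ≤ T ^ 2 / 4 * (s * sg T t) := by
    calc s = s * 1 := by ring
      _ ≤ s * (T ^ 2 / 4 * sg T t) := by gcongr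
      _ = _ := by ring
  have h3 : |s * sg1 T t| ≤ T * ((s * sg T t) ^ 2 / s) := by
    rw [abs_mul, abs_of_pos hs0]
    calc _ ≤ s * (T * sg T t ^ 2) := by gcongr; exact sg1_le ht
      _ = _ := by field_simp
  refine ⟨h2, hs.trans h2, h3, h3.trans ?_, ?_, by positivity⟩
  · gcongr
    exact div_le_self (by positivity) hs
  · rw [abs_mul, abs_of_pos hs0]
    calc _ ≤ s * (3 * T ^ 2 * sg T t ^ 3) := by gcongr; exact sg2_le ht
      _ ≤ s * (3 * T ^ 2 * sg T t ^ 3) * s := by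
        exact le_mul_of_one_le_right (by positivity) hs
      _ = _ := by field_simp

lemma CSol.bdd {c : Coef n} {T : ℝ} {B : Set (Eucl n)} {u ut : ℝ → Eucl n → ℝ}
    (h : CSol c T B u ut) (hB : Bornology.IsBounded B) :
    ∃ M : ℝ, 0 ≤ M ∧ ∀ t ∈ Icc 0 T, ∀ x ∈ closure B,
      dd (u t x) (gradient (u t) x) (ut t x) ≤ M := by
  have hc : IsCompact (Icc (0 : ℝ) T ×ˢ closure B) :=
    isCompact_Icc.prod hB.isCompact_closure
  have : ContinuousOn (fun q : ℝ × Eucl n => dd (u q.1 q.2) (gradient (u q.1) q.2) (ut q.1 q.2))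
      (Icc 0 T ×ˢ closure B) := ((h.cu.pow 2).add (h.cg.norm.pow 2)).add (h.ct.pow 2)
  obtain ⟨M, hM⟩ := hc.exists_bound_of_continuousOn this
  refine ⟨max M 0, le_max_right _ _, fun t ht x hx => ?_⟩
  exact ((le_abs_self _).trans (hM (t, x) ⟨ht, hx⟩)).trans (le_max_left _ _)

/-- Bound of the weighted density. -/
lemma wden_le_exp {P : Eucl n → ℝ} (hP : ContDiff ℝ 2 P) {K : Set (Eucl n)} (hK : IsCompact K)
    {T : ℝ} (hT : 0 < T) (R : ℝ) : ∃ C : ℝ, 0 < C ∧ ∀ s : ℝ, 1 ≤ s → ∀ u ut : ℝ → Eucl n → ℝ,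
      ∀ t ∈ Ioo 0 T, ∀ x ∈ K, wden T s R P u ut t x ≤
      C * ((s * sg T t) ^ 3 * Real.exp (-(2 * (s * sg T t) * (R - P x)))) *
        dd (u t x) (gradient (u t) x) (ut t x) := by
  obtain ⟨C, hC, h⟩ := den_le hP hK R (T ^ 2 / 4) T (by positivity) hT
  refine ⟨C, hC, fun s hs u ut t ht x hx => ?_⟩
  obtain ⟨_, b2, _, b4, _, b6⟩ := sS_bounds hs ht
  have := h _ _ b2 b4 x hx (u t x) (gradient (u t) x) (ut t x)
  unfold wden
  have e : cex (s * sg T t) R P x ^ 2 = Real.exp (-(2 * (s * sg T t) * (R - P x))) := by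
    unfold cex
    rw [← Real.exp_nat_mul]; congr 1; push_cast; ring
  rw [e]
  calc _ ≤ Real.exp (-(2 * (s * sg T t) * (R - P x))) * (C * (s * sg T t) ^ 3 *
        dd (u t x) (gradient (u t) x) (ut t x)) := by gcongr
    _ = _ := by ring

lemma wden_bdd {c : Coef n} {P : Eucl n → ℝ} (hP : ContDiff ℝ 2 P) {K : Set (Eucl n)}
    (hK : IsCompact K)
    {T : ℝ} (hT : 0 < T) {R r : ℝ} (hr : 0 < r) (hR : ∀ x ∈ K, P x ≤ R - r) {s : ℝ} (hs : 1 ≤ s)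
    {B : Set (Eucl n)} (hB : Bornology.IsBounded B) {u ut : ℝ → Eucl n → ℝ}
    (h : CSol c T B u ut) : ∃ M : ℝ, 0 ≤ M ∧ (∀ t ∈ Ioo 0 T, ∀ x ∈ K ∩ closure B,
      wden T s R P u ut t x ≤ M * ((s * sg T t) ^ 3 * Real.exp (-(2 * r * (s * sg T t))))) ∧
      ∀ t ∈ Ioo 0 T, ∀ x ∈ K ∩ closure B, wden T s R P u ut t x ≤ M := by
  obtain ⟨C, hC, h1⟩ := wden_le_exp hP hK hT R
  obtain ⟨M, hM, h2⟩ := h.bdd hB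
  have key : ∀ t ∈ Ioo 0 T, ∀ x ∈ K ∩ closure B,
      wden T s R P u ut t x ≤ C * M * ((s * sg T t) ^ 3 * Real.exp (-(2 * r * (s * sg T t)))) := by
    intro t ht x hx
    obtain ⟨_, _, _, _, _, b6⟩ := sS_bounds hs ht
    refine (h1 s hs u ut t ht x hx.1).trans ?_
    have e1 := h2 t (Ioo_subset_Icc_self ht) x hx.2
    have e0 := dd_nonneg (u t x) (gradient (u t) x) (ut t x)
    have e2 : Real.exp (-(2 * (s * sg T t) * (R - P x))) ≤ Real.exp (-(2 * r * (s * sg T t))) := by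
      apply Real.exp_le_exp.2
      have := hR x hx.1
      have : r * (s * sg T t) ≤ (R - P x) * (s * sg T t) := by gcongr; linarith
      linarith
    calc _ ≤ C * ((s * sg T t) ^ 3 * Real.exp (-(2 * r * (s * sg T t)))) * M := by gcongr
      _ = _ := by ring
  have hp3 : ∀ t ∈ Ioo 0 T, (s * sg T t) ^ 3 * Real.exp (-(2 * r * (s * sg T t))) ≤
      6 / (2 * r) ^ 3 := by
    intro t ht
    obtain ⟨_, _, _, _, _, b6⟩ := sS_bounds hs ht
    rw [Real.exp_neg, ← div_eq_mul_inv, div_le_iff₀ (Real.exp_pos _)]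
    exact pow3_exp (2 * r) _ (by positivity) b6.le
  refine ⟨C * M * (1 + 6 / (2 * r) ^ 3), by positivity, fun t ht x hx => ?_, fun t ht x hx => ?_⟩
  · refine (key t ht x hx).trans ?_
    obtain ⟨_, _, _, _, _, b6⟩ := sS_bounds hs ht
    have : 0 ≤ 6 / (2 * r) ^ 3 := by positivity
    exact mul_le_mul_of_nonneg_right
      (le_mul_of_one_le_right (by positivity) (by linarith [this])) (by positivity)
  · refine (key t ht x hx).trans ?_
    have := hp3 t ht
    have h0 : 0 ≤ C * M := by positivity
    gcongr
    linarith

lemma cutoff_hasDerivAt {B : Set (Eucl n)} (hB : IsOpen B) {η : Eucl n → ℝ}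
    (η1 : Continuous η) (η2 : HasCompactSupport η) (η3 : tsupport η ⊆ B) {I : Set ℝ}
    (hI : IsOpen I) {F F' : ℝ → Eucl n → ℝ}
    (hd : ∀ t ∈ I, ∀ x ∈ B, HasDerivAt (fun s => F s x) (F' t x) t)
    (cF : ContinuousOn (fun q : ℝ × Eucl n => F q.1 q.2) (I ×ˢ B))
    (cF' : ContinuousOn (fun q : ℝ × Eucl n => F' q.1 q.2) (I ×ˢ B)) {t0 : ℝ} (ht0 : t0 ∈ I) :
    HasDerivAt (fun t => ∫ x, η x * F t x) (∫ x, η x * F' t0 x) t0 := by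
  obtain ⟨δ, hδ, hδI⟩ : ∃ δ > 0, Icc (t0 - δ) (t0 + δ) ⊆ I := by
    obtain ⟨δ, hδ, h⟩ := Metric.isOpen_iff.1 hI t0 ht0
    refine ⟨δ / 2, by positivity, fun y hy => h ?_⟩
    rw [Metric.mem_ball, Real.dist_eq, abs_lt]
    constructor <;> linarith [hy.1, hy.2]
  have hsub : Icc (t0 - δ) (t0 + δ) ×ˢ tsupport η ⊆ I ×ˢ B := prod_mono hδI η3
  obtain ⟨M1, hM1, b1⟩ := bound_prod η2 (cF'.mono hsub)
  have hmem : Ioo (t0 - δ) (t0 + δ) ∈ 𝓝 t0 := Ioo_mem_nhds (by linarith) (by linarith)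
  have := hasDerivAt_integral_of_dominated_loc_of_deriv_le (μ := volume)
    (F := fun t x => η x * F t x) (F' := fun t x => η x * F' t x)
    (bound := fun x => |η x| * M1) hmem
    (Filter.mem_of_superset hmem fun t ht =>
      (cutoff_integrable hB η1 η2 η3
        (slice_cont_right cF (hδI (Ioo_subset_Icc_self ht)))).aestronglyMeasurable)
    (cutoff_integrable hB η1 η2 η3 (slice_cont_right cF ht0))
    (cutoff_integrable hB η1 η2 η3 (slice_cont_right cF' ht0)).aestronglyMeasurable
    (Filter.Eventually.of_forall fun x t ht => by
      by_cases hx : x ∈ tsupport η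
      · rw [norm_mul]
        exact mul_le_mul_of_nonneg_left (b1 t (Ioo_subset_Icc_self ht) x hx) (abs_nonneg _)
      · simp [image_eq_zero_of_notMem_tsupport hx])
    ((η1.abs.integrable_of_hasCompactSupport (by simpa using η2.norm)).mul_const _)
    (Filter.Eventually.of_forall fun x t ht => by
      by_cases hx : x ∈ tsupport η
      · exact (hd t (hδI (Ioo_subset_Icc_self ht)) x (η3 hx)).const_mul _
      · simpa [image_eq_zero_of_notMem_tsupport hx] using hasDerivAt_const t (0 : ℝ))
  exact this.2

section conj
variable {c : Coef n} {T : ℝ} {B : Set (Eucl n)} {u ut : ℝ → Eucl n → ℝ} {P b : Eucl n → ℝ}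

lemma en_eq_wden (h : CSol c T B u ut) (hB : IsOpen B) (hP : ContDiff ℝ 2 P) (s R : ℝ) {t : ℝ}
    (ht : t ∈ Ioo 0 T) {x : Eucl n} (hx : x ∈ B) :
    en (s * sg T t) (fun y => cex (s * sg T t) R P y * u t y)
      (fun y => cex (s * sg T t) R P y * cqt (s * sg1 T t) R P y (u t y) (ut t y)) x =
      wden T s R P u ut t x := by
  have hU : DifferentiableAt ℝ (u t) x :=
    ((h.c2 t ht).contDiffAt (hB.mem_nhds hx)).differentiableAt two_ne_zero
  unfold en wden den
  rw [gradient_conj _ R hP hU, norm_smul, Real.norm_eq_abs]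
  simp only [mul_pow, sq_abs]
  ring

lemma Bfl_eq_wflx (h : CSol c T B u ut) (hB : IsOpen B) (hP : ContDiff ℝ 2 P) (s R : ℝ) {t : ℝ}
    (ht : t ∈ Ioo 0 T) {x : Eucl n} (hx : x ∈ B) :
    c.Bfl (s * sg T t) (s * sg1 T t) R P b (fun y => cex (s * sg T t) R P y * u t y)
      (fun y => cex (s * sg T t) R P y * cqt (s * sg1 T t) R P y (u t y) (ut t y)) x =
      c.wflx T s R P b u ut t x := by
  have hU : DifferentiableAt ℝ (u t) x :=
    ((h.c2 t ht).contDiffAt (hB.mem_nhds hx)).differentiableAt two_ne_zero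
  unfold Coef.wflx Coef.flx
  rw [← Coef.flx0_smul]
  unfold Coef.Bfl Coef.Fl Coef.flx0 Coef.Z
  rw [gradient_conj _ R hP hU]

lemma W_hasDerivAt (h : CSol c T B u ut) (s R : ℝ) {t : ℝ}
    (ht : t ∈ Ioo 0 T) {x : Eucl n} (hx : x ∈ B) :
    HasDerivAt (fun τ => cex (s * sg T τ) R P x * u τ x)
      (cex (s * sg T t) R P x * cqt (s * sg1 T t) R P x (u t x) (ut t x)) t := by
  have h1 : HasDerivAt (fun τ => cex (s * sg T τ) R P x)
      (cex (s * sg T t) R P x * (s * sg1 T t * (P x - R))) t :=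
    (((sg_hasDerivAt ht).const_mul s).mul_const (P x - R)).exp
  refine (h1.mul (h.hd t ht x hx)).congr_deriv ?_
  unfold cqt
  ring

lemma qf_hasDerivAt (c : Coef n) (s R : ℝ) {t : ℝ} (ht : t ∈ Ioo 0 T) (x : Eucl n) :
    HasDerivAt (fun τ => c.qf (s * sg T τ) (s * sg1 T τ) R P x)
      (c.qt (s * sg T t) (s * sg1 T t) (s * sg2 T t) R P x) t := by
  have h1 := (((sg_hasDerivAt ht).const_mul s).pow 2).mul_const (c.Gm P x)
  have h2 := ((sg1_hasDerivAt ht).const_mul s).mul_const (P x - R)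
  refine (h1.add h2).congr_deriv ?_
  unfold Coef.qt
  simp

lemma sg2_cont (T : ℝ) : ContinuousOn (sg2 T) (Ioo 0 T) := by
  unfold sg2
  have := sg_cont T
  fun_prop

set_option maxHeartbeats 800000 in
lemma J_hasDerivAt (h : CSol c T B u ut) (hB : IsOpen B) (hP : ContDiff ℝ 2 P) (s R : ℝ)
    {η : Eucl n → ℝ} (η1 : ContDiff ℝ 1 η) (η2 : HasCompactSupport η) (η3 : tsupport η ⊆ B)
    {t : ℝ} (ht : t ∈ Ioo 0 T) :
    HasDerivAt (fun t =>
      (∫ x, η x * (c.ω x * ⟪gradient (fun y => cex (s * sg T t) R P y * u t y) x,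
        c.Z (fun y => cex (s * sg T t) R P y * u t y) x⟫)) -
      ∫ x, η x * (c.ω x * (c.qf (s * sg T t) (s * sg1 T t) R P x *
        (cex (s * sg T t) R P x * u t x) ^ 2)))
      (c.Jd η (s * sg T t) (s * sg1 T t) (s * sg2 T t) R P
        (fun y => cex (s * sg T t) R P y * u t y)
        (fun y => cex (s * sg T t) R P y * cqt (s * sg1 T t) R P y (u t y) (ut t y))) t := by
  have hsub : Ioo 0 T ×ˢ B ⊆ Ioo 0 T ×ˢ closure B := prod_mono subset_rfl subset_closure
  have hC2 : ∀ t ∈ Ioo 0 T, ContDiffOn ℝ 2 (fun y => cex (s * sg T t) R P y * u t y) B :=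
    fun t ht => (cex_contDiff _ R hP).contDiffOn.mul (h.c2 t ht)
  have cE := cont_cex T s R B hP
  have cU := h.cu'.mono hsub
  have cQ := (cont_cqt h s R hP).mono hsub
  have cW : ContinuousOn (fun q : ℝ × Eucl n => cex (s * sg T q.1) R P q.2 * u q.1 q.2)
    (Ioo 0 T ×ˢ B) := cE.mul cU
  have cWT : ContinuousOn (fun q : ℝ × Eucl n => cex (s * sg T q.1) R P q.2 *
    cqt (s * sg1 T q.1) R P q.2 (u q.1 q.2) (ut q.1 q.2)) (Ioo 0 T ×ˢ B) := cE.mul cQ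
  have cG : ContinuousOn (fun q : ℝ × Eucl n =>
      gradient (fun y => cex (s * sg T q.1) R P y * u q.1 y) q.2) (Ioo 0 T ×ˢ B) := by
    refine (cE.smul ((cont_cgr h s hP).mono hsub)).congr fun q hq => ?_
    exact gradient_conj _ R hP
      (((h.c2 _ hq.1).contDiffAt (hB.mem_nhds hq.2)).differentiableAt two_ne_zero)
  have cqf := cont_qf c T s R B hP
  have cL : ContinuousOn (fun q : ℝ × Eucl n =>
      c.L (fun y => cex (s * sg T q.1) R P y * u q.1 y) q.2) (Ioo 0 T ×ˢ B) := by
    have : ContinuousOn (fun q : ℝ × Eucl n => cex (s * sg T q.1) R P q.2 *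
      cqt (s * sg1 T q.1) R P q.2 (u q.1 q.2) (ut q.1 q.2) +
      2 * (s * sg T q.1 * ⟪gradient (fun y => cex (s * sg T q.1) R P y * u q.1 y) q.2,
        c.Z P q.2⟫) -
      (c.qf (s * sg T q.1) (s * sg1 T q.1) R P q.2 - s * sg T q.1 * c.L P q.2) *
        (cex (s * sg T q.1) R P q.2 * u q.1 q.2)) (Ioo 0 T ×ˢ B) :=
      (cWT.add (continuousOn_const.mul ((cont_sgS T s B).mul (cG.inner
        (cont_snd (c.Z_contDiff hP).continuous _))))).sub
        ((cqf.sub ((cont_sgS T s B).mul (cont_snd (c.L_cont hP) _))).mul cW)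
    refine this.congr fun q hq => ?_
    have := conj_pde c (s * sg T q.1) R (s * sg1 T q.1) hP
      ((h.c2 _ hq.1).contDiffAt (hB.mem_nhds hq.2)) (h.pde _ hq.1 _ hq.2)
    linarith
  have d1 := energy_hasDerivAt c hB η1 η2 η3 isOpen_Ioo hC2
    (fun t ht x hx => W_hasDerivAt (P := P) h s R ht hx) cWT cG cL ht
  have cω := cont_snd c.hω.continuous (Ioo 0 T ×ˢ B)
  have d2 := cutoff_hasDerivAt hB η1.continuous η2 η3 isOpen_Ioo
    (F := fun t x => c.ω x * (c.qf (s * sg T t) (s * sg1 T t) R P x *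
        (cex (s * sg T t) R P x * u t x) ^ 2))
    (F' := fun t x => c.ω x * (c.qt (s * sg T t) (s * sg1 T t) (s * sg2 T t) R P x *
        (cex (s * sg T t) R P x * u t x) ^ 2 + 2 * c.qf (s * sg T t) (s * sg1 T t) R P x *
        (cex (s * sg T t) R P x * u t x) * (cex (s * sg T t) R P x *
          cqt (s * sg1 T t) R P x (u t x) (ut t x))))
    (fun t ht x hx => by
      have e1 := qf_hasDerivAt (P := P) c s R ht x
      have e2 := (W_hasDerivAt (P := P) h s R ht hx).pow 2
      refine ((e1.mul e2).const_mul (c.ω x)).congr_deriv ?_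
      simp only [Nat.cast_ofNat, Nat.add_one_sub_one, pow_one, Pi.pow_apply]
      ring)
    (cω.mul (cqf.mul (cW.pow 2)))
    (cω.mul (ContinuousOn.add (ContinuousOn.mul ?_ (cW.pow 2))
      (((continuousOn_const.mul cqf).mul cW).mul cWT))) ht
  · exact d1.sub d2
  · unfold Coef.qt
    have e3 : ContinuousOn (fun q : ℝ × Eucl n => s * sg2 T q.1) (Ioo 0 T ×ˢ B) :=
      continuousOn_const.mul ((sg2_cont T).comp continuousOn_fst fun _ h => h.1)
    exact (((continuousOn_const.mul (cont_sgS T s B)).mul (cont_sgm T s B)).mul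
      (cont_snd (c.Gm_contDiff hP).continuous _)).add (e3.mul
      ((cont_snd hP.continuous _).sub continuousOn_const))

end conj

lemma tendsto_pow3_exp {r s : ℝ} (hr : 0 < r) (hs : 0 < s) {l : Filter ℝ} {f : ℝ → ℝ}
    (hf : Filter.Tendsto f l Filter.atTop) :
    Filter.Tendsto (fun t => (s * f t) ^ 3 * Real.exp (-(2 * r * (s * f t)))) l (𝓝 0) := by
  have h1 := (Real.tendsto_pow_mul_exp_neg_atTop_nhds_zero 3).comp
    (hf.const_mul_atTop (show 0 < 2 * r * s by positivity))
  have h2 := h1.const_mul (((2 * r) ^ 3)⁻¹)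
  rw [mul_zero] at h2
  refine h2.congr fun t => ?_
  simp only [Function.comp]
  rw [show 2 * r * s * f t = 2 * r * (s * f t) by ring, mul_pow (2 * r) (s * f t)]
  field_simp

set_option maxHeartbeats 800000 in
/-- The integrated Carleman estimate. -/
theorem carleman (c : Coef n) {P b : Eucl n → ℝ} (hP : ContDiff ℝ 2 P) (hb : ContDiff ℝ 1 b)
    {K : Set (Eucl n)} (hK : IsCompact K) {c0 : ℝ} (hc0 : 0 < c0) (hPC : c.PC P b K c0)
    {T : ℝ} (hT : 0 < T) {R r : ℝ} (hr : 0 < r) (hR : ∀ x ∈ K, P x ≤ R - r) :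
    ∃ s0 : ℝ, 1 ≤ s0 ∧ ∃ c' : ℝ, 0 < c' ∧ ∀ s : ℝ, s0 ≤ s →
      ∀ B : Set (Eucl n), IsOpen B → Bornology.IsBounded B →
      ∀ u ut : ℝ → Eucl n → ℝ, CSol c T B u ut →
      ∀ η : Eucl n → ℝ, ContDiff ℝ 1 η → HasCompactSupport η → tsupport η ⊆ B → tsupport η ⊆ K →
      (∀ x, 0 ≤ η x) →
      c' * (∫ t in Ioo 0 T, ∫ x, η x * (c.ω x * wden T s R P u ut t x)) ≤
        ∫ t in Ioo 0 T, ∫ x, fderiv ℝ η x (c.wflx T s R P b u ut t x) := by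
  obtain ⟨s0, hs0, c', hc', H⟩ := slice_carleman c hP hb hK hc0 hPC R (T ^ 2 / 4) (T + 3 * T ^ 2)
    (by positivity)
  obtain ⟨Cf, hCf, Hf⟩ := flx_le c hP hb hK R (T ^ 2 / 4) T (by positivity) hT
  refine ⟨s0, hs0, c', hc', fun s hs B hB hBb u ut h η η1 η2 η3 η4 η5 => ?_⟩
  have hs1 : 1 ≤ s := hs0.trans hs
  have hsp : 0 < s := by linarith
  have hsub : Ioo 0 T ×ˢ B ⊆ Ioo 0 T ×ˢ closure B := prod_mono subset_rfl subset_closure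
  obtain ⟨M, hM, hM1, hM2⟩ := wden_bdd hP hK hT hr hR hs1 hBb h
  obtain ⟨Mη, hMη, bη⟩ := exists_bound_on η2 η1.continuous.continuousOn
  obtain ⟨Mω, hMω, bω⟩ := exists_bound_on η2 c.hω.continuous.continuousOn
  obtain ⟨Mf, hMf, bf⟩ := exists_bound_on η2 (η1.continuous_fderiv one_ne_zero).norm.continuousOn
  have hfz : ∀ x ∉ tsupport η, fderiv ℝ η x = 0 := fun x hx => by
    rw [(notMem_tsupport_iff_eventuallyEq.1 hx).fderiv_eq]; simp
  have hKm : MeasurableSet (tsupport η) := (isClosed_tsupport η).measurableSet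
  have hKf : volume (tsupport η) ≠ ⊤ := η2.isCompact.measure_ne_top
  have hKc : ∀ x ∈ tsupport η, x ∈ K ∩ closure B := fun x hx => ⟨η4 hx, subset_closure (η3 hx)⟩
  have hsub2 : Ioo 0 T ×ˢ tsupport η ⊆ Ioo 0 T ×ˢ closure B :=
    prod_mono subset_rfl (η3.trans subset_closure)
  have i1 : IntegrableOn (fun t => ∫ x, η x * (c.ω x * wden T s R P u ut t x)) (Ioo 0 T) := by
    have := slice_integrable (T := T) hKm hKf
      (f := fun t x => η x * (c.ω x * wden T s R P u ut t x)) (M := Mη * (Mω * M))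
      ((cont_snd η1.continuous _).mul ((cont_snd c.hω.continuous _).mul
        ((cont_wden h hsp R hP).mono hsub2))) (fun t ht x hx => by
        rw [abs_mul, abs_mul, abs_of_nonneg (wden_nonneg hsp R ht x)]
        have := wden_nonneg (P := P) (u := u) (ut := ut) hsp R ht x
        gcongr
        exacts [bη x hx, bω x hx, hM2 t ht x (hKc x hx)])
    refine this.congr_fun (fun t _ => ?_) measurableSet_Ioo
    exact setIntegral_eq_integral_of_forall_compl_eq_zero fun x hx => by
      rw [image_eq_zero_of_notMem_tsupport hx, zero_mul]
  have hwf : ∀ t ∈ Ioo 0 T, ∀ x ∈ tsupport η, ‖c.wflx T s R P b u ut t x‖ ≤ Cf * M := by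
    intro t ht x hx
    obtain ⟨_, b2, _, b4, _, b6⟩ := sS_bounds hs1 ht
    have e1 := (Hf _ _ b2 b4 x (η4 hx) (u t x) (gradient (u t) x) (ut t x)).1
    unfold Coef.wflx
    rw [norm_smul, Real.norm_eq_abs, abs_of_nonneg (sq_nonneg _)]
    calc _ ≤ cex (s * sg T t) R P x ^ 2 * (Cf * den (s * sg T t) (s * sg1 T t) R P x (u t x)
          (gradient (u t) x) (ut t x)) := by gcongr
      _ = Cf * wden T s R P u ut t x := by unfold wden; ring
      _ ≤ _ := by gcongr; exact hM2 t ht x (hKc x hx)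
  have i2 : IntegrableOn (fun t => ∫ x, fderiv ℝ η x (c.wflx T s R P b u ut t x)) (Ioo 0 T) := by
    have := slice_integrable (T := T) hKm hKf
      (f := fun t x => fderiv ℝ η x (c.wflx T s R P b u ut t x)) (M := Mf * (Cf * M))
      ((cont_snd (η1.continuous_fderiv one_ne_zero) _).clm_apply
        ((cont_wflx h s R hP hb).mono hsub2)) (fun t ht x hx => by
        refine ((fderiv ℝ η x).le_opNorm _).trans ?_
        gcongr
        exacts [(le_abs_self _).trans (bf x hx), hwf t ht x hx])
    refine this.congr_fun (fun t _ => ?_) measurableSet_Ioo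
    exact setIntegral_eq_integral_of_forall_compl_eq_zero fun x hx => by
      rw [hfz x hx]; rfl
  -- the functional J is small
  have hJ0 : ∀ t ∈ Ioo 0 T, |(∫ x, η x * (c.ω x * ⟪gradient (fun y => cex (s * sg T t) R P y * u t y) x,
        c.Z (fun y => cex (s * sg T t) R P y * u t y) x⟫)) -
      ∫ x, η x * (c.ω x * (c.qf (s * sg T t) (s * sg1 T t) R P x *
        (cex (s * sg T t) R P x * u t x) ^ 2))| ≤ Mη * (Mω * (Cf * M)) * volume.real (tsupport η) *
          ((s * sg T t) ^ 3 * Real.exp (-(2 * r * (s * sg T t)))) := by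
    intro t ht
    obtain ⟨_, b2, _, b4, _, b6⟩ := sS_bounds hs1 ht
    have hC2 : ContDiffOn ℝ 2 (fun y => cex (s * sg T t) R P y * u t y) B :=
      (cex_contDiff _ R hP).contDiffOn.mul (h.c2 t ht)
    have hGr : ∀ x ∈ B, gradient (fun y => cex (s * sg T t) R P y * u t y) x = _ := fun x hx =>
      gradient_conj (s * sg T t) R hP
        (((h.c2 _ ht).contDiffAt (hB.mem_nhds hx)).differentiableAt two_ne_zero)
    have cgr1 : ContinuousOn (gradient (fun y => cex (s * sg T t) R P y * u t y)) B :=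
      (gradient_contDiffOn hB hC2).continuousOn
    have j1 : Integrable fun x => η x * (c.ω x *
        ⟪gradient (fun y => cex (s * sg T t) R P y * u t y) x,
        c.Z (fun y => cex (s * sg T t) R P y * u t y) x⟫) :=
      cutoff_integrable hB η1.continuous η2 η3 (c.hω.continuous.continuousOn.mul
        (cgr1.inner (c.hA.continuous.continuousOn.clm_apply cgr1)))
    have j2 : Integrable fun x => η x * (c.ω x * (c.qf (s * sg T t) (s * sg1 T t) R P x *
        (cex (s * sg T t) R P x * u t x) ^ 2)) :=
      cutoff_integrable hB η1.continuous η2 η3 (c.hω.continuous.continuousOn.mul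
        (ContinuousOn.mul (slice_cont_right (cont_qf c T s R B hP) ht)
          (hC2.continuousOn.pow 2)))
    rw [← integral_sub j1 j2]
    rw [← setIntegral_eq_integral_of_forall_compl_eq_zero (s := tsupport η) (fun x hx => by
      rw [image_eq_zero_of_notMem_tsupport hx]; ring)]
    have key := norm_setIntegral_le_of_norm_le_const (μ := volume) (s := tsupport η)
      (f := fun x => η x * (c.ω x * ⟪gradient (fun y => cex (s * sg T t) R P y * u t y) x,
        c.Z (fun y => cex (s * sg T t) R P y * u t y) x⟫) -
        η x * (c.ω x * (c.qf (s * sg T t) (s * sg1 T t) R P x *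
        (cex (s * sg T t) R P x * u t x) ^ 2)))
      (C := Mη * (Mω * (Cf * (M * ((s * sg T t) ^ 3 * Real.exp (-(2 * r * (s * sg T t))))))))
      hKf.lt_top (fun x hx => by
        rw [Real.norm_eq_abs, ← mul_sub, ← mul_sub, abs_mul, abs_mul]
        unfold Coef.Z
        rw [hGr x (η3 hx), map_smul, inner_smul_left, inner_smul_right, conj_trivial]
        have e1 := (Hf _ _ b2 b4 x (η4 hx) (u t x) (gradient (u t) x) (ut t x)).2
        have e2 := hM1 t ht x (hKc x hx)
        gcongr
        · exact bη x hx
        · exact bω x hx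
        · calc _ = cex (s * sg T t) R P x ^ 2 *
              |⟪cgr (s * sg T t) P x (u t x) (gradient (u t) x),
              c.A x (cgr (s * sg T t) P x (u t x) (gradient (u t) x))⟫ -
              c.qf (s * sg T t) (s * sg1 T t) R P x * u t x ^ 2| := by
                rw [← abs_of_nonneg (sq_nonneg (cex (s * sg T t) R P x)), ← abs_mul]
                congr 1
                ring
            _ ≤ cex (s * sg T t) R P x ^ 2 * (Cf * den (s * sg T t) (s * sg1 T t) R P x (u t x)
              (gradient (u t) x) (ut t x)) := by gcongr
            _ = Cf * wden T s R P u ut t x := by unfold wden; ring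
            _ ≤ _ := by gcongr)
    refine key.trans (le_of_eq ?_)
    ring
  have hlim : ∀ l : Filter ℝ, (∀ᶠ t in l, t ∈ Ioo 0 T) → Filter.Tendsto (sg T) l Filter.atTop →
      Filter.Tendsto (fun t => (∫ x, η x * (c.ω x *
        ⟪gradient (fun y => cex (s * sg T t) R P y * u t y) x,
        c.Z (fun y => cex (s * sg T t) R P y * u t y) x⟫)) -
      ∫ x, η x * (c.ω x * (c.qf (s * sg T t) (s * sg1 T t) R P x *
        (cex (s * sg T t) R P x * u t x) ^ 2))) l (𝓝 0) := by
    intro l hl hlt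
    refine squeeze_zero_norm' (hl.mono fun t ht => hJ0 t ht) ?_
    simpa using (tendsto_pow3_exp hr hsp hlt).const_mul
      (Mη * (Mω * (Cf * M)) * volume.real (tsupport η))
  have hJ := J_lemma hT (fun t ht => J_hasDerivAt h hB hP s R η1 η2 η3 ht)
    (φ := fun t => (∫ x, fderiv ℝ η x (c.wflx T s R P b u ut t x)) -
      c' * ∫ x, η x * (c.ω x * wden T s R P u ut t x))
    (fun t ht => by
      obtain ⟨b1, b2, b3, b4, b5, b6⟩ := sS_bounds hs1 ht
      have hC2 : ContDiffOn ℝ 2 (fun y => cex (s * sg T t) R P y * u t y) B :=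
        (cex_contDiff _ R hP).contDiffOn.mul (h.c2 t ht)
      have cWT : ContinuousOn (fun y => cex (s * sg T t) R P y *
          cqt (s * sg1 T t) R P y (u t y) (ut t y)) B :=
        (cex_contDiff _ R hP).continuous.continuousOn.mul
          (slice_cont_right ((cont_cqt h s R hP).mono hsub) ht)
      have := H s (s * sg T t) (s * sg1 T t) (s * sg2 T t) hs b1
        (b3.trans (by gcongr; linarith [show 0 ≤ 3 * T ^ 2 by positivity]))
        (b5.trans (by gcongr; linarith)) B hB _ _ hC2 cWT
        (fun x hx => conj_pde c (s * sg T t) R (s * sg1 T t) hP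
          ((h.c2 _ ht).contDiffAt (hB.mem_nhds hx)) (h.pde _ ht _ hx)) η η1 η2 η3 η4 η5
      have e1 : (∫ x, η x * (c.ω x * en (s * sg T t) (fun y => cex (s * sg T t) R P y * u t y)
          (fun y => cex (s * sg T t) R P y * cqt (s * sg1 T t) R P y (u t y) (ut t y)) x)) =
          ∫ x, η x * (c.ω x * wden T s R P u ut t x) := by
        refine integral_congr_ae (Filter.Eventually.of_forall fun x => ?_)
        by_cases hx : x ∈ tsupport η
        · simp only [en_eq_wden h hB hP s R ht (η3 hx)]
        · simp only [image_eq_zero_of_notMem_tsupport hx, zero_mul]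
      have e2 : (∫ x, fderiv ℝ η x (c.Bfl (s * sg T t) (s * sg1 T t) R P b
          (fun y => cex (s * sg T t) R P y * u t y)
          (fun y => cex (s * sg T t) R P y * cqt (s * sg1 T t) R P y (u t y) (ut t y)) x)) =
          ∫ x, fderiv ℝ η x (c.wflx T s R P b u ut t x) := by
        refine integral_congr_ae (Filter.Eventually.of_forall fun x => ?_)
        by_cases hx : x ∈ tsupport η
        · simp only [Bfl_eq_wflx h hB hP s R ht (η3 hx)]
        · simp only [hfz x hx]; rfl
      rw [e1, e2] at this
      linarith)
    (i2.sub (i1.const_mul c'))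
    (hlim _ (Ioo_mem_nhdsGT hT) (sg_tendsto_zero hT))
    (hlim _ (Ioo_mem_nhdsLT hT) (sg_tendsto_T hT))
  rw [integral_sub i2 (i1.const_mul c'), integral_const_mul] at hJ
  linarith

/-! ### Graph coordinates and boundary shells -/

section graph
variable {m : ℕ}

/-- insert a coordinate -/
def ins (k : Fin (m + 1)) (r : ℝ) (y : Fin m → ℝ) : Eucl (m + 1) :=
  WithLp.toLp 2 (k.insertNth (α := fun _ => ℝ) r y)

/-- drop a coordinate -/
def dr (k : Fin (m + 1)) (x : Eucl (m + 1)) : Fin m → ℝ := fun i => x (k.succAbove i)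

/-- graph defining function -/
def rt (k : Fin (m + 1)) (σ : ℝ) (h : (Fin m → ℝ) → ℝ) (x : Eucl (m + 1)) : ℝ :=
  σ * (x k - h (dr k x))

@[simp] lemma ins_same (k : Fin (m + 1)) (r : ℝ) (y : Fin m → ℝ) : ins k r y k = r := by
  simp [ins]
@[simp] lemma dr_ins (k : Fin (m + 1)) (r : ℝ) (y : Fin m → ℝ) : dr k (ins k r y) = y := by
  ext i; simp [ins, dr]
lemma ins_dr (k : Fin (m + 1)) (x : Eucl (m + 1)) : ins k (x k) (dr k x) = x := by
  ext i
  rcases eq_or_ne i k with rfl | hi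
  · simp
  · obtain ⟨j, rfl⟩ := Fin.exists_succAbove_eq hi
    simp [ins, dr]

lemma dr_cont (k : Fin (m + 1)) : Continuous (dr k) := by unfold dr; fun_prop
lemma ins_cont (k : Fin (m + 1)) : Continuous fun q : ℝ × (Fin m → ℝ) => ins k q.1 q.2 := by
  unfold ins
  refine (PiLp.continuous_toLp 2 _).comp (continuous_pi fun i => ?_)
  rcases eq_or_ne i k with rfl | hi
  · simpa using continuous_fst
  · obtain ⟨j, rfl⟩ := Fin.exists_succAbove_eq hi
    simp only [Fin.insertNth_apply_succAbove]
    fun_prop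

lemma rt_cont (k : Fin (m + 1)) (σ : ℝ) {h : (Fin m → ℝ) → ℝ} (hh : Continuous h) :
    Continuous (rt k σ h) := by
  have h1 := hh.comp (dr_cont k)
  have h2 : Continuous fun x : Eucl (m + 1) => x k := by fun_prop
  exact continuous_const.mul (h2.sub h1)

lemma rt_ins {k : Fin (m + 1)} {σ : ℝ} (hσ : σ * σ = 1) (h : (Fin m → ℝ) → ℝ) (q : ℝ)
    (y : Fin m → ℝ) : rt k σ h (ins k (h y + σ * q) y) = q := by
  simp only [rt, ins_same, dr_ins, add_sub_cancel_left]
  rw [← mul_assoc, hσ, one_mul]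

lemma integral_ins (k : Fin (m + 1)) (f : Eucl (m + 1) → ℝ) :
    ∫ x, f x = ∫ q : ℝ × (Fin m → ℝ), f (ins k q.1 q.2) := by
  rw [← (PiLp.volume_preserving_toLp (Fin (m + 1))).integral_comp
    (MeasurableEquiv.toLp 2 (Fin (m + 1) → ℝ)).measurableEmbedding]
  rw [← (volume_preserving_piFinSuccAbove (fun _ : Fin (m + 1) => ℝ) k).symm.integral_comp
    (MeasurableEquiv.measurableEmbedding _)]
  rfl

lemma integrable_ins (k : Fin (m + 1)) {f : Eucl (m + 1) → ℝ} (hf : Integrable f) :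
    Integrable fun q : ℝ × (Fin m → ℝ) => f (ins k q.1 q.2) := by
  rw [← (PiLp.volume_preserving_toLp (Fin (m + 1))).integrable_comp_emb
    (MeasurableEquiv.toLp 2 (Fin (m + 1) → ℝ)).measurableEmbedding] at hf
  rw [← (volume_preserving_piFinSuccAbove (fun _ : Fin (m + 1) => ℝ) k).symm.integrable_comp_emb
    (MeasurableEquiv.measurableEmbedding _)] at hf
  exact hf

lemma integral_shear (k : Fin (m + 1)) {σ : ℝ} (hσ : σ * σ = 1) (h : (Fin m → ℝ) → ℝ) {ε : ℝ}
    (hε : 0 < ε) {f : Eucl (m + 1) → ℝ} (hf : Integrable f)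
    (hf2 : Integrable fun q : ℝ × (Fin m → ℝ) => f (ins k (h q.2 + σ * (ε * q.1)) q.2)) :
    ∫ x, f x = ε * ∫ q : ℝ × (Fin m → ℝ), f (ins k (h q.2 + σ * (ε * q.1)) q.2) := by
  have h1 := integrable_ins k hf
  rw [Measure.volume_eq_prod] at h1 hf2
  rw [integral_ins k, Measure.volume_eq_prod, integral_prod_symm _ h1, integral_prod_symm _ hf2,
    ← integral_const_mul]
  refine integral_congr_ae (Filter.Eventually.of_forall fun y => ?_)
  simp only
  have e1 := Measure.integral_comp_mul_left (fun r => f (ins k (h y + r) y)) (σ * ε)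
  have e2 : |(σ * ε)⁻¹| = ε⁻¹ := by
    rw [abs_inv, abs_mul, abs_of_pos hε]
    have : |σ| = 1 := by
      have : |σ| * |σ| = 1 := by rw [← abs_mul, hσ, abs_one]
      nlinarith [abs_nonneg σ]
    rw [this, one_mul]
  rw [e2, integral_add_left_eq_self (fun r => f (ins k r y)) (h y), smul_eq_mul] at e1
  have e3 : (∫ r, f (ins k (h y + σ * (ε * r)) y)) = ∫ r, f (ins k (h y + σ * ε * r) y) := by
    congr 1; ext r; rw [mul_assoc]
  rw [e3, e1, ← mul_assoc, mul_inv_cancel₀ hε.ne', one_mul]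

end graph

/-- cutoff profile -/
def Th (r : ℝ) : ℝ := Real.smoothTransition (-r - 1)

lemma Th_contDiff : ContDiff ℝ 2 Th := by
  unfold Th
  exact (Real.smoothTransition.contDiff (n := 2)).comp (by fun_prop : ContDiff ℝ 2 fun r : ℝ => -r - 1)
lemma Th_one {r : ℝ} (hr : r ≤ -2) : Th r = 1 :=
  Real.smoothTransition.one_of_one_le (by linarith)
lemma Th_zero {r : ℝ} (hr : -1 ≤ r) : Th r = 0 :=
  Real.smoothTransition.zero_of_nonpos (by linarith)
lemma Th_nonneg (r : ℝ) : 0 ≤ Th r := Real.smoothTransition.nonneg _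
lemma Th_le_one (r : ℝ) : Th r ≤ 1 := Real.smoothTransition.le_one _
lemma Th_anti : Antitone Th := fun a b h => Real.smoothTransition.monotone (by linarith)
lemma Th_deriv_nonpos (r : ℝ) : deriv Th r ≤ 0 := Th_anti.deriv_nonpos
lemma Th_deriv_cont : Continuous (deriv Th) := Th_contDiff.continuous_deriv (by norm_num)
lemma Th_deriv_zero {r : ℝ} (hr : r ∉ Icc (-2 : ℝ) (-1)) : deriv Th r = 0 := by
  rw [mem_Icc, not_and_or, not_le, not_le] at hr
  rcases hr with hr | hr
  · have : Th =ᶠ[𝓝 r] fun _ => 1 := by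
      filter_upwards [Iio_mem_nhds hr] with y hy using Th_one (le_of_lt hy)
    rw [this.deriv_eq]; simp
  · have : Th =ᶠ[𝓝 r] fun _ => 0 := by
      filter_upwards [Ioi_mem_nhds hr] with y hy using Th_zero (le_of_lt hy)
    rw [this.deriv_eq]; simp
lemma Th_deriv_cs : HasCompactSupport (deriv Th) :=
  HasCompactSupport.intro isCompact_Icc fun _ hx => Th_deriv_zero hx
lemma Th_deriv_int : ∫ r, -deriv Th r = 1 := by
  rw [integral_neg]
  have h1 : ∫ r, deriv Th r = ∫ r in Icc (-2 : ℝ) (-1), deriv Th r :=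
    (setIntegral_eq_integral_of_forall_compl_eq_zero fun x hx => Th_deriv_zero hx).symm
  rw [integral_Icc_eq_integral_Ioc] at h1
  rw [h1, ← intervalIntegral.integral_of_le (by norm_num)]
  rw [intervalIntegral.integral_deriv_eq_sub
    (fun x _ => (Th_contDiff.differentiable two_ne_zero x)) (Th_deriv_cont.intervalIntegrable _ _)]
  rw [Th_one (le_refl _), Th_zero (le_refl _)]; norm_num

section shell
variable {m : ℕ}

lemma indicator_measurable {A : Set (Eucl n)} (hA : MeasurableSet A) {G : Eucl n → ℝ}
    (hG : ContinuousOn G A) : Measurable (A.indicator G) := by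
  classical
  have := ContinuousOn.measurable_piecewise (f := G) (g := fun _ => (0 : ℝ)) hG continuousOn_const hA
  rwa [← piecewise_eq_indicator] 

set_option maxHeartbeats 400000 in
lemma shell_limit (k : Fin (m + 1)) {σ : ℝ} (hσ : σ * σ = 1) {h : (Fin m → ℝ) → ℝ}
    (hh : Continuous h) {G : Eucl (m + 1) → ℝ} {K0 U : Set (Eucl (m + 1))} (hK0 : IsCompact K0)
    (hU : IsOpen U) (hKU : K0 ⊆ U) (hG0 : ∀ x ∉ K0, G x = 0)
    (hGc : ContinuousOn G {x | x ∈ U ∧ rt k σ h x ≤ 0}) :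
    Filter.Tendsto (fun ε : ℝ => ∫ x, G x * (-deriv Th (rt k σ h x / ε) / ε)) (𝓝[>] 0)
      (𝓝 (∫ y, G (ins k (h y) y))) := by
  have hrt := rt_cont k σ hh
  set K1 : Set (Eucl (m + 1)) := K0 ∩ {x | rt k σ h x ≤ 0} with hK1
  have hK1c : IsCompact K1 := hK0.inter_right (isClosed_le hrt continuous_const)
  have hGK : ContinuousOn G K1 := hGc.mono fun x hx => ⟨hKU hx.1, hx.2⟩
  set G' : Eucl (m + 1) → ℝ := K1.indicator G with hG'
  have hG'm : Measurable G' := indicator_measurable hK1c.measurableSet hGK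
  obtain ⟨M, hM, bM⟩ := exists_bound_on hK1c hGK
  have bM' : ∀ x, |G' x| ≤ M := by
    intro x
    by_cases hx : x ∈ K1
    · rw [hG', indicator_of_mem hx]; exact bM x hx
    · rw [hG', indicator_of_notMem hx, abs_zero]; exact hM
  have hGG : ∀ x, rt k σ h x ≤ 0 → G x = G' x := by
    intro x hx
    by_cases hx0 : x ∈ K0
    · rw [hG', indicator_of_mem (show x ∈ K1 from ⟨hx0, hx⟩)]
    · rw [hG', indicator_of_notMem (fun h => hx0 h.1), hG0 x hx0]
  set Y : Set (Fin m → ℝ) := dr k '' K0 with hY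
  have hYc : IsCompact Y := hK0.image (dr_cont k)
  have hGY : ∀ r y, y ∉ Y → G' (ins k r y) = 0 := by
    intro r y hy
    rw [hG', indicator_of_notMem]
    intro hx
    exact hy ⟨_, hx.1, dr_ins k r y⟩
  have hins : Continuous fun q : ℝ × (Fin m → ℝ) => ins k q.1 q.2 := ins_cont k
  have hΦm : ∀ ε : ℝ, Measurable fun q : ℝ × (Fin m → ℝ) => ins k (h q.2 + σ * (ε * q.1)) q.2 := by
    intro ε
    exact (hins.comp (by fun_prop : Continuous fun q : ℝ × (Fin m → ℝ) =>
      (h q.2 + σ * (ε * q.1), q.2))).measurable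
  have hThm : Measurable (deriv Th) := Th_deriv_cont.measurable
  have hThi : Integrable fun r => |deriv Th r| :=
    (Th_deriv_cont.integrable_of_hasCompactSupport Th_deriv_cs).abs
  have hbi : Integrable (fun q : ℝ × (Fin m → ℝ) => |deriv Th q.1| * Y.indicator (fun _ => M) q.2) := by
    rw [Measure.volume_eq_prod]
    refine hThi.mul_prod (f := fun r => |deriv Th r|) (g := Y.indicator (fun _ => M)) ?_
    rw [integrable_indicator_iff hYc.measurableSet]
    exact integrableOn_const hYc.measure_ne_top
  have hbound : ∀ ε : ℝ, ∀ q : ℝ × (Fin m → ℝ),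
      ‖G' (ins k (h q.2 + σ * (ε * q.1)) q.2) * -deriv Th q.1‖ ≤
        |deriv Th q.1| * Y.indicator (fun _ => M) q.2 := by
    intro ε q
    rw [norm_mul, norm_neg, mul_comm]
    refine mul_le_mul_of_nonneg_left ?_ (abs_nonneg _)
    by_cases hy : q.2 ∈ Y
    · rw [indicator_of_mem hy]; exact bM' _
    · rw [indicator_of_notMem hy, hGY _ _ hy, norm_zero]
  have hmeas : ∀ ε : ℝ, Measurable fun q : ℝ × (Fin m → ℝ) =>
      G' (ins k (h q.2 + σ * (ε * q.1)) q.2) * -deriv Th q.1 := fun ε =>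
    (hG'm.comp (hΦm ε)).mul (hThm.comp measurable_fst).neg
  have hintg : ∀ ε : ℝ, Integrable fun q : ℝ × (Fin m → ℝ) =>
      G' (ins k (h q.2 + σ * (ε * q.1)) q.2) * -deriv Th q.1 := fun ε =>
    hbi.mono' (hmeas ε).aestronglyMeasurable (Filter.Eventually.of_forall (hbound ε))
  have hzero : ∀ ε > 0, ∀ x, 0 < rt k σ h x → deriv Th (rt k σ h x / ε) = 0 := by
    intro ε hε x hx
    refine Th_deriv_zero fun hm => ?_
    have : 0 < rt k σ h x / ε := by positivity
    linarith [hm.2]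
  have heq : ∀ ε > 0, ∫ x, G x * (-deriv Th (rt k σ h x / ε) / ε) =
      ∫ q : ℝ × (Fin m → ℝ), G' (ins k (h q.2 + σ * (ε * q.1)) q.2) * -deriv Th q.1 := by
    intro ε hε
    have e0 : ∀ x, G x * (-deriv Th (rt k σ h x / ε) / ε) =
        G' x * (-deriv Th (rt k σ h x / ε) / ε) := by
      intro x
      rcases le_or_gt (rt k σ h x) 0 with hx | hx
      · rw [hGG x hx]
      · rw [hzero ε hε x hx]; simp
    have e1 : ∀ q : ℝ × (Fin m → ℝ), G' (ins k (h q.2 + σ * (ε * q.1)) q.2) *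
        (-deriv Th (rt k σ h (ins k (h q.2 + σ * (ε * q.1)) q.2) / ε) / ε) =
        (G' (ins k (h q.2 + σ * (ε * q.1)) q.2) * -deriv Th q.1) * ε⁻¹ := by
      intro q
      rw [rt_ins hσ, mul_div_cancel_left₀ _ hε.ne']; ring
    simp_rw [e0]
    rw [integral_shear k hσ h hε (f := fun x => G' x * (-deriv Th (rt k σ h x / ε) / ε))]
    · simp_rw [e1]
      rw [integral_mul_const]
      field_simp
    · obtain ⟨M2, hM2⟩ := Th_deriv_cont.bounded_above_of_compact_support Th_deriv_cs
      have hm : Measurable fun x => G' x * (-deriv Th (rt k σ h x / ε) / ε) :=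
        hG'm.mul (((hThm.comp (hrt.measurable.div_const ε)).neg).div_const ε)
      have : IntegrableOn (fun x => G' x * (-deriv Th (rt k σ h x / ε) / ε)) K1 := by
        refine IntegrableOn.of_bound (C := M * (M2 / ε)) hK1c.measure_lt_top hm.aestronglyMeasurable ?_
        refine Filter.Eventually.of_forall fun x => ?_
        rw [norm_mul, norm_div, norm_neg, Real.norm_of_nonneg hε.le]
        have := hM2 (rt k σ h x / ε)
        gcongr
        exact bM' x
      rwa [integrableOn_iff_integrable_of_support_subset] at this
      intro x hx
      by_contra hxK
      apply hx
      simp only [hG']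
      rw [indicator_of_notMem hxK, zero_mul]
    · simp_rw [e1]
      exact (hintg ε).mul_const _
  have hlimv : (∫ y, G (ins k (h y) y)) = ∫ q : ℝ × (Fin m → ℝ), G' (ins k (h q.2) q.2) * -deriv Th q.1 := by
    have e2 : (fun q : ℝ × (Fin m → ℝ) => G' (ins k (h q.2) q.2) * -deriv Th q.1) =
        fun q => (fun r => -deriv Th r) q.1 * (fun y => G' (ins k (h y) y)) q.2 := by
      ext q; ring
    rw [e2, Measure.volume_eq_prod, integral_prod_mul (fun r => -deriv Th r) (fun y => G' (ins k (h y) y)), Th_deriv_int,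
      one_mul]
    congr 1
    ext y
    refine hGG _ ?_
    simp [rt]
  rw [hlimv]
  refine Filter.Tendsto.congr' (f₁ := fun ε : ℝ => ∫ q : ℝ × (Fin m → ℝ),
    G' (ins k (h q.2 + σ * (ε * q.1)) q.2) * -deriv Th q.1)
    (Filter.mem_of_superset self_mem_nhdsWithin fun ε hε => (heq ε hε).symm) ?_
  refine tendsto_integral_filter_of_dominated_convergence
    (fun q : ℝ × (Fin m → ℝ) => |deriv Th q.1| * Y.indicator (fun _ => M) q.2)
    (Filter.Eventually.of_forall fun ε => (hmeas ε).aestronglyMeasurable)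
    (Filter.Eventually.of_forall fun ε => Filter.Eventually.of_forall (hbound ε)) hbi
    (Filter.Eventually.of_forall fun q => ?_)
  by_cases hq : q.1 ∈ Icc (-2 : ℝ) (-1)
  swap
  · simp only [Th_deriv_zero hq, neg_zero, mul_zero]; exact tendsto_const_nhds
  refine Filter.Tendsto.mul_const _ ?_
  have ht : Filter.Tendsto (fun ε : ℝ => ins k (h q.2 + σ * (ε * q.1)) q.2) (𝓝[>] 0)
      (𝓝 (ins k (h q.2) q.2)) := by
    have : Continuous fun ε : ℝ => ins k (h q.2 + σ * (ε * q.1)) q.2 :=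
      hins.comp (by fun_prop : Continuous fun ε : ℝ => (h q.2 + σ * (ε * q.1), q.2))
    have := (this.tendsto 0).mono_left (nhdsWithin_le_nhds (s := Ioi 0))
    simpa using this
  have hneg : ∀ ε > 0, rt k σ h (ins k (h q.2 + σ * (ε * q.1)) q.2) ≤ 0 := by
    intro ε hε
    rw [rt_ins hσ]
    have := mul_pos hε (show 0 < -q.1 by linarith [hq.2])
    linarith
  have h00 : rt k σ h (ins k (h q.2) q.2) ≤ 0 := by simp [rt]
  by_cases hz : ins k (h q.2) q.2 ∈ U
  · have hc := hGc _ ⟨hz, h00⟩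
    have ht2 : Filter.Tendsto (fun ε : ℝ => ins k (h q.2 + σ * (ε * q.1)) q.2) (𝓝[>] 0)
        (𝓝[{x | x ∈ U ∧ rt k σ h x ≤ 0}] (ins k (h q.2) q.2)) := by
      rw [tendsto_nhdsWithin_iff]
      refine ⟨ht, ?_⟩
      filter_upwards [ht (hU.mem_nhds hz), self_mem_nhdsWithin] with ε h1 h2 using ⟨h1, hneg ε h2⟩
    rw [← hGG _ h00]
    refine (hc.tendsto.comp ht2).congr' ?_
    filter_upwards [self_mem_nhdsWithin] with ε h2 using hGG _ (hneg ε h2)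
  · have hz' : ins k (h q.2) q.2 ∉ K0 := fun h => hz (hKU h)
    rw [← hGG _ h00, hG0 _ hz']
    refine tendsto_const_nhds.congr' ?_
    filter_upwards [ht (hK0.isClosed.isOpen_compl.mem_nhds hz'), self_mem_nhdsWithin] with ε h1 h2
    rw [← hGG _ (hneg ε h2), hG0 _ h1]

end shell

section shelltime
variable {m : ℕ}

lemma shell_slice_int (k : Fin (m + 1)) {σ : ℝ} {h : (Fin m → ℝ) → ℝ}
    (hh : Continuous h) {T : ℝ} {f : ℝ → Eucl (m + 1) → ℝ} {K0 U : Set (Eucl (m + 1))}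
    (hK0 : IsCompact K0) (hKU : K0 ⊆ U) (hf0 : ∀ t, ∀ x ∉ K0, f t x = 0)
    (hfc : ContinuousOn (fun q : ℝ × Eucl (m + 1) => f q.1 q.2)
      (Ioo 0 T ×ˢ {x | x ∈ U ∧ rt k σ h x ≤ 0})) {M : ℝ}
    (hM : ∀ t ∈ Ioo 0 T, ∀ x ∈ K0, rt k σ h x ≤ 0 → |f t x| ≤ M)
    {w : Eucl (m + 1) → ℝ} (hw : Continuous w) (hw0 : ∀ x, 0 < rt k σ h x → w x = 0) :
    IntegrableOn (fun t => ∫ x, f t x * w x) (Ioo 0 T) := by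
  have hrt := rt_cont k σ hh
  have hK1c : IsCompact (K0 ∩ {x | rt k σ h x ≤ 0}) :=
    hK0.inter_right (isClosed_le hrt continuous_const)
  obtain ⟨Mw, hMw, bw⟩ := exists_bound_on hK1c hw.continuousOn
  have := slice_integrable (T := T) hK1c.measurableSet hK1c.measure_ne_top
    (f := fun t x => f t x * w x) (M := M * Mw)
    ((hfc.mono (prod_mono subset_rfl fun x hx => ⟨hKU hx.1, hx.2⟩)).mul (cont_snd hw _))
    (fun t ht x hx => by
      rw [abs_mul]
      have h1 := hM t ht x hx.1 hx.2
      have h2 := bw x hx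
      have : 0 ≤ M := (abs_nonneg _).trans h1
      gcongr)
  refine this.congr_fun (fun t _ => ?_) measurableSet_Ioo
  refine setIntegral_eq_integral_of_forall_compl_eq_zero fun x hx => ?_
  by_cases h0 : x ∈ K0
  · rw [hw0 x (not_le.1 fun h1 => hx ⟨h0, h1⟩), mul_zero]
  · rw [hf0 t x h0, zero_mul]

lemma shell_time1 (k : Fin (m + 1)) {σ : ℝ} {h : (Fin m → ℝ) → ℝ}
    (hh : Continuous h) {T : ℝ} {f : ℝ → Eucl (m + 1) → ℝ} {K0 U : Set (Eucl (m + 1))}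
    (hK0 : IsCompact K0) (hKU : K0 ⊆ U) (hf0 : ∀ t, ∀ x ∉ K0, f t x = 0)
    (hfc : ContinuousOn (fun q : ℝ × Eucl (m + 1) => f q.1 q.2)
      (Ioo 0 T ×ˢ {x | x ∈ U ∧ rt k σ h x ≤ 0})) {M : ℝ}
    (hM : ∀ t ∈ Ioo 0 T, ∀ x ∈ K0, rt k σ h x ≤ 0 → |f t x| ≤ M) :
    (∀ ε > 0, IntegrableOn (fun t => ∫ x, f t x * Th (rt k σ h x / ε)) (Ioo 0 T)) ∧
    Filter.Tendsto (fun ε : ℝ => ∫ t in Ioo 0 T, ∫ x, f t x * Th (rt k σ h x / ε)) (𝓝[>] 0)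
      (𝓝 (∫ t in Ioo 0 T, ∫ x in {x | rt k σ h x < 0}, f t x)) := by
  have hrt := rt_cont k σ hh
  have hwc : ∀ ε : ℝ, Continuous fun x => Th (rt k σ h x / ε) := fun ε =>
    Th_contDiff.continuous.comp (hrt.div_const ε)
  have hw0 : ∀ ε > 0, ∀ x, 0 < rt k σ h x → Th (rt k σ h x / ε) = 0 := fun ε hε x hx =>
    Th_zero (by have : 0 < rt k σ h x / ε := by positivity
                linarith)
  have hI : ∀ ε > 0, IntegrableOn (fun t => ∫ x, f t x * Th (rt k σ h x / ε)) (Ioo 0 T) :=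
    fun ε hε => shell_slice_int k hh hK0 hKU hf0 hfc hM (hwc ε) (hw0 ε hε)
  refine ⟨hI, ?_⟩
  rcases (Ioo (0 : ℝ) T).eq_empty_or_nonempty with he | ⟨t1, ht1⟩
  · simp [he]
  have hK1c : IsCompact (K0 ∩ {x | rt k σ h x ≤ 0}) :=
    hK0.inter_right (isClosed_le hrt continuous_const)
  have hbd : ∀ ε > 0, ∀ t ∈ Ioo 0 T, ∀ x,
      ‖f t x * Th (rt k σ h x / ε)‖ ≤ (K0 ∩ {x | rt k σ h x ≤ 0}).indicator (fun _ => M) x := by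
    intro ε hε t ht x
    by_cases hx : x ∈ K0 ∩ {x | rt k σ h x ≤ 0}
    · rw [indicator_of_mem hx, norm_mul, Real.norm_of_nonneg (Th_nonneg _)]
      exact (mul_le_of_le_one_right (norm_nonneg _) (Th_le_one _)).trans (hM t ht x hx.1 hx.2)
    · rw [indicator_of_notMem hx]
      by_cases h0 : x ∈ K0
      · rw [hw0 ε hε x (not_le.1 fun h1 => hx ⟨h0, h1⟩), mul_zero, norm_zero]
      · rw [hf0 t x h0, zero_mul, norm_zero]
  have hbi : Integrable ((K0 ∩ {x | rt k σ h x ≤ 0}).indicator (fun _ => M)) := by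
    rw [integrable_indicator_iff hK1c.measurableSet]
    exact integrableOn_const hK1c.measure_ne_top
  have hxm : ∀ ε > 0, ∀ t ∈ Ioo 0 T, Measurable fun x => f t x * Th (rt k σ h x / ε) := by
    intro ε hε t ht
    have h1 := indicator_measurable hK1c.measurableSet (G := fun x => f t x * Th (rt k σ h x / ε))
      (((slice_cont_right hfc ht).mono fun x hx => ⟨hKU hx.1, hx.2⟩).mul (hwc ε).continuousOn)
    have e : (fun x => f t x * Th (rt k σ h x / ε)) = (K0 ∩ {x | rt k σ h x ≤ 0}).indicator
        (fun x => f t x * Th (rt k σ h x / ε)) := by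
      ext x
      by_cases hx : x ∈ K0 ∩ {x | rt k σ h x ≤ 0}
      · rw [indicator_of_mem hx]
      · rw [indicator_of_notMem hx]
        by_cases h0 : x ∈ K0
        · rw [hw0 ε hε x (not_le.1 fun h1 => hx ⟨h0, h1⟩), mul_zero]
        · rw [hf0 t x h0, zero_mul]
    rw [e]
    exact h1
  have hx : ∀ t ∈ Ioo 0 T, Filter.Tendsto (fun ε : ℝ => ∫ x, f t x * Th (rt k σ h x / ε)) (𝓝[>] 0)
      (𝓝 (∫ x in {x | rt k σ h x < 0}, f t x)) := by
    intro t ht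
    rw [← integral_indicator (isOpen_lt hrt continuous_const).measurableSet]
    refine tendsto_integral_filter_of_dominated_convergence
      ((K0 ∩ {x | rt k σ h x ≤ 0}).indicator (fun _ => M))
      (Filter.mem_of_superset self_mem_nhdsWithin fun ε hε => (hxm ε hε t ht).aestronglyMeasurable)
      (by filter_upwards [self_mem_nhdsWithin] with ε hε using
            Filter.Eventually.of_forall (hbd ε hε t ht)) hbi
      (Filter.Eventually.of_forall fun x => ?_)
    rcases lt_or_ge (rt k σ h x) 0 with hx | hx
    · rw [indicator_of_mem (show x ∈ {x | rt k σ h x < 0} from hx)]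
      refine tendsto_const_nhds.congr' ?_
      have : Ioo 0 (-rt k σ h x / 2) ∈ 𝓝[>] (0 : ℝ) := Ioo_mem_nhdsGT (by linarith)
      filter_upwards [this] with ε hε
      rw [Th_one, mul_one]
      rw [div_le_iff₀ hε.1]
      linarith [hε.2]
    · rw [indicator_of_notMem (show x ∉ {x | rt k σ h x < 0} from not_lt.2 hx)]
      refine tendsto_const_nhds.congr' ?_
      filter_upwards [self_mem_nhdsWithin] with ε hε
      rw [Th_zero, mul_zero]
      have : 0 ≤ rt k σ h x / ε := div_nonneg hx (le_of_lt hε)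
      linarith
  refine tendsto_integral_filter_of_dominated_convergence
    (fun _ => ∫ x, (K0 ∩ {x | rt k σ h x ≤ 0}).indicator (fun _ => M) x)
    (Filter.mem_of_superset self_mem_nhdsWithin fun ε hε => (hI ε hε).aestronglyMeasurable)
    (Filter.mem_of_superset self_mem_nhdsWithin fun ε hε => ?_)
    (integrable_const _) ?_
  · filter_upwards [ae_restrict_mem measurableSet_Ioo] with t ht
    exact norm_integral_le_of_norm_le hbi (Filter.Eventually.of_forall (hbd ε hε t ht))
  · filter_upwards [ae_restrict_mem measurableSet_Ioo] with t ht using hx t ht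

lemma shell_time2 (k : Fin (m + 1)) {σ : ℝ} (hσ : σ * σ = 1) {h : (Fin m → ℝ) → ℝ}
    (hh : Continuous h) {T : ℝ} {f : ℝ → Eucl (m + 1) → ℝ} {K0 U : Set (Eucl (m + 1))}
    (hK0 : IsCompact K0) (hU : IsOpen U) (hKU : K0 ⊆ U) (hf0 : ∀ t, ∀ x ∉ K0, f t x = 0)
    (hfc : ContinuousOn (fun q : ℝ × Eucl (m + 1) => f q.1 q.2)
      (Ioo 0 T ×ˢ {x | x ∈ U ∧ rt k σ h x ≤ 0})) {M : ℝ}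
    (hM : ∀ t ∈ Ioo 0 T, ∀ x ∈ K0, rt k σ h x ≤ 0 → |f t x| ≤ M) :
    (∀ ε > 0, IntegrableOn (fun t => ∫ x, f t x * (-deriv Th (rt k σ h x / ε) / ε)) (Ioo 0 T)) ∧
    Filter.Tendsto (fun ε : ℝ => ∫ t in Ioo 0 T, ∫ x, f t x * (-deriv Th (rt k σ h x / ε) / ε))
      (𝓝[>] 0) (𝓝 (∫ t in Ioo 0 T, ∫ y, f t (ins k (h y) y))) := by
  have hrt := rt_cont k σ hh
  have hwc : ∀ ε : ℝ, Continuous fun x => -deriv Th (rt k σ h x / ε) / ε := fun ε =>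
    (Th_deriv_cont.comp (hrt.div_const ε)).neg.div_const ε
  have hw0 : ∀ ε > 0, ∀ x, 0 < rt k σ h x → -deriv Th (rt k σ h x / ε) / ε = 0 := by
    intro ε hε x hx
    rw [Th_deriv_zero, neg_zero, zero_div]
    intro hm
    have : 0 < rt k σ h x / ε := by positivity
    linarith [hm.2]
  have hwn : ∀ ε > 0, ∀ x, 0 ≤ -deriv Th (rt k σ h x / ε) / ε := fun ε hε x =>
    div_nonneg (neg_nonneg.2 (Th_deriv_nonpos _)) (le_of_lt hε)
  have hI : ∀ ε > 0, IntegrableOn (fun t => ∫ x, f t x * (-deriv Th (rt k σ h x / ε) / ε))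
      (Ioo 0 T) :=
    fun ε hε => shell_slice_int k hh hK0 hKU hf0 hfc hM (hwc ε) (hw0 ε hε)
  refine ⟨hI, ?_⟩
  rcases (Ioo (0 : ℝ) T).eq_empty_or_nonempty with he | ⟨t1, ht1⟩
  · simp [he]
  obtain ⟨ρ0, hρ0⟩ := hK0.isBounded.subset_closedBall (0 : Eucl (m + 1))
  set χ : Eucl (m + 1) → ℝ := fun x => |M| * max 0 (ρ0 + 1 - ‖x‖) with hχ
  have hχc : Continuous χ := by fun_prop
  have hχ0 : ∀ x ∉ Metric.closedBall (0 : Eucl (m + 1)) (ρ0 + 1), χ x = 0 := by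
    intro x hx
    rw [Metric.mem_closedBall, dist_zero_right, not_le] at hx
    simp only [hχ]
    rw [max_eq_left (by linarith), mul_zero]
  have hχn : ∀ x, 0 ≤ χ x := fun x => mul_nonneg (abs_nonneg _) (le_max_left _ _)
  have hlim := shell_limit k hσ hh (isCompact_closedBall (0 : Eucl (m + 1)) (ρ0 + 1)) isOpen_univ
    (subset_univ _) hχ0 hχc.continuousOn
  have hev : ∀ᶠ ε : ℝ in 𝓝[>] 0, ∫ x, χ x * (-deriv Th (rt k σ h x / ε) / ε) ≤
      (∫ y, χ (ins k (h y) y)) + 1 :=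
    hlim.eventually (Iic_mem_nhds (by linarith))
  have hχi : ∀ ε : ℝ, Integrable fun x => χ x * (-deriv Th (rt k σ h x / ε) / ε) := fun ε =>
    (hχc.mul (hwc ε)).integrable_of_hasCompactSupport
      (HasCompactSupport.intro (isCompact_closedBall (0 : Eucl (m + 1)) (ρ0 + 1)) fun x hx => by
        simp only [Pi.mul_apply]; rw [hχ0 x hx, zero_mul])
  refine tendsto_integral_filter_of_dominated_convergence
    (fun _ => (∫ y, χ (ins k (h y) y)) + 1)
    (Filter.mem_of_superset self_mem_nhdsWithin fun ε hε => (hI ε hε).aestronglyMeasurable)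
    ?_ (integrable_const _) ?_
  · filter_upwards [hev, self_mem_nhdsWithin] with ε h1 hε
    filter_upwards [ae_restrict_mem measurableSet_Ioo] with t ht
    refine (norm_integral_le_of_norm_le (hχi ε) (Filter.Eventually.of_forall fun x => ?_)).trans h1
    rw [norm_mul, Real.norm_of_nonneg (hwn ε hε x)]
    by_cases hx : x ∈ K0
    · rcases le_or_gt (rt k σ h x) 0 with h2 | h2
      · refine mul_le_mul_of_nonneg_right ?_ (hwn ε hε x)
        refine (hM t ht x hx h2).trans ((le_abs_self M).trans ?_)
        have h3 := hρ0 hx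
        rw [Metric.mem_closedBall, dist_zero_right] at h3
        exact le_mul_of_one_le_right (abs_nonneg _) (le_max_of_le_right (by linarith))
      · rw [hw0 ε hε x h2, mul_zero, mul_zero]
    · rw [hf0 t x hx, norm_zero, zero_mul]
      exact mul_nonneg (hχn x) (hwn ε hε x)
  · filter_upwards [ae_restrict_mem measurableSet_Ioo] with t ht
    exact shell_limit k hσ hh hK0 hU hKU (hf0 t) (slice_cont_right hfc ht)

end shelltime

lemma wflx_le (c : Coef n) {P b : Eucl n → ℝ} (hP : ContDiff ℝ 2 P) (hb : ContDiff ℝ 1 b)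
    {K : Set (Eucl n)} (hK : IsCompact K) (R : ℝ) {T : ℝ} (hT : 0 < T) :
    ∃ C : ℝ, 0 < C ∧ ∀ s : ℝ, 1 ≤ s → ∀ u ut : ℝ → Eucl n → ℝ, ∀ t ∈ Ioo 0 T, ∀ x ∈ K,
      ‖c.wflx T s R P b u ut t x‖ ≤ C * wden T s R P u ut t x := by
  obtain ⟨Cf, hCf, Hf⟩ := flx_le c hP hb hK R (T ^ 2 / 4) T (by positivity) hT
  refine ⟨Cf, hCf, fun s hs1 u ut t ht x hx => ?_⟩
  obtain ⟨_, b2, _, b4, _, b6⟩ := sS_bounds hs1 ht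
  have e1 := (Hf _ _ b2 b4 x hx (u t x) (gradient (u t) x) (ut t x)).1
  unfold Coef.wflx
  rw [norm_smul, Real.norm_eq_abs, abs_of_nonneg (sq_nonneg _)]
  calc _ ≤ cex (s * sg T t) R P x ^ 2 * (Cf * den (s * sg T t) (s * sg1 T t) R P x (u t x)
        (gradient (u t) x) (ut t x)) := by gcongr
    _ = Cf * wden T s R P u ut t x := by unfold wden; ring

section bdry
variable {m : ℕ}

lemma rt_contDiff (k : Fin (m + 1)) (σ : ℝ) {h : (Fin m → ℝ) → ℝ} {N : WithTop ℕ∞}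
    (hh : ContDiff ℝ N h) : ContDiff ℝ N (rt k σ h) := by
  unfold rt dr
  have h1 : ∀ j : Fin (m + 1), ContDiff ℝ N fun x : Eucl (m + 1) => x j := fun j =>
    (EuclideanSpace.proj (𝕜 := ℝ) j).contDiff
  exact contDiff_const.mul ((h1 k).sub (hh.comp (contDiff_pi.2 fun i => h1 _)))

lemma shell_x_int (k : Fin (m + 1)) {σ : ℝ} {h : (Fin m → ℝ) → ℝ}
    (hh : Continuous h) {f : Eucl (m + 1) → ℝ} {K0 U : Set (Eucl (m + 1))}
    (hK0 : IsCompact K0) (hKU : K0 ⊆ U) (hf0 : ∀ x ∉ K0, f x = 0)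
    (hfc : ContinuousOn f {x | x ∈ U ∧ rt k σ h x ≤ 0})
    {w : Eucl (m + 1) → ℝ} (hw : Continuous w) (hw0 : ∀ x, 0 < rt k σ h x → w x = 0) :
    Integrable (fun x => f x * w x) := by
  have hrt := rt_cont k σ hh
  have hK1c : IsCompact (K0 ∩ {x | rt k σ h x ≤ 0}) :=
    hK0.inter_right (isClosed_le hrt continuous_const)
  have h1 : IntegrableOn (fun x => f x * w x) (K0 ∩ {x | rt k σ h x ≤ 0}) :=
    ((hfc.mono fun x hx => ⟨hKU hx.1, hx.2⟩).mul hw.continuousOn).integrableOn_compact hK1c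
  rw [← integrableOn_univ]
  refine h1.of_forall_sdiff_eq_zero MeasurableSet.univ fun x hx => ?_
  by_cases h0 : x ∈ K0
  · rw [hw0 x (not_le.1 fun h1 => hx.2 ⟨h0, h1⟩), mul_zero]
  · rw [hf0 x h0, zero_mul]

theorem carleman_bdry (c : Coef (m + 1)) {P b : Eucl (m + 1) → ℝ} (hP : ContDiff ℝ 2 P)
    (hb : ContDiff ℝ 1 b)
    {K : Set (Eucl (m + 1))} (hK : IsCompact K) {c0 : ℝ} (hc0 : 0 < c0) (hPC : c.PC P b K c0)
    {T : ℝ} (hT : 0 < T) {R r : ℝ} (hr : 0 < r) (hR : ∀ x ∈ K, P x ≤ R - r) :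
    ∃ s0 : ℝ, 1 ≤ s0 ∧ ∃ c' : ℝ, 0 < c' ∧ ∀ s : ℝ, s0 ≤ s →
      ∀ B : Set (Eucl (m + 1)), IsOpen B → Bornology.IsBounded B →
      ∀ u ut : ℝ → Eucl (m + 1) → ℝ, CSol c T B u ut →
      ∀ (k : Fin (m + 1)) (σ : ℝ) (h : (Fin m → ℝ) → ℝ) (U : Set (Eucl (m + 1))),
      σ * σ = 1 → ContDiff ℝ 2 h → IsOpen U → (∀ x ∈ U, rt k σ h x < 0 → x ∈ B) →
      (∀ x ∈ U, rt k σ h x ≤ 0 → x ∈ closure B) →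
      ∀ ζ : Eucl (m + 1) → ℝ, ContDiff ℝ 1 ζ → HasCompactSupport ζ → tsupport ζ ⊆ U →
      tsupport ζ ⊆ K → (∀ x, 0 ≤ ζ x) →
      c' * (∫ t in Ioo 0 T, ∫ x in {x | rt k σ h x < 0}, ζ x * (c.ω x * wden T s R P u ut t x)) +
        (∫ t in Ioo 0 T, ∫ y, ζ (ins k (h y) y) *
          fderiv ℝ (rt k σ h) (ins k (h y) y) (c.wflx T s R P b u ut t (ins k (h y) y))) ≤
        ∫ t in Ioo 0 T, ∫ x in {x | rt k σ h x < 0},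
          fderiv ℝ ζ x (c.wflx T s R P b u ut t x) := by
  obtain ⟨s0, hs0, c', hc', H⟩ := carleman c hP hb hK hc0 hPC hT hr hR
  obtain ⟨Cf, hCf, Hf⟩ := wflx_le c hP hb hK R hT
  refine ⟨s0, hs0, c', hc', fun s hs B hB hBb u ut hsol k σ h U hσ hh hU hUB hUc ζ ζ1 ζ2 ζ3 ζ4 ζ5 =>
    ?_⟩
  have hs1 : 1 ≤ s := hs0.trans hs
  have hsp : 0 < s := by linarith
  obtain ⟨M, hM, hM1, hM2⟩ := wden_bdd hP hK hT hr hR hs1 hBb hsol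
  obtain ⟨Mη, hMη, bη⟩ := exists_bound_on ζ2 ζ1.continuous.continuousOn
  obtain ⟨Mω, hMω, bω⟩ := exists_bound_on ζ2 c.hω.continuous.continuousOn
  obtain ⟨Mf, hMf, bf⟩ := exists_bound_on ζ2 (ζ1.continuous_fderiv one_ne_zero).norm.continuousOn
  have hrt1 : ContDiff ℝ 1 (rt k σ h) := (rt_contDiff k σ hh).of_le one_le_two
  obtain ⟨Mr, hMr, br⟩ := exists_bound_on ζ2 (hrt1.continuous_fderiv one_ne_zero).norm.continuousOn
  have hfz : ∀ x ∉ tsupport ζ, fderiv ℝ ζ x = 0 := fun x hx => by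
    rw [(notMem_tsupport_iff_eventuallyEq.1 hx).fderiv_eq]; simp
  have hsub : Ioo 0 T ×ˢ {x | x ∈ U ∧ rt k σ h x ≤ 0} ⊆ Ioo 0 T ×ˢ closure B :=
    prod_mono subset_rfl fun x hx => hUc x hx.1 hx.2
  have hKc : ∀ x ∈ tsupport ζ, rt k σ h x ≤ 0 → x ∈ K ∩ closure B := fun x hx h0 =>
    ⟨ζ4 hx, hUc x (ζ3 hx) h0⟩
  have hwf : ∀ t ∈ Ioo 0 T, ∀ x ∈ tsupport ζ, rt k σ h x ≤ 0 →
      ‖c.wflx T s R P b u ut t x‖ ≤ Cf * M := fun t ht x hx h0 =>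
    (Hf s hs1 u ut t ht x (ζ4 hx)).trans
      (mul_le_mul_of_nonneg_left (hM2 t ht x (hKc x hx h0)) hCf.le)
  have cwf := (cont_wflx hsol s R hP hb).mono hsub
  have hhc := hh.continuous
  set f1 : ℝ → Eucl (m + 1) → ℝ := fun t x => ζ x * (c.ω x * wden T s R P u ut t x) with hf1
  set f2 : ℝ → Eucl (m + 1) → ℝ := fun t x => fderiv ℝ ζ x (c.wflx T s R P b u ut t x) with hf2
  set f3 : ℝ → Eucl (m + 1) → ℝ := fun t x =>
    ζ x * fderiv ℝ (rt k σ h) x (c.wflx T s R P b u ut t x) with hf3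
  have z1 : ∀ t, ∀ x ∉ tsupport ζ, f1 t x = 0 := fun t x hx => by
    simp only [hf1]; rw [image_eq_zero_of_notMem_tsupport hx, zero_mul]
  have z2 : ∀ t, ∀ x ∉ tsupport ζ, f2 t x = 0 := fun t x hx => by
    simp only [hf2]; rw [hfz x hx]; rfl
  have z3 : ∀ t, ∀ x ∉ tsupport ζ, f3 t x = 0 := fun t x hx => by
    simp only [hf3]; rw [image_eq_zero_of_notMem_tsupport hx, zero_mul]
  have c1 : ContinuousOn (fun q : ℝ × Eucl (m + 1) => f1 q.1 q.2)
      (Ioo 0 T ×ˢ {x | x ∈ U ∧ rt k σ h x ≤ 0}) :=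
    (cont_snd ζ1.continuous _).mul ((cont_snd c.hω.continuous _).mul
        ((cont_wden hsol hsp R hP).mono hsub))
  have c2 : ContinuousOn (fun q : ℝ × Eucl (m + 1) => f2 q.1 q.2)
      (Ioo 0 T ×ˢ {x | x ∈ U ∧ rt k σ h x ≤ 0}) :=
    (cont_snd (ζ1.continuous_fderiv one_ne_zero) _).clm_apply cwf
  have c3 : ContinuousOn (fun q : ℝ × Eucl (m + 1) => f3 q.1 q.2)
      (Ioo 0 T ×ˢ {x | x ∈ U ∧ rt k σ h x ≤ 0}) :=
    (cont_snd ζ1.continuous _).mul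
      ((cont_snd (hrt1.continuous_fderiv one_ne_zero) _).clm_apply cwf)
  have b1 : ∀ t ∈ Ioo 0 T, ∀ x ∈ tsupport ζ, rt k σ h x ≤ 0 → |f1 t x| ≤ Mη * (Mω * M) := by
    intro t ht x hx h0
    simp only [hf1]
    rw [abs_mul, abs_mul, abs_of_nonneg (wden_nonneg hsp R ht x)]
    have := wden_nonneg (P := P) (u := u) (ut := ut) hsp R ht x
    gcongr
    exacts [bη x hx, bω x hx, hM2 t ht x (hKc x hx h0)]
  have b2 : ∀ t ∈ Ioo 0 T, ∀ x ∈ tsupport ζ, rt k σ h x ≤ 0 → |f2 t x| ≤ Mf * (Cf * M) := by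
    intro t ht x hx h0
    refine ((fderiv ℝ ζ x).le_opNorm _).trans ?_
    gcongr
    exacts [(le_abs_self _).trans (bf x hx), hwf t ht x hx h0]
  have b3 : ∀ t ∈ Ioo 0 T, ∀ x ∈ tsupport ζ, rt k σ h x ≤ 0 → |f3 t x| ≤ Mη * (Mr * (Cf * M)) := by
    intro t ht x hx h0
    simp only [hf3]
    rw [abs_mul]
    gcongr
    · exact bη x hx
    · refine ((fderiv ℝ (rt k σ h) x).le_opNorm _).trans ?_
      gcongr
      exacts [(le_abs_self _).trans (br x hx), hwf t ht x hx h0]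
  obtain ⟨i1, l1⟩ := shell_time1 k hhc ζ2 ζ3 z1 c1 b1
  obtain ⟨i2, l2⟩ := shell_time1 k hhc ζ2 ζ3 z2 c2 b2
  obtain ⟨i3, l3⟩ := shell_time2 k hσ hhc ζ2 hU ζ3 z3 c3 b3
  refine le_of_tendsto_of_tendsto ((l1.const_mul c').add l3) l2 ?_
  filter_upwards [self_mem_nhdsWithin] with ε hε
  have hε0 : (0 : ℝ) < ε := hε
  have hTc : ContDiff ℝ 1 fun x => Th (rt k σ h x / ε) :=
    (Th_contDiff.of_le one_le_two).comp (hrt1.div_const ε)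
  have hη : ContDiff ℝ 1 fun x => ζ x * Th (rt k σ h x / ε) := ζ1.mul hTc
  have hsup : tsupport (fun x => ζ x * Th (rt k σ h x / ε)) ⊆
      tsupport ζ ∩ {x | rt k σ h x ≤ -ε} := by
    refine closure_minimal ?_ ((isClosed_tsupport ζ).inter
      (isClosed_le (rt_cont k σ hhc) continuous_const))
    intro x hx
    refine ⟨?_, ?_⟩
    · by_contra h0
      exact hx (by simp only; rw [image_eq_zero_of_notMem_tsupport h0, zero_mul])
    · by_contra h0
      refine hx ?_
      simp only
      rw [Th_zero, mul_zero]
      rw [le_div_iff₀ hε0]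
      rw [mem_ofPred_eq, not_le] at h0
      linarith
  have key := H s hs B hB hBb u ut hsol (fun x => ζ x * Th (rt k σ h x / ε)) hη
    (HasCompactSupport.intro ζ2 fun x hx => by
      rw [image_eq_zero_of_notMem_tsupport hx, zero_mul])
    (fun x hx => hUB x (ζ3 (hsup hx).1) (lt_of_le_of_lt (hsup hx).2 (by linarith)))
    (fun x hx => ζ4 (hsup hx).1) (fun x => mul_nonneg (ζ5 x) (Th_nonneg _))
  have hw0 : ∀ x, 0 < rt k σ h x → Th (rt k σ h x / ε) = 0 := fun x hx =>
    Th_zero (by have : 0 < rt k σ h x / ε := by positivity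
                linarith)
  have hw1 : ∀ x, 0 < rt k σ h x → -deriv Th (rt k σ h x / ε) / ε = 0 := by
    intro x hx
    rw [Th_deriv_zero, neg_zero, zero_div]
    intro hm
    have : 0 < rt k σ h x / ε := by positivity
    linarith [hm.2]
  have hder : ∀ x v, fderiv ℝ (fun x => ζ x * Th (rt k σ h x / ε)) x v =
      fderiv ℝ ζ x v * Th (rt k σ h x / ε) -
        ζ x * fderiv ℝ (rt k σ h) x v * (-deriv Th (rt k σ h x / ε) / ε) := by
    intro x v
    have d1 := (ζ1.differentiable one_ne_zero x).hasFDerivAt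
    have d2 := (hrt1.differentiable one_ne_zero x).hasFDerivAt
    have d3 : HasDerivAt Th (deriv Th (rt k σ h x / ε)) (rt k σ h x / ε) :=
      ((Th_contDiff.differentiable two_ne_zero) _).hasDerivAt
    have d4 : HasFDerivAt (fun x => rt k σ h x / ε) (ε⁻¹ • fderiv ℝ (rt k σ h) x) x := by
      simpa only [div_eq_inv_mul] using d2.const_mul ε⁻¹
    have d5 := d1.mul (d3.comp_hasFDerivAt x d4)
    rw [show fderiv ℝ (fun x => ζ x * Th (rt k σ h x / ε)) x = _ from d5.fderiv]
    simp only [add_apply, smul_apply, smul_eq_mul, Function.comp]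
    field_simp
    ring
  have e1 : ∀ t, ∫ x, ζ x * Th (rt k σ h x / ε) * (c.ω x * wden T s R P u ut t x) =
      ∫ x, f1 t x * Th (rt k σ h x / ε) := fun t => by
    congr 1; ext x; simp only [hf1]; ring
  have e2 : ∀ t ∈ Ioo 0 T, ∫ x, fderiv ℝ (fun x => ζ x * Th (rt k σ h x / ε)) x
        (c.wflx T s R P b u ut t x) = (∫ x, f2 t x * Th (rt k σ h x / ε)) -
        ∫ x, f3 t x * (-deriv Th (rt k σ h x / ε) / ε) := by
    intro t ht
    have hwc : Continuous fun x => -deriv Th (rt k σ h x / ε) / ε :=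
      (Th_deriv_cont.comp ((rt_cont k σ hhc).div_const ε)).neg.div_const ε
    rw [← integral_sub
      (shell_x_int k hhc ζ2 ζ3 (z2 t) (slice_cont_right c2 ht) hTc.continuous hw0)
      (shell_x_int k hhc ζ2 ζ3 (z3 t) (slice_cont_right c3 ht) hwc hw1)]
    congr 1; ext x; rw [hder]
  rw [setIntegral_congr_fun measurableSet_Ioo e2, integral_sub (i2 ε hε0) (i3 ε hε0)] at key
  simp only [e1] at key
  linarith

end bdry

section iterated
variable {X : Type*} [MetricSpace X] [SecondCountableTopology X] [MeasurableSpace X] [BorelSpace X]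

/-- bounded continuous functions on `(0,T) × A` -/
def Gd (T : ℝ) (A : Set X) (f : ℝ → X → ℝ) : Prop :=
  ContinuousOn (fun q : ℝ × X => f q.1 q.2) (Ioo 0 T ×ˢ A) ∧
    ∃ M : ℝ, ∀ t ∈ Ioo 0 T, ∀ x ∈ A, |f t x| ≤ M

/-- iterated integral -/
def I2 (μ : Measure X) (T : ℝ) (A : Set X) (f : ℝ → X → ℝ) : ℝ :=
  ∫ t in Ioo 0 T, ∫ x in A, f t x ∂μ

variable {μ : Measure X} {T : ℝ} {A A' : Set X} {f g : ℝ → X → ℝ}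

lemma Gd.mono (h : Gd T A' f) (hA : A ⊆ A') : Gd T A f :=
  ⟨h.1.mono (prod_mono subset_rfl hA), h.2.imp fun _ hM t ht x hx => hM t ht x (hA hx)⟩

lemma Gd.add (hf : Gd T A f) (hg : Gd T A g) : Gd T A (fun t x => f t x + g t x) := by
  obtain ⟨c1, M1, h1⟩ := hf
  obtain ⟨c2, M2, h2⟩ := hg
  exact ⟨c1.add c2, M1 + M2, fun t ht x hx => (abs_add_le _ _).trans
    (add_le_add (h1 t ht x hx) (h2 t ht x hx))⟩

lemma Gd.mul (hf : Gd T A f) (hg : Gd T A g) : Gd T A (fun t x => f t x * g t x) := by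
  obtain ⟨c1, M1, h1⟩ := hf
  obtain ⟨c2, M2, h2⟩ := hg
  refine ⟨c1.mul c2, |M1| * |M2|, fun t ht x hx => ?_⟩
  rw [abs_mul]
  exact mul_le_mul ((h1 t ht x hx).trans (le_abs_self _)) ((h2 t ht x hx).trans (le_abs_self _))
    (abs_nonneg _) (abs_nonneg _)

lemma Gd.const_mul (hf : Gd T A f) (r : ℝ) : Gd T A (fun t x => r * f t x) :=
  Gd.mul (f := fun _ _ => r) ⟨continuousOn_const, |r|, fun _ _ _ _ => le_rfl⟩ hf

lemma Gd.of_le (hc : ContinuousOn (fun q : ℝ × X => f q.1 q.2) (Ioo 0 T ×ˢ A)) (hg : Gd T A g)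
    (h0 : ∀ t ∈ Ioo 0 T, ∀ x ∈ A, |f t x| ≤ g t x) : Gd T A f := by
  obtain ⟨_, M, hM⟩ := hg
  exact ⟨hc, M, fun t ht x hx => (h0 t ht x hx).trans ((le_abs_self _).trans (hM t ht x hx))⟩

lemma Gd.slice (hA : MeasurableSet A) (hA' : μ A ≠ ⊤) (hf : Gd T A f) {t : ℝ} (ht : t ∈ Ioo 0 T) :
    IntegrableOn (f t) A μ := by
  obtain ⟨c1, M1, h1⟩ := hf
  have c2 : ContinuousOn (f t) A :=
    c1.comp (f := fun x => (t, x)) (by fun_prop) fun x hx => ⟨ht, hx⟩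
  refine IntegrableOn.of_bound (C := M1) hA'.lt_top (c2.aestronglyMeasurable hA) ?_
  filter_upwards [ae_restrict_mem hA] with x hx using h1 t ht x hx

lemma Gd.time (hA : MeasurableSet A) (hA' : μ A ≠ ⊤) (hf : Gd T A f) :
    IntegrableOn (fun t => ∫ x in A, f t x ∂μ) (Ioo 0 T) := by
  obtain ⟨c1, M, h1⟩ := hf
  have hm : MeasurableSet (Ioo 0 T ×ˢ A) := measurableSet_Ioo.prod hA
  haveI : IsFiniteMeasure (μ.restrict A) := ⟨by simpa using hA'.lt_top⟩
  classical
  have hmeas : Measurable ((Ioo 0 T ×ˢ A).indicator fun q : ℝ × X => f q.1 q.2) := by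
    have : ((Ioo 0 T ×ˢ A).indicator fun q : ℝ × X => f q.1 q.2) =
      (Ioo 0 T ×ˢ A).piecewise (fun q : ℝ × X => f q.1 q.2) (fun _ => 0) := by
      ext q; simp [indicator, piecewise]
    rw [this]
    exact c1.measurable_piecewise continuousOn_const hm
  have h2 : Integrable ((Ioo 0 T ×ˢ A).indicator fun q : ℝ × X => f q.1 q.2)
      ((volume.restrict (Ioo 0 T)).prod (μ.restrict A)) := by
    refine Integrable.of_bound hmeas.aestronglyMeasurable |M| (Filter.Eventually.of_forall fun q => ?_)
    by_cases hq : q ∈ Ioo 0 T ×ˢ A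
    · rw [indicator_of_mem hq]
      exact (h1 _ hq.1 _ hq.2).trans (le_abs_self _)
    · rw [indicator_of_notMem hq, norm_zero]; exact abs_nonneg _
  have h3 := h2.integral_prod_left
  have h4 : IntegrableOn (fun t => ∫ x in A, (Ioo 0 T ×ˢ A).indicator
    (fun q : ℝ × X => f q.1 q.2) (t, x) ∂μ) (Ioo 0 T) := h3
  refine h4.congr_fun (fun t ht => ?_) measurableSet_Ioo
  refine setIntegral_congr_fun hA fun x hx => ?_
  exact indicator_of_mem (show (t, x) ∈ Ioo 0 T ×ˢ A from ⟨ht, hx⟩) _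

lemma I2_mono (hA : MeasurableSet A) (hA' : μ A ≠ ⊤) (hf : Gd T A f) (hg : Gd T A g)
    (h : ∀ t ∈ Ioo 0 T, ∀ x ∈ A, f t x ≤ g t x) : I2 μ T A f ≤ I2 μ T A g :=
  setIntegral_mono_on (hf.time hA hA') (hg.time hA hA') measurableSet_Ioo fun t ht =>
    setIntegral_mono_on (hf.slice hA hA' ht) (hg.slice hA hA' ht) hA fun x hx => h t ht x hx

lemma I2_congr (hA : MeasurableSet A)
    (h : ∀ t ∈ Ioo 0 T, ∀ x ∈ A, f t x = g t x) : I2 μ T A f = I2 μ T A g :=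
  setIntegral_congr_fun measurableSet_Ioo fun t ht =>
    setIntegral_congr_fun hA fun x hx => h t ht x hx

lemma I2_nonneg (hA : MeasurableSet A) (h : ∀ t ∈ Ioo 0 T, ∀ x ∈ A, 0 ≤ f t x) :
    0 ≤ I2 μ T A f :=
  setIntegral_nonneg measurableSet_Ioo fun t ht => setIntegral_nonneg hA fun x hx => h t ht x hx

lemma I2_set_mono (hA : MeasurableSet A) (hB : MeasurableSet A') (hB' : μ A' ≠ ⊤) (hAB : A ⊆ A')
    (hf : Gd T A' f) (h : ∀ t ∈ Ioo 0 T, ∀ x ∈ A', 0 ≤ f t x) : I2 μ T A f ≤ I2 μ T A' f :=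
  setIntegral_mono_on ((hf.mono hAB).time hA (ne_top_of_le_ne_top hB' (measure_mono hAB)))
    (hf.time hB hB') measurableSet_Ioo fun t ht =>
    setIntegral_mono_set (hf.slice hB hB' ht)
      (by filter_upwards [ae_restrict_mem hB] with x hx using h t ht x hx)
      (Filter.Eventually.of_forall hAB)

lemma I2_union_le (hA : MeasurableSet A) (hB : MeasurableSet A') (hA' : μ A ≠ ⊤) (hB' : μ A' ≠ ⊤)
    (hf : Gd T (A ∪ A') f) (h : ∀ t ∈ Ioo 0 T, ∀ x ∈ A ∪ A', 0 ≤ f t x) :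
    I2 μ T (A ∪ A') f ≤ I2 μ T A f + I2 μ T A' f := by
  have hf1 := hf.mono subset_union_left
  have hf2 := hf.mono subset_union_right
  unfold I2
  rw [← integral_add (hf1.time hA hA') (hf2.time hB hB')]
  refine setIntegral_mono_on (hf.time (hA.union hB) (measure_union_ne_top hA' hB'))
    ((hf1.time hA hA').add (hf2.time hB hB')) measurableSet_Ioo fun t ht => ?_
  have e : A ∪ A' = A ∪ (A' \ A) := union_sdiff_self.symm
  rw [e, setIntegral_union disjoint_sdiff_right (hB.diff hA) (hf1.slice hA hA' ht)
    ((hf2.slice hB hB' ht).mono_set sdiff_subset)]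
  refine add_le_add le_rfl (setIntegral_mono_set (hf2.slice hB hB' ht)
      (by filter_upwards [ae_restrict_mem hB] with x hx using h t ht x (Or.inr hx))
      (Filter.Eventually.of_forall sdiff_subset))

lemma I2_const_mul (r : ℝ) : I2 μ T A (fun t x => r * f t x) = r * I2 μ T A f := by
  unfold I2
  simp only [integral_const_mul]

lemma I2_add (hA : MeasurableSet A) (hA' : μ A ≠ ⊤) (hf : Gd T A f) (hg : Gd T A g) :
    I2 μ T A (fun t x => f t x + g t x) = I2 μ T A f + I2 μ T A g := by
  unfold I2
  rw [← integral_add (hf.time hA hA') (hg.time hA hA')]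
  refine setIntegral_congr_fun measurableSet_Ioo fun t ht => ?_
  exact integral_add (hf.slice hA hA' ht) (hg.slice hA hA' ht)

end iterated

/-- weighted density -/
def nden (T a : ℝ) (u ut : ℝ → Eucl n → ℝ) (t : ℝ) (x : Eucl n) : ℝ :=
  Real.exp (-(2 * a * sg T t)) * dd (u t x) (gradient (u t) x) (ut t x)

/-- weighted norm -/
def NN (T : ℝ) (u ut : ℝ → Eucl n → ℝ) (A : Set (Eucl n)) (a : ℝ) : ℝ :=
  I2 volume T A (nden T a u ut)

lemma nden_nonneg (T a : ℝ) (u ut : ℝ → Eucl n → ℝ) (t : ℝ) (x : Eucl n) :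
    0 ≤ nden T a u ut t x := mul_nonneg (Real.exp_pos _).le (dd_nonneg _ _ _)

lemma nden_gd {c : Coef n} {T : ℝ} {B : Set (Eucl n)} {u ut : ℝ → Eucl n → ℝ}
    (h : CSol c T B u ut) (hB : Bornology.IsBounded B) {a : ℝ} (ha : 0 ≤ a) :
    Gd T (closure B) (nden T a u ut) := by
  obtain ⟨M, hM, hb⟩ := h.bdd hB
  have hs : ContinuousOn (fun q : ℝ × Eucl n => sg T q.1) (Ioo 0 T ×ˢ closure B) := by
    have := cont_sgS T 1 (closure B)
    simpa only [one_mul] using this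
  refine ⟨?_, M, fun t ht x hx => ?_⟩
  · unfold nden dd
    exact (Real.continuous_exp.comp_continuousOn (continuousOn_const.mul hs).neg).mul
      (((h.cu'.pow 2).add (h.cg'.norm.pow 2)).add (h.ct'.pow 2))
  · rw [abs_of_nonneg (nden_nonneg _ _ _ _ _ _)]
    unfold nden
    have h1 := hb t (Ioo_subset_Icc_self ht) x hx
    have h2 : Real.exp (-(2 * a * sg T t)) ≤ 1 := by
      rw [Real.exp_le_one_iff]
      have := (sg_pos ht).le
      have : 0 ≤ 2 * a * sg T t := by positivity
      linarith
    calc _ ≤ 1 * M := mul_le_mul h2 h1 (dd_nonneg _ _ _) zero_le_one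
      _ = M := one_mul M

lemma wden_gd {c : Coef n} {P : Eucl n → ℝ} (hP : ContDiff ℝ 2 P) {K : Set (Eucl n)}
    (hK : IsCompact K)
    {T : ℝ} (hT : 0 < T) {R r : ℝ} (hr : 0 < r) (hR : ∀ x ∈ K, P x ≤ R - r) {s : ℝ} (hs : 1 ≤ s)
    {B : Set (Eucl n)} (hB : Bornology.IsBounded B) {u ut : ℝ → Eucl n → ℝ}
    (h : CSol c T B u ut) : Gd T (K ∩ closure B) (wden T s R P u ut) := by
  obtain ⟨M, hM, _, h1⟩ := wden_bdd hP hK hT hr hR hs hB h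
  exact ⟨(cont_wden h (by linarith) R hP).mono (prod_mono subset_rfl inter_subset_right), M,
    fun t ht x hx => by
      rw [abs_of_nonneg (wden_nonneg (by linarith) R ht x)]; exact h1 t ht x hx⟩

lemma wden_up {P : Eucl n → ℝ} (hP : ContDiff ℝ 2 P) {K : Set (Eucl n)} (hK : IsCompact K)
    {T : ℝ} (hT : 0 < T) (R : ℝ) {δ : ℝ} (hδ : 0 < δ) :
    ∃ C : ℝ, 0 < C ∧ ∀ s : ℝ, 1 ≤ s → ∀ u ut : ℝ → Eucl n → ℝ,
      ∀ t ∈ Ioo 0 T, ∀ x ∈ K, ∀ p, P x ≤ p →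
        wden T s R P u ut t x ≤ C * nden T (s * (R - p - δ)) u ut t x := by
  obtain ⟨C, hC, h⟩ := wden_le_exp hP hK hT R
  refine ⟨C * (6 / (2 * δ) ^ 3), by positivity, fun s hs u ut t ht x hx p hp => ?_⟩
  obtain ⟨_, b2, _, b4, _, b6⟩ := sS_bounds hs ht
  have h1 := h s hs u ut t ht x hx
  have h2 := pow3_exp (2 * δ) (s * sg T t) (by positivity) b6.le
  refine h1.trans ?_
  unfold nden
  rw [← mul_assoc (C * (6 / (2 * δ) ^ 3))]
  refine mul_le_mul_of_nonneg_right ?_ (dd_nonneg _ _ _)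
  rw [mul_assoc C]
  refine mul_le_mul_of_nonneg_left ?_ hC.le
  have h3 : Real.exp (-(2 * (s * sg T t) * (R - P x))) ≤ Real.exp (-(2 * (s * sg T t) * (R - p))) := by
    rw [Real.exp_le_exp]
    have := mul_le_mul_of_nonneg_left hp b6.le
    nlinarith only [this]
  calc _ ≤ (6 / (2 * δ) ^ 3 * Real.exp (2 * δ * (s * sg T t))) *
        Real.exp (-(2 * (s * sg T t) * (R - p))) := by gcongr
    _ = _ := by
      rw [mul_assoc, ← Real.exp_add]
      congr 2
      ring

lemma wden_low {P : Eucl n → ℝ} (hP : ContDiff ℝ 2 P) {K : Set (Eucl n)} (hK : IsCompact K)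
    {T : ℝ} (hT : 0 < T) (R : ℝ) {δ : ℝ} (hδ : 0 < δ) :
    ∃ C : ℝ, 0 < C ∧ ∀ s : ℝ, 1 ≤ s → ∀ u ut : ℝ → Eucl n → ℝ,
      ∀ t ∈ Ioo 0 T, ∀ x ∈ K, ∀ p, p ≤ P x →
        nden T (s * (R - p + δ)) u ut t x ≤ C * wden T s R P u ut t x := by
  obtain ⟨C, hC, h⟩ := den_ge hP hK R (T ^ 2 / 4) T (by positivity) hT
  refine ⟨C / (2 * δ), by positivity, fun s hs u ut t ht x hx p hp => ?_⟩
  obtain ⟨_, b2, _, b4, _, b6⟩ := sS_bounds hs ht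
  have h1 := h _ _ b2 b4 x hx (u t x) (gradient (u t) x) (ut t x)
  have h0 := den_nonneg b6 (s * sg1 T t) R P x (u t x) (gradient (u t) x) (ut t x)
  set D := den (s * sg T t) (s * sg1 T t) R P x (u t x) (gradient (u t) x) (ut t x) with hD
  unfold nden wden cex
  rw [← hD]
  have h2 : 2 * δ * (s * sg T t) ≤ Real.exp (2 * δ * (s * sg T t)) := by
    have := Real.add_one_le_exp (2 * δ * (s * sg T t)); linarith
  have e1 : Real.exp (s * sg T t * (P x - R)) ^ 2 = Real.exp (2 * (s * sg T t) * (P x - R)) := by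
    rw [← Real.exp_nat_mul]; congr 1; push_cast; ring
  have e2 : Real.exp (-(2 * (s * (R - p + δ)) * sg T t)) * Real.exp (2 * δ * (s * sg T t)) ≤
      Real.exp (2 * (s * sg T t) * (P x - R)) := by
    rw [← Real.exp_add, Real.exp_le_exp]
    have := mul_le_mul_of_nonneg_left hp b6.le
    nlinarith only [this]
  calc _ ≤ Real.exp (-(2 * (s * (R - p + δ)) * sg T t)) * (C * (s * sg T t) * D) := by gcongr
    _ = C / (2 * δ) * (Real.exp (-(2 * (s * (R - p + δ)) * sg T t)) *
          (2 * δ * (s * sg T t)) * D) := by field_simp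
    _ ≤ C / (2 * δ) * (Real.exp (-(2 * (s * (R - p + δ)) * sg T t)) *
          Real.exp (2 * δ * (s * sg T t)) * D) := by gcongr
    _ ≤ C / (2 * δ) * (Real.exp (2 * (s * sg T t) * (P x - R)) * D) := by gcongr
    _ = _ := by rw [e1]

/-- the data of the propagation argument -/
structure Stp (n : ℕ) where
  c : Coef n
  T : ℝ
  hT : 0 < T
  B : Set (Eucl n)
  hB : IsOpen B
  hBb : Bornology.IsBounded B
  Adm : (ℝ → Eucl n → ℝ) → (ℝ → Eucl n → ℝ) → Prop
  En : (ℝ → Eucl n → ℝ) → (ℝ → Eucl n → ℝ) → ℝ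
  adm : ∀ u ut, Adm u ut → CSol c T B u ut
  en0 : ∀ u ut, Adm u ut → 0 ≤ En u ut

/-- control of the energy on `A` -/
def Stp.HH (Z : Stp n) (A : Set (Eucl n)) : Prop :=
  ∃ κ : ℝ, 1 < κ ∧ ∃ a0 : ℝ, 0 < a0 ∧ ∃ C0 : ℝ, 0 ≤ C0 ∧ ∀ a, a0 ≤ a → ∃ C1 : ℝ, 0 ≤ C1 ∧
    ∀ u ut, Z.Adm u ut → NN Z.T u ut A a ≤ C1 * Z.En u ut + C0 * NN Z.T u ut Z.B (κ * a)

section stp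
variable {Z : Stp n}

lemma Stp.vol_ne_top (Z : Stp n) {A : Set (Eucl n)} (hA : A ⊆ closure Z.B) : volume A ≠ ⊤ :=
  ne_top_of_le_ne_top Z.hBb.isCompact_closure.measure_ne_top (measure_mono hA)

lemma Stp.gd (Z : Stp n) {u ut : ℝ → Eucl n → ℝ} (h : Z.Adm u ut) {a : ℝ} (ha : 0 ≤ a)
    {A : Set (Eucl n)} (hA : A ⊆ closure Z.B) : Gd Z.T A (nden Z.T a u ut) :=
  (nden_gd (Z.adm _ _ h) Z.hBb ha).mono hA

lemma NN_nonneg {T : ℝ} {u ut : ℝ → Eucl n → ℝ} {A : Set (Eucl n)} (hA : MeasurableSet A) (a : ℝ) :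
    0 ≤ NN T u ut A a := I2_nonneg hA fun _ _ _ _ => nden_nonneg _ _ _ _ _ _

lemma Stp.NN_mono {u ut : ℝ → Eucl n → ℝ} (h : Z.Adm u ut) {a : ℝ} (ha : 0 ≤ a)
    {A A' : Set (Eucl n)} (hm : MeasurableSet A) (hm' : MeasurableSet A') (hA : A' ⊆ closure Z.B)
    (hAA : A ⊆ A') : NN Z.T u ut A a ≤ NN Z.T u ut A' a :=
  I2_set_mono hm hm' (Z.vol_ne_top hA) hAA (Z.gd h ha hA) fun _ _ _ _ => nden_nonneg _ _ _ _ _ _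

lemma Stp.NN_union {u ut : ℝ → Eucl n → ℝ} (h : Z.Adm u ut) {a : ℝ} (ha : 0 ≤ a)
    {A A' : Set (Eucl n)} (hm : MeasurableSet A) (hm' : MeasurableSet A') (hA : A ⊆ closure Z.B)
    (hA' : A' ⊆ closure Z.B) :
    NN Z.T u ut (A ∪ A') a ≤ NN Z.T u ut A a + NN Z.T u ut A' a :=
  I2_union_le hm hm' (Z.vol_ne_top hA) (Z.vol_ne_top hA') (Z.gd h ha (union_subset hA hA'))
    fun _ _ _ _ => nden_nonneg _ _ _ _ _ _

lemma Stp.NN_exp {u ut : ℝ → Eucl n → ℝ} (h : Z.Adm u ut) {a a' : ℝ} (ha : 0 ≤ a) (haa : a ≤ a')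
    {A : Set (Eucl n)} (hm : MeasurableSet A) (hA : A ⊆ closure Z.B) :
    NN Z.T u ut A a' ≤ Real.exp (-(2 * (a' - a) * (4 / Z.T ^ 2))) * NN Z.T u ut A a := by
  unfold NN
  rw [← I2_const_mul]
  refine I2_mono hm (Z.vol_ne_top hA) (Z.gd h (ha.trans haa) hA) ((Z.gd h ha hA).const_mul _) ?_
  intro t ht x hx
  unfold nden
  rw [← mul_assoc, ← Real.exp_add]
  refine mul_le_mul_of_nonneg_right ?_ (dd_nonneg _ _ _)
  rw [Real.exp_le_exp]
  have := mul_le_mul_of_nonneg_left (sg_lower ht) (sub_nonneg.2 haa)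
  nlinarith only [this]

lemma Stp.NN_anti {u ut : ℝ → Eucl n → ℝ} (h : Z.Adm u ut) {a a' : ℝ} (ha : 0 ≤ a) (haa : a ≤ a')
    {A : Set (Eucl n)} (hm : MeasurableSet A) (hA : A ⊆ closure Z.B) :
    NN Z.T u ut A a' ≤ NN Z.T u ut A a := by
  refine (Z.NN_exp h ha haa hm hA).trans (mul_le_of_le_one_left (NN_nonneg hm a) ?_)
  rw [Real.exp_le_one_iff]
  have := mul_nonneg (sub_nonneg.2 haa) (by positivity : (0 : ℝ) ≤ 4 / Z.T ^ 2)
  nlinarith only [this]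

lemma Stp.NN_B_anti {u ut : ℝ → Eucl n → ℝ} (h : Z.Adm u ut) {a a' : ℝ} (ha : 0 ≤ a) (haa : a ≤ a') :
    NN Z.T u ut Z.B a' ≤ NN Z.T u ut Z.B a :=
  Z.NN_anti h ha haa Z.hB.measurableSet subset_closure

lemma Stp.HH_empty (Z : Stp n) : Z.HH ∅ := by
  refine ⟨2, by norm_num, 1, one_pos, 0, le_rfl, fun a _ => ⟨0, le_rfl, fun u ut _ => ?_⟩⟩
  unfold NN I2
  simp

lemma Stp.HH_mono {A A' : Set (Eucl n)} (hm : MeasurableSet A) (hm' : MeasurableSet A')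
    (hA : A' ⊆ closure Z.B) (hAA : A ⊆ A') (h : Z.HH A') : Z.HH A := by
  obtain ⟨κ, hκ, a0, ha0, C0, hC0, h⟩ := h
  refine ⟨κ, hκ, a0, ha0, C0, hC0, fun a ha => ?_⟩
  obtain ⟨C1, hC1, h⟩ := h a ha
  exact ⟨C1, hC1, fun u ut hu =>
    (Z.NN_mono hu (ha0.le.trans ha) hm hm' hA hAA).trans (h u ut hu)⟩

lemma Stp.HH_union {A A' : Set (Eucl n)} (hm : MeasurableSet A) (hm' : MeasurableSet A')
    (hA : A ⊆ closure Z.B) (hA' : A' ⊆ closure Z.B) (h : Z.HH A) (h' : Z.HH A') :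
    Z.HH (A ∪ A') := by
  obtain ⟨κ, hκ, a0, ha0, C0, hC0, h⟩ := h
  obtain ⟨κ', hκ', a0', ha0', C0', hC0', h'⟩ := h'
  refine ⟨min κ κ', lt_min hκ hκ', max a0 a0', lt_max_of_lt_left ha0, C0 + C0', by positivity,
    fun a ha => ?_⟩
  obtain ⟨C1, hC1, h⟩ := h a ((le_max_left _ _).trans ha)
  obtain ⟨C1', hC1', h'⟩ := h' a ((le_max_right _ _).trans ha)
  have ha1 : 0 < a := ha0.trans_le ((le_max_left _ _).trans ha)
  refine ⟨C1 + C1', by positivity, fun u ut hu => ?_⟩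
  have hmin : 0 ≤ min κ κ' * a := mul_nonneg (le_min (by linarith) (by linarith)) ha1.le
  have e1 := Z.NN_B_anti hu hmin (mul_le_mul_of_nonneg_right (min_le_left κ κ') ha1.le)
  have e2 := Z.NN_B_anti hu hmin (mul_le_mul_of_nonneg_right (min_le_right κ κ') ha1.le)
  have e3 := Z.NN_union hu ha1.le hm hm' hA hA'
  have e4 := h u ut hu
  have e5 := h' u ut hu
  have e6 := mul_le_mul_of_nonneg_left e1 hC0
  have e7 := mul_le_mul_of_nonneg_left e2 hC0'
  linarith

/-- propagation of smallness -/
lemma Stp.HH_prop {P : Eucl n → ℝ} (hP : ContDiff ℝ 2 P) {K A Z1 Z2 : Set (Eucl n)}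
    (hK : IsCompact K) (mA : MeasurableSet A) (m1 : MeasurableSet Z1) (m2 : MeasurableSet Z2)
    (sA : A ⊆ K ∩ closure Z.B) (s1 : Z1 ⊆ K ∩ closure Z.B) (s2 : Z2 ⊆ K ∩ Z.B)
    {pin pout : ℝ} (hp : pout < pin) (hA : ∀ x ∈ A, pin ≤ P x) (h2 : ∀ x ∈ Z2, P x ≤ pout)
    (h1 : Z.HH Z1)
    (hcar : ∀ R r : ℝ, 0 < r → (∀ x ∈ K, P x ≤ R - r) → ∃ s0 : ℝ, 1 ≤ s0 ∧ ∃ C : ℝ, 0 ≤ C ∧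
      ∀ s, s0 ≤ s → ∃ Bd : ℝ, 0 ≤ Bd ∧ ∀ u ut, Z.Adm u ut →
        I2 volume Z.T A (wden Z.T s R P u ut) ≤ C * (I2 volume Z.T Z1 (wden Z.T s R P u ut) +
          I2 volume Z.T Z2 (wden Z.T s R P u ut)) + Bd * Z.En u ut) : Z.HH A := by
  obtain ⟨κ, hκ, a0, ha0, C0, hC0, h1⟩ := h1
  obtain ⟨pm, hpm0, hpm⟩ := exists_bound_on hK hP.continuous.continuousOn
  set δ := (pin - pout) / 4 with hδ
  have hδ0 : 0 < δ := by rw [hδ]; linarith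
  set D := |pm - pin| + 2 * δ with hD
  have hD0 : 0 < D := by positivity
  set κ' := (1 + κ) / 2 with hκ'
  set bb := D * (κ / (κ - κ') + 1) with hbb
  have hκκ : 0 < κ - κ' := by rw [hκ']; linarith
  have hbbD : D < bb := by
    rw [hbb]
    have : 0 < κ / (κ - κ') := by apply div_pos <;> linarith
    nlinarith only [this, hD0]
  have hbb0 : 0 < bb := hD0.trans hbbD
  have hκb : κ' * bb ≤ κ * (bb - D) := by
    have : (κ - κ') * bb ≥ κ * D := by
      rw [hbb]
      have e : (κ - κ') * (D * (κ / (κ - κ') + 1)) = κ * D + (κ - κ') * D := by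
        field_simp
      rw [e]
      have : 0 < (κ - κ') * D := by positivity
      linarith
    nlinarith only [this]
  set R := bb + pin - δ with hR
  have hRK : ∀ x ∈ K, P x ≤ R - δ := by
    intro x hx
    have e1 := (le_abs_self _).trans (hpm x hx)
    have e2 := le_abs_self (pm - pin)
    have e3 : bb > |pm - pin| + 2 * δ := hbbD
    rw [hR]; linarith
  obtain ⟨s0, hs0, C, hC, hcar⟩ := hcar R δ hδ0 hRK
  obtain ⟨Cu, hCu, hup⟩ := wden_up hP hK Z.hT R hδ0
  obtain ⟨Cl, hCl, hlow⟩ := wden_low hP hK Z.hT R hδ0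
  set κ'' := (bb + 2 * δ) / bb with hκ''
  have hk2 : 1 < κ'' := by rw [hκ'', one_lt_div hbb0]; linarith
  have hk1 : 1 < κ' := by rw [hκ']; linarith
  refine ⟨min κ' κ'', lt_min hk1 hk2, max (s0 * bb) (a0 * bb / (bb - D)), by positivity,
    Cl * (C * Cu) * (C0 + 1), by positivity, fun a ha => ?_⟩
  set s := a / bb with hs
  have hsb : s * bb = a := by rw [hs]; field_simp
  have hss0 : s0 ≤ s := by
    rw [hs, le_div_iff₀ hbb0]; exact (le_max_left _ _).trans ha
  have hs1 : 1 ≤ s := hs0.trans hss0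
  have ha0' : a0 ≤ s * (bb - D) := by
    have := (le_max_right _ _).trans ha
    rw [div_le_iff₀ (by linarith)] at this
    rw [hs, div_mul_eq_mul_div, le_div_iff₀ hbb0]
    exact this
  obtain ⟨Bd, hBd, hcar⟩ := hcar s hss0
  obtain ⟨C1, hC1, h1⟩ := h1 (s * (bb - D)) ha0'
  refine ⟨Cl * (C * Cu) * C1 + Cl * Bd, by positivity, fun u ut hu => ?_⟩
  have hsol := Z.adm _ _ hu
  have s0' : (0 : ℝ) ≤ s := by linarith
  have cA : A ⊆ closure Z.B := sA.trans inter_subset_right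
  have c1 : Z1 ⊆ closure Z.B := s1.trans inter_subset_right
  have c2 : Z2 ⊆ Z.B := s2.trans inter_subset_right
  have s2' : Z2 ⊆ K ∩ closure Z.B := fun x hx => ⟨(s2 hx).1, subset_closure (s2 hx).2⟩
  have gw := wden_gd hP hK Z.hT hδ0 hRK hs1 Z.hBb hsol
  have ha1 : 0 ≤ a := by rw [← hsb]; positivity
  have e1 : NN Z.T u ut A a ≤ Cl * I2 volume Z.T A (wden Z.T s R P u ut) := by
    unfold NN
    rw [← I2_const_mul]
    refine I2_mono mA (Z.vol_ne_top cA) (Z.gd hu ha1 cA) ((gw.mono sA).const_mul _) ?_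
    intro t ht x hx
    have := hlow s hs1 u ut t ht x (sA hx).1 pin (hA x hx)
    have e : s * (R - pin + δ) = a := by rw [← hsb, hR]; ring
    rwa [e] at this
  have q0 : 0 ≤ s * (bb - D) := ha0.le.trans ha0'
  have e2 : I2 volume Z.T Z1 (wden Z.T s R P u ut) ≤ Cu * NN Z.T u ut Z1 (s * (bb - D)) := by
    unfold NN
    rw [← I2_const_mul]
    refine I2_mono m1 (Z.vol_ne_top c1) (gw.mono s1) ((Z.gd hu q0 c1).const_mul _) ?_
    intro t ht x hx
    have := hup s hs1 u ut t ht x (s1 hx).1 (|pm - pin| + pin) (by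
      have e1 := (le_abs_self _).trans (hpm x (s1 hx).1)
      have e2 := le_abs_self (pm - pin)
      linarith)
    have e : s * (R - (|pm - pin| + pin) - δ) = s * (bb - D) := by rw [hR, hD]; ring
    rwa [e] at this
  have q1 : 0 ≤ s * (bb + 2 * δ) := by positivity
  have e3 : I2 volume Z.T Z2 (wden Z.T s R P u ut) ≤ Cu * NN Z.T u ut Z2 (s * (bb + 2 * δ)) := by
    unfold NN
    rw [← I2_const_mul]
    refine I2_mono m2 (Z.vol_ne_top (c2.trans subset_closure)) (gw.mono s2')
      ((Z.gd hu q1 (c2.trans subset_closure)).const_mul _) ?_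
    intro t ht x hx
    have := hup s hs1 u ut t ht x (s2 hx).1 pout (h2 x hx)
    have e : s * (R - pout - δ) = s * (bb + 2 * δ) := by rw [hR, hδ]; ring
    rwa [e] at this
  have e4 := h1 u ut hu
  have q2 : 0 ≤ min κ' κ'' * a := mul_nonneg (le_min (by linarith) (by linarith)) ha1
  have e5 : NN Z.T u ut Z.B (κ * (s * (bb - D))) ≤ NN Z.T u ut Z.B (min κ' κ'' * a) := by
    refine Z.NN_B_anti hu q2 ?_
    calc min κ' κ'' * a ≤ κ' * a := by gcongr; exact min_le_left _ _
      _ = s * (κ' * bb) := by rw [← hsb]; ring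
      _ ≤ s * (κ * (bb - D)) := by gcongr
      _ = _ := by ring
  have e6 : NN Z.T u ut Z2 (s * (bb + 2 * δ)) ≤ NN Z.T u ut Z.B (min κ' κ'' * a) := by
    refine (Z.NN_mono hu q1 m2 Z.hB.measurableSet subset_closure c2).trans (Z.NN_B_anti hu q2 ?_)
    calc min κ' κ'' * a ≤ κ'' * a := by gcongr; exact min_le_right _ _
      _ = _ := by rw [hκ'', ← hsb]; field_simp
  have e7 := hcar u ut hu
  have e8 := mul_le_mul_of_nonneg_left e5 hC0
  set NB := NN Z.T u ut Z.B (min κ' κ'' * a)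
  calc NN Z.T u ut A a ≤ Cl * I2 volume Z.T A (wden Z.T s R P u ut) := e1
    _ ≤ Cl * (C * (I2 volume Z.T Z1 (wden Z.T s R P u ut) +
          I2 volume Z.T Z2 (wden Z.T s R P u ut)) + Bd * Z.En u ut) := by gcongr
    _ ≤ Cl * (C * (Cu * (C1 * Z.En u ut + C0 * NB) + Cu * NB) + Bd * Z.En u ut) := by
        gcongr
        · exact e2.trans (mul_le_mul_of_nonneg_left (by linarith) hCu.le)
        · exact e3.trans (mul_le_mul_of_nonneg_left e6 hCu.le)
    _ = _ := by ring

end stp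

section cut
variable {c : Coef n} {P b : Eucl n → ℝ} {K G A Z1 Z2 B : Set (Eucl n)} {ζ : Eucl n → ℝ}

lemma cut_low (c : Coef n) (hP : ContDiff ℝ 2 P) (hK : IsCompact K) {T : ℝ} (hT : 0 < T)
    {R r : ℝ} (hr : 0 < r) (hR : ∀ x ∈ K, P x ≤ R - r)
    (hBb : Bornology.IsBounded B) (hζ : Continuous ζ) (hζc : HasCompactSupport ζ)
    (hζ0 : ∀ x, 0 ≤ ζ x) (hζK : tsupport ζ ⊆ K) (mG : MeasurableSet G)
    (hGK : tsupport ζ ∩ G ⊆ closure B) (mA : MeasurableSet A) (hAG : A ⊆ G)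
    (hA : ∀ x ∈ A, ζ x = 1) :
    ∃ ca : ℝ, 0 < ca ∧ ∀ s, 1 ≤ s → ∀ u ut, CSol c T B u ut →
      ca * I2 volume T A (wden T s R P u ut) ≤
        ∫ t in Ioo 0 T, ∫ x in G, ζ x * (c.ω x * wden T s R P u ut t x) := by
  obtain ⟨ca, hca, hω⟩ : ∃ ca : ℝ, 0 < ca ∧ ∀ x ∈ K, ca ≤ c.ω x := by
    rcases K.eq_empty_or_nonempty with he | hne
    · exact ⟨1, one_pos, by simp [he]⟩
    · obtain ⟨x0, hx0, h0⟩ := hK.exists_isMinOn hne c.hω.continuous.continuousOn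
      exact ⟨c.ω x0, c.ωpos x0, fun x hx => h0 hx⟩
  refine ⟨ca, hca, fun s hs u ut hsol => ?_⟩
  have gw := wden_gd hP hK hT hr hR hs hBb hsol
  have mt : MeasurableSet (tsupport ζ ∩ G) := (isClosed_tsupport ζ).measurableSet.inter mG
  have vt : volume (tsupport ζ ∩ G) ≠ ⊤ :=
    ne_top_of_le_ne_top hζc.isCompact.measure_ne_top (measure_mono inter_subset_left)
  have hsub : tsupport ζ ∩ G ⊆ K ∩ closure B := fun x hx => ⟨hζK hx.1, hGK hx⟩
  have hAs : A ⊆ tsupport ζ ∩ G := fun x hx =>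
    ⟨subset_tsupport ζ (by rw [Function.mem_support, hA x hx]; exact one_ne_zero), hAG hx⟩
  have e : ∀ t, ∫ x in G, ζ x * (c.ω x * wden T s R P u ut t x) =
      ∫ x in tsupport ζ ∩ G, ζ x * (c.ω x * wden T s R P u ut t x) := fun t =>
    setIntegral_eq_of_subset_of_forall_diff_eq_zero mG inter_subset_right fun x hx => by
      rw [image_eq_zero_of_notMem_tsupport fun h => hx.2 ⟨h, hx.1⟩, zero_mul]
  simp only [e]
  obtain ⟨Mζ, _, bζ⟩ := exists_bound_on hζc hζ.continuousOn
  obtain ⟨Mω, _, bω⟩ := exists_bound_on hζc c.hω.continuous.continuousOn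
  have g1 : Gd T (tsupport ζ ∩ G) (fun t x => ζ x * (c.ω x * wden T s R P u ut t x)) :=
    Gd.mul (f := fun _ x => ζ x) ⟨cont_snd hζ _, Mζ, fun t _ x hx => bζ x hx.1⟩
      (Gd.mul (f := fun _ x => c.ω x) ⟨cont_snd c.hω.continuous _, Mω, fun t _ x hx => bω x hx.1⟩
        (gw.mono hsub))
  have hw : ∀ t ∈ Ioo 0 T, ∀ x, 0 ≤ wden T s R P u ut t x := fun t ht x =>
    wden_nonneg (by linarith) R ht x
  have h1 : I2 volume T A (fun t x => ca * wden T s R P u ut t x) ≤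
      I2 volume T A (fun t x => ζ x * (c.ω x * wden T s R P u ut t x)) := by
    refine I2_mono mA (ne_top_of_le_ne_top vt (measure_mono hAs))
      ((gw.mono (hAs.trans hsub)).const_mul _) (g1.mono hAs) fun t ht x hx => ?_
    rw [hA x hx, one_mul]
    exact mul_le_mul_of_nonneg_right (hω x (hsub (hAs hx)).1) (hw t ht x)
  rw [I2_const_mul] at h1
  refine h1.trans (I2_set_mono mA mt vt hAs g1 fun t ht x hx => ?_)
  exact mul_nonneg (hζ0 x) (mul_nonneg (c.ωpos x).le (hw t ht x))

lemma cut_up (c : Coef n) (hP : ContDiff ℝ 2 P) (hb : ContDiff ℝ 1 b) (hK : IsCompact K) {T : ℝ}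
    (hT : 0 < T) {R r : ℝ} (hr : 0 < r) (hR : ∀ x ∈ K, P x ≤ R - r)
    (hBb : Bornology.IsBounded B) (hζ : ContDiff ℝ 1 ζ) (hζc : HasCompactSupport ζ)
    (mG : MeasurableSet G)
    (m1 : MeasurableSet Z1) (m2 : MeasurableSet Z2)
    (s1 : Z1 ⊆ K ∩ closure B) (s2 : Z2 ⊆ K ∩ closure B)
    (hZ : ∀ x ∈ G, fderiv ℝ ζ x ≠ 0 → x ∈ Z1 ∪ Z2) :
    ∃ Cz : ℝ, 0 < Cz ∧ ∀ s, 1 ≤ s → ∀ u ut, CSol c T B u ut →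
      (∫ t in Ioo 0 T, ∫ x in G, fderiv ℝ ζ x (c.wflx T s R P b u ut t x)) ≤
      Cz * (I2 volume T Z1 (wden T s R P u ut) + I2 volume T Z2 (wden T s R P u ut)) := by
  obtain ⟨Cf, hCf, Hf⟩ := wflx_le c hP hb hK R hT
  obtain ⟨Mf, hMf, bf⟩ := exists_bound_on hK (hζ.continuous_fderiv one_ne_zero).norm.continuousOn
  refine ⟨(Mf + 1) * Cf, by positivity, fun s hs u ut hsol => ?_⟩
  have gw := wden_gd hP hK hT hr hR hs hBb hsol
  have vK : ∀ D ⊆ K, volume D ≠ ⊤ := fun D hD =>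
    ne_top_of_le_ne_top hK.measure_ne_top (measure_mono hD)
  have s12 : Z1 ∪ Z2 ⊆ K ∩ closure B := union_subset s1 s2
  have hw : ∀ t ∈ Ioo 0 T, ∀ x, 0 ≤ wden T s R P u ut t x := fun t ht x =>
    wden_nonneg (by linarith) R ht x
  have e : ∀ t, ∫ x in G, fderiv ℝ ζ x (c.wflx T s R P b u ut t x) =
      ∫ x in (Z1 ∪ Z2) ∩ G, fderiv ℝ ζ x (c.wflx T s R P b u ut t x) := fun t =>
    setIntegral_eq_of_subset_of_forall_diff_eq_zero mG inter_subset_right fun x hx => by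
      have : fderiv ℝ ζ x = 0 := by
        by_contra h0
        exact hx.2 ⟨hZ x hx.1 h0, hx.1⟩
      rw [this]; rfl
  simp only [e]
  have mD : MeasurableSet ((Z1 ∪ Z2) ∩ G) := (m1.union m2).inter mG
  have sD : (Z1 ∪ Z2) ∩ G ⊆ K ∩ closure B := inter_subset_left.trans s12
  have hle : ∀ t ∈ Ioo 0 T, ∀ x ∈ (Z1 ∪ Z2) ∩ G,
      |fderiv ℝ ζ x (c.wflx T s R P b u ut t x)| ≤ (Mf + 1) * Cf * wden T s R P u ut t x := by
    intro t ht x hx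
    refine ((fderiv ℝ ζ x).le_opNorm _).trans ?_
    rw [mul_assoc]
    refine mul_le_mul ?_ (Hf s hs u ut t ht x (sD hx).1) (norm_nonneg _) (by positivity)
    have := (le_abs_self _).trans (bf x (sD hx).1)
    linarith
  have gD := (gw.mono sD).const_mul ((Mf + 1) * Cf)
  have g2 : Gd T ((Z1 ∪ Z2) ∩ G) (fun t x => fderiv ℝ ζ x (c.wflx T s R P b u ut t x)) :=
    Gd.of_le ((cont_snd (hζ.continuous_fderiv one_ne_zero) _).clm_apply
      ((cont_wflx hsol s R hP hb).mono (prod_mono subset_rfl (sD.trans inter_subset_right)))) gD hle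
  have h1 := I2_mono (μ := volume) mD (vK _ (sD.trans inter_subset_left)) g2 gD
    fun t ht x hx => (le_abs_self _).trans (hle t ht x hx)
  rw [I2_const_mul] at h1
  refine h1.trans (mul_le_mul_of_nonneg_left ?_ (by positivity))
  refine (I2_set_mono mD (m1.union m2) (vK _ (s12.trans inter_subset_left)) inter_subset_left
    (gw.mono s12) fun t ht x _ => hw t ht x).trans ?_
  exact I2_union_le m1 m2 (vK _ (s1.trans inter_subset_left)) (vK _ (s2.trans inter_subset_left))
    (gw.mono s12) fun t ht x _ => hw t ht x

end cut

lemma gradient_sqdist (y x : Eucl n) : gradient (fun x => -‖x - y‖ ^ 2) x = -((2 : ℝ) • (x - y)) := by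
  have h1 : HasGradientAt (fun x => -‖x - y‖ ^ 2) (-((2 : ℝ) • (x - y))) x := by
    rw [hasGradientAt_iff_hasFDerivAt]
    have := (((hasFDerivAt_id x).sub_const y).norm_sq).neg
    refine this.congr_fderiv ?_
    ext v
    simp [inner_sub_left, inner_smul_left]
  exact h1.gradient

section interior
variable {Z : Stp n}

lemma Stp.HH_interior {y : Eucl n} {r0 r1 r2 : ℝ} (h0 : 0 < r0) (h01 : r0 < r1) (h12 : r1 < r2)
    (hB : Metric.closedBall y r2 ⊆ Z.B) (h : Z.HH (Metric.ball y r0)) :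
    Z.HH (Metric.ball y r1) := by
  set K := Metric.closedBall y r2 \ Metric.ball y (r0 / 2) with hKdef
  have hK : IsCompact K := (isCompact_closedBall y r2).diff Metric.isOpen_ball
  have hψ : ContDiff ℝ 2 fun x : Eucl n => -‖x - y‖ ^ 2 :=
    ((contDiff_id.sub contDiff_const).norm_sq ℝ).neg
  have hg : ∀ x ∈ K, gradient (fun x => -‖x - y‖ ^ 2) x ≠ 0 := by
    intro x hx h0'
    rw [gradient_sqdist, neg_eq_zero, smul_eq_zero, sub_eq_zero] at h0'
    rcases h0' with h0' | h0'
    · norm_num at h0'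
    · refine hx.2 ?_
      rw [h0']; exact Metric.mem_ball_self (by positivity)
  obtain ⟨l, hl, b, hb, c0, hc0, hPC⟩ := exists_weight Z.c hψ hK hg
  set P : Eucl n → ℝ := fun x => Real.exp (l * -‖x - y‖ ^ 2) with hPdef
  have hP : ContDiff ℝ 2 P := Real.contDiff_exp.comp (contDiff_const.mul hψ)
  set ζ : Eucl n → ℝ := fun x => Real.smoothTransition ((‖x - y‖ ^ 2 - r0 ^ 2 / 4) / (r0 ^ 2 / 2)) *
    Real.smoothTransition ((r2 ^ 2 - ‖x - y‖ ^ 2) / ((r2 ^ 2 - r1 ^ 2) / 2)) with hζ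
  have hq : ContDiff ℝ 1 fun x : Eucl n => ‖x - y‖ ^ 2 :=
    (contDiff_id.sub contDiff_const).norm_sq ℝ
  have hζ1 : ContDiff ℝ 1 ζ :=
    (Real.smoothTransition.contDiff.comp ((hq.sub contDiff_const).div_const _)).mul
      (Real.smoothTransition.contDiff.comp ((contDiff_const.sub hq).div_const _))
  have h12' : 0 < (r2 ^ 2 - r1 ^ 2) / 2 := by nlinarith only [h12, h0, h01]
  have hr0 : 0 < r0 ^ 2 / 2 := by positivity
  have hsup : tsupport ζ ⊆ K := by
    refine closure_minimal ?_ hK.isClosed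
    intro x hx
    rw [Function.mem_support] at hx
    have := mul_ne_zero_iff.1 hx
    refine ⟨?_, ?_⟩
    · by_contra hc
      refine this.2 (Real.smoothTransition.zero_of_nonpos ?_)
      rw [Metric.mem_closedBall, dist_eq_norm, not_le] at hc
      refine div_nonpos_of_nonpos_of_nonneg ?_ h12'.le
      nlinarith only [hc, h0, h01, h12]
    · intro hc
      refine this.1 (Real.smoothTransition.zero_of_nonpos ?_)
      rw [Metric.mem_ball, dist_eq_norm] at hc
      refine div_nonpos_of_nonpos_of_nonneg ?_ hr0.le
      nlinarith only [hc, h0, norm_nonneg (x - y)]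
  have hζc : HasCompactSupport ζ := hK.of_isClosed_subset (isClosed_tsupport ζ) hsup
  set A := Metric.ball y r1 \ Metric.ball y r0 with hA
  set Z1 := Metric.ball y r0 ∩ K with hZ1
  set Z2 := {x | (r1 ^ 2 + r2 ^ 2) / 2 ≤ ‖x - y‖ ^ 2} ∩ K with hZ2
  have mA : MeasurableSet A := Metric.isOpen_ball.measurableSet.diff Metric.isOpen_ball.measurableSet
  have m1 : MeasurableSet Z1 := Metric.isOpen_ball.measurableSet.inter hK.measurableSet
  have m2 : MeasurableSet Z2 := (isClosed_le continuous_const hq.continuous).measurableSet.inter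
    hK.measurableSet
  have hKB : K ⊆ Z.B := diff_subset.trans hB
  have hKB' : K ⊆ K ∩ closure Z.B := fun x hx => ⟨hx, subset_closure (hKB hx)⟩
  have hAK : A ⊆ K := fun x hx => ⟨Metric.ball_subset_closedBall
    (Metric.ball_subset_ball h12.le hx.1), fun h => hx.2 (Metric.ball_subset_ball (by linarith) h)⟩
  have h1lt : ∀ x ∈ Metric.ball y r1, ‖x - y‖ ^ 2 < r1 ^ 2 := by
    intro x hx
    rw [Metric.mem_ball, dist_eq_norm] at hx
    nlinarith only [hx, norm_nonneg (x - y)]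
  have hζA : ∀ x ∈ A, ζ x = 1 := by
    intro x hx
    have e1 := h1lt x hx.1
    have e2 : r0 ≤ ‖x - y‖ := by
      have := hx.2; rw [Metric.mem_ball, dist_eq_norm, not_lt] at this; exact this
    simp only [hζ]
    rw [Real.smoothTransition.one_of_one_le, Real.smoothTransition.one_of_one_le, one_mul]
    · rw [le_div_iff₀ h12']; nlinarith only [e1, h12, h0, h01]
    · rw [le_div_iff₀ hr0]; nlinarith only [e2, h0]
  have hD : ∀ x ∈ (univ : Set (Eucl n)), fderiv ℝ ζ x ≠ 0 → x ∈ Z1 ∪ Z2 := by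
    intro x _ hx
    have hxK : x ∈ K := by
      by_contra hxK
      refine hx ?_
      rw [(notMem_tsupport_iff_eventuallyEq.1 fun h => hxK (hsup h)).fderiv_eq]; simp
    by_contra hc
    rw [mem_union, not_or] at hc
    refine hx ?_
    have e1 : r0 ≤ ‖x - y‖ := by
      by_contra h'
      exact hc.1 ⟨by rw [Metric.mem_ball, dist_eq_norm]; exact not_le.1 h', hxK⟩
    have e2 : ‖x - y‖ ^ 2 < (r1 ^ 2 + r2 ^ 2) / 2 := by
      by_contra h'
      exact hc.2 ⟨not_lt.1 h', hxK⟩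
    have : ζ =ᶠ[𝓝 x] fun _ => 1 := by
      have o1 : ∀ᶠ z in 𝓝 x, 3 * r0 ^ 2 / 4 < ‖z - y‖ ^ 2 :=
        hq.continuous.continuousAt.eventually (lt_mem_nhds (by nlinarith only [e1, h0]))
      have o2 : ∀ᶠ z in 𝓝 x, ‖z - y‖ ^ 2 < (r1 ^ 2 + r2 ^ 2) / 2 :=
        hq.continuous.continuousAt.eventually (gt_mem_nhds e2)
      filter_upwards [o1, o2] with z z1 z2
      simp only [hζ]
      rw [Real.smoothTransition.one_of_one_le, Real.smoothTransition.one_of_one_le, one_mul]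
      · rw [le_div_iff₀ h12']; linarith
      · rw [le_div_iff₀ hr0]; linarith
    rw [this.fderiv_eq]; simp
  have hζ0 : ∀ x, 0 ≤ ζ x := fun x =>
    mul_nonneg (Real.smoothTransition.nonneg _) (Real.smoothTransition.nonneg _)
  have hHA : Z.HH A := by
    refine Z.HH_prop hP hK mA m1 m2 (hAK.trans hKB') (inter_subset_right.trans hKB')
      (fun x hx => ⟨hx.2, hKB hx.2⟩) (pin := Real.exp (l * -r1 ^ 2))
      (pout := Real.exp (l * -((r1 ^ 2 + r2 ^ 2) / 2))) ?_ ?_ ?_ ?_ ?_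
    · rw [Real.exp_lt_exp]
      nlinarith only [mul_pos hl h12']
    · intro x hx
      rw [Real.exp_le_exp]
      have := h1lt x hx.1
      nlinarith only [mul_pos hl (sub_pos.2 this)]
    · intro x hx
      rw [Real.exp_le_exp]
      have := hx.1
      rw [mem_ofPred_eq] at this
      nlinarith only [mul_nonneg hl.le (sub_nonneg.2 this)]
    · exact Z.HH_mono m1 Metric.isOpen_ball.measurableSet
        ((Metric.ball_subset_closedBall.trans
          (Metric.closedBall_subset_closedBall (by linarith))).trans (hB.trans subset_closure))
        inter_subset_left h
    · intro R r hr hR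
      obtain ⟨s0, hs0, c', hc', H⟩ := carleman Z.c hP hb hK hc0 hPC Z.hT hr hR
      obtain ⟨ca, hca, Hlow⟩ := cut_low Z.c hP hK Z.hT hr hR Z.hBb hζ1.continuous hζc hζ0 hsup
        MeasurableSet.univ (fun x hx => subset_closure (hKB (hsup hx.1))) mA (subset_univ A) hζA
      obtain ⟨Cz, hCz, Hup⟩ := cut_up Z.c hP hb hK Z.hT hr hR Z.hBb hζ1 hζc MeasurableSet.univ m1 m2
        (inter_subset_right.trans hKB') (inter_subset_right.trans hKB') hD
      refine ⟨s0, hs0, Cz / (c' * ca), by positivity, fun s hs => ⟨0, le_rfl, fun u ut hu => ?_⟩⟩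
      have e1 := H s hs Z.B Z.hB Z.hBb u ut (Z.adm _ _ hu) ζ hζ1 hζc (hsup.trans hKB) hsup hζ0
      have e2 := Hlow s (hs0.trans hs) u ut (Z.adm _ _ hu)
      have e3 := Hup s (hs0.trans hs) u ut (Z.adm _ _ hu)
      simp only [Measure.restrict_univ] at e2 e3
      rw [zero_mul, add_zero, div_mul_eq_mul_div, le_div_iff₀ (by positivity)]
      have e4 := mul_le_mul_of_nonneg_left e2 hc'.le
      nlinarith only [e1, e3, e4]
  have hsubB : Metric.ball y r1 ⊆ closure Z.B := (Metric.ball_subset_closedBall.trans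
    (Metric.closedBall_subset_closedBall h12.le)).trans (hB.trans subset_closure)
  have := Z.HH_union mA Metric.isOpen_ball.measurableSet (diff_subset.trans hsubB)
    ((Metric.ball_subset_ball h01.le).trans hsubB) hHA h
  rwa [hA, diff_union_of_subset (Metric.ball_subset_ball h01.le)] at this

lemma Stp.HH_connected (hc : IsPreconnected Z.B) {x0 : Eucl n} {r0 : ℝ} (hr0 : 0 < r0)
    (hx0 : Metric.ball x0 r0 ⊆ Z.B) (h : Z.HH (Metric.ball x0 r0)) {x : Eucl n} (hx : x ∈ Z.B) :
    ∃ r > 0, Metric.ball x r ⊆ Z.B ∧ Z.HH (Metric.ball x r) := by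
  set W := {x | ∃ r > 0, Metric.ball x r ⊆ Z.B ∧ Z.HH (Metric.ball x r)} with hW
  have hWo : IsOpen W := by
    rw [Metric.isOpen_iff]
    rintro z ⟨r, hr, h1, h2⟩
    refine ⟨r, hr, fun y hy => ?_⟩
    have hs : Metric.ball y (r - dist y z) ⊆ Metric.ball z r :=
      Metric.ball_subset_ball' (by linarith)
    exact ⟨r - dist y z, by rw [Metric.mem_ball] at hy; linarith, hs.trans h1,
      Z.HH_mono Metric.isOpen_ball.measurableSet Metric.isOpen_ball.measurableSet
        (h1.trans subset_closure) hs h2⟩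
  refine hc.subset_of_closure_inter_subset hWo
    ⟨x0, hx0 (Metric.mem_ball_self hr0), r0, hr0, hx0, h⟩ ?_ hx
  rintro y ⟨hyW, hyB⟩
  obtain ⟨ρ, hρ, hball⟩ := Metric.isOpen_iff.1 Z.hB y hyB
  obtain ⟨z, ⟨r, hr, h1, h2⟩, hz⟩ := Metric.mem_closure_iff.1 hyW (ρ / 8) (by positivity)
  rw [dist_comm] at hz
  have k1 : Z.HH (Metric.ball z (min r (ρ / 8))) :=
    Z.HH_mono Metric.isOpen_ball.measurableSet Metric.isOpen_ball.measurableSet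
        (h1.trans subset_closure) (Metric.ball_subset_ball (min_le_left _ _)) h2
  have k2 := Z.HH_interior (r1 := ρ / 4) (r2 := ρ / 2) (lt_min hr (by positivity))
    (lt_of_le_of_lt (min_le_right _ _) (by linarith)) (by linarith)
    ((Metric.closedBall_subset_ball' (by linarith)).trans hball) k1
  have hs : Metric.ball y (ρ / 8) ⊆ Metric.ball z (ρ / 4) :=
    Metric.ball_subset_ball' (by rw [dist_comm]; linarith)
  refine ⟨ρ / 8, by positivity, (Metric.ball_subset_ball (by linarith)).trans hball, ?_⟩
  exact Z.HH_mono Metric.isOpen_ball.measurableSet Metric.isOpen_ball.measurableSet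
    ((Metric.ball_subset_ball' (by linarith)).trans (hball.trans subset_closure)) hs k2

lemma Stp.HH_compact {K : Set (Eucl n)} (hK : IsCompact K)
    (h : ∀ x ∈ K, ∃ U ∈ 𝓝 x, ∃ A, MeasurableSet A ∧ A ⊆ closure Z.B ∧ U ∩ K ⊆ A ∧ Z.HH A) :
    ∃ A, MeasurableSet A ∧ A ⊆ closure Z.B ∧ K ⊆ A ∧ Z.HH A := by
  have := hK.induction_on (p := fun s => ∃ A, MeasurableSet A ∧ A ⊆ closure Z.B ∧ s ⊆ A ∧ Z.HH A)
    ⟨∅, MeasurableSet.empty, empty_subset _, subset_rfl, Z.HH_empty⟩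
    (fun s t hst ⟨A, h1, h2, h3, h4⟩ => ⟨A, h1, h2, hst.trans h3, h4⟩)
    (fun s t ⟨A, h1, h2, h3, h4⟩ ⟨A', h1', h2', h3', h4'⟩ => ⟨A ∪ A', h1.union h1',
      union_subset h2 h2', union_subset_union h3 h3', Z.HH_union h1 h1' h2 h2' h4 h4'⟩)
    (fun x hx => by
      obtain ⟨U, hU, A, h1, h2, h3, h4⟩ := h x hx
      exact ⟨U ∩ K, Filter.inter_mem (mem_nhdsWithin_of_mem_nhds hU) self_mem_nhdsWithin,
        A, h1, h2, h3, h4⟩)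
  exact this

end interior

/-! ### Boundary algebra -/

lemma prod_close {a a' b b' e1 e2 A B : ℝ} (h1 : |a - a'| ≤ e1) (h2 : |b - b'| ≤ e2)
    (hA : |a'| ≤ A) (hB : |b| ≤ B) : |a * b - a' * b'| ≤ e1 * B + A * e2 := by
  have : a * b - a' * b' = (a - a') * b + a' * (b - b') := by ring
  rw [this]
  refine (abs_add_le _ _).trans ?_
  rw [abs_mul, abs_mul]
  exact add_le_add (mul_le_mul h1 hB (abs_nonneg _) ((abs_nonneg _).trans h1))
    (mul_le_mul hA h2 (abs_nonneg _) ((abs_nonneg _).trans hA))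

lemma bdry_real {b0 η H μ Y n0 a d f g q p1 p2 : ℝ} (hb0 : 1 ≤ b0)
    (hη : 0 ≤ η) (hη1 : η ≤ 1) (hn : |n0| ≤ b0) (hH : 0 ≤ H)
    (hμ : |μ| ≤ H) (hY : |Y| ≤ H) (ha : |a - μ * n0| ≤ η * H) (hd : |d - μ * n0| ≤ η * H)
    (hf : |f - μ ^ 2 * n0| ≤ η * H ^ 2) (hg : |g - n0| ≤ η) (hq : |q - n0| ≤ η)
    (hp1 : |p1| ≤ η * H) (hp2 : |p2| ≤ η * H) :
    2 * n0 ^ 2 * (μ ^ 2 + Y ^ 2) - 40 * b0 * η * H ^ 2 ≤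
      4 * d * a - 2 * p1 * a - (2 * f - 2 * q * Y ^ 2) * g - 2 * p2 * a := by
  have hμn : |μ * n0| ≤ b0 * H := by
    rw [abs_mul, mul_comm]; exact mul_le_mul hn hμ (abs_nonneg _) (by linarith)
  have hηH : η * H ≤ b0 * H := mul_le_mul_of_nonneg_right (by linarith) hH
  have hab : |a| ≤ 2 * b0 * H := by
    have := abs_sub_abs_le_abs_sub a (μ * n0); linarith
  have hgb : |g| ≤ 2 * b0 := by
    have := abs_sub_abs_le_abs_sub g n0; linarith
  have hμ2 : μ ^ 2 ≤ H ^ 2 := by rw [← sq_abs μ]; exact pow_le_pow_left₀ (abs_nonneg _) hμ 2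
  have hY2 : Y ^ 2 ≤ H ^ 2 := by rw [← sq_abs Y]; exact pow_le_pow_left₀ (abs_nonneg _) hY 2
  have e1 := abs_le.1 (prod_close hd ha hμn hab)
  have hμ2n : |μ ^ 2 * n0| ≤ b0 * H ^ 2 := by
    rw [abs_mul, mul_comm, abs_of_nonneg (sq_nonneg μ)]
    exact mul_le_mul hn hμ2 (sq_nonneg _) (by linarith)
  have e2 := abs_le.1 (prod_close hf hg hμ2n hgb)
  have e3 := abs_le.1 (prod_close hq hg hn hgb)
  have e3' : (n0 * n0 - (η * (2 * b0) + b0 * η)) * Y ^ 2 ≤ q * g * Y ^ 2 :=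
    mul_le_mul_of_nonneg_right (by linarith [e3.1]) (sq_nonneg _)
  have e3'' : b0 * η * Y ^ 2 ≤ b0 * η * H ^ 2 :=
    mul_le_mul_of_nonneg_left hY2 (by positivity)
  have e4 : |p1 * a| ≤ η * H * (2 * b0 * H) := by
    rw [abs_mul]; exact mul_le_mul hp1 hab (abs_nonneg _) (by positivity)
  have e5 : |p2 * a| ≤ η * H * (2 * b0 * H) := by
    rw [abs_mul]; exact mul_le_mul hp2 hab (abs_nonneg _) (by positivity)
  have e4 := abs_le.1 e4
  have e5 := abs_le.1 e5
  have hpos : 0 ≤ b0 * η * H ^ 2 := by positivity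
  nlinarith only [e1.1, e2.2, e3', e3'', e4.2, e5.2, hpos]

lemma clm_inner_le {E : Type*} [NormedAddCommGroup E] [InnerProductSpace ℝ E] {A : E →L[ℝ] E}
    {a1 : ℝ} (hA : ‖A‖ ≤ a1) (v w : E) : |⟪v, A w⟫| ≤ a1 * (‖v‖ * ‖w‖) := by
  refine (abs_real_inner_le_norm _ _).trans ?_
  have := A.le_opNorm w
  have h2 : ‖A‖ * ‖w‖ ≤ a1 * ‖w‖ := mul_le_mul_of_nonneg_right hA (norm_nonneg _)
  calc ‖v‖ * ‖A w‖ ≤ ‖v‖ * (a1 * ‖w‖) := mul_le_mul_of_nonneg_left (by linarith) (norm_nonneg _)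
    _ = _ := by ring

lemma bdry_alg (E : Type*) [NormedAddCommGroup E] [InnerProductSpace ℝ E] {a0 a1 ν1 : ℝ}
    (ha0 : 0 < a0) (ha1 : 1 ≤ a1) (hν1 : 1 ≤ ν1) :
    ∃ ε0 : ℝ, 0 < ε0 ∧ ∀ ε, 0 < ε → ε ≤ ε0 → ∀ (A : E →L[ℝ] E) (N y vt : E)
      (W Wt μ Ξ sb q : ℝ),
      ‖A‖ ≤ a1 → (∀ v, a0 * ‖v‖ ^ 2 ≤ ⟪v, A v⟫) → 1 ≤ ‖N‖ → ‖N‖ ≤ ν1 → ‖y‖ ≤ ε → 0 < Ξ →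
      ‖vt‖ ≤ 3 * ε * Ξ * |W| → |sb| ≤ ε * Ξ ^ 2 → |Wt| ≤ ε * Ξ ^ 2 * |W| →
      |q - Ξ ^ 2 * ⟪N + (2:ℝ) • y, A (N + (2:ℝ) • y)⟫| ≤ ε * Ξ ^ 2 →
      a0 ^ 2 * (Ξ ^ 3 * W ^ 2) ≤
        4 * Ξ * ⟪vt + μ • N, A (N + (2:ℝ) • y)⟫ * ⟪N, A (vt + μ • N)⟫
          - 2 * sb * W * ⟪N, A (vt + μ • N)⟫
          - (2 * ⟪vt + μ • N, A (vt + μ • N)⟫ - 2 * q * W ^ 2) * Ξ * ⟪N, A (N + (2:ℝ) • y)⟫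
          - 2 * Wt * ⟪N, A (vt + μ • N)⟫ := by
  set k : ℝ := 20 * a1 * ν1 with hk
  have hk1 : 1 ≤ k := by
    have : 1 ≤ a1 * ν1 := by nlinarith only [ha1, hν1]
    rw [hk]; nlinarith only [this]
  set b0 : ℝ := a1 * ν1 ^ 2 with hb0
  have hb1 : 1 ≤ b0 := by
    have : 1 ≤ ν1 ^ 2 := by nlinarith only [hν1]
    rw [hb0]; nlinarith only [this, ha1]
  have hε : 0 < min (1 / k) (a0 ^ 2 / (80 * b0 * k)) := lt_min (by positivity) (by positivity)
  refine ⟨_, hε, fun ε hε0 hεle A N y vt W Wt μ Ξ sb q hA hell hN1 hN2 hy hΞ hvt hsb hWt hq => ?_⟩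
  have hεk : ε * k ≤ 1 := by
    have := hεle.trans (min_le_left _ _)
    rwa [le_div_iff₀ (by linarith)] at this
  have hεb : ε * (80 * b0 * k) ≤ a0 ^ 2 := by
    have := hεle.trans (min_le_right _ _)
    rwa [le_div_iff₀ (by positivity)] at this
  have hε1 : ε ≤ 1 := by nlinarith only [hεk, hk1, hε0]
  have hε10 : ε ≤ 1/20 := by
    have : 20 ≤ k := by
      have : 1 ≤ a1 * ν1 := by nlinarith only [ha1, hν1]
      rw [hk]; nlinarith only [this]
    nlinarith only [this, hεk, hε0]
  set n0 : ℝ := ⟪N, A N⟫ with hn0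
  set Y : ℝ := Ξ * W with hY
  have hYabs : |Y| = Ξ * |W| := by rw [hY, abs_mul, abs_of_pos hΞ]
  set H : ℝ := |μ| + |Y| with hH
  have hμ0 := abs_nonneg μ
  have hY0 := abs_nonneg Y
  have hH0 : 0 ≤ H := by positivity
  have hvt' : ‖vt‖ ≤ 3 * ε * |Y| := by rw [hYabs]; linarith
  have hn0b : |n0| ≤ b0 := by
    refine (clm_inner_le hA N N).trans ?_
    rw [hb0, sq]
    exact mul_le_mul_of_nonneg_left (mul_self_le_mul_self (norm_nonneg _) hN2) (by linarith)
  have hn0a : a0 ≤ n0 := by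
    have := hell N
    have h2 : 1 ≤ ‖N‖ ^ 2 := by nlinarith only [hN1]
    nlinarith only [this, h2, ha0]
  have i1 : |⟪N, A vt⟫| ≤ a1 * (ν1 * (3 * ε * |Y|)) :=
    (clm_inner_le hA N vt).trans (mul_le_mul_of_nonneg_left
      (mul_le_mul hN2 hvt' (norm_nonneg _) (by linarith)) (by linarith))
  have i1' : |⟪vt, A N⟫| ≤ a1 * (ν1 * (3 * ε * |Y|)) := by
    refine (clm_inner_le hA vt N).trans (mul_le_mul_of_nonneg_left ?_ (by linarith))
    rw [mul_comm]
    exact mul_le_mul hN2 hvt' (norm_nonneg _) (by linarith)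
  have i2 : |⟪vt, A y⟫| ≤ a1 * (3 * ε * |Y| * ε) :=
    (clm_inner_le hA vt y).trans (mul_le_mul_of_nonneg_left
      (mul_le_mul hvt' hy (norm_nonneg _) (by positivity)) (by linarith))
  have i3 : |⟪N, A y⟫| ≤ a1 * (ν1 * ε) :=
    (clm_inner_le hA N y).trans (mul_le_mul_of_nonneg_left
      (mul_le_mul hN2 hy (norm_nonneg _) (by linarith)) (by linarith))
  have i3' : |⟪y, A N⟫| ≤ a1 * (ν1 * ε) := by
    refine (clm_inner_le hA y N).trans (mul_le_mul_of_nonneg_left ?_ (by linarith))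
    rw [mul_comm]
    exact mul_le_mul hN2 hy (norm_nonneg _) (by linarith)
  have i4 : |⟪y, A y⟫| ≤ a1 * (ε * ε) :=
    (clm_inner_le hA y y).trans (mul_le_mul_of_nonneg_left
      (mul_le_mul hy hy (norm_nonneg _) (by linarith)) (by linarith))
  have i5 : |⟪vt, A vt⟫| ≤ a1 * (3 * ε * |Y| * (3 * ε * |Y|)) :=
    (clm_inner_le hA vt vt).trans (mul_le_mul_of_nonneg_left
      (mul_le_mul hvt' hvt' (norm_nonneg _) (by positivity)) (by linarith))
  set a : ℝ := ⟪N, A (vt + μ • N)⟫ with ha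
  set d : ℝ := ⟪vt + μ • N, A (N + (2:ℝ) • y)⟫ with hd
  set f : ℝ := ⟪vt + μ • N, A (vt + μ • N)⟫ with hf
  set g : ℝ := ⟪N, A (N + (2:ℝ) • y)⟫ with hg
  have ea : a - μ * n0 = ⟪N, A vt⟫ := by
    rw [ha, map_add, map_smul, inner_add_right, inner_smul_right]; ring
  have ed : d - μ * n0 = ⟪vt, A N⟫ + 2 * ⟪vt, A y⟫ + μ * (2 * ⟪N, A y⟫) := by
    rw [hd, map_add, map_smul]
    simp only [inner_add_right, inner_smul_right, inner_add_left, real_inner_smul_left]; ring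
  have ef : f - μ ^ 2 * n0 = ⟪vt, A vt⟫ + μ * ⟪vt, A N⟫ + μ * ⟪N, A vt⟫ := by
    rw [hf, map_add, map_smul]
    simp only [inner_add_right, inner_smul_right, inner_add_left, real_inner_smul_left]; ring
  have eg : g - n0 = 2 * ⟪N, A y⟫ := by
    rw [hg, map_add, map_smul]
    simp only [inner_add_right, inner_smul_right]; ring
  have eq : ⟪N + (2:ℝ) • y, A (N + (2:ℝ) • y)⟫ - n0 =
      2 * ⟪N, A y⟫ + 2 * ⟪y, A N⟫ + 4 * ⟪y, A y⟫ := by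
    rw [map_add, map_smul]
    simp only [inner_add_right, inner_smul_right, inner_add_left, real_inner_smul_left]; ring
  have hP : 0 ≤ a1 * ν1 * ε := by positivity
  have haε : a1 * ε ≤ a1 * ν1 * ε := by
    have : a1 * 1 ≤ a1 * ν1 := mul_le_mul_of_nonneg_left hν1 (by linarith)
    nlinarith only [this, hε0]
  have haεε : a1 * (ε * ε) ≤ a1 * ν1 * ε / 20 := by
    have h1 : (a1 * ε) * ε ≤ (a1 * ε) * (1/20) := mul_le_mul_of_nonneg_left hε10 (by positivity)
    nlinarith only [haε, h1]
  have key := bdry_real (b0 := b0) (η := ε * k) (H := H) (μ := μ) (Y := Y) (n0 := n0) (a := a)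
    (d := d) (f := f) (g := g) (q := q / Ξ ^ 2) (p1 := sb * W / Ξ) (p2 := Wt / Ξ) hb1
    (by positivity) hεk hn0b hH0 (by rw [hH]; linarith) (by rw [hH]; linarith)
    (by
      rw [ea]
      refine i1.trans ?_
      rw [hk, hH]
      nlinarith only [mul_nonneg hP hμ0, mul_nonneg hP hY0])
    (by
      rw [ed]
      refine (abs_add_three _ _ _).trans ?_
      rw [abs_mul μ, abs_mul 2, abs_mul 2, abs_two]
      have h3 : |μ| * (2 * |⟪N, A y⟫|) ≤ |μ| * (2 * (a1 * (ν1 * ε))) :=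
        mul_le_mul_of_nonneg_left (by linarith) hμ0
      rw [hk, hH]
      nlinarith only [mul_nonneg hP hμ0, mul_nonneg hP hY0, i1', i2, h3,
        mul_le_mul_of_nonneg_right haεε hY0])
    (by
      rw [ef]
      refine (abs_add_three _ _ _).trans ?_
      rw [abs_mul μ, abs_mul μ]
      have h3 := mul_le_mul_of_nonneg_left i1 hμ0
      have h4 := mul_le_mul_of_nonneg_left i1' hμ0
      rw [hk, hH]
      nlinarith only [mul_nonneg hP (mul_nonneg hμ0 hY0), mul_nonneg hP (mul_nonneg hY0 hY0),
        mul_nonneg hP (mul_nonneg hμ0 hμ0), h3, h4, i5,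
        mul_le_mul_of_nonneg_right haεε (mul_nonneg hY0 hY0)])
    (by
      rw [eg, abs_mul, abs_two, hk]
      nlinarith only [i3, hP])
    (by
      have h1 : q / Ξ ^ 2 - n0 = (q - Ξ ^ 2 * ⟪N + (2:ℝ) • y, A (N + (2:ℝ) • y)⟫) / Ξ ^ 2 +
          (2 * ⟪N, A y⟫ + 2 * ⟪y, A N⟫ + 4 * ⟪y, A y⟫) := by
        rw [← eq]; field_simp; ring
      rw [h1]
      have h2 : |(q - Ξ ^ 2 * ⟪N + (2:ℝ) • y, A (N + (2:ℝ) • y)⟫) / Ξ ^ 2| ≤ ε := by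
        rw [abs_div, abs_of_pos (by positivity : 0 < Ξ ^ 2), div_le_iff₀ (by positivity)]
        exact hq
      have h3 : |2 * ⟪N, A y⟫ + 2 * ⟪y, A N⟫ + 4 * ⟪y, A y⟫| ≤
          2 * |⟪N, A y⟫| + 2 * |⟪y, A N⟫| + 4 * |⟪y, A y⟫| := by
        refine (abs_add_three _ _ _).trans (le_of_eq ?_)
        rw [abs_mul, abs_mul, abs_mul, abs_two, abs_of_pos (by norm_num : (0:ℝ) < 4)]
      have h5 : ε ≤ a1 * ν1 * ε := by
        have : 1 ≤ a1 * ν1 := by nlinarith only [ha1, hν1]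
        nlinarith only [this, hε0]
      refine (abs_add_le _ _).trans ?_
      rw [hk]
      nlinarith only [h2, h3, i3, i3', i4, haεε, hP, h5])
    (by
      rw [abs_div, abs_mul, abs_of_pos hΞ, div_le_iff₀ hΞ]
      have h1 : |sb| * |W| ≤ ε * Ξ ^ 2 * |W| := mul_le_mul_of_nonneg_right hsb (abs_nonneg _)
      have h2 : ε * Ξ ^ 2 * |W| = ε * |Y| * Ξ := by rw [hYabs]; ring
      have h3 : ε * |Y| ≤ ε * k * H := by
        rw [hH]
        have : 1 * |Y| ≤ k * (|μ| + |Y|) := mul_le_mul hk1 (by linarith) hY0 (by linarith)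
        nlinarith only [this, hε0]
      nlinarith only [h1, h2, h3, hΞ])
    (by
      rw [abs_div, abs_of_pos hΞ, div_le_iff₀ hΞ]
      have h2 : ε * Ξ ^ 2 * |W| = ε * |Y| * Ξ := by rw [hYabs]; ring
      have h3 : ε * |Y| ≤ ε * k * H := by
        rw [hH]
        have : 1 * |Y| ≤ k * (|μ| + |Y|) := mul_le_mul hk1 (by linarith) hY0 (by linarith)
        nlinarith only [this, hε0]
      nlinarith only [hWt, h2, h3, hΞ])
  have hHsq : H ^ 2 ≤ 2 * (μ ^ 2 + Y ^ 2) := by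
    rw [hH, ← sq_abs μ, ← sq_abs Y]
    nlinarith only [sq_nonneg (|μ| - |Y|)]
  have hfin : a0 ^ 2 * Y ^ 2 ≤ 2 * n0 ^ 2 * (μ ^ 2 + Y ^ 2) - 40 * b0 * (ε * k) * H ^ 2 := by
    have h1 : 40 * b0 * (ε * k) * H ^ 2 ≤ 40 * b0 * (ε * k) * (2 * (μ ^ 2 + Y ^ 2)) :=
      mul_le_mul_of_nonneg_left hHsq (by positivity)
    have h2 : a0 ^ 2 ≤ n0 ^ 2 := pow_le_pow_left₀ ha0.le hn0a 2
    have h3 : a0 ^ 2 * (μ ^ 2 + Y ^ 2) ≤ n0 ^ 2 * (μ ^ 2 + Y ^ 2) :=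
      mul_le_mul_of_nonneg_right h2 (by positivity)
    have h4 : ε * (80 * b0 * k) * (μ ^ 2 + Y ^ 2) ≤ a0 ^ 2 * (μ ^ 2 + Y ^ 2) :=
      mul_le_mul_of_nonneg_right hεb (by positivity)
    have h5 : 0 ≤ a0 ^ 2 * μ ^ 2 := by positivity
    nlinarith only [h1, h3, h4, h5]
  have h6 := mul_le_mul_of_nonneg_left (hfin.trans key) hΞ.le
  calc _ = Ξ * (a0 ^ 2 * Y ^ 2) := by rw [hY]; ring
    _ ≤ _ := h6
    _ = _ := by
      rw [hY]; field_simp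

/-! ### Boundary charts -/

section charts
variable {m : ℕ}

lemma ins_add (k : Fin (m + 1)) (r r0 : ℝ) (y : Fin m → ℝ) :
    ins k r y = ins k r0 y + (r - r0) • EuclideanSpace.single k (1:ℝ) := by
  ext j
  rcases Fin.eq_self_or_eq_succAbove k j with rfl | ⟨i, rfl⟩
  · simp [ins]
  · simp [ins]

lemma dr_add_single (k : Fin (m + 1)) (x : Eucl (m + 1)) (r : ℝ) :
    dr k (x + r • EuclideanSpace.single k (1:ℝ)) = dr k x := by
  ext i
  simp [dr]

lemma ins_contDiff (k : Fin (m + 1)) {N : WithTop ℕ∞} :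
    ContDiff ℝ N fun q : (Fin m → ℝ) × ℝ => ins k q.2 q.1 := by
  rw [contDiff_euclidean]
  intro j
  rcases Fin.eq_self_or_eq_succAbove k j with rfl | ⟨i, rfl⟩
  · simpa [ins] using contDiff_snd
  · simp only [ins, Fin.insertNth_apply_succAbove]
    exact (contDiff_apply ℝ ℝ i).comp contDiff_fst

lemma rt_add_single (k : Fin (m + 1)) (σ : ℝ) (h : (Fin m → ℝ) → ℝ) (x : Eucl (m + 1)) (r : ℝ) :
    rt k σ h (x + r • EuclideanSpace.single k (1:ℝ)) = rt k σ h x + σ * r := by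
  simp only [rt, dr_add_single]
  simp
  ring

lemma line_deriv {E : Type*} [NormedAddCommGroup E] [NormedSpace ℝ E] {f : E → ℝ} {x : E}
    (hf : DifferentiableAt ℝ f x) (v : E) :
    HasDerivAt (fun t : ℝ => f (x + t • v)) (fderiv ℝ f x v) 0 := by
  have h1 : HasDerivAt (fun t : ℝ => x + t • v) v 0 := by
    simpa using ((hasDerivAt_id (0:ℝ)).smul_const v).const_add x
  have h2 : HasFDerivAt f (fderiv ℝ f x) (x + (0:ℝ) • v) := by simpa using hf.hasFDerivAt
  exact h2.comp_hasDerivAt 0 h1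

lemma rt_fderiv_single (k : Fin (m + 1)) (σ : ℝ) {h : (Fin m → ℝ) → ℝ} (hh : ContDiff ℝ 1 h)
    (x : Eucl (m + 1)) : fderiv ℝ (rt k σ h) x (EuclideanSpace.single k (1:ℝ)) = σ := by
  have h1 := line_deriv (((rt_contDiff k σ hh).differentiable one_ne_zero) x)
    (EuclideanSpace.single k (1:ℝ))
  have h2 : HasDerivAt (fun t : ℝ => rt k σ h (x + t • EuclideanSpace.single k (1:ℝ))) σ 0 := by
    simp only [rt_add_single]
    simpa using ((hasDerivAt_id (0:ℝ)).const_mul σ).const_add (rt k σ h x)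
  exact h1.unique h2

lemma rt_grad_norm (k : Fin (m + 1)) {σ : ℝ} (hσ : σ * σ = 1) {h : (Fin m → ℝ) → ℝ}
    (hh : ContDiff ℝ 1 h) (x : Eucl (m + 1)) : 1 ≤ ‖gradient (rt k σ h) x‖ := by
  have h1 := rt_fderiv_single k σ hh x
  rw [← inner_grad] at h1
  have h2 := abs_real_inner_le_norm (gradient (rt k σ h) x) (EuclideanSpace.single k (1:ℝ))
  rw [h1] at h2
  have h3 : |σ| = 1 := by
    have : |σ| * |σ| = 1 := by rw [← abs_mul, hσ, abs_one]
    nlinarith [abs_nonneg σ]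
  simpa [h3] using h2

lemma neg_near {φ : ℝ → ℝ} {d : ℝ} (h : HasDerivAt φ d 0) (h0 : φ 0 = 0) (hd : d < 0) :
    ∀ᶠ t in 𝓝[>] (0:ℝ), φ t < 0 := by
  have h1 := (hasDerivAt_iff_tendsto_slope.1 h).eventually_lt_const hd
  have h2 : ∀ᶠ t in 𝓝[>] (0:ℝ), slope φ 0 t < 0 :=
    h1.filter_mono (nhdsWithin_mono _ fun t (ht : 0 < t) => ht.ne')
  filter_upwards [h2, self_mem_nhdsWithin] with t ht ht0
  rw [slope_def_field, h0, sub_zero, sub_zero] at ht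
  by_contra hc
  have : 0 ≤ φ t / t := div_nonneg (not_lt.1 hc) (le_of_lt ht0)
  linarith

lemma normal_unique {f1 f2 : Eucl n → ℝ} {x : Eucl n} (d1 : DifferentiableAt ℝ f1 x) (d2 : DifferentiableAt ℝ f2 x)
    (z1 : f1 x = 0) (z2 : f2 x = 0) (g1 : gradient f1 x ≠ 0) (g2 : gradient f2 x ≠ 0)
    (h : ∀ᶠ y in 𝓝 x, f1 y < 0 → f2 y < 0) :
    ‖gradient f1 x‖⁻¹ • gradient f1 x = ‖gradient f2 x‖⁻¹ • gradient f2 x := by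
  set p := gradient f1 x with hp
  set q := gradient f2 x with hq
  set a := ‖p‖⁻¹ • p with ha
  set b := ‖q‖⁻¹ • q with hb
  have np : 0 < ‖p‖ := norm_pos_iff.2 g1
  have nq : 0 < ‖q‖ := norm_pos_iff.2 g2
  have na : ‖a‖ = 1 := by rw [ha, norm_smul, norm_inv, norm_norm, inv_mul_cancel₀ np.ne']
  have nb : ‖b‖ = 1 := by rw [hb, norm_smul, norm_inv, norm_norm, inv_mul_cancel₀ nq.ne']
  have pa : p = ‖p‖ • a := by rw [ha, smul_smul, mul_inv_cancel₀ np.ne', one_smul]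
  have qb : q = ‖q‖ • b := by rw [hb, smul_smul, mul_inv_cancel₀ nq.ne', one_smul]
  have hle := real_inner_le_norm a b
  rw [na, nb, one_mul] at hle
  rcases hle.lt_or_eq with hlt | heq
  · exfalso
    have k1 := line_deriv d1 (b - a)
    have k2 := (line_deriv d2 (b - a)).neg
    have l1 : fderiv ℝ f1 x (b - a) < 0 := by
      rw [← inner_grad, ← hp, pa, real_inner_smul_left, inner_sub_right, real_inner_self_eq_norm_sq,
        na]
      exact mul_neg_of_pos_of_neg np (by linarith)
    have l2 : -fderiv ℝ f2 x (b - a) < 0 := by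
      rw [← inner_grad, ← hq, qb, real_inner_smul_left, inner_sub_right, real_inner_self_eq_norm_sq,
        nb, real_inner_comm]
      have : 0 < ‖q‖ * (1 ^ 2 - ⟪a, b⟫) := mul_pos nq (by linarith)
      linarith
    have e1 := neg_near k1 (by simp [z1]) l1
    have e2 := neg_near k2 (by simp [z2]) l2
    have ht : Filter.Tendsto (fun t : ℝ => x + t • (b - a)) (𝓝[>] 0) (𝓝 x) := by
      have : Continuous fun t : ℝ => x + t • (b - a) := by fun_prop
      have := this.tendsto 0
      simp only [zero_smul, add_zero] at this
      exact this.mono_left nhdsWithin_le_nhds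
    obtain ⟨t, ht1, ht2, ht3⟩ := ((e1.and (e2.and (ht.eventually h)))).exists
    have := ht3 ht1
    simp only [Pi.neg_apply] at ht2
    linarith
  · exact (inner_eq_one_iff_of_norm_eq_one na nb).1 heq

/-- graph chart of the boundary of `D` -/
structure Chart (D : Set (Eucl (m + 1))) (k : Fin (m + 1)) (σ : ℝ) (h : (Fin m → ℝ) → ℝ)
    (U : Set (Eucl (m + 1))) : Prop where
  hσ : σ * σ = 1
  hh : ContDiff ℝ 2 h
  lip : ∃ L, LipschitzWith L h
  hU : IsOpen U
  mem : ∀ x ∈ U, (x ∈ D ↔ rt k σ h x < 0)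
  memf : ∀ x ∈ U, (x ∈ frontier D ↔ rt k σ h x = 0)

lemma Chart.mono {D : Set (Eucl (m + 1))} {k : Fin (m + 1)} {σ : ℝ} {h : (Fin m → ℝ) → ℝ}
    {U U' : Set (Eucl (m + 1))} (c : Chart D k σ h U) (hU : IsOpen U') (hs : U' ⊆ U) :
    Chart D k σ h U' :=
  ⟨c.hσ, c.hh, c.lip, hU, fun x hx => c.mem x (hs hx), fun x hx => c.memf x (hs hx)⟩

lemma exists_chart {D : Set (Eucl (m + 1))} (hD : HasC4Boundary D) {z : Eucl (m + 1)}
    (hz : z ∈ frontier D) : ∃ k σ h U, z ∈ U ∧ Chart D k σ h U := by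
  obtain ⟨V, ρ, hV, hzV, hρ, hgr, hDV, hFV⟩ := hD z hz
  have hρz : ρ z = 0 := by
    have : z ∈ frontier D ∩ V := ⟨hz, hzV⟩
    rw [hFV] at this
    exact this.2
  obtain ⟨k, hk⟩ : ∃ k, gradient ρ z k ≠ 0 := by
    by_contra hc
    push Not at hc
    exact hgr z hzV (by ext j; simpa using hc j)
  have hpk : ∀ x, gradient ρ x k = fderiv ℝ ρ x (EuclideanSpace.single k (1:ℝ)) := fun x => by
    rw [← inner_grad, EuclideanSpace.inner_single_right, one_mul]; rfl
  obtain ⟨σ, hσ, hσk⟩ : ∃ σ : ℝ, σ * σ = 1 ∧ 0 < σ * gradient ρ z k := by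
    rcases lt_or_gt_of_ne hk with h | h
    · exact ⟨-1, by norm_num, by linarith⟩
    · exact ⟨1, by norm_num, by linarith⟩
  set F : (Fin m → ℝ) × ℝ → ℝ := fun q => ρ (ins k q.2 q.1) with hF
  set q0 : (Fin m → ℝ) × ℝ := (dr k z, z k) with hq0
  have hi0 : ins k q0.2 q0.1 = z := ins_dr k z
  have hρat : ∀ x ∈ V, ContDiffAt ℝ 4 ρ x := fun x hx => hρ.contDiffAt (hV.mem_nhds hx)
  have hFq : ContDiffAt ℝ 2 F q0 := by
    have h1 : ContDiffAt ℝ 2 ρ (ins k q0.2 q0.1) := by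
      rw [hi0]; exact (hρat z hzV).of_le (by norm_num)
    exact h1.comp q0 (ins_contDiff k).contDiffAt
  have hder : fderiv ℝ F q0 ((0 : Fin m → ℝ), (1:ℝ)) = gradient ρ z k := by
    have h1 := line_deriv (hFq.differentiableAt two_ne_zero) ((0 : Fin m → ℝ), (1:ℝ))
    have h2 := line_deriv ((hρat z hzV).differentiableAt (by norm_num))
      (EuclideanSpace.single k (1:ℝ))
    rw [← hpk] at h2
    refine h1.unique (h2.congr_of_eventuallyEq (Filter.Eventually.of_forall fun t => ?_))
    simp only [hF, hq0, Prod.smul_mk, Prod.mk_add_mk, smul_zero, add_zero, smul_eq_mul, mul_one]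
    rw [ins_add k _ (z k), ins_dr]
    simp
  have hinv : (fderiv ℝ F q0 ∘L .inr ℝ (Fin m → ℝ) ℝ).IsInvertible := by
    refine ⟨ContinuousLinearEquiv.unitsEquivAut ℝ (Units.mk0 _ hk), ?_⟩
    ext
    simp [← hder]
  set φ := hFq.implicitFunction two_ne_zero hinv with hφ
  have φ0 : φ (dr k z) = z k := hFq.implicitFunction_apply_self two_ne_zero hinv
  have φz : ∀ᶠ y in 𝓝 (dr k z), ρ (ins k (φ y) y) = 0 := by
    have := hFq.eventually_apply_implicitFunction two_ne_zero hinv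
    have e : F q0 = 0 := by simp only [hF]; rw [hi0, hρz]
    rw [e] at this
    exact this
  have φc : ContDiffAt ℝ 2 φ (dr k z) := hFq.contDiffAt_implicitFunction two_ne_zero hinv
  -- good box
  have hgc : ContinuousAt (fun x => σ * fderiv ℝ ρ x (EuclideanSpace.single k (1:ℝ))) z := by
    have h1 := ((hρat z hzV).fderiv_right (m := 3) (by norm_num)).continuousAt
    exact continuousAt_const.mul (h1.clm_apply continuousAt_const)
  have hbox : ∀ᶠ x in 𝓝 z, x ∈ V ∧ 0 < σ * fderiv ℝ ρ x (EuclideanSpace.single k (1:ℝ)) := by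
    refine Filter.Eventually.and (hV.mem_nhds hzV) (hgc.eventually_const_lt ?_)
    beta_reduce
    rw [← hpk]; exact hσk
  have hbox' : ∀ᶠ q in 𝓝 q0, ins k q.2 q.1 ∈ V ∧
      0 < σ * fderiv ℝ ρ (ins k q.2 q.1) (EuclideanSpace.single k (1:ℝ)) := by
    have : Filter.Tendsto (fun q : (Fin m → ℝ) × ℝ => ins k q.2 q.1) (𝓝 q0) (𝓝 z) := by
      have := ((ins_contDiff (N := 0) k).continuous).tendsto q0
      rwa [hi0] at this
    exact this.eventually hbox
  rw [nhds_prod_eq] at hbox'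
  obtain ⟨pa, hpa, pb, hpb, hpp⟩ := Filter.eventually_prod_iff.1 hbox'
  obtain ⟨δ, hδ, hδb⟩ := Metric.eventually_nhds_iff_ball.1 hpb
  have e1 : ∀ᶠ y in 𝓝 (dr k z), ContDiffAt ℝ 2 φ y := φc.eventually (by simp)
  have e2 : ∀ᶠ y in 𝓝 (dr k z), φ y ∈ Metric.ball (z k) δ := by
    have := φc.continuousAt.eventually_mem (by rw [φ0]; exact Metric.ball_mem_nhds (z k) hδ)
    exact this
  obtain ⟨ε, hε, hεb⟩ := Metric.eventually_nhds_iff_ball.1 (hpa.and (φz.and (e1.and e2)))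
  let χ : ContDiffBump (dr k z) := ⟨ε / 3, ε / 2, by positivity, by linarith⟩
  set h : (Fin m → ℝ) → ℝ := fun y => χ y * φ y with hh
  have hts : tsupport χ ⊆ Metric.ball (dr k z) ε := by
    rw [χ.tsupport_eq]
    exact Metric.closedBall_subset_ball (by change ε / 2 < ε; linarith)
  have hhC : ContDiff ℝ 2 h := by
    rw [contDiff_iff_contDiffAt]
    intro y
    by_cases hy : y ∈ tsupport χ
    · exact χ.contDiffAt.mul (hεb y (hts hy)).2.2.1
    · have : h =ᶠ[𝓝 y] fun _ => 0 := by
        filter_upwards [notMem_tsupport_iff_eventuallyEq.1 hy] with w hw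
        simp [hh, hw]
      exact contDiffAt_const.congr_of_eventuallyEq this
  have hhs : HasCompactSupport h := χ.hasCompactSupport.mul_right
  have hheq : ∀ y ∈ Metric.ball (dr k z) (ε / 3), h y = φ y := fun y hy => by
    simp only [hh]
    rw [χ.one_of_mem_closedBall (Metric.ball_subset_closedBall hy), one_mul]
  set U : Set (Eucl (m + 1)) := dr k ⁻¹' Metric.ball (dr k z) (ε / 3) ∩
    (fun x : Eucl (m + 1) => x k) ⁻¹' Metric.ball (z k) δ with hUdef
  have hxk : Continuous fun x : Eucl (m + 1) => x k := by fun_prop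
  have hU : IsOpen U := (Metric.isOpen_ball.preimage (dr_cont k)).inter
    (Metric.isOpen_ball.preimage hxk)
  have key : ∀ x ∈ U, x ∈ V ∧ (ρ x < 0 ↔ rt k σ h x < 0) ∧ (ρ x = 0 ↔ rt k σ h x = 0) := by
    intro x hx
    set y := dr k x with hy
    have hyε : y ∈ Metric.ball (dr k z) ε := Metric.ball_subset_ball (by linarith) hx.1
    obtain ⟨c1, c2, c3, c4⟩ := hεb y hyε
    have hmono : StrictMonoOn (fun r => σ * ρ (ins k r y)) (Metric.ball (z k) δ) := by
      have hd : ∀ r ∈ Metric.ball (z k) δ, HasDerivAt (fun r => σ * ρ (ins k r y))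
          (σ * fderiv ℝ ρ (ins k r y) (EuclideanSpace.single k (1:ℝ))) r := by
        intro r hr
        have hV' := (hpp c1 (hδb r hr)).1
        have h1 : HasFDerivAt ρ (fderiv ℝ ρ (ins k r y)) (ins k r y) :=
          ((hρat _ hV').differentiableAt (by norm_num)).hasFDerivAt
        have h2 : HasDerivAt (fun r' => ins k r' y) (EuclideanSpace.single k (1:ℝ)) r := by
          have : (fun r' => ins k r' y) =
              fun r' => ins k r y + (r' - r) • EuclideanSpace.single k (1:ℝ) :=
            funext fun r' => ins_add k r' r y
          rw [this]
          simpa using (((hasDerivAt_id r).sub_const r).smul_const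
            (EuclideanSpace.single k (1:ℝ))).const_add (ins k r y)
        exact (h1.comp_hasDerivAt r h2).const_mul σ
      refine strictMonoOn_of_deriv_pos (convex_ball _ _)
        (fun r hr => (hd r hr).continuousAt.continuousWithinAt) fun r hr => ?_
      rw [Metric.isOpen_ball.interior_eq] at hr
      rw [(hd r hr).deriv]
      exact (hpp c1 (hδb r hr)).2
    have hxi : ins k (x k) y = x := ins_dr k x
    have hxV : x ∈ V := by
      have := (hpp c1 (hδb _ hx.2)).1
      rwa [hxi] at this
    have hrt : rt k σ h x = σ * (x k - φ y) := by
      simp only [rt]; rw [hheq _ hx.1]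
    have t1 := hmono.lt_iff_lt hx.2 c4
    have t2 := hmono.lt_iff_lt c4 hx.2
    simp only [c2, mul_zero, hxi] at t1 t2
    refine ⟨hxV, ?_⟩
    rw [hrt]
    have hσ1 : σ = 1 ∨ σ = -1 := mul_self_eq_one_iff.1 hσ
    have tri := lt_trichotomy (x k) (φ y)
    rcases hσ1 with rfl | rfl
    · simp only [one_mul] at t1 t2 ⊢
      refine ⟨t1.trans sub_neg.symm, fun h => ?_, fun h => ?_⟩
      · rw [h] at t1 t2; simp at t1 t2; linarith
      · have : x k = φ y := by linarith
        rw [this] at t1 t2; simp at t1 t2; linarith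
    · simp only [neg_mul, one_mul, neg_lt_zero, neg_pos] at t1 t2 ⊢
      refine ⟨t2.trans sub_pos.symm, fun h => ?_, fun h => ?_⟩
      · rw [h] at t1 t2; simp at t1 t2; linarith
      · have : x k = φ y := by linarith
        rw [this] at t1 t2; simp at t1 t2; linarith
  refine ⟨k, σ, h, U, ⟨Metric.mem_ball_self (by positivity), Metric.mem_ball_self hδ⟩, hσ, hhC,
    hhC.lipschitzWith_of_hasCompactSupport hhs two_ne_zero, hU, fun x hx => ?_, fun x hx => ?_⟩
  · obtain ⟨hxV, h1, h2⟩ := key x hx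
    rw [← h1]
    have : x ∈ D ∩ V ↔ x ∈ V ∧ ρ x < 0 := by rw [hDV]; exact Iff.rfl
    exact ⟨fun h => (this.1 ⟨h, hxV⟩).2, fun h => (this.2 ⟨hxV, h⟩).1⟩
  · obtain ⟨hxV, h1, h2⟩ := key x hx
    rw [← h2]
    have : x ∈ frontier D ∩ V ↔ x ∈ V ∧ ρ x = 0 := by rw [hFV]; exact Iff.rfl
    exact ⟨fun h => (this.1 ⟨h, hxV⟩).2, fun h => (this.2 ⟨hxV, h⟩).1⟩

lemma Chart.normal {D : Set (Eucl (m + 1))} {k : Fin (m + 1)} {σ : ℝ} {h : (Fin m → ℝ) → ℝ}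
    {U : Set (Eucl (m + 1))} (c : Chart D k σ h U) {ν : Eucl (m + 1) → Eucl (m + 1)}
    (hν : IsOutwardNormalField D ν) {x : Eucl (m + 1)} (hx : x ∈ U) (hxD : x ∈ frontier D) :
    ν x = ‖gradient (rt k σ h) x‖⁻¹ • gradient (rt k σ h) x := by
  obtain ⟨V, ρ, hV, hzV, hρ, hgr, hDV, hFV, hνx⟩ := hν x hxD
  rw [hνx]
  have h1 := rt_grad_norm k c.hσ (c.hh.of_le one_le_two) x
  have hρx : ρ x = 0 := by
    have : x ∈ frontier D ∩ V := ⟨hxD, hzV⟩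
    rw [hFV] at this
    exact this.2
  refine normal_unique ((hρ.contDiffAt (hV.mem_nhds hzV)).differentiableAt (by norm_num))
    ((rt_contDiff k σ c.hh).differentiable two_ne_zero x) hρx ((c.memf x hx).1 hxD) (hgr x hzV)
    (norm_pos_iff.1 (by linarith)) ?_
  filter_upwards [hV.mem_nhds hzV, c.hU.mem_nhds hx] with y hyV hyU hy
  have : y ∈ D ∩ V := by rw [hDV]; exact ⟨hyV, hy⟩
  exact (c.mem y hyU).1 this.1

end charts

/-! ### Hausdorff measure on graphs -/

section hausd
variable {m : ℕ}

/-- graph map -/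
def gm (k : Fin (m + 1)) (h : (Fin m → ℝ) → ℝ) (y : Fin m → ℝ) : Eucl (m + 1) := ins k (h y) y

lemma gm_cont (k : Fin (m + 1)) {h : (Fin m → ℝ) → ℝ} (hh : Continuous h) :
    Continuous (gm k h) := (ins_cont k).comp (hh.prodMk continuous_id)

lemma gm_inj (k : Fin (m + 1)) (h : (Fin m → ℝ) → ℝ) : Function.Injective (gm k h) :=
  fun a b hab => by simpa [gm] using congrArg (dr k) hab

lemma gm_emb (k : Fin (m + 1)) {h : (Fin m → ℝ) → ℝ} (hh : Continuous h) :
    MeasurableEmbedding (gm k h) := (gm_cont k hh).measurableEmbedding (gm_inj k h)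

lemma gm_dr {k : Fin (m + 1)} {σ : ℝ} (hσ : σ * σ = 1) {h : (Fin m → ℝ) → ℝ}
    {x : Eucl (m + 1)} (hx : rt k σ h x = 0) : gm k h (dr k x) = x := by
  have h1 : x k = h (dr k x) := by
    have h2 : σ ≠ 0 := fun h0 => by rw [h0] at hσ; norm_num at hσ
    have := (mul_eq_zero.1 hx).resolve_left h2
    linarith
  rw [gm, ← h1, ins_dr]

lemma rt_gm (k : Fin (m + 1)) (σ : ℝ) (h : (Fin m → ℝ) → ℝ) (y : Fin m → ℝ) :
    rt k σ h (gm k h y) = 0 := by simp [rt, gm]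

lemma dr_lip (k : Fin (m + 1)) : LipschitzWith 1 (dr k) := by
  refine LipschitzWith.of_dist_le_mul fun x y => ?_
  rw [NNReal.coe_one, one_mul, dist_pi_le_iff dist_nonneg]
  intro i
  rw [Real.dist_eq, EuclideanSpace.dist_eq]
  refine Real.abs_le_sqrt ?_
  have := Finset.single_le_sum (f := fun j => dist (x j) (y j) ^ 2) (fun j _ => sq_nonneg _)
    (Finset.mem_univ (k.succAbove i))
  simpa [dr, Real.dist_eq] using this

lemma gm_lip (k : Fin (m + 1)) {h : (Fin m → ℝ) → ℝ} {L : NNReal} (hL : LipschitzWith L h) :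
    ∃ L', LipschitzWith L' (gm k h) := by
  have h1 : LipschitzWith (max L 1) fun y => (k.insertNth (α := fun _ => ℝ) (h y) y) := by
    refine LipschitzWith.of_dist_le_mul fun x y => ?_
    rw [dist_pi_le_iff (by positivity)]
    intro j
    rcases Fin.eq_self_or_eq_succAbove k j with rfl | ⟨i, rfl⟩
    · simp only [Fin.insertNth_apply_same]
      exact (hL.dist_le_mul x y).trans
        (mul_le_mul_of_nonneg_right (by simp) dist_nonneg)
    · simp only [Fin.insertNth_apply_succAbove]
      refine (dist_le_pi_dist x y i).trans ?_
      have : (1:ℝ) ≤ (max L 1 : NNReal) := by simp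
      nlinarith [dist_nonneg (x := x) (y := y)]
  exact ⟨_, (PiLp.lipschitzWith_toLp 2 (fun _ : Fin (m + 1) => ℝ)).comp h1⟩

lemma muH_pi : (μH[(m:ℝ)] : Measure (Fin m → ℝ)) = volume := by
  have := hausdorffMeasure_pi_real (ι := Fin m)
  rwa [Fintype.card_fin] at this

lemma gm_map_le (k : Fin (m + 1)) {h : (Fin m → ℝ) → ℝ} (hh : Continuous h)
    {Γ : Set (Eucl (m + 1))} {Y : Set (Fin m → ℝ)} (mY : MeasurableSet Y)
    (hY : ∀ y ∈ Y, gm k h y ∈ Γ) :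
    (volume.restrict Y).map (gm k h) ≤ μH[(m:ℝ)].restrict Γ := by
  rw [Measure.le_iff]
  intro E hE
  rw [Measure.map_apply (gm_cont k hh).measurable hE,
    Measure.restrict_apply ((gm_cont k hh).measurable hE), Measure.restrict_apply hE, ← muH_pi]
  have hsub : gm k h ⁻¹' E ∩ Y ⊆ dr k '' (E ∩ Γ) := fun y hy =>
    ⟨gm k h y, ⟨hy.1, hY y hy.2⟩, by simp [gm]⟩
  refine (measure_mono hsub).trans ?_
  have := (dr_lip k).hausdorffMeasure_image_le (d := (m:ℝ)) (by positivity) (E ∩ Γ)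
  simpa using this

lemma gm_le_map (k : Fin (m + 1)) {h : (Fin m → ℝ) → ℝ} (hh : Continuous h)
    {L : NNReal} (hL : LipschitzWith L (gm k h))
    {Γ : Set (Eucl (m + 1))} {Y : Set (Fin m → ℝ)} (mY : MeasurableSet Y)
    (hY : Γ ⊆ gm k h '' Y) :
    μH[(m:ℝ)].restrict Γ ≤ (L ^ m : NNReal) • (volume.restrict Y).map (gm k h) := by
  rw [Measure.le_iff]
  intro E hE
  rw [Measure.smul_apply, Measure.map_apply (gm_cont k hh).measurable hE,
    Measure.restrict_apply ((gm_cont k hh).measurable hE), Measure.restrict_apply hE, ← muH_pi]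
  have hsub : E ∩ Γ ⊆ gm k h '' (gm k h ⁻¹' E ∩ Y) := fun x hx => by
    obtain ⟨y, hy, rfl⟩ := hY hx.2
    exact ⟨y, ⟨hx.1, hy⟩, rfl⟩
  refine (measure_mono hsub).trans ?_
  have := hL.hausdorffMeasure_image_le (d := (m:ℝ)) (by positivity) (gm k h ⁻¹' E ∩ Y)
  refine this.trans (le_of_eq ?_)
  rw [ENNReal.smul_def, smul_eq_mul]
  simp

lemma muH_finite {D : Set (Eucl (m + 1))} (hD : HasC4Boundary D) (hb : Bornology.IsBounded D) :
    μH[(m:ℝ)] (frontier D) < ⊤ := by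
  have hK : IsCompact (frontier D) :=
    Metric.isCompact_of_isClosed_isBounded isClosed_frontier
      (hb.closure.subset frontier_subset_closure)
  refine hK.measure_lt_top_of_nhdsWithin fun x hx => ?_
  obtain ⟨k, σ, h, U, hxU, c⟩ := exists_chart hD hx
  obtain ⟨L0, hL0⟩ := c.lip
  obtain ⟨L, hL⟩ := gm_lip k hL0
  refine ⟨frontier D ∩ U, Filter.inter_mem self_mem_nhdsWithin (mem_nhdsWithin_of_mem_nhds (c.hU.mem_nhds hxU)), ?_⟩
  have hsub : frontier D ∩ U ⊆ gm k h '' (dr k '' frontier D) := fun y hy =>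
    ⟨dr k y, ⟨y, hy.1, rfl⟩, gm_dr c.hσ ((c.memf y hy.2).1 hy.1)⟩
  refine (measure_mono hsub).trans_lt ?_
  refine (hL.hausdorffMeasure_image_le (d := (m:ℝ)) (by positivity) _).trans_lt ?_
  rw [muH_pi]
  refine ENNReal.mul_lt_top (by simp) (hK.image (dr_cont k)).measure_lt_top

lemma gm_int_le (k : Fin (m + 1)) {h : (Fin m → ℝ) → ℝ} (hh : Continuous h)
    {Γ : Set (Eucl (m + 1))} (mΓ : MeasurableSet Γ) {Y : Set (Fin m → ℝ)} (mY : MeasurableSet Y)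
    (hY : ∀ y ∈ Y, gm k h y ∈ Γ) {f : Eucl (m + 1) → ℝ} (h0 : ∀ x ∈ Γ, 0 ≤ f x)
    (hi : IntegrableOn f Γ μH[(m:ℝ)]) :
    ∫ y in Y, f (gm k h y) ≤ ∫ x in Γ, f x ∂μH[(m:ℝ)] := by
  rw [← (gm_emb k hh).integral_map (μ := volume.restrict Y)]
  exact integral_mono_measure (gm_map_le k hh mY hY) (ae_restrict_of_forall_mem mΓ h0) hi

lemma gm_int_ge (k : Fin (m + 1)) {h : (Fin m → ℝ) → ℝ} (hh : Continuous h)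
    {L : NNReal} (hL : LipschitzWith L (gm k h))
    {Γ : Set (Eucl (m + 1))} {Y : Set (Fin m → ℝ)} (mY : MeasurableSet Y)
    (hY : Γ ⊆ gm k h '' Y) {f : Eucl (m + 1) → ℝ} (h0 : ∀ x, 0 ≤ f x)
    (hi : IntegrableOn (fun y => f (gm k h y)) Y) :
    ∫ x in Γ, f x ∂μH[(m:ℝ)] ≤ (L:ℝ) ^ m * ∫ y in Y, f (gm k h y) := by
  rw [← (gm_emb k hh).integral_map (μ := volume.restrict Y)]
  have h1 := integral_mono_measure (gm_le_map k hh hL mY hY) (f := f)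
    (Filter.Eventually.of_forall h0)
    (Integrable.smul_measure_nnreal ((gm_emb k hh).integrable_map_iff.2 hi))
  refine h1.trans (le_of_eq ?_)
  rw [integral_smul_nnreal_measure]
  simp [NNReal.smul_def]

end hausd

/-! ### Positivity of the boundary flux -/

lemma flx_inner (c : Coef n) (S m R : ℝ) {P : Eucl n → ℝ} (b : Eucl n → ℝ) (x : Eucl n)
    (U : ℝ) (p : Eucl n) (Ut : ℝ) {N y : Eucl n} {lP : ℝ}
    (hg : gradient P x = -(lP • (N + (2:ℝ) • y))) (μ : ℝ) :
    let v := ((p - μ • N) - (2 * (S * lP) * U) • y) + (μ - S * lP * U) • N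
    ⟪N, c.flx S m R P b x U p Ut⟫ = c.ω x * (
      4 * (S * lP) * ⟪v, c.A x (N + (2:ℝ) • y)⟫ * ⟪N, c.A x v⟫
      - 2 * (S * b x) * U * ⟪N, c.A x v⟫
      - (2 * ⟪v, c.A x v⟫ - 2 * (c.qf S m R P x) * U ^ 2) * (S * lP) * ⟪N, c.A x (N + (2:ℝ) • y)⟫
      - 2 * (cqt m R P x U Ut) * ⟪N, c.A x v⟫) := by
  intro v
  have hv : cgr S P x U p = v := by
    simp only [cgr, hg, v]
    module
  have hZ : c.Z P x = -(lP • c.A x (N + (2:ℝ) • y)) := by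
    rw [Coef.Z, hg, map_neg, map_smul]
  simp only [Coef.flx, Coef.flx0, hv, hZ]
  simp only [inner_add_right, inner_sub_right, inner_smul_right, inner_neg_right]
  ring

lemma bdry_flux (c : Coef n) {f : Eucl n → ℝ} (hf : ContDiff ℝ 2 f) (hf1 : ∀ x, 1 ≤ ‖gradient f x‖)
    (x0 : Eucl n) :
    ∃ ε0 : ℝ, 0 < ε0 ∧ ∀ ε, 0 < ε → ε ≤ ε0 → ∀ (l : ℝ) (P b : Eucl n → ℝ), 0 < l →
      Continuous P → Continuous b → (∀ x, 0 < P x) →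
      (∀ x, gradient P x = -((l * P x) • (gradient f x + (2:ℝ) • (x - x0)))) →
      ∀ L R T : ℝ, 0 ≤ L → 0 < T → ∃ s0 : ℝ, 1 ≤ s0 ∧ ∃ c1 : ℝ, 0 < c1 ∧ ∀ s, s0 ≤ s →
      ∀ t ∈ Ioo 0 T, ∀ x ∈ Metric.closedBall x0 ε, ∀ (U : ℝ) (p : Eucl n) (Ut μ : ℝ),
      ‖p - μ • gradient f x‖ ≤ L * |U| → |Ut| ≤ L * |U| →
      c1 * ((s * sg T t) ^ 3 * U ^ 2) ≤
        fderiv ℝ f x (c.flx (s * sg T t) (s * sg1 T t) R P b x U p Ut) := by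
  have hK : IsCompact (Metric.closedBall x0 1) := isCompact_closedBall x0 1
  obtain ⟨a0, ha0, hell⟩ := c.elliptic_on hK
  obtain ⟨a1, ha1, hA1⟩ := exists_bound_on hK (f := fun x => ‖c.A x‖)
    c.hA.continuous.norm.continuousOn
  have hgc : Continuous (gradient f) := (gradient_contDiff hf).continuous
  obtain ⟨ν1, hν1, hN1⟩ := exists_bound_on hK (f := fun x => ‖gradient f x‖)
    hgc.norm.continuousOn
  obtain ⟨e, he, H⟩ := bdry_alg (Eucl n) (a0 := a0) (a1 := a1 + 1) (ν1 := ν1 + 1) ha0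
    (by linarith) (by linarith)
  refine ⟨min e 1, lt_min he one_pos, fun ε hε hεe l P b hl hP hb hP0 hgP L R T hL hT => ?_⟩
  have hε1 : ε ≤ 1 := hεe.trans (min_le_right _ _)
  have hKε : IsCompact (Metric.closedBall x0 ε) := isCompact_closedBall x0 ε
  have hne : (Metric.closedBall x0 ε).Nonempty := ⟨x0, Metric.mem_closedBall_self hε.le⟩
  obtain ⟨xm, hxm, hmin⟩ := hKε.exists_isMinOn hne hP.continuousOn
  obtain ⟨xw, hxw, hwmin⟩ := hKε.exists_isMinOn hne c.hω.continuous.continuousOn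
  set pm := P xm with hpm
  have hpm0 : 0 < pm := hP0 xm
  have hω0 := c.ωpos xw
  obtain ⟨Mb, hMb, bb⟩ := exists_bound_on hKε hb.continuousOn
  obtain ⟨MR, hMR, bR⟩ := exists_bound_on hKε (f := fun x => P x - R)
    (hP.sub continuous_const).continuousOn
  set w := l * pm with hw
  have hw0 : 0 < w := by positivity
  -- thresholds
  set s0 : ℝ := 1 + (T ^ 2 / 4) * (2 * (L + 1) / (ε * w) + 1 / w + Mb / (ε * w ^ 2)) +
    2 * T * MR / (ε * w ^ 2) with hs0
  have hs01 : 1 ≤ s0 := by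
    rw [hs0]
    have : 0 ≤ (T ^ 2 / 4) * (2 * (L + 1) / (ε * w) + 1 / w + Mb / (ε * w ^ 2)) +
      2 * T * MR / (ε * w ^ 2) := by positivity
    linarith
  refine ⟨s0, hs01, c.ω xw * (a0 ^ 2 * w ^ 3), by positivity,
    fun s hs t ht x hx U p Ut μ hp hUt => ?_⟩
  have hs1 : 1 ≤ s := hs01.trans hs
  obtain ⟨b1, b2, b3, b4, b5, b6⟩ := sS_bounds hs1 ht
  set S := s * sg T t with hS
  have hx1 : x ∈ Metric.closedBall x0 1 := Metric.closedBall_subset_closedBall hε1 hx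
  set Ξ := S * (l * P x) with hΞ
  have hPx : pm ≤ P x := hmin hx
  have hΞ1 : S * w ≤ Ξ := by
    rw [hΞ, hw]
    exact mul_le_mul_of_nonneg_left (mul_le_mul_of_nonneg_left hPx hl.le) b6.le
  have hΞ0 : 0 < Ξ := lt_of_lt_of_le (by positivity) hΞ1
  have t1 : 2 * (L + 1) / (ε * w) + 1 / w + Mb / (ε * w ^ 2) ≤ S := by
    have h1 : (T ^ 2 / 4) * (2 * (L + 1) / (ε * w) + 1 / w + Mb / (ε * w ^ 2)) ≤ T ^ 2 / 4 * S := by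
      refine le_trans ?_ b1
      refine le_trans ?_ hs
      rw [hs0]
      have : 0 ≤ 2 * T * MR / (ε * w ^ 2) := by positivity
      linarith
    exact le_of_mul_le_mul_left h1 (by positivity)
  have t2 : 2 * T * MR / (ε * w ^ 2) ≤ s := by
    refine le_trans ?_ hs
    rw [hs0]
    have : 0 ≤ (T ^ 2 / 4) * (2 * (L + 1) / (ε * w) + 1 / w + Mb / (ε * w ^ 2)) := by positivity
    linarith
  have p1 : 0 ≤ 2 * (L + 1) / (ε * w) := by positivity
  have p2 : 0 ≤ 1 / w := by positivity
  have p3 : 0 ≤ Mb / (ε * w ^ 2) := by positivity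
  have q1 : 2 * (L + 1) ≤ ε * Ξ := by
    have h1 : 2 * (L + 1) / (ε * w) ≤ S := by linarith
    rw [div_le_iff₀ (by positivity)] at h1
    nlinarith only [h1, hΞ1, hε]
  have q2 : 1 ≤ Ξ := by
    have h1 : 1 / w ≤ S := by linarith
    rw [div_le_iff₀ hw0] at h1
    linarith
  have q3 : Mb ≤ ε * w * Ξ := by
    have h1 : Mb / (ε * w ^ 2) ≤ S := by linarith
    rw [div_le_iff₀ (by positivity)] at h1
    have := mul_le_mul_of_nonneg_left hΞ1 (by positivity : 0 ≤ ε * w)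
    nlinarith only [h1, this]
  have hΞsq : (S * w) ^ 2 ≤ Ξ ^ 2 := pow_le_pow_left₀ (by positivity) hΞ1 2
  have q4 : |s * sg1 T t * (P x - R)| ≤ ε * Ξ ^ 2 / 2 := by
    rw [abs_mul]
    have h1 : |s * sg1 T t| * |P x - R| ≤ T * (S ^ 2 / s) * MR :=
      mul_le_mul b3 (bR x hx) (abs_nonneg _) (by positivity)
    refine h1.trans ?_
    rw [div_le_iff₀ (by positivity)] at t2
    have h2 : T * (S ^ 2 / s) * MR = S ^ 2 * (2 * T * MR) / (2 * s) := by field_simp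
    rw [h2, div_le_iff₀ (by positivity)]
    have h3 := mul_le_mul_of_nonneg_left t2 (sq_nonneg S)
    have h4 := mul_le_mul_of_nonneg_left hΞsq (by positivity : 0 ≤ s * ε)
    nlinarith only [h3, h4]
  have key := H ε hε (hεe.trans (min_le_left _ _)) (c.A x) (gradient f x) (x - x0)
    ((p - μ • gradient f x) - (2 * Ξ * U) • (x - x0)) U
    (cqt (s * sg1 T t) R P x U Ut) (μ - Ξ * U) Ξ (S * b x) (c.qf S (s * sg1 T t) R P x)
    (by have := hA1 x hx1; rw [abs_norm] at this; linarith) (hell x hx1) (hf1 x)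
    (by have := hN1 x hx1; rw [abs_norm] at this; linarith)
    (by rw [← dist_eq_norm]; exact hx) hΞ0
    (by
      refine (norm_sub_le _ _).trans ?_
      rw [norm_smul, Real.norm_eq_abs, abs_mul, abs_mul, abs_two, abs_of_pos hΞ0]
      have h1 : ‖x - x0‖ ≤ ε := by rw [← dist_eq_norm]; exact hx
      have h2 : 2 * Ξ * |U| * ‖x - x0‖ ≤ 2 * Ξ * |U| * ε :=
        mul_le_mul_of_nonneg_left h1 (by positivity)
      have h3 : L * |U| ≤ ε * Ξ * |U| := mul_le_mul_of_nonneg_right (by linarith) (abs_nonneg _)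
      nlinarith only [h2, h3, hp])
    (by
      rw [abs_mul, abs_of_pos b6]
      have h1 : S * |b x| ≤ S * (ε * w * Ξ) :=
        mul_le_mul_of_nonneg_left ((bb x hx).trans q3) b6.le
      have h2 : (S * w) * (ε * Ξ) ≤ Ξ * (ε * Ξ) := mul_le_mul_of_nonneg_right hΞ1 (by positivity)
      nlinarith only [h1, h2])
    (by
      rw [cqt]
      refine (abs_add_le _ _).trans ?_
      rw [abs_mul _ U]
      have h1 : |s * sg1 T t * (P x - R)| * |U| ≤ ε * Ξ ^ 2 / 2 * |U| :=
        mul_le_mul_of_nonneg_right q4 (abs_nonneg _)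
      have h2 : L * |U| ≤ ε * Ξ ^ 2 / 2 * |U| := by
        refine mul_le_mul_of_nonneg_right ?_ (abs_nonneg _)
        nlinarith only [q1, q2, hε, hL, mul_le_mul_of_nonneg_left q2 (mul_pos hε hΞ0).le]
      linarith)
    (by
      have h1 : c.qf S (s * sg1 T t) R P x - Ξ ^ 2 * ⟪gradient f x + (2:ℝ) • (x - x0),
          c.A x (gradient f x + (2:ℝ) • (x - x0))⟫ = s * sg1 T t * (P x - R) := by
        rw [Coef.qf, Coef.Gm, Coef.Z, hgP x, map_neg, map_smul, inner_neg_left, inner_neg_right,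
          inner_smul_right, real_inner_smul_left, hΞ]
        ring
      rw [h1]
      refine q4.trans ?_
      have : 0 ≤ ε * Ξ ^ 2 := by positivity
      linarith)
  have hfl := flx_inner c S (s * sg1 T t) R b x U p Ut (hgP x) μ
  simp only at hfl
  rw [← inner_grad, hfl]
  refine le_trans ?_ (mul_le_mul_of_nonneg_left key (c.ωpos x).le)
  have h1 : (S * w) ^ 3 ≤ Ξ ^ 3 := pow_le_pow_left₀ (by positivity) hΞ1 3
  have h2 : c.ω xw ≤ c.ω x := hwmin hx
  calc c.ω xw * (a0 ^ 2 * w ^ 3) * (S ^ 3 * U ^ 2) = c.ω xw * (a0 ^ 2 * ((S * w) ^ 3 * U ^ 2)) := by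
        ring
    _ ≤ c.ω x * (a0 ^ 2 * (Ξ ^ 3 * U ^ 2)) := by
        refine mul_le_mul h2 ?_ (by positivity) (c.ωpos x).le
        exact mul_le_mul_of_nonneg_left (mul_le_mul_of_nonneg_right h1 (sq_nonneg U)) (sq_nonneg _)

/-! ### Boundary patches -/

lemma patch_cutoff {f : Eucl n → ℝ} (hf : ContDiff ℝ 1 f) (x0 : Eucl n) {R0 δ : ℝ} (hR0 : 0 < R0)
    (hδ : 0 < δ) : ∃ ζ : Eucl n → ℝ, ContDiff ℝ 1 ζ ∧ HasCompactSupport ζ ∧ (∀ x, 0 ≤ ζ x) ∧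
      tsupport ζ ⊆ Metric.closedBall x0 R0 ∩ {x | -δ ≤ f x} ∧
      (∀ x, ‖x - x0‖ < R0 / 2 → -(δ / 2) < f x → ζ x = 1) ∧
      (∀ x, fderiv ℝ ζ x ≠ 0 → R0 / 2 ≤ ‖x - x0‖ ∨ f x ≤ -(δ / 2)) := by
  set ζ : Eucl n → ℝ := fun x => Real.smoothTransition ((f x + δ) / (δ / 2)) *
    Real.smoothTransition ((R0 ^ 2 - ‖x - x0‖ ^ 2) / (3 * R0 ^ 2 / 4)) with hζ
  have hq : ContDiff ℝ 1 fun x : Eucl n => ‖x - x0‖ ^ 2 :=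
    (contDiff_id.sub contDiff_const).norm_sq ℝ
  have hζ1 : ContDiff ℝ 1 ζ :=
    (Real.smoothTransition.contDiff.comp ((hf.add contDiff_const).div_const _)).mul
      (Real.smoothTransition.contDiff.comp ((contDiff_const.sub hq).div_const _))
  have h1 : 0 < 3 * R0 ^ 2 / 4 := by positivity
  have h2 : 0 < δ / 2 := by positivity
  have hcl : IsClosed (Metric.closedBall x0 R0 ∩ {x | -δ ≤ f x}) :=
    Metric.isClosed_closedBall.inter (isClosed_le continuous_const hf.continuous)
  have hsup : tsupport ζ ⊆ Metric.closedBall x0 R0 ∩ {x | -δ ≤ f x} := by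
    refine closure_minimal ?_ hcl
    intro x hx
    rw [Function.mem_support] at hx
    have := mul_ne_zero_iff.1 hx
    refine ⟨?_, ?_⟩
    · by_contra hc
      refine this.2 (Real.smoothTransition.zero_of_nonpos ?_)
      rw [Metric.mem_closedBall, dist_eq_norm, not_le] at hc
      refine div_nonpos_of_nonpos_of_nonneg ?_ h1.le
      nlinarith only [hc, hR0]
    · rw [mem_ofPred_eq]
      by_contra hc
      refine this.1 (Real.smoothTransition.zero_of_nonpos ?_)
      refine div_nonpos_of_nonpos_of_nonneg ?_ h2.le
      linarith
  have h1' : ∀ x, ‖x - x0‖ < R0 / 2 → -(δ / 2) < f x → ζ x = 1 := by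
    intro x e1 e2
    simp only [hζ]
    rw [Real.smoothTransition.one_of_one_le, Real.smoothTransition.one_of_one_le, one_mul]
    · rw [le_div_iff₀ h1]; nlinarith only [e1, hR0, norm_nonneg (x - x0)]
    · rw [le_div_iff₀ h2]; linarith
  refine ⟨ζ, hζ1, (isCompact_closedBall x0 R0).of_isClosed_subset (isClosed_tsupport ζ)
    (hsup.trans inter_subset_left), fun x =>
    mul_nonneg (Real.smoothTransition.nonneg _) (Real.smoothTransition.nonneg _), hsup, h1', ?_⟩
  intro x hx
  by_contra hc
  push Not at hc
  refine hx ?_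
  have : ζ =ᶠ[𝓝 x] fun _ => 1 := by
    have o1 : ∀ᶠ z in 𝓝 x, ‖z - x0‖ < R0 / 2 :=
      (continuous_id.sub continuous_const).norm.continuousAt.eventually (gt_mem_nhds hc.1)
    have o2 : ∀ᶠ z in 𝓝 x, -(δ / 2) < f z :=
      hf.continuous.continuousAt.eventually (lt_mem_nhds hc.2)
    filter_upwards [o1, o2] with z z1 z2 using h1' z z1 z2
  rw [this.fderiv_eq]; simp

lemma patch_gradient {f : Eucl n → ℝ} (hf : ContDiff ℝ 2 f) (τ : ℝ) (x0 x : Eucl n) :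
    gradient (fun x => τ * f x - ‖x - x0‖ ^ 2) x = τ • gradient f x - (2:ℝ) • (x - x0) := by
  have hq : ContDiff ℝ 2 fun x : Eucl n => ‖x - x0‖ ^ 2 :=
    (contDiff_id.sub contDiff_const).norm_sq ℝ
  refine ext_inner_right ℝ fun v => ?_
  have d1 : DifferentiableAt ℝ f x := hf.contDiffAt.differentiableAt two_ne_zero
  have d2 : DifferentiableAt ℝ (fun x : Eucl n => -‖x - x0‖ ^ 2) x :=
    hq.neg.contDiffAt.differentiableAt two_ne_zero
  have e : (fun x => τ * f x - ‖x - x0‖ ^ 2) = fun x => τ * f x + -‖x - x0‖ ^ 2 := by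
    ext x; ring
  rw [inner_grad, e, inner_sub_left, inner_smul_left, inner_grad]
  have e2 : fderiv ℝ (fun x => τ * f x + -‖x - x0‖ ^ 2) x =
      fderiv ℝ (fun x => τ * f x) x + fderiv ℝ (fun x => -‖x - x0‖ ^ 2) x :=
    fderiv_add (d1.const_mul τ) d2
  have e3 : fderiv ℝ (fun x => τ * f x) x = τ • fderiv ℝ f x := fderiv_const_mul d1 τ
  rw [e2, add_apply, ← inner_grad (fun x => -‖x - x0‖ ^ 2), gradient_sqdist, e3, smul_apply,
    inner_neg_left]
  simp [sub_eq_add_neg]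

section
variable {m : ℕ}

lemma gm_pre_compact (k : Fin (m + 1)) {h : (Fin m → ℝ) → ℝ} (hh : Continuous h)
    {K : Set (Eucl (m + 1))} (hK : IsCompact K) : IsCompact (gm k h ⁻¹' K) := by
  refine (hK.image (dr_cont k)).of_isClosed_subset (hK.isClosed.preimage (gm_cont k hh)) ?_
  intro y hy
  exact ⟨gm k h y, hy, by simp [gm]⟩

/-- boundary flux -/
def bflx (c : Coef (m + 1)) (T s R : ℝ) (P b : Eucl (m + 1) → ℝ) (k : Fin (m + 1)) (σ : ℝ)
    (h : (Fin m → ℝ) → ℝ) (ζ : Eucl (m + 1) → ℝ)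
    (u ut : ℝ → Eucl (m + 1) → ℝ) (t : ℝ) (y : Fin m → ℝ) : ℝ :=
  ζ (gm k h y) * fderiv ℝ (rt k σ h) (gm k h y) (c.wflx T s R P b u ut t (gm k h y))

lemma bflx_le (c : Coef (m + 1)) {P b : Eucl (m + 1) → ℝ} (hP : ContDiff ℝ 2 P) (hb : ContDiff ℝ 1 b)
    {K : Set (Eucl (m + 1))} (hK : IsCompact K) (R : ℝ) {T : ℝ} (hT : 0 < T)
    {k : Fin (m + 1)} (σ : ℝ) {h : (Fin m → ℝ) → ℝ} (hh : ContDiff ℝ 2 h) {ζ : Eucl (m + 1) → ℝ}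
    (hζ : Continuous ζ) : ∃ C : ℝ, 0 < C ∧ ∀ s, 1 ≤ s → ∀ u ut : ℝ → Eucl (m + 1) → ℝ,
      ∀ t ∈ Ioo 0 T, ∀ y ∈ gm k h ⁻¹' K,
      |bflx c T s R P b k σ h ζ u ut t y| ≤ C * wden T s R P u ut t (gm k h y) := by
  obtain ⟨Cf, hCf, Hf⟩ := wflx_le c hP hb hK R hT
  obtain ⟨M1, hM1, b1⟩ := exists_bound_on hK hζ.continuousOn
  obtain ⟨M2, hM2, b2⟩ := exists_bound_on hK
    ((rt_contDiff k σ hh).continuous_fderiv two_ne_zero).norm.continuousOn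
  refine ⟨(M1 + 1) * ((M2 + 1) * Cf), by positivity, fun s hs u ut t ht y hy => ?_⟩
  unfold bflx
  rw [abs_mul, mul_assoc]
  have e1 := b1 _ hy
  have e2 := b2 _ hy
  rw [abs_of_nonneg (norm_nonneg _)] at e2
  have e3 := Hf s hs u ut t ht _ hy
  have e4 : |fderiv ℝ (rt k σ h) (gm k h y) (c.wflx T s R P b u ut t (gm k h y))| ≤
      (M2 + 1) * Cf * wden T s R P u ut t (gm k h y) := by
    rw [← Real.norm_eq_abs, mul_assoc]
    refine ((fderiv ℝ (rt k σ h) (gm k h y)).le_opNorm _).trans ?_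
    exact mul_le_mul (by linarith) e3 (norm_nonneg _) (by positivity)
  exact mul_le_mul (by linarith) e4 (abs_nonneg _) (by positivity)

lemma bflx_gd (c : Coef (m + 1)) {P b : Eucl (m + 1) → ℝ} (hP : ContDiff ℝ 2 P) (hb : ContDiff ℝ 1 b)
    {K : Set (Eucl (m + 1))} (hK : IsCompact K) {T : ℝ} (hT : 0 < T)
    {R r : ℝ} (hr : 0 < r) (hR : ∀ x ∈ K, P x ≤ R - r) {s : ℝ} (hs : 1 ≤ s)
    {B : Set (Eucl (m + 1))} (hB : Bornology.IsBounded B) {u ut : ℝ → Eucl (m + 1) → ℝ}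
    (hsol : CSol c T B u ut)
    {k : Fin (m + 1)} (σ : ℝ) {h : (Fin m → ℝ) → ℝ} (hh : ContDiff ℝ 2 h)
    (hKB : ∀ y, gm k h y ∈ K → gm k h y ∈ closure B)
    {ζ : Eucl (m + 1) → ℝ} (hζ : Continuous ζ) :
    Gd T (gm k h ⁻¹' K) (bflx c T s R P b k σ h ζ u ut) := by
  obtain ⟨C, hC, H⟩ := bflx_le c hP hb hK R hT (k := k) σ hh hζ
  obtain ⟨M, hM, _, h1⟩ := wden_bdd hP hK hT hr hR hs hB hsol
  have hg := gm_cont k hh.continuous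
  refine ⟨?_, C * M, fun t ht y hy => (H s hs u ut t ht y hy).trans
    (mul_le_mul_of_nonneg_left (h1 t ht _ ⟨hy, hKB y hy⟩) hC.le)⟩
  unfold bflx
  have a1 : ContinuousOn (fun q : ℝ × (Fin m → ℝ) => ζ (gm k h q.2)) (Ioo 0 T ×ˢ (gm k h ⁻¹' K)) :=
    (hζ.comp (hg.comp continuous_snd)).continuousOn
  have a2 : ContinuousOn (fun q : ℝ × (Fin m → ℝ) => fderiv ℝ (rt k σ h) (gm k h q.2))
      (Ioo 0 T ×ˢ (gm k h ⁻¹' K)) :=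
    (((rt_contDiff k σ hh).continuous_fderiv two_ne_zero).comp (hg.comp continuous_snd)).continuousOn
  have a3 : ContinuousOn (fun q : ℝ × (Fin m → ℝ) => c.wflx T s R P b u ut q.1 (gm k h q.2))
      (Ioo 0 T ×ˢ (gm k h ⁻¹' K)) :=
    (cont_wflx hsol s R hP hb).comp (f := fun q : ℝ × (Fin m → ℝ) => (q.1, gm k h q.2))
      (continuous_fst.prodMk (hg.comp continuous_snd)).continuousOn
      fun q hq => ⟨hq.1, hKB _ hq.2⟩
  exact a1.mul (a2.clm_apply a3)

lemma bflx_int (c : Coef (m + 1)) (T s R : ℝ) (P b : Eucl (m + 1) → ℝ) (k : Fin (m + 1)) (σ : ℝ)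
    (h : (Fin m → ℝ) → ℝ) {ζ : Eucl (m + 1) → ℝ} {K : Set (Eucl (m + 1))} (hK : tsupport ζ ⊆ K)
    (u ut : ℝ → Eucl (m + 1) → ℝ) :
    (∫ t in Ioo 0 T, ∫ y, ζ (ins k (h y) y) *
          fderiv ℝ (rt k σ h) (ins k (h y) y) (c.wflx T s R P b u ut t (ins k (h y) y))) =
      I2 volume T (gm k h ⁻¹' K) (bflx c T s R P b k σ h ζ u ut) := by
  unfold I2
  congr 1
  ext t
  rw [setIntegral_eq_integral_of_forall_compl_eq_zero]
  · rfl
  · intro y hy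
    have : ζ (gm k h y) = 0 := by
      by_contra h0
      exact hy (hK (subset_tsupport ζ h0))
    rw [bflx, this, zero_mul]
end

section
variable {m : ℕ}

/-- trace density -/
def tden (T s R : ℝ) (P : Eucl (m + 1) → ℝ) (k : Fin (m + 1)) (h : (Fin m → ℝ) → ℝ)
    (u : ℝ → Eucl (m + 1) → ℝ) (t : ℝ) (y : Fin m → ℝ) : ℝ :=
  cex (s * sg T t) R P (gm k h y) ^ 2 * ((s * sg T t) ^ 3 * u t (gm k h y) ^ 2)

lemma patch_weight (c : Coef n) {f : Eucl n → ℝ} (hf : ContDiff ℝ 2 f)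
    (hf1 : ∀ x, 1 ≤ ‖gradient f x‖) {τ : ℝ} (hτ : |τ| = 1)
    (x0 : Eucl n) {R0 : ℝ} (hR0 : R0 ≤ 1 / 4) :
    ∃ l : ℝ, 0 < l ∧ ∃ b : Eucl n → ℝ, ContDiff ℝ 1 b ∧ ∃ c0 : ℝ, 0 < c0 ∧
      c.PC (fun x => Real.exp (l * (τ * f x - ‖x - x0‖ ^ 2))) b (Metric.closedBall x0 R0) c0 := by
  have hψ : ContDiff ℝ 2 fun x : Eucl n => τ * f x - ‖x - x0‖ ^ 2 :=
    (contDiff_const.mul hf).sub ((contDiff_id.sub contDiff_const).norm_sq ℝ)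
  refine exists_weight c hψ (isCompact_closedBall x0 R0) fun x hx h0 => ?_
  rw [patch_gradient hf, sub_eq_zero] at h0
  have h1 := congrArg norm h0
  rw [norm_smul, norm_smul, Real.norm_eq_abs, hτ, one_mul, Real.norm_eq_abs, abs_two] at h1
  rw [Metric.mem_closedBall, dist_eq_norm] at hx
  have := hf1 x
  linarith

theorem S_patch (Z : Stp (m + 1)) {ν : Eucl (m + 1) → Eucl (m + 1)}
    (hν : IsOutwardNormalField Z.B ν) {L : ℝ} (hL : 0 ≤ L)
    (hbd : ∀ u ut, Z.Adm u ut → ∀ t ∈ Ioo 0 Z.T, ∀ x ∈ frontier Z.B, |ut t x| ≤ L * |u t x| ∧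
      ∃ μ : ℝ, ‖gradient (u t) x - μ • ν x‖ ≤ L * |u t x|)
    {k : Fin (m + 1)} {σ : ℝ} {h : (Fin m → ℝ) → ℝ} {U : Set (Eucl (m + 1))}
    (ch : Chart Z.B k σ h U) {x0 : Eucl (m + 1)} (hx0 : x0 ∈ U) (hx0f : x0 ∈ frontier Z.B) :
    ∃ (P : Eucl (m + 1) → ℝ) (K A Z1 Z2 V : Set (Eucl (m + 1))) (ρ pin pout : ℝ),
      ContDiff ℝ 2 P ∧ (∀ x, 0 < P x) ∧ IsCompact K ∧ MeasurableSet A ∧ IsCompact Z1 ∧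
      MeasurableSet Z2 ∧ A ⊆ K ∩ closure Z.B ∧ Z1 ⊆ K ∩ Z.B ∧ Z2 ⊆ K ∩ Z.B ∧ pout < pin ∧
      (∀ x ∈ A, pin ≤ P x) ∧ (∀ x ∈ Z2, P x ≤ pout) ∧ V ∈ 𝓝 x0 ∧ V ∩ Z.B ⊆ A ∧
      frontier Z.B ∩ V ⊆ gm k h '' (gm k h ⁻¹' Metric.ball x0 ρ) ∧
      (∀ y ∈ gm k h ⁻¹' Metric.ball x0 ρ, gm k h y ∈ K ∩ frontier Z.B) ∧
      ∀ R r : ℝ, 0 < r → (∀ x ∈ K, P x ≤ R - r) → ∃ s0 : ℝ, 1 ≤ s0 ∧ ∃ C : ℝ, 0 ≤ C ∧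
      ∀ s, s0 ≤ s → ∀ u ut, Z.Adm u ut →
        I2 volume Z.T A (wden Z.T s R P u ut) +
          I2 volume Z.T (gm k h ⁻¹' Metric.ball x0 ρ) (tden Z.T s R P k h u) ≤
          C * (I2 volume Z.T Z1 (wden Z.T s R P u ut) + I2 volume Z.T Z2 (wden Z.T s R P u ut)) := by
  set f := rt k σ h with hfdef
  have hf : ContDiff ℝ 2 f := rt_contDiff k σ ch.hh
  have hf1 : ∀ x, 1 ≤ ‖gradient f x‖ := rt_grad_norm k ch.hσ (ch.hh.of_le one_le_two)
  obtain ⟨ε0, hε0, HF⟩ := bdry_flux Z.c hf hf1 x0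
  obtain ⟨ρ, hρ, hρU⟩ := Metric.isOpen_iff.1 ch.hU x0 hx0
  set R0 := min (min ε0 (ρ / 2)) (1 / 4) with hR0def
  have hR0 : 0 < R0 := lt_min (lt_min hε0 (by positivity)) (by norm_num)
  have hR1 : R0 ≤ ε0 := (min_le_left _ _).trans (min_le_left _ _)
  have hR2 : R0 ≤ ρ / 2 := (min_le_left _ _).trans (min_le_right _ _)
  have hR3 : R0 ≤ 1 / 4 := min_le_right _ _
  set K := Metric.closedBall x0 R0 with hKdef
  have hK : IsCompact K := isCompact_closedBall x0 R0
  have hKU : K ⊆ U := (Metric.closedBall_subset_ball (by linarith)).trans hρU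
  have hfx0 : f x0 = 0 := (ch.memf x0 hx0).1 hx0f
  obtain ⟨l, hl, b, hb, c0, hc0, hPC⟩ := patch_weight Z.c hf hf1 (τ := -1) (by simp) x0 hR3
  set P : Eucl (m + 1) → ℝ := fun x => Real.exp (l * (-1 * f x - ‖x - x0‖ ^ 2)) with hPdef
  have hψ : ContDiff ℝ 2 fun x : Eucl (m + 1) => -1 * f x - ‖x - x0‖ ^ 2 :=
    (contDiff_const.mul hf).sub ((contDiff_id.sub contDiff_const).norm_sq ℝ)
  have hP : ContDiff ℝ 2 P := Real.contDiff_exp.comp (contDiff_const.mul hψ)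
  have hP0 : ∀ x, 0 < P x := fun x => Real.exp_pos _
  have hgP : ∀ x, gradient P x = -((l * P x) • (gradient f x + (2:ℝ) • (x - x0))) := by
    intro x
    rw [hPdef, gradient_exp hψ l x, patch_gradient hf]
    module
  set δ := R0 ^ 2 / 16 with hδdef
  have hδ : 0 < δ := by positivity
  obtain ⟨ζ, hζ1, hζc, hζ0, hζs, hζone, hζd⟩ := patch_cutoff (hf.of_le one_le_two) x0 hR0 hδ
  have hζK : tsupport ζ ⊆ K := hζs.trans inter_subset_left
  have fc : Continuous f := hf.continuous
  have nc : Continuous fun x : Eucl (m + 1) => ‖x - x0‖ := by fun_prop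
  set A := Metric.ball x0 (R0 / 4) ∩ {x | -(δ / 2) < f x} ∩ {x | f x < 0} with hA
  set Z1 := K ∩ {x | -δ ≤ f x} ∩ {x | f x ≤ -(δ / 2)} with hZ1
  set Z2 := K ∩ {x | -δ ≤ f x} ∩ {x | f x < 0} ∩ {x | R0 / 2 ≤ ‖x - x0‖} with hZ2
  have mlt : MeasurableSet {x | f x < 0} := (isOpen_lt fc continuous_const).measurableSet
  have mA : MeasurableSet A := (Metric.isOpen_ball.measurableSet.inter
    (isOpen_lt continuous_const fc).measurableSet).inter mlt
  have cZ1 : IsCompact Z1 := (hK.inter_right (isClosed_le continuous_const fc)).inter_right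
    (isClosed_le fc continuous_const)
  have m2 : MeasurableSet Z2 := ((hK.measurableSet.inter
    (isClosed_le continuous_const fc).measurableSet).inter mlt).inter
    (isClosed_le continuous_const nc).measurableSet
  have hKB : ∀ x ∈ K, f x < 0 → x ∈ Z.B := fun x hx h0 => (ch.mem x (hKU hx)).2 h0
  have hKF : ∀ x ∈ K, f x = 0 → x ∈ frontier Z.B := fun x hx h0 => (ch.memf x (hKU hx)).2 h0
  have hbK : Metric.ball x0 (R0 / 4) ⊆ K :=
    Metric.ball_subset_closedBall.trans (Metric.closedBall_subset_closedBall (by linarith))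
  have sA : A ⊆ K ∩ closure Z.B := fun x hx =>
    ⟨hbK hx.1.1, subset_closure (hKB x (hbK hx.1.1) hx.2)⟩
  have s1 : Z1 ⊆ K ∩ Z.B := fun x hx => ⟨hx.1.1, hKB x hx.1.1 (by
    have := hx.2; rw [mem_ofPred_eq] at this; linarith)⟩
  have s2 : Z2 ⊆ K ∩ Z.B := fun x hx => ⟨hx.1.1.1, hKB x hx.1.1.1 hx.1.2⟩
  have hYf : ∀ y, gm k h y ∈ K → gm k h y ∈ frontier Z.B := fun y hy =>
    hKF _ hy (rt_gm k σ h y)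
  have hYK : gm k h ⁻¹' Metric.ball x0 (R0 / 4) ⊆ gm k h ⁻¹' K := preimage_mono hbK
  have gc := gm_cont k ch.hh.continuous
  refine ⟨P, K, A, Z1, Z2, Metric.ball x0 (R0 / 4) ∩ {x | -(δ / 2) < f x}, R0 / 4,
    Real.exp (l * -(R0 ^ 2 / 16)), Real.exp (l * -(3 * R0 ^ 2 / 16)), hP, hP0, hK, mA, cZ1, m2, sA, s1,
    s2, ?_, ?_, ?_, ?_, ?_, ?_, fun y hy => ⟨hYK hy, hYf y (hYK hy)⟩, ?_⟩
  · rw [Real.exp_lt_exp]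
    have : 0 < l * R0 ^ 2 := by positivity
    nlinarith only [this]
  · intro x hx
    rw [Real.exp_le_exp]
    have h1 := hx.1.1
    have h2 : f x < 0 := hx.2
    rw [Metric.mem_ball, dist_eq_norm] at h1
    refine mul_le_mul_of_nonneg_left ?_ hl.le
    nlinarith only [h1, h2, norm_nonneg (x - x0)]
  · intro x hx
    rw [Real.exp_le_exp]
    have h1 : R0 / 2 ≤ ‖x - x0‖ := hx.2
    have h2 : -δ ≤ f x := hx.1.1.2
    refine mul_le_mul_of_nonneg_left ?_ hl.le
    nlinarith only [h1, h2, hR0, hδdef]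
  · exact Filter.inter_mem (Metric.ball_mem_nhds _ (by positivity))
      ((isOpen_lt continuous_const fc).mem_nhds (by rw [mem_ofPred_eq, hfx0]; linarith))
  · intro x hx
    exact ⟨hx.1, (ch.mem x (hKU (hbK hx.1.1))).1 hx.2⟩
  · intro x hx
    have h1 := (ch.memf x (hKU (hbK hx.2.1))).1 hx.1
    exact ⟨dr k x, by rw [mem_preimage, gm_dr ch.hσ h1]; exact hx.2.1, gm_dr ch.hσ h1⟩
  · intro R r hr hR
    have mY : MeasurableSet (gm k h ⁻¹' Metric.ball x0 (R0 / 4)) :=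
      (Metric.isOpen_ball.preimage gc).measurableSet
    have cYc := gm_pre_compact k ch.hh.continuous hK
    have vYc : volume (gm k h ⁻¹' K) ≠ ⊤ := cYc.measure_ne_top
    have vY : volume (gm k h ⁻¹' Metric.ball x0 (R0 / 4)) ≠ ⊤ :=
      ne_top_of_le_ne_top vYc (measure_mono hYK)
    obtain ⟨s0, hs0, c', hc', H⟩ := carleman_bdry Z.c hP hb hK hc0 hPC Z.hT hr hR
    obtain ⟨s1', hs1', c1, hc1, HB⟩ := HF R0 hR0 hR1 l P b hl hP.continuous hb.continuous hP0 hgP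
      L R Z.T hL Z.hT
    have hUc : ∀ x ∈ U, f x ≤ 0 → x ∈ closure Z.B := fun x hx h0 => by
      rcases h0.lt_or_eq with h0 | h0
      · exact subset_closure ((ch.mem x hx).2 h0)
      · exact frontier_subset_closure ((ch.memf x hx).2 h0)
    obtain ⟨ca, hca, Hlow⟩ := cut_low Z.c hP hK Z.hT hr hR Z.hBb hζ1.continuous hζc hζ0 hζK
      mlt (fun x hx => hUc x (hKU (hζK hx.1)) (le_of_lt hx.2)) mA (fun x hx => hx.2)
      (fun x hx => hζone x (by
        have := hx.1.1; rw [Metric.mem_ball, dist_eq_norm] at this; linarith) hx.1.2)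
    have hD : ∀ x ∈ {x | f x < 0}, fderiv ℝ ζ x ≠ 0 → x ∈ Z1 ∪ Z2 := by
      intro x hx0' hx
      have hxs : x ∈ tsupport ζ := by
        by_contra hxK
        refine hx ?_
        rw [(notMem_tsupport_iff_eventuallyEq.1 hxK).fderiv_eq]; simp
      have hxK := hζs hxs
      rcases hζd x hx with h1 | h1
      · exact Or.inr ⟨⟨hxK, hx0'⟩, h1⟩
      · exact Or.inl ⟨hxK, h1⟩
    have mZ1 := cZ1.measurableSet
    obtain ⟨Cz, hCz, Hup⟩ := cut_up Z.c hP hb hK Z.hT hr hR Z.hBb hζ1 hζc mlt mZ1 m2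
      (fun x hx => ⟨(s1 hx).1, subset_closure (s1 hx).2⟩)
      (fun x hx => ⟨(s2 hx).1, subset_closure (s2 hx).2⟩) hD
    refine ⟨max s0 s1', hs0.trans (le_max_left _ _), Cz / min (c' * ca) c1, by positivity,
      fun s hs u ut hu => ?_⟩
    have hss0 := (le_max_left _ _).trans hs
    have hss1 := (le_max_right _ _).trans hs
    have hs1 : 1 ≤ s := hs0.trans hss0
    have hsol := Z.adm _ _ hu
    have e1 := H s hss0 Z.B Z.hB Z.hBb u ut hsol k σ h U ch.hσ ch.hh ch.hU
      (fun x hx h0 => (ch.mem x hx).2 h0) hUc ζ hζ1 hζc (hζK.trans hKU) hζK hζ0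
    rw [bflx_int Z.c Z.T s R P b k σ h hζK u ut] at e1
    have e2 := Hlow s hs1 u ut hsol
    have e3 := Hup s hs1 u ut hsol
    have gB := bflx_gd Z.c hP hb hK Z.hT hr hR hs1 Z.hBb hsol (k := k) σ ch.hh
      (fun y hy => frontier_subset_closure (hYf y hy)) hζ1.continuous
    have key : ∀ t ∈ Ioo 0 Z.T, ∀ y ∈ gm k h ⁻¹' K,
        ζ (gm k h y) * (c1 * tden Z.T s R P k h u t y) ≤
          bflx Z.c Z.T s R P b k σ h ζ u ut t y := by
      intro t ht y hy
      have hyf := hYf y hy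
      obtain ⟨k1, μ, k2⟩ := hbd u ut hu t ht _ hyf
      rw [ch.normal hν (hKU hy) hyf, smul_smul] at k2
      have k3 := HB s hss1 t ht _ hy _ _ _ _ k2 k1
      unfold bflx tden Coef.wflx
      refine mul_le_mul_of_nonneg_left ?_ (hζ0 _)
      rw [map_smul, smul_eq_mul]
      have k4 := mul_le_mul_of_nonneg_left k3 (sq_nonneg (cex (s * sg Z.T t) R P (gm k h y)))
      refine le_trans (le_of_eq ?_) k4
      ring
    have t0 : ∀ t ∈ Ioo 0 Z.T, ∀ y, 0 ≤ tden Z.T s R P k h u t y := by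
      intro t ht y
      unfold tden
      have := (mul_pos (by linarith : 0 < s) (sg_pos ht)).le
      positivity
    have e4 : I2 volume Z.T (gm k h ⁻¹' Metric.ball x0 (R0 / 4))
        (bflx Z.c Z.T s R P b k σ h ζ u ut) ≤ I2 volume Z.T (gm k h ⁻¹' K)
        (bflx Z.c Z.T s R P b k σ h ζ u ut) := by
      refine I2_set_mono mY cYc.measurableSet vYc hYK gB fun t ht y hy => ?_
      exact (mul_nonneg (hζ0 _) (mul_nonneg hc1.le (t0 t ht y))).trans (key t ht y hy)
    have key2 : ∀ t ∈ Ioo 0 Z.T, ∀ y ∈ gm k h ⁻¹' Metric.ball x0 (R0 / 4),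
        c1 * tden Z.T s R P k h u t y ≤ bflx Z.c Z.T s R P b k σ h ζ u ut t y := by
      intro t ht y hy
      have := key t ht y (hYK hy)
      rwa [hζone, one_mul] at this
      · have := hy; rw [mem_preimage, Metric.mem_ball, dist_eq_norm] at this; linarith
      · rw [hfdef, rt_gm]; linarith
    have tc : ContinuousOn (fun q : ℝ × (Fin m → ℝ) => c1 * tden Z.T s R P k h u q.1 q.2)
        (Ioo 0 Z.T ×ˢ (gm k h ⁻¹' Metric.ball x0 (R0 / 4))) := by
      have a1 : ContinuousOn (fun q : ℝ × Eucl (m + 1) => c1 * (cex (s * sg Z.T q.1) R P q.2 ^ 2 *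
          ((s * sg Z.T q.1) ^ 3 * u q.1 q.2 ^ 2))) (Ioo 0 Z.T ×ˢ closure Z.B) :=
        continuousOn_const.mul (((cont_cex Z.T s R _ hP).pow 2).mul
          (((cont_sgS Z.T s _).pow 3).mul (hsol.cu'.pow 2)))
      exact a1.comp (f := fun q : ℝ × (Fin m → ℝ) => (q.1, gm k h q.2))
        (continuous_fst.prodMk (gc.comp continuous_snd)).continuousOn
        fun q hq => ⟨hq.1, frontier_subset_closure (hYf _ (hYK hq.2))⟩
    have e5 : c1 * I2 volume Z.T (gm k h ⁻¹' Metric.ball x0 (R0 / 4)) (tden Z.T s R P k h u) ≤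
        I2 volume Z.T (gm k h ⁻¹' Metric.ball x0 (R0 / 4))
        (bflx Z.c Z.T s R P b k σ h ζ u ut) := by
      rw [← I2_const_mul]
      refine I2_mono mY vY (Gd.of_le tc (gB.mono hYK) fun t ht y hy => ?_) (gB.mono hYK) key2
      rw [abs_of_nonneg (mul_nonneg hc1.le (t0 t ht y))]
      exact key2 t ht y hy
    have p1 : 0 ≤ I2 volume Z.T A (wden Z.T s R P u ut) :=
      I2_nonneg mA fun t ht x _ => wden_nonneg (by linarith) R ht x
    have p2 : 0 ≤ I2 volume Z.T (gm k h ⁻¹' Metric.ball x0 (R0 / 4)) (tden Z.T s R P k h u) :=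
      I2_nonneg mY fun t ht y _ => t0 t ht y
    have hmin : 0 < min (c' * ca) c1 := lt_min (by positivity) hc1
    rw [div_mul_eq_mul_div, le_div_iff₀ hmin]
    have e6 := mul_le_mul_of_nonneg_left e2 hc'.le
    have e7 := mul_le_mul_of_nonneg_right (min_le_left (c' * ca) c1) p1
    have e8 := mul_le_mul_of_nonneg_right (min_le_right (c' * ca) c1) p2
    rw [← hfdef] at e1
    linarith only [e1, e3, e4, e5, e6, e7, e8]
end

section
variable {m : ℕ}

lemma Gd.comp {X Y : Type*} [MetricSpace X] [MetricSpace Y] {T : ℝ} {A : Set X} {D : Set Y}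
    {F : ℝ → X → ℝ} (hf : Gd T A F) {φ : Y → X} (hφ : Continuous φ) (h : ∀ y ∈ D, φ y ∈ A) :
    Gd T D (fun t y => F t (φ y)) :=
  ⟨hf.1.comp (f := fun q : ℝ × Y => (q.1, φ q.2))
    (continuous_fst.prodMk (hφ.comp continuous_snd)).continuousOn fun q hq => ⟨hq.1, h _ hq.2⟩,
    hf.2.imp fun _ hM t ht y hy => hM t ht _ (h y hy)⟩

lemma wden_NN (Z : Stp n) {P : Eucl n → ℝ} (hP : ContDiff ℝ 2 P) {K : Set (Eucl n)}
    (hK : IsCompact K) {pm : ℝ} (hpm : ∀ x ∈ K, P x ≤ pm) {D : Set (Eucl n)} (mD : MeasurableSet D)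
    (sD : D ⊆ K ∩ Z.B) : ∃ C : ℝ, 0 < C ∧ ∀ s, 1 ≤ s → ∀ u ut, Z.Adm u ut →
      I2 volume Z.T D (wden Z.T s (pm + 2) P u ut) ≤ C * NN Z.T u ut Z.B s := by
  obtain ⟨C, hC, H⟩ := wden_up hP hK Z.hT (pm + 2) one_pos
  refine ⟨C, hC, fun s hs u ut hu => ?_⟩
  have sc : D ⊆ closure Z.B := fun x hx => subset_closure (sD hx).2
  have h1 : NN Z.T u ut D s ≤ NN Z.T u ut Z.B s :=
    Z.NN_mono hu (by linarith) mD Z.hB.measurableSet subset_closure fun x hx => (sD hx).2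
  refine le_trans ?_ (mul_le_mul_of_nonneg_left h1 hC.le)
  unfold NN
  rw [← I2_const_mul]
  refine I2_mono mD (Z.vol_ne_top sc)
    ((wden_gd hP hK Z.hT one_pos (fun x hx => (hpm x hx).trans (by linarith)) hs Z.hBb
      (Z.adm _ _ hu)).mono fun x hx => ⟨(sD hx).1, sc hx⟩)
    ((Z.gd hu (by linarith) sc).const_mul _) fun t ht x hx => ?_
  have := H s hs u ut t ht x (sD hx).1 pm (hpm x (sD hx).1)
  have e : s * (pm + 2 - pm - 1) = s := by ring
  rwa [e] at this

/-- time weight -/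
def tw (T s R : ℝ) (g0 : ℝ → ℝ) (t : ℝ) : ℝ :=
  Real.exp (-(2 * R * (s * sg T t))) * ((s * sg T t) ^ 3 * g0 t ^ 2)

lemma tw_int {T : ℝ} (hT : 0 < T) {s R : ℝ} (hs : 1 ≤ s) (hR : 0 < R) {g0 : ℝ → ℝ}
    (hg : ContinuousOn g0 (Icc 0 T)) (h0 : ∀ t ∈ Ioo 0 T, g0 t ≠ 0) :
    0 < ∫ t in Ioo 0 T, tw T s R g0 t := by
  have hp : ∀ t ∈ Ioo 0 T, 0 < tw T s R g0 t := by
    intro t ht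
    have h1 := mul_pos (by linarith : 0 < s) (sg_pos ht)
    have h2 := h0 t ht
    unfold tw
    positivity
  obtain ⟨M, hb⟩ := isCompact_Icc.exists_bound_of_continuousOn hg
  simp only [Real.norm_eq_abs] at hb
  have hintg : IntegrableOn (tw T s R g0) (Ioo 0 T) := by
    have hc : ContinuousOn (tw T s R g0) (Ioo 0 T) := by
      have a1 : ContinuousOn (fun t => s * sg T t) (Ioo 0 T) := continuousOn_const.mul (sg_cont T)
      exact ((continuousOn_const.mul a1).neg.rexp).mul
        ((a1.pow 3).mul ((hg.mono Ioo_subset_Icc_self).pow 2))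
    refine IntegrableOn.of_bound (C := 6 / (2 * R) ^ 3 * M ^ 2) (by simp)
      (hc.aestronglyMeasurable measurableSet_Ioo) ?_
    filter_upwards [ae_restrict_mem measurableSet_Ioo] with t ht
    rw [Real.norm_eq_abs, abs_of_pos (hp t ht)]
    have h1 := mul_pos (by linarith : 0 < s) (sg_pos ht)
    have h2 := pow3_exp (2 * R) (s * sg T t) (by positivity) h1.le
    unfold tw
    have h3 : g0 t ^ 2 ≤ M ^ 2 := sq_le_sq' (by
      have := neg_le_of_abs_le (hb t (Ioo_subset_Icc_self ht)); linarith)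
      (le_of_abs_le (hb t (Ioo_subset_Icc_self ht)))
    have h4 : Real.exp (-(2 * R * (s * sg T t))) * (s * sg T t) ^ 3 ≤ 6 / (2 * R) ^ 3 := by
      rw [Real.exp_neg, inv_mul_le_iff₀ (Real.exp_pos _)]
      exact h2.trans (le_of_eq (mul_comm _ _))
    rw [← mul_assoc]
    exact mul_le_mul h4 h3 (sq_nonneg _) (by positivity)
  rw [setIntegral_pos_iff_support_of_nonneg_ae _ hintg]
  · have : Function.support (tw T s R g0) ∩ Ioo 0 T = Ioo 0 T :=
      inter_eq_right.2 fun t ht => (hp t ht).ne'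
    rw [this]; simpa using hT
  · filter_upwards [ae_restrict_mem measurableSet_Ioo] with t ht using (hp t ht).le

theorem S_HH (Z : Stp (m + 1)) (hB4 : HasC4Boundary Z.B) {ν : Eucl (m + 1) → Eucl (m + 1)}
    (hν : IsOutwardNormalField Z.B ν) {L : ℝ} (hL : 0 ≤ L)
    (hbd : ∀ u ut, Z.Adm u ut → ∀ t ∈ Ioo 0 Z.T, ∀ x ∈ frontier Z.B, |ut t x| ≤ L * |u t x| ∧
      ∃ μ : ℝ, ‖gradient (u t) x - μ • ν x‖ ≤ L * |u t x|)
    (hintg : ∀ K : Set (Eucl (m + 1)), IsCompact K → K ⊆ Z.B → Z.HH K)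
    {x0 : Eucl (m + 1)} (hx0f : x0 ∈ frontier Z.B) :
    ∃ V ∈ 𝓝 x0, ∃ A, MeasurableSet A ∧ A ⊆ closure Z.B ∧ V ∩ Z.B ⊆ A ∧ Z.HH A := by
  obtain ⟨k, σ, h, U, hx0, ch⟩ := exists_chart hB4 hx0f
  obtain ⟨P, K, A, Z1, Z2, V, ρ, pin, pout, hP, hP0, hK, mA, cZ1, m2, sA, s1, s2, hp, hA, h2, hV,
    hVA, hVf, hY, H⟩ := S_patch Z hν hL hbd ch hx0 hx0f
  refine ⟨V, hV, A, mA, fun x hx => (sA hx).2, hVA, ?_⟩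
  refine Z.HH_prop hP hK mA cZ1.measurableSet m2 sA
    (fun x hx => ⟨(s1 hx).1, subset_closure (s1 hx).2⟩) s2 hp hA h2
    (hintg Z1 cZ1 fun x hx => (s1 hx).2) fun R r hr hR => ?_
  obtain ⟨s0, hs0, C, hC, H⟩ := H R r hr hR
  refine ⟨s0, hs0, C, hC, fun s hs => ⟨0, le_rfl, fun u ut hu => ?_⟩⟩
  have h1 := H s hs u ut hu
  have h3 : 0 ≤ I2 volume Z.T (gm k h ⁻¹' Metric.ball x0 ρ) (tden Z.T s R P k h u) := by
    refine I2_nonneg ((Metric.isOpen_ball.preimage (gm_cont k ch.hh.continuous)).measurableSet)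
      fun t ht y _ => ?_
    unfold tden
    have := (mul_pos (by linarith : 0 < s) (sg_pos ht)).le
    positivity
  linarith

theorem S_trace (Z : Stp (m + 1)) (hB4 : HasC4Boundary Z.B) {ν : Eucl (m + 1) → Eucl (m + 1)}
    (hν : IsOutwardNormalField Z.B ν) {L : ℝ} (hL : 0 ≤ L)
    (hbd : ∀ u ut, Z.Adm u ut → ∀ t ∈ Ioo 0 Z.T, ∀ x ∈ frontier Z.B, |ut t x| ≤ L * |u t x| ∧
      ∃ μ : ℝ, ‖gradient (u t) x - μ • ν x‖ ≤ L * |u t x|)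
    {g0 : ℝ → ℝ} (hg : ContinuousOn g0 (Icc 0 Z.T)) (h0 : ∀ t ∈ Ioo 0 Z.T, g0 t ≠ 0)
    {x0 : Eucl (m + 1)} (hx0f : x0 ∈ frontier Z.B) :
    ∃ V ∈ 𝓝 x0, ∀ a1 : ℝ, 0 ≤ a1 → ∃ C : ℝ, 0 ≤ C ∧ ∀ u ut, Z.Adm u ut → ∀ w : Eucl (m + 1) → ℝ,
      Continuous w → (∀ t ∈ Ioo 0 Z.T, ∀ x ∈ frontier Z.B, u t x = g0 t * w x) →
      ∫ x in frontier Z.B ∩ V, w x ^ 2 ∂μH[(m:ℝ)] ≤ C * NN Z.T u ut Z.B a1 := by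
  obtain ⟨k, σ, h, U, hx0, ch⟩ := exists_chart hB4 hx0f
  obtain ⟨P, K, A, Z1, Z2, V, ρ, pin, pout, hP, hP0, hK, mA, cZ1, m2, sA, s1, s2, hp, hA, h2, hV,
    hVA, hVf, hY, H⟩ := S_patch Z hν hL hbd ch hx0 hx0f
  obtain ⟨pm, hpm0, hpm⟩ := exists_bound_on hK hP.continuous.continuousOn
  have hpm' : ∀ x ∈ K, P x ≤ pm := fun x hx => le_of_abs_le (hpm x hx)
  have hR : ∀ x ∈ K, P x ≤ pm + 2 - 1 := fun x hx => (hpm' x hx).trans (by linarith)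
  obtain ⟨s0, hs0, C, hC, H⟩ := H (pm + 2) 1 one_pos hR
  obtain ⟨C1, hC1, H1⟩ := wden_NN Z hP hK hpm' cZ1.measurableSet s1
  obtain ⟨C2, hC2, H2⟩ := wden_NN Z hP hK hpm' m2 s2
  obtain ⟨L0, hL0⟩ := ch.lip
  obtain ⟨L', hL'⟩ := gm_lip k hL0
  have gc := gm_cont k ch.hh.continuous
  set Y := gm k h ⁻¹' Metric.ball x0 ρ with hYdef
  have mY : MeasurableSet Y := (Metric.isOpen_ball.preimage gc).measurableSet
  have vY : volume Y ≠ ⊤ := ne_top_of_le_ne_top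
    (gm_pre_compact k ch.hh.continuous hK).measure_ne_top (measure_mono fun y hy => (hY y hy).1)
  refine ⟨V, hV, fun a1 ha1 => ?_⟩
  set s := max s0 a1 with hs
  have hs1 : 1 ≤ s := hs0.trans (le_max_left _ _)
  have hΦ := tw_int Z.hT hs1 (by linarith : 0 < pm + 2) hg h0
  set Φ := ∫ t in Ioo 0 Z.T, tw Z.T s (pm + 2) g0 t with hΦdef
  refine ⟨(L':ℝ) ^ m * (C * (C1 + C2) / Φ), by positivity, fun u ut hu w hw hu0 => ?_⟩
  have hsol := Z.adm _ _ hu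
  have iw : IntegrableOn (fun y => w (gm k h y) ^ 2) Y := by
    refine IntegrableOn.mono_set ?_ (fun y hy => (hY y hy).1 : Y ⊆ gm k h ⁻¹' K)
    exact ((hw.comp gc).pow 2).continuousOn.integrableOn_compact
      (gm_pre_compact k ch.hh.continuous hK)
  have k1 := gm_int_ge k ch.hh.continuous hL' mY (fun x hx => hVf hx)
    (f := fun x => w x ^ 2) (fun x => sq_nonneg _) iw
  refine k1.trans ?_
  rw [mul_assoc]
  refine mul_le_mul_of_nonneg_left ?_ (by positivity)
  rw [div_mul_eq_mul_div, le_div_iff₀ hΦ]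
  have k2 := H s (le_max_left _ _) u ut hu
  have k3 := H1 s hs1 u ut hu
  have k4 := H2 s hs1 u ut hu
  have k5 := Z.NN_B_anti hu ha1 (le_max_right s0 a1)
  have p1 : 0 ≤ I2 volume Z.T A (wden Z.T s (pm + 2) P u ut) :=
    I2_nonneg mA fun t ht x _ => wden_nonneg (by linarith) _ ht x
  have t0 : ∀ t ∈ Ioo 0 Z.T, ∀ y, 0 ≤ tden Z.T s (pm + 2) P k h u t y := by
    intro t ht y
    unfold tden
    have := (mul_pos (by linarith : 0 < s) (sg_pos ht)).le
    positivity
  have gw : Gd Z.T Y fun t y => wden Z.T s (pm + 2) P u ut t (gm k h y) :=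
    (wden_gd hP hK Z.hT one_pos hR hs1 Z.hBb hsol).comp gc
      fun y hy => ⟨(hY y hy).1, frontier_subset_closure (hY y hy).2⟩
  have tle : ∀ t ∈ Ioo 0 Z.T, ∀ y, tden Z.T s (pm + 2) P k h u t y ≤
      wden Z.T s (pm + 2) P u ut t (gm k h y) := by
    intro t ht y
    unfold tden wden den
    refine mul_le_mul_of_nonneg_left ?_ (sq_nonneg _)
    have := (mul_pos (by linarith : 0 < s) (sg_pos ht)).le
    exact le_add_of_nonneg_left (by positivity)
  have tc : ContinuousOn (fun q : ℝ × (Fin m → ℝ) => tden Z.T s (pm + 2) P k h u q.1 q.2)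
      (Ioo 0 Z.T ×ˢ Y) := by
    have a1 : ContinuousOn (fun q : ℝ × Eucl (m + 1) => (cex (s * sg Z.T q.1) (pm + 2) P q.2 ^ 2 *
        ((s * sg Z.T q.1) ^ 3 * u q.1 q.2 ^ 2))) (Ioo 0 Z.T ×ˢ closure Z.B) :=
      ((cont_cex Z.T s (pm + 2) _ hP).pow 2).mul
        (((cont_sgS Z.T s _).pow 3).mul (hsol.cu'.pow 2))
    exact a1.comp (f := fun q : ℝ × (Fin m → ℝ) => (q.1, gm k h q.2))
      (continuous_fst.prodMk (gc.comp continuous_snd)).continuousOn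
      fun q hq => ⟨hq.1, frontier_subset_closure (hY _ hq.2).2⟩
  have gt : Gd Z.T Y (tden Z.T s (pm + 2) P k h u) := Gd.of_le tc gw fun t ht y hy => by
    rw [abs_of_nonneg (t0 t ht y)]; exact tle t ht y
  have lo : ∀ t ∈ Ioo 0 Z.T, ∀ y ∈ Y, tw Z.T s (pm + 2) g0 t * w (gm k h y) ^ 2 ≤
      tden Z.T s (pm + 2) P k h u t y := by
    intro t ht y hy
    unfold tw tden cex
    rw [hu0 t ht _ (hY y hy).2, mul_pow (g0 t), ← Real.exp_nat_mul]
    have h1 := mul_pos (by linarith : 0 < s) (sg_pos ht)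
    have h3 : Real.exp (-(2 * (pm + 2) * (s * sg Z.T t))) ≤
        Real.exp ((2:ℕ) * (s * sg Z.T t * (P (gm k h y) - (pm + 2)))) := by
      rw [Real.exp_le_exp]
      have := mul_pos h1 (hP0 (gm k h y))
      push_cast
      nlinarith only [this]
    have h4 := mul_le_mul_of_nonneg_right h3
      (by positivity : 0 ≤ (s * sg Z.T t) ^ 3 * (g0 t ^ 2 * w (gm k h y) ^ 2))
    refine le_trans (le_of_eq ?_) h4
    ring
  have gl : Gd Z.T Y fun t y => tw Z.T s (pm + 2) g0 t * w (gm k h y) ^ 2 := by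
    refine Gd.of_le ?_ gt fun t ht y hy => ?_
    · have a1 : ContinuousOn (fun t => s * sg Z.T t) (Ioo 0 Z.T) :=
        continuousOn_const.mul (sg_cont Z.T)
      have a2 : ContinuousOn (tw Z.T s (pm + 2) g0) (Ioo 0 Z.T) :=
        ((continuousOn_const.mul a1).neg.rexp).mul
          ((a1.pow 3).mul ((hg.mono Ioo_subset_Icc_self).pow 2))
      exact (a2.comp continuousOn_fst fun q hq => hq.1).mul
        ((hw.comp (gc.comp continuous_snd)).pow 2).continuousOn
    · rw [abs_of_nonneg]
      · exact lo t ht y hy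
      · have h1 := (mul_pos (by linarith : 0 < s) (sg_pos ht)).le
        unfold tw
        positivity
  have k6 := I2_mono mY vY gl gt lo
  have k7 : I2 volume Z.T Y (fun t y => tw Z.T s (pm + 2) g0 t * w (gm k h y) ^ 2) =
      (∫ y in Y, w (gm k h y) ^ 2) * Φ := by
    unfold I2
    simp only [integral_const_mul, integral_mul_const]
    rw [mul_comm]
  have k8 : I2 volume Z.T Z1 (wden Z.T s (pm + 2) P u ut) +
      I2 volume Z.T Z2 (wden Z.T s (pm + 2) P u ut) ≤ (C1 + C2) * NN Z.T u ut Z.B a1 := by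
    have := mul_le_mul_of_nonneg_left k5 (by positivity : 0 ≤ C1 + C2)
    linarith
  have k9 := mul_le_mul_of_nonneg_left k8 hC
  rw [k7] at k6
  linarith
end

section
variable {m : ℕ}

theorem Gam_seed (Z : Stp (m + 1)) {Ω : Set (Eucl (m + 1))} (hΩ4 : HasC4Boundary Ω)
    (hΩb : Bornology.IsBounded Ω) (hΩB : closure Ω ⊆ Z.B)
    (hEn : ∀ u ut, Z.Adm u ut → I2 μH[(m:ℝ)] Z.T (frontier Ω) (nden Z.T 0 u ut) ≤ Z.En u ut)
    {x0 : Eucl (m + 1)} (hx0f : x0 ∈ frontier Ω) :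
    ∃ x1 : Eucl (m + 1), ∃ r1 > 0, Metric.ball x1 r1 ⊆ Z.B ∧ Z.HH (Metric.ball x1 r1) := by
  obtain ⟨k, σ, h, U1, hx1, ch1⟩ := exists_chart hΩ4 hx0f
  have ch : Chart Ω k σ h (U1 ∩ Z.B) := ch1.mono (ch1.hU.inter Z.hB) inter_subset_left
  have hx0 : x0 ∈ U1 ∩ Z.B := ⟨hx1, hΩB (frontier_subset_closure hx0f)⟩
  set U := U1 ∩ Z.B with hU
  have hUB : U ⊆ Z.B := inter_subset_right
  set f := rt k σ h with hfdef
  have hf : ContDiff ℝ 2 f := rt_contDiff k σ ch.hh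
  have hf1 : ∀ x, 1 ≤ ‖gradient f x‖ := rt_grad_norm k ch.hσ (ch.hh.of_le one_le_two)
  obtain ⟨ρ, hρ, hρU⟩ := Metric.isOpen_iff.1 ch.hU x0 hx0
  set R0 := min (ρ / 2) (1 / 4) with hR0def
  have hR0 : 0 < R0 := lt_min (by positivity) (by norm_num)
  have hR2 : R0 ≤ ρ / 2 := min_le_left _ _
  have hR3 : R0 ≤ 1 / 4 := min_le_right _ _
  set K := Metric.closedBall x0 R0 with hKdef
  have hK : IsCompact K := isCompact_closedBall x0 R0
  have hKU : K ⊆ U := (Metric.closedBall_subset_ball (by linarith)).trans hρU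
  have hKB : K ⊆ Z.B := hKU.trans hUB
  have hfx0 : f x0 = 0 := (ch.memf x0 hx0).1 hx0f
  obtain ⟨l, hl, b, hb, c0, hc0, hPC⟩ := patch_weight Z.c hf hf1 (τ := 1) (by simp) x0 hR3
  set P : Eucl (m + 1) → ℝ := fun x => Real.exp (l * (1 * f x - ‖x - x0‖ ^ 2)) with hPdef
  have hψ : ContDiff ℝ 2 fun x : Eucl (m + 1) => 1 * f x - ‖x - x0‖ ^ 2 :=
    (contDiff_const.mul hf).sub ((contDiff_id.sub contDiff_const).norm_sq ℝ)
  have hP : ContDiff ℝ 2 P := Real.contDiff_exp.comp (contDiff_const.mul hψ)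
  have hδ : 0 < R0 ^ 2 := by positivity
  obtain ⟨ζ, hζ1, hζc, hζ0, hζs, hζone, hζd⟩ := patch_cutoff (hf.of_le one_le_two) x0 hR0 hδ
  have hζK : tsupport ζ ⊆ K := hζs.trans inter_subset_left
  have fc : Continuous f := hf.continuous
  have nc : Continuous fun x : Eucl (m + 1) => ‖x - x0‖ := by fun_prop
  set A := Metric.ball x0 (R0 / 4) ∩ {x | -(R0 ^ 2 / 16) < f x} ∩ {x | f x < 0} with hA
  set Z2 := K ∩ {x | f x < 0} ∩ {x | 1 * f x - ‖x - x0‖ ^ 2 ≤ -(R0 ^ 2 / 4)} with hZ2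
  have mlt : MeasurableSet {x | f x < 0} := (isOpen_lt fc continuous_const).measurableSet
  have oA : IsOpen A := (Metric.isOpen_ball.inter
    (isOpen_lt continuous_const fc)).inter (isOpen_lt fc continuous_const)
  have mA : MeasurableSet A := oA.measurableSet
  have m2 : MeasurableSet Z2 := (hK.measurableSet.inter mlt).inter
    (isClosed_le hψ.continuous continuous_const).measurableSet
  have hbK : Metric.ball x0 (R0 / 4) ⊆ K :=
    Metric.ball_subset_closedBall.trans (Metric.closedBall_subset_closedBall (by linarith))
  have sAB : A ⊆ Z.B := fun x hx => hKB (hbK hx.1.1)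
  have sA : A ⊆ K ∩ closure Z.B := fun x hx => ⟨hbK hx.1.1, subset_closure (sAB hx)⟩
  have s2 : Z2 ⊆ K ∩ Z.B := fun x hx => ⟨hx.1.1, hKB hx.1.1⟩
  have hYf : ∀ y ∈ gm k h ⁻¹' K, gm k h y ∈ frontier Ω := fun y hy =>
    (ch.memf _ (hKU hy)).2 (rt_gm k σ h y)
  have gc := gm_cont k ch.hh.continuous
  have cYc := gm_pre_compact k ch.hh.continuous hK
  have vYc : volume (gm k h ⁻¹' K) ≠ ⊤ := cYc.measure_ne_top
  have fin : μH[(m:ℝ)] (frontier Ω) ≠ ⊤ := (muH_finite hΩ4 hΩb).ne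
  have mF : MeasurableSet (frontier Ω) := isClosed_frontier.measurableSet
  have hFB : frontier Ω ⊆ closure Z.B :=
    frontier_subset_closure.trans (hΩB.trans subset_closure)
  have hHA : Z.HH A := by
    refine Z.HH_prop hP hK mA MeasurableSet.empty m2 sA (empty_subset _) s2
      (pin := Real.exp (l * -(R0 ^ 2 / 8))) (pout := Real.exp (l * -(R0 ^ 2 / 4))) ?_ ?_ ?_
      Z.HH_empty ?_
    · rw [Real.exp_lt_exp]
      have : 0 < l * R0 ^ 2 := by positivity
      nlinarith only [this]
    · intro x hx
      rw [Real.exp_le_exp]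
      have h1 := hx.1.1
      have h2 : -(R0 ^ 2 / 16) < f x := hx.1.2
      rw [Metric.mem_ball, dist_eq_norm] at h1
      refine mul_le_mul_of_nonneg_left ?_ hl.le
      nlinarith only [h1, h2, norm_nonneg (x - x0)]
    · intro x hx
      rw [Real.exp_le_exp]
      exact mul_le_mul_of_nonneg_left hx.2 hl.le
    · intro R r hr hR
      obtain ⟨s0, hs0, c', hc', H⟩ := carleman_bdry Z.c hP hb hK hc0 hPC Z.hT hr hR
      obtain ⟨ca, hca, Hlow⟩ := cut_low Z.c hP hK Z.hT hr hR Z.hBb hζ1.continuous hζc hζ0 hζK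
        mlt (fun x hx => subset_closure (hKB (hζK hx.1))) mA (fun x hx => hx.2)
        (fun x hx => hζone x (by
          have := hx.1.1; rw [Metric.mem_ball, dist_eq_norm] at this; linarith) (by
          have : -(R0 ^ 2 / 16) < f x := hx.1.2
          linarith))
      have hD : ∀ x ∈ {x | f x < 0}, fderiv ℝ ζ x ≠ 0 → x ∈ ∅ ∪ Z2 := by
        intro x hx0' hx
        have hxs : x ∈ tsupport ζ := by
          by_contra hxK
          refine hx ?_
          rw [(notMem_tsupport_iff_eventuallyEq.1 hxK).fderiv_eq]; simp
        have hf0 : f x < 0 := hx0'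
        refine Or.inr ⟨⟨hζK hxs, hx0'⟩, ?_⟩
        rw [mem_ofPred_eq]
        rcases hζd x hx with h1 | h1
        · nlinarith only [h1, hf0, hR0]
        · nlinarith only [h1, hR0, sq_nonneg ‖x - x0‖]
      obtain ⟨Cz, hCz, Hup⟩ := cut_up Z.c hP hb hK Z.hT hr hR Z.hBb hζ1 hζc mlt MeasurableSet.empty
        m2 (empty_subset _) (fun x hx => ⟨(s2 hx).1, subset_closure (s2 hx).2⟩) hD
      obtain ⟨Cb, hCb, Hb⟩ := bflx_le Z.c hP hb hK R Z.hT (k := k) σ ch.hh hζ1.continuous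
      obtain ⟨Cw, hCw, Hw⟩ := wden_up hP hK Z.hT R hr
      refine ⟨s0, hs0, Cz / (c' * ca), by positivity, fun s hs =>
        ⟨Cb * Cw / (c' * ca), by positivity, fun u ut hu => ?_⟩⟩
      have hs1 : 1 ≤ s := hs0.trans hs
      have hsol := Z.adm _ _ hu
      have e1 := H s hs Z.B Z.hB Z.hBb u ut hsol k σ h U ch.hσ ch.hh ch.hU
        (fun x hx _ => hUB hx) (fun x hx _ => subset_closure (hUB hx)) ζ hζ1 hζc
        (hζK.trans hKU) hζK hζ0
      rw [bflx_int Z.c Z.T s R P b k σ h hζK u ut] at e1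
      have e2 := Hlow s hs1 u ut hsol
      have e3 := Hup s hs1 u ut hsol
      have gB := bflx_gd Z.c hP hb hK Z.hT hr hR hs1 Z.hBb hsol (k := k) σ ch.hh
        (fun y hy => subset_closure (hKB hy)) hζ1.continuous
      have gN := Z.gd hu le_rfl (A := closure Z.B) subset_rfl
      have gN1 : Gd Z.T (gm k h ⁻¹' K) fun t y => nden Z.T 0 u ut t (gm k h y) :=
        gN.comp gc fun y hy => subset_closure (hKB hy)
      have gN2 : Gd Z.T (frontier Ω) (nden Z.T 0 u ut) := gN.mono hFB
      have k1 : ∀ t ∈ Ioo 0 Z.T, ∀ y ∈ gm k h ⁻¹' K,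
          -(Cb * Cw) * nden Z.T 0 u ut t (gm k h y) ≤ bflx Z.c Z.T s R P b k σ h ζ u ut t y := by
        intro t ht y hy
        have a1 := neg_le_of_abs_le (Hb s hs1 u ut t ht y hy)
        have a2 := Hw s hs1 u ut t ht _ hy (R - r) (hR _ hy)
        have e0 : s * (R - (R - r) - r) = 0 := by ring
        rw [e0] at a2
        have a3 := mul_le_mul_of_nonneg_left a2 hCb.le
        linarith
      have e4 := I2_mono cYc.measurableSet vYc (gN1.const_mul (-(Cb * Cw))) gB k1
      rw [I2_const_mul] at e4
      have e5 : I2 volume Z.T (gm k h ⁻¹' K) (fun t y => nden Z.T 0 u ut t (gm k h y)) ≤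
          I2 μH[(m:ℝ)] Z.T (frontier Ω) (nden Z.T 0 u ut) := by
        refine setIntegral_mono_on (gN1.time cYc.measurableSet vYc) (gN2.time mF fin)
          measurableSet_Ioo fun t ht => ?_
        exact gm_int_le k ch.hh.continuous mF cYc.measurableSet hYf
          (fun x _ => nden_nonneg _ _ _ _ _ _) (gN2.slice mF fin ht)
      have e6 := mul_le_mul_of_nonneg_left (e5.trans (hEn u ut hu)) (by positivity : 0 ≤ Cb * Cw)
      have e7 := mul_le_mul_of_nonneg_left e2 hc'.le
      rw [← hfdef] at e1
      have hpos : 0 < c' * ca := by positivity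
      rw [div_mul_eq_mul_div, div_mul_eq_mul_div, ← add_div, le_div_iff₀ hpos]
      linarith only [e1, e3, e4, e6, e7]
  obtain ⟨x1, hx1A⟩ : A.Nonempty := by
    have hV : Metric.ball x0 (R0 / 4) ∩ {x | -(R0 ^ 2 / 16) < f x} ∈ 𝓝 x0 :=
      Filter.inter_mem (Metric.ball_mem_nhds _ (by positivity))
      ((isOpen_lt continuous_const fc).mem_nhds (by rw [mem_ofPred_eq, hfx0]; linarith))
    obtain ⟨x, hx1, hx2⟩ := mem_closure_iff_nhds.1 (frontier_subset_closure hx0f) _ hV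
    exact ⟨x, hx1, (ch.mem x (hKU (hbK hx1.1))).1 hx2⟩
  obtain ⟨r1, hr1, hball⟩ := Metric.isOpen_iff.1 oA x1 hx1A
  exact ⟨x1, r1, hr1, hball.trans sAB, Z.HH_mono Metric.isOpen_ball.measurableSet mA
    (sAB.trans subset_closure) hball hHA⟩

/-- Global estimate. -/
theorem global_est (Z : Stp (m + 1)) (hconn : IsPreconnected Z.B) (hB4 : HasC4Boundary Z.B)
    {ν : Eucl (m + 1) → Eucl (m + 1)}
    (hν : IsOutwardNormalField Z.B ν) {L : ℝ} (hL : 0 ≤ L)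
    (hbd : ∀ u ut, Z.Adm u ut → ∀ t ∈ Ioo 0 Z.T, ∀ x ∈ frontier Z.B, |ut t x| ≤ L * |u t x| ∧
      ∃ μ : ℝ, ‖gradient (u t) x - μ • ν x‖ ≤ L * |u t x|)
    {x1 : Eucl (m + 1)} {r1 : ℝ} (hr1 : 0 < r1) (hb1 : Metric.ball x1 r1 ⊆ Z.B)
    (hH : Z.HH (Metric.ball x1 r1)) :
    ∃ a : ℝ, 0 ≤ a ∧ ∃ C : ℝ, 0 ≤ C ∧ ∀ u ut, Z.Adm u ut → NN Z.T u ut Z.B a ≤ C * Z.En u ut := by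
  have hpt : ∀ x ∈ Z.B, ∃ r > 0, Metric.ball x r ⊆ Z.B ∧ Z.HH (Metric.ball x r) :=
    fun x hx => Z.HH_connected hconn hr1 hb1 hH hx
  have hintg : ∀ K : Set (Eucl (m + 1)), IsCompact K → K ⊆ Z.B → Z.HH K := by
    intro K hK hKB
    obtain ⟨A, mA, sA, hA, hHA⟩ := Z.HH_compact hK fun x hx => by
      obtain ⟨r, hr, h1, h2⟩ := hpt x (hKB hx)
      exact ⟨Metric.ball x r, Metric.ball_mem_nhds x hr, Metric.ball x r,
        Metric.isOpen_ball.measurableSet, h1.trans subset_closure, inter_subset_left, h2⟩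
    exact Z.HH_mono hK.measurableSet mA sA hA hHA
  have hloc : ∀ x ∈ closure Z.B, ∃ V ∈ 𝓝 x, ∃ A, MeasurableSet A ∧ A ⊆ closure Z.B ∧
      V ∩ Z.B ⊆ A ∧ Z.HH A := by
    intro x hx
    by_cases hxB : x ∈ Z.B
    · obtain ⟨r, hr, h1, h2⟩ := hpt x hxB
      exact ⟨Metric.ball x r, Metric.ball_mem_nhds x hr, Metric.ball x r,
        Metric.isOpen_ball.measurableSet, h1.trans subset_closure, inter_subset_left, h2⟩
    · exact S_HH Z hB4 hν hL hbd hintg ⟨hx, fun h => hxB (interior_subset h)⟩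
  have hcov : ∃ A, MeasurableSet A ∧ A ⊆ closure Z.B ∧ closure Z.B ∩ Z.B ⊆ A ∧ Z.HH A :=
    Z.hBb.isCompact_closure.induction_on
    (p := fun s => ∃ A, MeasurableSet A ∧ A ⊆ closure Z.B ∧ s ∩ Z.B ⊆ A ∧ Z.HH A)
    ⟨∅, MeasurableSet.empty, empty_subset _, by simp, Z.HH_empty⟩
    (fun s t hst ⟨A, h1, h2, h3, h4⟩ => ⟨A, h1, h2, (inter_subset_inter_left _ hst).trans h3, h4⟩)
    (fun s t ⟨A, h1, h2, h3, h4⟩ ⟨A', h1', h2', h3', h4'⟩ => ⟨A ∪ A', h1.union h1',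
      union_subset h2 h2', by rw [union_inter_distrib_right]; exact union_subset_union h3 h3',
      Z.HH_union h1 h1' h2 h2' h4 h4'⟩)
    (fun x hx => by
      obtain ⟨V, hV, A, h1, h2, h3, h4⟩ := hloc x hx
      exact ⟨V, mem_nhdsWithin_of_mem_nhds hV, A, h1, h2, h3, h4⟩)
  obtain ⟨A, mA, sA, hBA, hHA⟩ := hcov
  rw [inter_eq_right.2 subset_closure] at hBA
  obtain ⟨κ, hκ, a0, ha0, C0, hC0, H⟩ := Z.HH_mono Z.hB.measurableSet mA sA hBA hHA
  -- choose `a` with `C0 * exp(-2 (κ-1) a 4/T²) ≤ 1/2`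
  have hT2 : 0 < 4 / Z.T ^ 2 := by have := Z.hT; positivity
  set q := 2 * (κ - 1) * (4 / Z.T ^ 2) with hq
  have hq0 : 0 < q := by have : 0 < κ - 1 := by linarith
                         positivity
  set a := max a0 (2 * C0 / q) with ha
  have haq : 2 * C0 ≤ q * a := by
    have := le_max_right a0 (2 * C0 / q)
    rw [div_le_iff₀ hq0] at this
    linarith
  have ha0' : 0 < a := lt_of_lt_of_le ha0 (le_max_left _ _)
  obtain ⟨C1, hC1, H⟩ := H a (le_max_left _ _)
  refine ⟨a, ha0'.le, 2 * C1, by positivity, fun u ut hu => ?_⟩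
  have h1 := H u ut hu
  have h2 := Z.NN_exp hu ha0'.le (by nlinarith : a ≤ κ * a) Z.hB.measurableSet subset_closure
  have h3 : C0 * Real.exp (-(2 * (κ * a - a) * (4 / Z.T ^ 2))) ≤ 1 / 2 := by
    have e : 2 * (κ * a - a) * (4 / Z.T ^ 2) = q * a := by rw [hq]; ring
    rw [e, Real.exp_neg, ← div_eq_mul_inv, div_le_iff₀ (Real.exp_pos _)]
    have := Real.add_one_le_exp (q * a)
    linarith
  have h4 := NN_nonneg (T := Z.T) (u := u) (ut := ut) Z.hB.measurableSet a
  have h5 := mul_le_mul_of_nonneg_left h2 hC0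
  have h6 := mul_le_mul_of_nonneg_right h3 h4
  linarith
end

section
variable {m : ℕ}

lemma sq_intOn {D : Set (Eucl (m + 1))} (hD : HasC4Boundary D) (hb : Bornology.IsBounded D)
    {w : Eucl (m + 1) → ℝ} (hw : ContinuousOn w (frontier D)) :
    IntegrableOn (fun x => w x ^ 2) (frontier D) μH[(m:ℝ)] := by
  have hK : IsCompact (frontier D) :=
    Metric.isCompact_of_isClosed_isBounded isClosed_frontier
      (hb.closure.subset frontier_subset_closure)
  have hw2 : ContinuousOn (fun x => w x ^ 2) (frontier D) := hw.pow 2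
  obtain ⟨M, _, hM⟩ := exists_bound_on hK hw2
  refine IntegrableOn.of_bound (C := M) (muH_finite hD hb)
    (hw2.aestronglyMeasurable hK.measurableSet) ?_
  filter_upwards [ae_restrict_mem hK.measurableSet] with x hx using hM x hx

theorem abs_est (Z : Stp (m + 1)) (hconn : IsPreconnected Z.B) (hB4 : HasC4Boundary Z.B)
    {ν : Eucl (m + 1) → Eucl (m + 1)}
    (hν : IsOutwardNormalField Z.B ν) {L : ℝ} (hL : 0 ≤ L)
    (hbd : ∀ u ut, Z.Adm u ut → ∀ t ∈ Ioo 0 Z.T, ∀ x ∈ frontier Z.B, |ut t x| ≤ L * |u t x| ∧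
      ∃ μ : ℝ, ‖gradient (u t) x - μ • ν x‖ ≤ L * |u t x|)
    {g0 : ℝ → ℝ} (hg : ContinuousOn g0 (Icc 0 Z.T)) (h0 : ∀ t ∈ Ioo 0 Z.T, g0 t ≠ 0)
    {Ω : Set (Eucl (m + 1))} (hΩ4 : HasC4Boundary Ω)
    (hΩb : Bornology.IsBounded Ω) (hΩB : closure Ω ⊆ Z.B)
    (hEn : ∀ u ut, Z.Adm u ut → I2 μH[(m:ℝ)] Z.T (frontier Ω) (nden Z.T 0 u ut) ≤ Z.En u ut)
    (hne : (frontier Ω).Nonempty) :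
    ∃ C : ℝ, 0 ≤ C ∧ ∀ u ut, Z.Adm u ut → ∀ w : Eucl (m + 1) → ℝ,
      Continuous w → (∀ t ∈ Ioo 0 Z.T, ∀ x ∈ frontier Z.B, u t x = g0 t * w x) →
      ∫ x in frontier Z.B, w x ^ 2 ∂μH[(m:ℝ)] ≤ C * Z.En u ut := by
  obtain ⟨x0, hx0⟩ := hne
  obtain ⟨x1, r1, hr1, hb1, hH⟩ := Gam_seed Z hΩ4 hΩb hΩB hEn hx0
  obtain ⟨a, ha, C1, hC1, H1⟩ := global_est Z hconn hB4 hν hL hbd hr1 hb1 hH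
  have hK : IsCompact (frontier Z.B) :=
    Metric.isCompact_of_isClosed_isBounded isClosed_frontier
      (Z.hBb.closure.subset frontier_subset_closure)
  have hcov : ∃ A, MeasurableSet A ∧ A ⊆ frontier Z.B ∧ frontier Z.B ∩ frontier Z.B ⊆ A ∧
      ∃ C : ℝ, 0 ≤ C ∧ ∀ u ut, Z.Adm u ut → ∀ w : Eucl (m + 1) → ℝ,
      Continuous w → (∀ t ∈ Ioo 0 Z.T, ∀ x ∈ frontier Z.B, u t x = g0 t * w x) →
      ∫ x in A, w x ^ 2 ∂μH[(m:ℝ)] ≤ C * NN Z.T u ut Z.B a :=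
    hK.induction_on
    (p := fun s => ∃ A, MeasurableSet A ∧ A ⊆ frontier Z.B ∧ s ∩ frontier Z.B ⊆ A ∧
      ∃ C : ℝ, 0 ≤ C ∧ ∀ u ut, Z.Adm u ut → ∀ w : Eucl (m + 1) → ℝ,
      Continuous w → (∀ t ∈ Ioo 0 Z.T, ∀ x ∈ frontier Z.B, u t x = g0 t * w x) →
      ∫ x in A, w x ^ 2 ∂μH[(m:ℝ)] ≤ C * NN Z.T u ut Z.B a)
    ⟨∅, MeasurableSet.empty, empty_subset _, by simp, 0, le_rfl, fun u ut _ w _ _ => by simp⟩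
    (fun s t hst ⟨A, h1, h2, h3, h4⟩ => ⟨A, h1, h2, (inter_subset_inter_left _ hst).trans h3, h4⟩)
    (fun s t ⟨A, h1, h2, h3, c, hc, h4⟩ ⟨A', h1', h2', h3', c', hc', h4'⟩ => ⟨A ∪ A', h1.union h1',
      union_subset h2 h2', by rw [union_inter_distrib_right]; exact union_subset_union h3 h3',
      c + c', by positivity, fun u ut hu w hw hbw => by
        have hi := sq_intOn hB4 Z.hBb hw.continuousOn
        have e : A ∪ A' = A ∪ (A' \ A) := union_sdiff_self.symm
        rw [e, setIntegral_union disjoint_sdiff_right (h1'.diff h1) (hi.mono_set h2)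
          ((hi.mono_set h2').mono_set sdiff_subset), add_mul]
        refine add_le_add (h4 u ut hu w hw hbw) (le_trans ?_ (h4' u ut hu w hw hbw))
        exact setIntegral_mono_set (hi.mono_set h2')
          (Filter.Eventually.of_forall fun x => sq_nonneg (w x))
          (Filter.Eventually.of_forall sdiff_subset)⟩)
    (fun x hx => by
      obtain ⟨V, hV, H⟩ := S_trace Z hB4 hν hL hbd hg h0 hx
      obtain ⟨C, hC, H⟩ := H a ha
      refine ⟨V, mem_nhdsWithin_of_mem_nhds hV, toMeasurable μH[(m:ℝ)] (frontier Z.B ∩ V) ∩ frontier Z.B,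
        (measurableSet_toMeasurable _ _).inter hK.measurableSet, inter_subset_right,
        fun y hy => ⟨subset_toMeasurable _ _ ⟨hy.2, hy.1⟩, hy.2⟩, C, hC, fun u ut hu w hw hbw => ?_⟩
      have hi := sq_intOn hB4 Z.hBb hw.continuousOn
      refine le_trans ?_ (H u ut hu w hw hbw)
      have hfin : μH[(m:ℝ)] (frontier Z.B ∩ V) ≠ ⊤ :=
        ((measure_mono inter_subset_left).trans_lt (muH_finite hB4 Z.hBb)).ne
      rw [← Measure.restrict_toMeasurable hfin]
      refine setIntegral_mono_set ?_ (Filter.Eventually.of_forall fun x => sq_nonneg (w x))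
          (Filter.Eventually.of_forall inter_subset_left)
      rw [IntegrableOn, Measure.restrict_toMeasurable hfin]
      exact hi.mono_set inter_subset_left)
  obtain ⟨A, mA, sA, hBA, C, hC, H⟩ := hcov
  rw [inter_self] at hBA
  obtain rfl := subset_antisymm sA hBA
  refine ⟨C * C1, by positivity, fun u ut hu w hw hbw => ?_⟩
  refine (H u ut hu w hw hbw).trans ?_
  rw [mul_assoc]
  exact mul_le_mul_of_nonneg_left (H1 u ut hu) hC
end

section maxprinciple

/-- the Hessian is nonpositive at a local maximum -/
lemma hess_nonpos {P : Eucl n → ℝ} {x : Eucl n} (hP : ContDiffAt ℝ 2 P x) (hm : IsLocalMax P x)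
    (v : Eucl n) : ⟪v, fderiv ℝ (gradient P) x v⟫ ≤ 0 := by
  by_contra! hcon
  have hg0 : fderiv ℝ P x = 0 := hm.fderiv_eq_zero
  set φ : ℝ → ℝ := fun s => P (x + s • v) with hφ
  have hline : ContinuousAt (fun s : ℝ => x + s • v) 0 := by fun_prop
  have hx0 : x + (0:ℝ) • v = x := by simp
  have hlt : Filter.Tendsto (fun s : ℝ => x + s • v) (𝓝 0) (𝓝 x) := by
    have h := hline.tendsto
    beta_reduce at h
    rwa [hx0] at h
  have hdiff : ∀ᶠ y in 𝓝 x, DifferentiableAt ℝ P y := by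
    filter_upwards [hP.eventually (by simp)] with y hy using hy.differentiableAt two_ne_zero
  have hφ' : deriv φ =ᶠ[𝓝 0] fun s => ⟪v, gradient P (x + s • v)⟫ := by
    have : ∀ᶠ s in 𝓝 (0:ℝ), DifferentiableAt ℝ P (x + s • v) := hlt.eventually hdiff
    filter_upwards [this] with s hs
    have h1 : HasDerivAt (fun s : ℝ => x + s • v) v s := by
      simpa using ((hasDerivAt_id s).smul_const v).const_add x
    have h2 : HasDerivAt φ (fderiv ℝ P (x + s • v) v) s := hs.hasFDerivAt.comp_hasDerivAt s h1
    rw [h2.deriv, real_inner_comm, inner_grad]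
  have hg : DifferentiableAt ℝ (gradient P) x :=
    (gradient_contDiffAt hP).differentiableAt one_ne_zero
  have hφ2 : deriv (deriv φ) 0 = ⟪v, fderiv ℝ (gradient P) x v⟫ := by
    rw [hφ'.deriv_eq]
    have h1 : HasDerivAt (fun s : ℝ => x + s • v) v 0 := by
      simpa using ((hasDerivAt_id (0:ℝ)).smul_const v).const_add x
    have hg' : HasFDerivAt (gradient P) (fderiv ℝ (gradient P) x) (x + (0:ℝ) • v) := by
      rw [hx0]; exact hg.hasFDerivAt
    have h2 : HasDerivAt (fun s : ℝ => gradient P (x + s • v)) (fderiv ℝ (gradient P) x v) 0 :=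
      HasFDerivAt.comp_hasDerivAt (f := fun s : ℝ => x + s • v) 0 hg' h1
    have h3 : HasDerivAt (fun s : ℝ => ⟪v, gradient P (x + s • v)⟫)
        (⟪v, fderiv ℝ (gradient P) x v⟫ + ⟪(0 : Eucl n), gradient P (x + (0:ℝ) • v)⟫) 0 :=
      (hasDerivAt_const (0:ℝ) v).inner ℝ h2
    rw [h3.deriv, inner_zero_left, add_zero]
  have hφ1 : deriv φ 0 = 0 := by
    rw [hφ'.eq_of_nhds, real_inner_comm, inner_grad]
    simp [hg0]
  have hPc : ContinuousAt P (x + (0:ℝ) • v) := by rw [hx0]; exact hP.continuousAt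
  have hφc : ContinuousAt φ 0 := ContinuousAt.comp (f := fun s : ℝ => x + s • v) hPc hline
  have hmin : IsLocalMin φ 0 := isLocalMin_of_deriv_deriv_pos (by rw [hφ2]; exact hcon) hφ1 hφc
  have hmax : IsLocalMax φ 0 := by
    have : ∀ᶠ s in 𝓝 (0:ℝ), P (x + s • v) ≤ P x := hlt.eventually hm
    filter_upwards [this] with s hs
    simpa [hφ] using hs
  have hconst : φ =ᶠ[𝓝 0] fun _ => φ 0 := by
    filter_upwards [hmin, hmax] with s h1 h2 using le_antisymm h2 h1
  have : deriv (deriv φ) 0 = 0 := by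
    rw [hconst.deriv.deriv_eq]; simp
  rw [hφ2] at this
  linarith

lemma trace_nonpos (A H : Eucl n →L[ℝ] Eucl n) (hs : ∀ v w, ⟪A v, w⟫ = ⟪v, A w⟫)
    (hA : ∀ v, 0 ≤ ⟪v, A v⟫) (hH : ∀ v, ⟪v, H v⟫ ≤ 0) :
    ∑ i, A (H (EuclideanSpace.single i 1)) i ≤ 0 := by
  set T : Eucl n →ₗ[ℝ] Eucl n := (A : Eucl n →ₗ[ℝ] Eucl n) ∘ₗ (H : Eucl n →ₗ[ℝ] Eucl n)
  have hsym : (A : Eucl n →ₗ[ℝ] Eucl n).IsSymmetric := hs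
  have e1 := T.trace_eq_sum_inner (EuclideanSpace.basisFun (Fin n) ℝ)
  have hfr : Module.finrank ℝ (Eucl n) = n := by simp
  have e2 := T.trace_eq_sum_inner (hsym.eigenvectorBasis hfr)
  have e3 : ∑ i, A (H (EuclideanSpace.single i 1)) i =
      ∑ i, ⟪EuclideanSpace.basisFun (Fin n) ℝ i, T (EuclideanSpace.basisFun (Fin n) ℝ i)⟫ := by
    refine Finset.sum_congr rfl fun i _ => ?_
    rw [EuclideanSpace.basisFun_apply, EuclideanSpace.inner_single_left]
    simp [T]
  rw [e3, ← e1, e2]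
  refine Finset.sum_nonpos fun i _ => ?_
  set b := hsym.eigenvectorBasis hfr i
  have hb : A b = hsym.eigenvalues hfr i • b := hsym.apply_eigenvectorBasis hfr i
  have hl : 0 ≤ hsym.eigenvalues hfr i := by
    have := hA b
    rw [hb, inner_smul_right, real_inner_self_eq_norm_sq] at this
    have hn : ‖b‖ = 1 := (hsym.eigenvectorBasis hfr).norm_eq_one i
    rw [hn] at this; linarith
  have : ⟪b, T b⟫ = hsym.eigenvalues hfr i * ⟪b, H b⟫ := by
    change ⟪b, A (H b)⟫ = _
    rw [← hs, hb, inner_smul_left]; rfl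
  rw [this]
  exact mul_nonpos_of_nonneg_of_nonpos hl (hH b)

lemma L_max (c : Coef n) {P : Eucl n → ℝ} {x : Eucl n} (hP : ContDiffAt ℝ 2 P x)
    (hm : IsLocalMax P x) : c.L P x ≤ 0 := by
  have hg0 : gradient P x = 0 := by
    unfold gradient; rw [hm.fderiv_eq_zero]; simp
  have hg : DifferentiableAt ℝ (gradient P) x :=
    (gradient_contDiffAt hP).differentiableAt one_ne_zero
  have hZd : DifferentiableAt ℝ (c.Z P) x := (c.Z_contDiffAt hP).differentiableAt one_ne_zero
  have hZ : HasFDerivAt (c.Z P) _ x := (c.A_diff x).hasFDerivAt.clm_apply hg.hasFDerivAt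
  have e := c.L_mul P x
  rw [dv_smul (c.ω_diff x) hZd] at e
  have hZx : c.Z P x = 0 := by unfold Coef.Z; rw [hg0, map_zero]
  rw [hZx, map_zero, add_zero] at e
  rw [← mul_left_cancel₀ (c.ωpos x).ne' e]
  unfold dv
  rw [hZ.fderiv]
  have := trace_nonpos (c.A x) (fderiv ℝ (gradient P) x) (c.symm x) (c.nonneg x) (hess_nonpos hP hm)
  refine le_trans (le_of_eq ?_) this
  refine Finset.sum_congr rfl fun i _ => ?_
  simp [hg0]

lemma L_comb (c : Coef n) {U V W : Eucl n → ℝ} {x : Eucl n} (hU : ContDiffAt ℝ 2 U x)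
    (hV : ContDiffAt ℝ 2 V x) (hW : ContDiffAt ℝ 2 W x) (r ε k : ℝ) :
    c.L (fun y => U y + r * V y - k + ε * W y) x = c.L U x + r * c.L V x + ε * c.L W x := by
  have hd : ∀ {F : Eucl n → ℝ}, ContDiffAt ℝ 2 F x → ∀ᶠ y in 𝓝 x, DifferentiableAt ℝ F y := by
    intro F hF
    filter_upwards [hF.eventually (by simp)] with y hy using hy.differentiableAt two_ne_zero
  have hgr : (fun y => c.ω y • c.Z (fun y => U y + r * V y - k + ε * W y) y) =ᶠ[𝓝 x]
      fun y => (c.ω y • c.Z U y + r • (c.ω y • c.Z V y)) + ε • (c.ω y • c.Z W y) := by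
    filter_upwards [hd hU, hd hV, hd hW] with y h1 h2 h3
    have : gradient (fun y => U y + r * V y - k + ε * W y) y =
        gradient U y + r • gradient V y + ε • gradient W y := by
      have h : HasFDerivAt (fun y => U y + r * V y - k + ε * W y)
        (fderiv ℝ U y + r • fderiv ℝ V y + ε • fderiv ℝ W y) y :=
        ((h1.hasFDerivAt.add (h2.hasFDerivAt.const_mul r)).sub_const k).add
          (h3.hasFDerivAt.const_mul ε)
      unfold gradient
      rw [h.fderiv]; simp
    unfold Coef.Z
    rw [this]
    simp only [map_add, map_smul, smul_add]
    rw [smul_comm (c.ω y) r, smul_comm (c.ω y) ε]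
  have hz : ∀ {F : Eucl n → ℝ}, ContDiffAt ℝ 2 F x →
      DifferentiableAt ℝ (fun y => c.ω y • c.Z F y) x := fun hF =>
    (c.ω_diff x).smul ((c.Z_contDiffAt hF).differentiableAt one_ne_zero)
  have hsm : ∀ (q : ℝ) {F : Eucl n → ℝ}, ContDiffAt ℝ 2 F x →
      dv (fun y => q • (c.ω y • c.Z F y)) x = q * (c.ω x * c.L F x) := by
    intro q F hF
    rw [dv_smul (differentiableAt_const q) (hz hF), c.L_mul]; simp
  have e := c.L_mul (fun y => U y + r * V y - k + ε * W y) x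
  have d1 : DifferentiableAt ℝ (fun y => r • (c.ω y • c.Z V y)) x := (hz hV).const_smul r
  have d2 : DifferentiableAt ℝ (fun y => ε • (c.ω y • c.Z W y)) x := (hz hW).const_smul ε
  have d3 : DifferentiableAt ℝ (fun y => c.ω y • c.Z U y + r • (c.ω y • c.Z V y)) x := (hz hU).add d1
  rw [dv_congr hgr, dv_add d3 d2, dv_add (hz hU) d1, hsm r hV, hsm ε hW, c.L_mul] at e
  apply mul_left_cancel₀ (c.ωpos x).ne'
  rw [← e]; ring

/-- a strict subsolution -/
lemma exists_chi {m : ℕ} (c : Coef (m + 1)) {K : Set (Eucl (m + 1))} (hK : IsCompact K) :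
    ∃ χ : Eucl (m + 1) → ℝ, ContDiff ℝ 2 χ ∧ ∀ x ∈ K, 0 < c.L χ x := by
  set P : Eucl (m + 1) → ℝ := fun x => x 0 with hPdef
  have hP' : ∀ x, HasFDerivAt P (EuclideanSpace.proj (𝕜 := ℝ) (0 : Fin (m+1))) x := fun x =>
    (EuclideanSpace.proj (𝕜 := ℝ) (0 : Fin (m+1))).hasFDerivAt
  have hP : ContDiff ℝ 2 P := (EuclideanSpace.proj (𝕜 := ℝ) (0 : Fin (m+1))).contDiff
  have hgr : ∀ x, 1 ≤ ‖gradient P x‖ := by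
    intro x
    have h1 : ⟪gradient P x, EuclideanSpace.single 0 1⟫ = 1 := by
      rw [inner_grad, (hP' x).fderiv]; simp
    have h2 := real_inner_le_norm (gradient P x) (EuclideanSpace.single 0 1)
    rw [h1] at h2
    simpa using h2
  obtain ⟨a0, ha0, hell⟩ := c.elliptic_on hK
  obtain ⟨M, hM, hL⟩ := exists_bound_on hK (c.L_cont hP).continuousOn
  set S := (M + 1) / a0 with hS
  have hS0 : 0 < S := by positivity
  refine ⟨cex S 0 P, cex_contDiff S 0 hP, fun x hx => ?_⟩
  rw [L_cex]
  · refine mul_pos (Real.exp_pos _) ?_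
    have h1 : a0 ≤ c.Gm P x := by
      have := hell x hx (gradient P x)
      have h2 := hgr x
      unfold Coef.Gm Coef.Z
      nlinarith only [this, h2, ha0, mul_le_mul h2 h2 zero_le_one (norm_nonneg _)]
    have h2 : M + 1 ≤ S * c.Gm P x := by
      have : S * a0 = M + 1 := by rw [hS]; field_simp
      rw [← this]; exact mul_le_mul_of_nonneg_left h1 hS0.le
    have h3 := (abs_le.1 (hL x hx)).1
    have : S * c.L P x + S ^ 2 * c.Gm P x = S * (c.L P x + S * c.Gm P x) := by ring
    rw [this]
    exact mul_pos hS0 (by linarith)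
  · exact hP
end maxprinciple

section timereg

lemma deriv_left_nonneg {h : ℝ → ℝ} {d s t : ℝ} (hst : s < t) (hd : HasDerivAt h d t)
    (hm : ∀ τ ∈ Icc s t, h τ ≤ h t) : 0 ≤ d := by
  have h1 := (hasDerivWithinAt_iff_tendsto_slope' (s := Iio t) (by simp)).1
    (hd.hasDerivWithinAt (s := Iio t))
  refine ge_of_tendsto h1 ?_
  filter_upwards [Ioo_mem_nhdsLT hst] with τ hτ
  rw [slope_def_field]
  exact div_nonneg_of_nonpos (by linarith [hm τ ⟨hτ.1.le, hτ.2.le⟩]) (by linarith [hτ.2])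

lemma deriv_right_nonpos {h : ℝ → ℝ} {d s t : ℝ} (hst : s < t) (hd : HasDerivAt h d s)
    (hm : ∀ τ ∈ Icc s t, h τ ≤ h s) : d ≤ 0 := by
  have h1 := (hasDerivWithinAt_iff_tendsto_slope' (s := Ioi s) (by simp)).1
    (hd.hasDerivWithinAt (s := Ioi s))
  refine le_of_tendsto h1 ?_
  filter_upwards [Ioo_mem_nhdsGT hst] with τ hτ
  rw [slope_def_field]
  exact div_nonpos_of_nonpos_of_nonneg (by linarith [hm τ ⟨hτ.1.le, hτ.2.le⟩]) (by linarith [hτ.1])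

variable {m : ℕ}

lemma time_onesided (c : Coef (m + 1)) {B : Set (Eucl (m + 1))} (hB : IsOpen B)
    (hBb : Bornology.IsBounded B) {t0 t1 M : ℝ} {u : ℝ → Eucl (m + 1) → ℝ}
    (hu : ContinuousOn (fun q : ℝ × Eucl (m + 1) => u q.1 q.2) (Icc t0 t1 ×ˢ closure B))
    (h2 : ∀ t ∈ Icc t0 t1, ContDiffOn ℝ 2 (u t) B)
    (hf : ∀ t ∈ Icc t0 t1, ∀ x ∈ B, deriv (fun s => u s x) t < M)
    (pde : ∀ t ∈ Icc t0 t1, ∀ x ∈ B, deriv (fun s => u s x) t = c.L (u t) x)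
    (bd : ∀ s ∈ Icc t0 t1, ∀ t ∈ Icc t0 t1, s ≤ t → ∀ x ∈ frontier B, u t x - u s x ≤ M * (t - s)) :
    ∀ s ∈ Icc t0 t1, ∀ t ∈ Icc t0 t1, s ≤ t → ∀ x ∈ closure B, u t x - u s x ≤ M * (t - s) := by
  intro s0 hs0 r0 hr0 hsr x0 hx0
  by_contra! hcon
  have hK := hBb.isCompact_closure
  obtain ⟨χ, hχ, hLχ⟩ := exists_chi c hK
  obtain ⟨N, hN, hχN⟩ := exists_bound_on hK hχ.continuous.continuousOn
  set δ := u r0 x0 - u s0 x0 - M * (r0 - s0) with hδ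
  have hδ0 : 0 < δ := by linarith
  set ε := δ / (2 * N + 1) with hε
  have hε0 : 0 < ε := by positivity
  have hεN : ε * (2 * N) < δ := by
    have : ε * (2 * N + 1) = δ := by rw [hε]; field_simp
    linarith
  set Q : Set (ℝ × ℝ × Eucl (m + 1)) :=
    (Icc t0 t1 ×ˢ Icc t0 t1 ×ˢ closure B) ∩ {q | q.1 ≤ q.2.1} with hQ
  have hQc : IsCompact Q := (isCompact_Icc.prod (isCompact_Icc.prod hK)).inter_right
    (isClosed_le continuous_fst (continuous_fst.comp continuous_snd))
  set Φ : ℝ × ℝ × Eucl (m + 1) → ℝ := fun q =>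
    u q.2.1 q.2.2 - u q.1 q.2.2 - M * (q.2.1 - q.1) + ε * χ q.2.2 with hΦ
  have c1 : ContinuousOn (fun q : ℝ × ℝ × Eucl (m + 1) => u q.2.1 q.2.2) Q :=
    hu.comp (f := fun q : ℝ × ℝ × Eucl (m + 1) => q.2) (by fun_prop) fun q hq => hq.1.2
  have c2 : ContinuousOn (fun q : ℝ × ℝ × Eucl (m + 1) => u q.1 q.2.2) Q :=
    hu.comp (f := fun q : ℝ × ℝ × Eucl (m + 1) => (q.1, q.2.2)) (by fun_prop)
      fun q hq => ⟨hq.1.1, hq.1.2.2⟩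
  have c3 : ContinuousOn (fun q : ℝ × ℝ × Eucl (m + 1) => M * (q.2.1 - q.1)) Q := by fun_prop
  have c4 : ContinuousOn (fun q : ℝ × ℝ × Eucl (m + 1) => ε * χ q.2.2) Q := by
    have := hχ.continuous
    fun_prop
  have hΦc : ContinuousOn Φ Q := ((c1.sub c2).sub c3).add c4
  have hmem0 : (s0, r0, x0) ∈ Q := ⟨⟨hs0, hr0, hx0⟩, hsr⟩
  obtain ⟨⟨s, t, x⟩, hq, hmax⟩ := hQc.exists_isMaxOn ⟨_, hmem0⟩ hΦc
  have hs : s ∈ Icc t0 t1 := hq.1.1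
  have ht : t ∈ Icc t0 t1 := hq.1.2.1
  have hx : x ∈ closure B := hq.1.2.2
  have hst : s ≤ t := hq.2
  have hbig : ε * χ x < Φ (s, t, x) := by
    have h := hmax hmem0
    have e1 := (abs_le.1 (hχN x0 hx0)).1
    have e2 := (abs_le.1 (hχN x hx)).2
    have e3 := mul_le_mul_of_nonneg_left e1 hε0.le
    have e4 := mul_le_mul_of_nonneg_left e2 hε0.le
    simp only [mem_ofPred_eq] at h
    have e5 : Φ (s0, r0, x0) = δ + ε * χ x0 := by simp only [hΦ, hδ]
    rw [e5] at h
    nlinarith only [h, e3, e4, hεN]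
  have hbig' : 0 < u t x - u s x - M * (t - s) := by
    have : Φ (s, t, x) = u t x - u s x - M * (t - s) + ε * χ x := rfl
    linarith
  have hlt : s < t := by
    refine lt_of_le_of_ne hst fun h => ?_
    subst h
    linarith
  have hxB : x ∈ B := by
    by_contra h
    have := bd s hs t ht hst x ⟨hx, fun h' => h (interior_subset h')⟩
    linarith
  have hIcc : ∀ τ ∈ Icc s t, τ ∈ Icc t0 t1 := fun τ hτ => ⟨hs.1.trans hτ.1, hτ.2.trans ht.2⟩
  have hft : deriv (fun r => u r x) t = 0 := by
    by_cases hd : DifferentiableAt ℝ (fun r => u r x) t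
    · exfalso
      have h1 : HasDerivAt (fun τ => u τ x - M * τ) (deriv (fun r => u r x) t - M * 1) t :=
        hd.hasDerivAt.sub ((hasDerivAt_id t).const_mul M)
      have := deriv_left_nonneg hlt h1 fun τ hτ => by
        have h : Φ (s, τ, x) ≤ Φ (s, t, x) := hmax ⟨⟨hs, hIcc τ hτ, hx⟩, hτ.1⟩
        simp only [hΦ] at h
        linarith
      linarith [hf t ht x hxB]
    · exact deriv_zero_of_not_differentiableAt hd
  have hfs : deriv (fun r => u r x) s = 0 := by
    by_cases hd : DifferentiableAt ℝ (fun r => u r x) s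
    · exfalso
      have h1 : HasDerivAt (fun τ => M * τ - u τ x) (M * 1 - deriv (fun r => u r x) s) s :=
        ((hasDerivAt_id s).const_mul M).sub hd.hasDerivAt
      have := deriv_right_nonpos hlt h1 fun τ hτ => by
        have h : Φ (τ, t, x) ≤ Φ (s, t, x) := hmax ⟨⟨hIcc τ hτ, ht, hx⟩, hτ.2⟩
        simp only [hΦ] at h
        linarith
      linarith [hf s hs x hxB]
    · exact deriv_zero_of_not_differentiableAt hd
  have k1 : ContDiffAt ℝ 2 (u t) x := (h2 t ht).contDiffAt (hB.mem_nhds hxB)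
  have k2 : ContDiffAt ℝ 2 (u s) x := (h2 s hs).contDiffAt (hB.mem_nhds hxB)
  have k3 : ContDiffAt ℝ 2 (fun y => u t y + (-1) * u s y - M * (t - s) + ε * χ y) x :=
    ((k1.add (contDiffAt_const.mul k2)).sub contDiffAt_const).add
      (contDiffAt_const.mul hχ.contDiffAt)
  have hloc : IsLocalMax (fun y => u t y + (-1) * u s y - M * (t - s) + ε * χ y) x := by
    filter_upwards [hB.mem_nhds hxB] with y hy
    have h : Φ (s, t, y) ≤ Φ (s, t, x) := hmax ⟨⟨hs, ht, subset_closure hy⟩, hst⟩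
    simp only [hΦ] at h
    linarith
  have h := L_max c k3 hloc
  rw [L_comb c k1 k2 hχ.contDiffAt, ← pde t ht x hxB, ← pde s hs x hxB, hft, hfs] at h
  have := mul_pos hε0 (hLχ x hx)
  linarith

lemma time_deriv (c : Coef (m + 1)) {B : Set (Eucl (m + 1))} (hB : IsOpen B)
    (hBb : Bornology.IsBounded B) {T : ℝ} {u : ℝ → Eucl (m + 1) → ℝ}
    (hu : ContinuousOn (fun q : ℝ × Eucl (m + 1) => u q.1 q.2) (Icc 0 T ×ˢ closure B))
    (hut : ContinuousOn (fun q : ℝ × Eucl (m + 1) => deriv (fun s => u s q.2) q.1)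
      (Icc 0 T ×ˢ closure B))
    (h2 : ∀ t ∈ Ioo 0 T, ContDiffOn ℝ 2 (u t) B)
    (pde : ∀ t ∈ Ioo 0 T, ∀ x ∈ B, deriv (fun s => u s x) t = c.L (u t) x)
    {M0 : ℝ} (bd : ∀ s ∈ Ioo 0 T, ∀ t ∈ Ioo 0 T, s ≤ t → ∀ x ∈ frontier B,
      |u t x - u s x| ≤ M0 * (t - s)) {t : ℝ} (ht : t ∈ Ioo 0 T) {x : Eucl (m + 1)} (hx : x ∈ B) :
    HasDerivAt (fun s => u s x) (deriv (fun s => u s x) t) t := by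
  have hK := hBb.isCompact_closure
  obtain ⟨t0, ht0, ht0t⟩ := exists_between ht.1
  obtain ⟨t1, htt1, ht1⟩ := exists_between ht.2
  have hsub : Icc t0 t1 ⊆ Ioo 0 T := fun s hs => ⟨ht0.trans_le hs.1, hs.2.trans_lt ht1⟩
  have hsub' : Icc t0 t1 ⊆ Icc 0 T := hsub.trans Ioo_subset_Icc_self
  obtain ⟨M1, hM1⟩ := (isCompact_Icc.prod hK).exists_bound_of_continuousOn
    (hut.mono (prod_mono_left hsub'))
  set M := max M0 (M1 + 1) with hM
  have hM' : ∀ s ∈ Icc t0 t1, ∀ y ∈ B, |deriv (fun s => u s y) s| < M := fun s hs y hy =>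
    lt_of_lt_of_le (lt_of_le_of_lt (hM1 (s, y) ⟨hs, subset_closure hy⟩) (lt_add_one M1))
      (le_max_right _ _)
  have hbd' : ∀ s ∈ Icc t0 t1, ∀ r ∈ Icc t0 t1, s ≤ r → ∀ y ∈ frontier B,
      |u r y - u s y| ≤ M * (r - s) := fun s hs r hr hsr y hy =>
    (bd s (hsub hs) r (hsub hr) hsr y hy).trans
      (mul_le_mul_of_nonneg_right (le_max_left _ _) (by linarith))
  have a1 := time_onesided c hB hBb (hu.mono (prod_mono_left hsub')) (fun s hs => h2 s (hsub hs))
    (fun s hs y hy => lt_of_abs_lt (hM' s hs y hy)) (fun s hs y hy => pde s (hsub hs) y hy)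
    (fun s hs r hr hsr y hy => le_of_abs_le (hbd' s hs r hr hsr y hy))
  have a2 := time_onesided c (u := fun t y => - u t y) hB hBb (hu.mono (prod_mono_left hsub')).neg
    (fun s hs => (h2 s (hsub hs)).neg)
    (fun s hs y hy => by
      rw [deriv.fun_neg]; exact lt_of_abs_lt (by rw [abs_neg]; exact hM' s hs y hy))
    (fun s hs y hy => by
      rw [deriv.fun_neg, pde s (hsub hs) y hy]
      have k : ContDiffAt ℝ 2 (u s) y := (h2 s (hsub hs)).contDiffAt (hB.mem_nhds hy)
      have := L_comb c (contDiffAt_const (c := (0:ℝ))) k (contDiffAt_const (c := (0:ℝ))) (-1) 0 0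
      have e : (fun z => (0:ℝ) + -1 * u s z - 0 + 0 * 0) = fun z => - u s z := by
        funext z; ring
      have e0 : c.L (fun _ => (0:ℝ)) y = 0 := by
        have : c.Z (fun _ => (0:ℝ)) = fun _ => 0 := by
          funext z; unfold Coef.Z gradient; simp
        have h := c.L_mul (fun _ => (0:ℝ)) y
        rw [this] at h
        simp [dv] at h
        exact h.resolve_left (c.ωpos y).ne'
      rw [e, e0] at this
      rw [this]; ring)
    (fun s hs r hr hsr y hy => by
      have := (abs_le.1 (hbd' s hs r hr hsr y hy)).1
      linarith)
  have hM0 : 0 ≤ M := (abs_nonneg _).trans (hM' t ⟨ht0t.le, htt1.le⟩ x hx).le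
  set φ : ℝ → ℝ := fun s => u s x with hφ
  have hxc := subset_closure hx
  have hle : t0 ≤ t1 := (ht0t.trans htt1).le
  have hlip : LipschitzOnWith ⟨M, hM0⟩ φ (uIcc t0 t1) := by
    rw [uIcc_of_le hle]
    refine LipschitzOnWith.of_dist_le_mul fun s hs r hr => ?_
    rw [Real.dist_eq, Real.dist_eq]
    change |φ s - φ r| ≤ M * |s - r|
    rcases le_total s r with h | h
    · rw [abs_sub_comm, abs_sub_comm s, abs_of_nonneg (by linarith : 0 ≤ r - s)]
      have b1 := a1 s hs r hr h x hxc
      have b2 := a2 s hs r hr h x hxc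
      exact abs_le.2 ⟨by simp only [hφ]; linarith, b1⟩
    · rw [abs_of_nonneg (by linarith : 0 ≤ s - r)]
      have b1 := a1 r hr s hs h x hxc
      have b2 := a2 r hr s hs h x hxc
      exact abs_le.2 ⟨by simp only [hφ]; linarith, b1⟩
  have hac := hlip.absolutelyContinuousOnInterval
  have hFTC : ∀ r ∈ Icc t0 t1, ∫ s in t0..r, deriv φ s = φ r - φ t0 := fun r hr =>
    (hac.mono (by rw [uIcc_of_le hle, uIcc_of_le hr.1]; exact Icc_subset_Icc le_rfl hr.2)).integral_deriv_eq_sub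
  have hdc : ContinuousOn (deriv φ) (Icc t0 t1) :=
    hut.comp (f := fun s : ℝ => (s, x)) (by fun_prop) fun s hs => ⟨hsub' hs, hxc⟩
  have hdi : IntervalIntegrable (deriv φ) volume t0 t :=
    (hdc.mono (Icc_subset_Icc le_rfl htt1.le)).intervalIntegrable_of_Icc ht0t.le
  have hnh : Icc t0 t1 ∈ 𝓝 t := Icc_mem_nhds ht0t htt1
  have hder := intervalIntegral.integral_hasDerivAt_right hdi
    (hdc.stronglyMeasurableAtFilter_nhdsWithin measurableSet_Icc t |>.filter_mono
      (by rw [nhdsWithin_eq_nhds.2 hnh])) (hdc.continuousAt hnh)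
  have heq : φ =ᶠ[𝓝 t] fun r => (∫ s in t0..r, deriv φ s) + φ t0 := by
    filter_upwards [hnh] with r hr
    rw [hFTC r hr]; ring
  exact (hder.add_const (φ t0)).congr_of_eventuallyEq heq
end timereg

section bdrygrad

lemma normal_norm {D : Set (Eucl n)} {ν : Eucl n → Eucl n} (hν : IsOutwardNormalField D ν)
    {x : Eucl n} (hx : x ∈ frontier D) : ‖ν x‖ = 1 := by
  obtain ⟨V, ρ, hV, hxV, _, hgr, _, _, e⟩ := hν x hx
  rw [e, norm_smul, norm_inv, norm_norm]
  exact inv_mul_cancel₀ (norm_ne_zero_iff.2 (hgr x hxV))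

/-- the (junk-free) gradient at boundary points -/
lemma bdry_fderiv {B : Set (Eucl n)} (hB : IsOpen B) {U : Eucl n → ℝ}
    (hU : ContDiffOn ℝ 2 U (closure B)) (hg : ContinuousOn (gradient U) (closure B))
    {x : Eucl n} (hx : x ∈ closure B) : HasFDerivWithinAt U (fderiv ℝ U x) (closure B) x := by
  have h1 : ContDiffWithinAt ℝ 1 U (closure B) x := (hU x hx).of_le one_le_two
  have h1' : ContDiffWithinAt ℝ (0 + 1) U (closure B) x := by simpa using h1
  obtain ⟨w, hw, -, f', hf', hc⟩ := (contDiffWithinAt_succ_iff_hasFDerivWithinAt (by simp)).1 h1'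
  rw [insert_eq_of_mem hx] at hw
  obtain ⟨O, hO, hxO, hOw⟩ := mem_nhdsWithin.1 hw
  have hne : (𝓝[B] x).NeBot := mem_closure_iff_nhdsWithin_neBot.1 hx
  have hxw : x ∈ w := hOw ⟨hxO, hx⟩
  have hBw : w ∈ 𝓝[B] x := mem_nhdsWithin.2 ⟨O, hO, hxO, fun y hy => hOw ⟨hy.1, subset_closure hy.2⟩⟩
  have hev : fderiv ℝ U =ᶠ[𝓝[B] x] f' := by
    filter_upwards [mem_nhdsWithin.2 ⟨O, hO, hxO, Subset.rfl⟩] with y hy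
    have hwy : w ∈ 𝓝 y := Filter.mem_of_superset ((hO.inter hB).mem_nhds hy) fun z hz =>
      hOw ⟨hz.1, subset_closure hz.2⟩
    exact ((hf' y (mem_of_mem_nhds hwy)).hasFDerivAt hwy).fderiv
  have t1 : Filter.Tendsto f' (𝓝[B] x) (𝓝 (f' x)) :=
    hc.continuousWithinAt.tendsto.mono_left (nhdsWithin_le_of_mem hBw)
  have t2 : Filter.Tendsto (fderiv ℝ U) (𝓝[B] x) (𝓝 (fderiv ℝ U x)) := by
    have h2 : Filter.Tendsto (gradient U) (𝓝[B] x) (𝓝 (gradient U x)) :=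
      (hg x hx).tendsto.mono_left (nhdsWithin_mono x subset_closure)
    have h3 := ((InnerProductSpace.toDual ℝ (Eucl n)).continuous.tendsto (gradient U x)).comp h2
    have e : ∀ y, InnerProductSpace.toDual ℝ (Eucl n) (gradient U y) = fderiv ℝ U y := fun y => by
      unfold gradient; simp
    rw [e] at h3
    exact h3.congr e
  have e : fderiv ℝ U x = f' x := tendsto_nhds_unique (t2.congr' hev) t1
  rw [e]
  exact (hf' x hxw).mono_of_mem_nhdsWithin hw

variable {m : ℕ}

lemma graph_curve {k : Fin (m + 1)} {σ : ℝ} (hσ : σ * σ = 1) {h : (Fin m → ℝ) → ℝ}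
    (z : Eucl (m + 1)) :
    gm k h (dr k z) = z - (σ * rt k σ h z) • EuclideanSpace.single k (1:ℝ) := by
  unfold gm rt
  rw [ins_add k (h (dr k z)) (z k), ins_dr, ← mul_assoc, hσ, one_mul, ← neg_sub (z k), neg_smul,
    ← sub_eq_add_neg]

lemma tang_eq {B : Set (Eucl (m + 1))} (hB : IsOpen B) (hB4 : HasC4Boundary B)
    {ν : Eucl (m + 1) → Eucl (m + 1)} (hν : IsOutwardNormalField B ν) {U V : Eucl (m + 1) → ℝ}
    (hU : ContDiffOn ℝ 2 U (closure B)) (hg : ContinuousOn (gradient U) (closure B))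
    (hV : Differentiable ℝ V) (hUV : ∀ x ∈ frontier B, U x = V x)
    {x : Eucl (m + 1)} (hx : x ∈ frontier B) : tangGrad ν U x = tangGrad ν V x := by
  have hnu := normal_norm hν hx
  obtain ⟨k, σ, h, O, hxO, ch⟩ := exists_chart hB4 hx
  have hσ := ch.hσ
  have hrt : Differentiable ℝ (rt k σ h) := (rt_contDiff k σ ch.hh).differentiable two_ne_zero
  have hrx : rt k σ h x = 0 := (ch.memf x hxO).1 hx
  have hD : HasFDerivWithinAt (fun y => U y - V y) (fderiv ℝ U x - fderiv ℝ V x) (frontier B) x :=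
    ((bdry_fderiv hB hU hg (frontier_subset_closure hx)).mono frontier_subset_closure).sub
      (hV x).hasFDerivAt.hasFDerivWithinAt
  have key : ∀ v, ⟪ν x, v⟫ = 0 → ⟪gradient U x - gradient V x, v⟫ = 0 := by
    intro v hv
    have hrv : fderiv ℝ (rt k σ h) x v = 0 := by
      rw [ch.normal hν hxO hx, inner_smul_left, inner_grad] at hv
      have h1 := rt_grad_norm k hσ (ch.hh.of_le one_le_two) x
      refine (mul_eq_zero.1 hv).resolve_left ?_
      simp only [conj_trivial]
      exact inv_ne_zero (by linarith)
    set γ : ℝ → Eucl (m + 1) := fun s => gm k h (dr k (x + s • v)) with hγ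
    have hγ0 : γ 0 = x := by simp only [hγ, zero_smul, add_zero]; exact gm_dr hσ hrx
    have hγd : HasDerivAt γ v 0 := by
      have e : γ = fun s => (x + s • v) - (σ * rt k σ h (x + s • v)) • EuclideanSpace.single k (1:ℝ) := by
        funext s; exact graph_curve hσ _
      have h1 : HasDerivAt (fun s : ℝ => x + s • v) v 0 := by
        simpa using ((hasDerivAt_id (0:ℝ)).smul_const v).const_add x
      have h2 := line_deriv (hrt x) v
      rw [hrv] at h2
      have h3 : HasDerivAt (fun s : ℝ => (x + s • v) -
          (σ * rt k σ h (x + s • v)) • EuclideanSpace.single k (1:ℝ))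
          (v - (σ * 0) • EuclideanSpace.single k (1:ℝ)) 0 :=
        h1.sub ((h2.const_mul σ).smul_const (EuclideanSpace.single k (1:ℝ)))
      rw [mul_zero, zero_smul, sub_zero] at h3
      rw [e]
      exact h3
    have hev : ∀ᶠ s in 𝓝 (0:ℝ), γ s ∈ frontier B := by
      have h1 : γ ⁻¹' O ∈ 𝓝 (0:ℝ) := hγd.continuousAt.preimage_mem_nhds
        (by rw [hγ0]; exact ch.hU.mem_nhds hxO)
      filter_upwards [h1] with s hs using (ch.memf _ hs).2 (rt_gm k σ h _)
    have hD' : HasFDerivWithinAt (fun y => U y - V y) (fderiv ℝ U x - fderiv ℝ V x)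
      (frontier B) (γ 0) := by rw [hγ0]; exact hD
    have h1 := (hD'.comp_hasDerivWithinAt (s := {s | γ s ∈ frontier B}) 0 hγd.hasDerivWithinAt
      fun s hs => hs).hasDerivAt hev
    have h2 : ((fun y => U y - V y) ∘ γ) =ᶠ[𝓝 0] fun _ => (0:ℝ) := by
      filter_upwards [hev] with s hs
      simp [hUV _ hs]
    have h3 := h1.unique ((hasDerivAt_const (0:ℝ) (0:ℝ)).congr_of_eventuallyEq h2)
    rw [sub_apply] at h3
    rw [inner_sub_left, inner_grad, inner_grad, h3]
  set p := gradient U x - gradient V x with hp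
  have h1 : ⟪ν x, p - ⟪p, ν x⟫ • ν x⟫ = 0 := by
    rw [inner_sub_right, inner_smul_right, real_inner_self_eq_norm_sq, hnu, real_inner_comm]; ring
  have h2 := key _ h1
  have h3 : p - ⟪p, ν x⟫ • ν x = 0 := by
    rw [← inner_self_eq_zero (𝕜 := ℝ), inner_sub_left, h2, inner_smul_left, h1]; simp
  have e : tangGrad ν U x - tangGrad ν V x = p - ⟪p, ν x⟫ • ν x := by
    unfold tangGrad normalDeriv
    rw [hp, inner_sub_left, sub_smul]; abel
  exact sub_eq_zero.1 (e.trans h3)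
end bdrygrad

section coefg
variable {g : Eucl n → Matrix (Fin n) (Fin n) ℝ}

lemma g_posDef (hg : MetricC3Bounded g) {θ : ℝ} (hθ : 0 < θ) (he : UniformlyElliptic g θ)
    (x : Eucl n) : (g x).PosDef := by
  refine Matrix.PosDef.of_dotProduct_mulVec_pos ?_ fun v hv => ?_
  · rw [Matrix.IsHermitian, Matrix.conjTranspose_eq_transpose_of_trivial]; exact hg.1 x
  · have h1 : 0 < ∑ i, v i ^ 2 := by
      obtain ⟨i, hi⟩ := Function.ne_iff.1 hv
      exact Finset.sum_pos' (fun i _ => sq_nonneg _) ⟨i, Finset.mem_univ i, by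
        have : v i ≠ 0 := hi
        positivity⟩
    have h2 := he x v
    have h3 : star v ⬝ᵥ (g x).mulVec v = ∑ i, ∑ j, g x i j * v i * v j := by
      simp only [dotProduct, Matrix.mulVec, Finset.mul_sum]
      refine Finset.sum_congr rfl fun i _ => Finset.sum_congr rfl fun j _ => ?_
      simp
      ring
    rw [h3]
    exact lt_of_lt_of_le (mul_pos hθ h1) h2

lemma det_contDiff {N : Eucl n → Matrix (Fin n) (Fin n) ℝ}
    (hN : ∀ i j, ContDiff ℝ 1 fun x => N x i j) : ContDiff ℝ 1 fun x => (N x).det := by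
  simp only [Matrix.det_apply]
  refine ContDiff.sum fun σ _ => ?_
  exact (contDiff_prod fun i _ => hN _ _).const_smul _

lemma inv_contDiff (hg : ∀ i j, ContDiff ℝ 1 fun x => g x i j) (hd : ∀ x, (g x).det ≠ 0)
    (i j : Fin n) : ContDiff ℝ 1 fun x => (g x)⁻¹ i j := by
  have e : (fun x => (g x)⁻¹ i j) = fun x => ((g x).det)⁻¹ * (g x).adjugate i j := by
    funext x
    rw [Matrix.inv_def, Matrix.smul_apply, Ring.inverse_eq_inv', smul_eq_mul]
  rw [e]
  refine ((det_contDiff hg).inv hd).mul ?_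
  simp only [Matrix.adjugate_apply]
  refine det_contDiff fun a b => ?_
  by_cases h : a = j
  · subst h; simp only [Matrix.updateRow_self]; exact contDiff_const
  · simp only [Matrix.updateRow_ne h]; exact hg a b

lemma toE_apply (N : Matrix (Fin n) (Fin n) ℝ) (v : Eucl n) (i : Fin n) :
    Matrix.toEuclideanCLM (𝕜 := ℝ) N v i = ∑ j, N i j * v j := by
  rw [Matrix.ofLp_toEuclideanCLM]; rfl

/-- the coefficients attached to a metric -/
def coefg (hg : MetricC3Bounded g) {θ : ℝ} (hθ : 0 < θ) (he : UniformlyElliptic g θ) : Coef n where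
  ω := fun x => Real.sqrt (g x).det
  A := fun x => Matrix.toEuclideanCLM (𝕜 := ℝ) (g x)⁻¹
  hω := ContDiff.sqrt (det_contDiff fun i j => (hg.2.1 i j).of_le (by norm_num))
    fun x => (g_posDef hg hθ he x).det_pos.ne'
  hA := by
    rw [contDiff_clm_apply_iff]
    intro v
    rw [contDiff_euclidean]
    intro i
    simp only [toE_apply]
    refine ContDiff.sum fun j _ => ContDiff.mul (inv_contDiff (fun i j =>
      (hg.2.1 i j).of_le (by norm_num)) (fun x => (g_posDef hg hθ he x).det_pos.ne') i j) contDiff_const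
  ωpos := fun x => Real.sqrt_pos.2 (g_posDef hg hθ he x).det_pos
  symm := by
    intro x v w
    have hs : (g x)⁻¹.transpose = (g x)⁻¹ := by
      rw [Matrix.transpose_nonsing_inv, hg.1 x]
    have hs' : ∀ i j, (g x)⁻¹ i j = (g x)⁻¹ j i := fun i j => by
      conv_lhs => rw [← hs, Matrix.transpose_apply]
    simp only [PiLp.inner_apply, toE_apply]
    simp only [RCLike.inner_apply, conj_trivial, Finset.mul_sum, Finset.sum_mul]
    rw [Finset.sum_comm]
    refine Finset.sum_congr rfl fun i _ => Finset.sum_congr rfl fun j _ => ?_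
    rw [hs' j i]; ring
  pos := by
    intro x v hv
    have hv' : v.ofLp ≠ 0 := fun h => hv (by ext i; simp [h])
    have h := (g_posDef hg hθ he x).inv.dotProduct_mulVec_pos hv'
    have e : ⟪v, Matrix.toEuclideanCLM (𝕜 := ℝ) (g x)⁻¹ v⟫ =
        star v.ofLp ⬝ᵥ ((g x)⁻¹).mulVec v.ofLp := by
      simp only [PiLp.inner_apply, toE_apply]
      simp only [RCLike.inner_apply, conj_trivial, dotProduct, Matrix.mulVec]
      refine Finset.sum_congr rfl fun i _ => ?_
      simp [mul_comm]
    rw [e]; exact h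

lemma lapBel_eq (hg : MetricC3Bounded g) {θ : ℝ} (hθ : 0 < θ) (he : UniformlyElliptic g θ)
    {u : Eucl n → ℝ} {x : Eucl n} (hu : ContDiffAt ℝ 2 u x) :
    LapBel g u x = (coefg hg hθ he).L u x := by
  unfold LapBel Coef.L
  have hd : DifferentiableAt ℝ (fun y => (coefg hg hθ he).ω y • (coefg hg hθ he).A y (gradient u y)) x :=
    ((coefg hg hθ he).ω_diff x).smul
      (((coefg hg hθ he).Z_contDiffAt hu).differentiableAt one_ne_zero)
  rw [dv_eq_pd hd]
  have e : ∀ i, (fun y => Real.sqrt (g y).det * ∑ j, (g y)⁻¹ i j * pd u j y) =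
      fun y => ((coefg hg hθ he).ω y • (coefg hg hθ he).A y (gradient u y)) i := by
    intro i
    funext y
    change _ = Real.sqrt (g y).det * (Matrix.toEuclideanCLM (𝕜 := ℝ) (g y)⁻¹ (gradient u y)) i
    rw [toE_apply]
    congr 1
    refine Finset.sum_congr rfl fun j _ => ?_
    congr 1
    unfold pd
    rw [← inner_grad, EuclideanSpace.inner_single_right]
    simp
  simp only [e]
  rfl
end coefg

section final
variable {m : ℕ}

/-- the outward normal field is continuous on the boundary -/
lemma normal_cont {D : Set (Eucl (m + 1))} (hD : HasC4Boundary D)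
    {ν : Eucl (m + 1) → Eucl (m + 1)} (hν : IsOutwardNormalField D ν) :
    ContinuousOn ν (frontier D) := by
  intro x hx
  obtain ⟨k, σ, h, O, hxO, ch⟩ := exists_chart hD hx
  have hc : Continuous (gradient (rt k σ h)) := by
    have h1 : Continuous (fderiv ℝ (rt k σ h)) :=
      (rt_contDiff k σ ch.hh).continuous_fderiv two_ne_zero
    exact (InnerProductSpace.toDual ℝ (Eucl (m + 1))).symm.continuous.comp h1
  have hne : ‖gradient (rt k σ h) x‖ ≠ 0 := by
    have := rt_grad_norm k ch.hσ (ch.hh.of_le one_le_two) x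
    linarith
  have h2 : ContinuousAt (fun y => ‖gradient (rt k σ h) y‖⁻¹ • gradient (rt k σ h) y) x :=
    (hc.norm.continuousAt.inv₀ hne).smul hc.continuousAt
  refine h2.continuousWithinAt.congr_of_eventuallyEq ?_ (ch.normal hν hxO hx)
  filter_upwards [mem_nhdsWithin_of_mem_nhds (ch.hU.mem_nhds hxO), self_mem_nhdsWithin] with y hy hyD
  exact ch.normal hν hy hyD

lemma tang_pyth {ν : Eucl n → Eucl n} {w : Eucl n → ℝ} {x : Eucl n} (h : ‖ν x‖ = 1) :
    ‖gradient w x‖ ^ 2 = ‖tangGrad ν w x‖ ^ 2 + (normalDeriv ν w x) ^ 2 := by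
  unfold tangGrad normalDeriv
  rw [norm_sub_sq_real, inner_smul_right, norm_smul, h, Real.norm_eq_abs, mul_one, sq_abs]
  ring

lemma tang_smul {ν : Eucl n → Eucl n} {w : Eucl n → ℝ} {x : Eucl n} (r : ℝ)
    (hw : DifferentiableAt ℝ w x) :
    tangGrad ν (fun y => r * w y) x = r • tangGrad ν w x := by
  have e : gradient (fun y => r * w y) x = r • gradient w x := by
    unfold gradient
    rw [fderiv_const_mul hw, map_smul]
  unfold tangGrad normalDeriv
  rw [e, real_inner_smul_left, smul_sub, smul_smul]

/-- The energy on the inner boundary splits into the two data terms. -/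
lemma energy_split {c : Coef (m + 1)} {T : ℝ} {B Ω : Set (Eucl (m + 1))}
    (hBb : Bornology.IsBounded B)
    (hΩ4 : HasC4Boundary Ω) (hΩb : Bornology.IsBounded Ω) (hΩB : closure Ω ⊆ B)
    {ν : Eucl (m + 1) → Eucl (m + 1)} (hν : IsOutwardNormalField Ω ν)
    {u ut : ℝ → Eucl (m + 1) → ℝ} (hu : CSol c T B u ut) :
    I2 μH[(m:ℝ)] T (frontier Ω) (nden T 0 u ut) =
      I2 μH[(m:ℝ)] T (frontier Ω)
        (fun t x => (u t x) ^ 2 + (ut t x) ^ 2 + ‖tangGrad ν (u t) x‖ ^ 2) +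
      I2 μH[(m:ℝ)] T (frontier Ω) (fun t x => (normalDeriv ν (u t) x) ^ 2) := by
  have hs : frontier Ω ⊆ closure B :=
    frontier_subset_closure.trans (hΩB.trans subset_closure)
  have hA : MeasurableSet (frontier Ω) := isClosed_frontier.measurableSet
  have hA' : μH[(m:ℝ)] (frontier Ω) ≠ ⊤ := (muH_finite hΩ4 hΩb).ne
  have hgd : Gd T (frontier Ω) (nden T 0 u ut) := (nden_gd hu hBb le_rfl).mono hs
  have e : ∀ t ∈ Ioo 0 T, ∀ x ∈ frontier Ω, nden T 0 u ut t x =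
      ((u t x) ^ 2 + (ut t x) ^ 2 + ‖tangGrad ν (u t) x‖ ^ 2) + (normalDeriv ν (u t) x) ^ 2 := by
    intro t ht x hx
    unfold nden dd
    rw [tang_pyth (normal_norm hν hx)]
    simp only [mul_zero, zero_mul, neg_zero, Real.exp_zero, one_mul]
    ring
  have hsub : Ioo 0 T ×ˢ frontier Ω ⊆ Icc 0 T ×ˢ closure B :=
    prod_mono Ioo_subset_Icc_self hs
  have cν : ContinuousOn (fun q : ℝ × Eucl (m + 1) => ν q.2) (Ioo 0 T ×ˢ frontier Ω) :=
    (normal_cont hΩ4 hν).comp continuousOn_snd fun q hq => hq.2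
  have cg := hu.cg.mono hsub
  have cn : ContinuousOn (fun q : ℝ × Eucl (m + 1) => normalDeriv ν (u q.1) q.2)
      (Ioo 0 T ×ˢ frontier Ω) := by
    unfold normalDeriv
    exact cg.inner cν
  have ctg : ContinuousOn (fun q : ℝ × Eucl (m + 1) => tangGrad ν (u q.1) q.2)
      (Ioo 0 T ×ˢ frontier Ω) := by
    unfold tangGrad
    exact cg.sub (cn.smul cν)
  have g2 : Gd T (frontier Ω) (fun t x => (normalDeriv ν (u t) x) ^ 2) := by
    refine Gd.of_le (cn.pow 2) hgd fun t ht x hx => ?_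
    rw [e t ht x hx, abs_of_nonneg (sq_nonneg _)]
    have : 0 ≤ (u t x) ^ 2 + (ut t x) ^ 2 + ‖tangGrad ν (u t) x‖ ^ 2 := by positivity
    linarith
  have g1 : Gd T (frontier Ω)
      (fun t x => (u t x) ^ 2 + (ut t x) ^ 2 + ‖tangGrad ν (u t) x‖ ^ 2) := by
    refine Gd.of_le ((((hu.cu.mono hsub).pow 2).add ((hu.ct.mono hsub).pow 2)).add
      (ctg.norm.pow 2)) hgd fun t ht x hx => ?_
    have : 0 ≤ (u t x) ^ 2 + (ut t x) ^ 2 + ‖tangGrad ν (u t) x‖ ^ 2 := by positivity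
    rw [e t ht x hx, abs_of_nonneg this]
    have := sq_nonneg (normalDeriv ν (u t) x)
    linarith
  rw [← I2_add hA hA' g1 g2]
  exact I2_congr hA e

/-- the admissibility condition at the outer boundary -/
def BdCond (T L : ℝ) (B : Set (Eucl n)) (ν : Eucl n → Eucl n) (u ut : ℝ → Eucl n → ℝ) : Prop :=
  ∀ t ∈ Ioo 0 T, ∀ x ∈ frontier B, |ut t x| ≤ L * |u t x| ∧
      ∃ μ : ℝ, ‖gradient (u t) x - μ • ν x‖ ≤ L * |u t x|

/-- the abstract setup used in the proof -/
def finStp (c : Coef (m + 1)) {T L : ℝ} (hT : 0 < T) {B : Set (Eucl (m + 1))} (hB : IsOpen B)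
    (hBb : Bornology.IsBounded B) (ν : Eucl (m + 1) → Eucl (m + 1)) (Ω : Set (Eucl (m + 1))) :
    Stp (m + 1) where
  c := c
  T := T
  hT := hT
  B := B
  hB := hB
  hBb := hBb
  Adm := fun u ut => CSol c T B u ut ∧ BdCond T L B ν u ut
  En := fun u ut => I2 μH[(m:ℝ)] T (frontier Ω) (nden T 0 u ut)
  adm := fun _ _ h => h.1
  en0 := fun u ut _ => I2_nonneg isClosed_frontier.measurableSet
    fun t _ x _ => nden_nonneg T 0 u ut t x

/-- solutions in the sense of the statement are admissible -/
lemma reg_adm {g : Eucl (m + 1) → Matrix (Fin (m + 1)) (Fin (m + 1)) ℝ} (hg : MetricC3Bounded g)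
    {θ : ℝ} (hθ : 0 < θ) (hgθ : UniformlyElliptic g θ) {B : Set (Eucl (m + 1))}
    (hB : IsOpen B) (hBb : Bornology.IsBounded B) (hB4 : HasC4Boundary B)
    {ν : Eucl (m + 1) → Eucl (m + 1)} (hν : IsOutwardNormalField B ν)
    {T α β : ℝ} (hα : 0 < α) (hβ : 0 < β) {g0 : ℝ → ℝ}
    (hg0 : ContDiff ℝ 1 g0) {w : Eucl (m + 1) → ℝ} (hw : ContDiff ℝ 1 w)
    (h1 : ∀ t ∈ Ioo (0 : ℝ) T, ∀ x ∈ frontier B, α ≤ |g0 t * w x|)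
    (h2 : ∀ t ∈ Ioo (0 : ℝ) T, ∀ x ∈ frontier B,
          |deriv (fun s => g0 s * w x) t| + ‖tangGrad ν (fun y => g0 t * w y) x‖ ≤ β)
    {u : ℝ → Eucl (m + 1) → ℝ} (hu : ParabolicReg T (closure B) u)
    (pde : ∀ t ∈ Ioo (0 : ℝ) T, ∀ x ∈ B, deriv (fun s => u s x) t - LapBel g (u t) x = 0)
    (hbd : ∀ t ∈ Ioo (0 : ℝ) T, ∀ x ∈ frontier B, u t x = g0 t * w x) :
    CSol (coefg hg hθ hgθ) T B u (fun t x => deriv (fun s => u s x) t) ∧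
      BdCond T (β / α) B ν u (fun t x => deriv (fun s => u s x) t) := by
  obtain ⟨r1, r2, r3, r4, _⟩ := hu
  have hc2 : ∀ t ∈ Ioo 0 T, ContDiffOn ℝ 2 (u t) B := fun t ht =>
    (r1 t (Ioo_subset_Icc_self ht)).mono subset_closure
  have hpde : ∀ t ∈ Ioo 0 T, ∀ x ∈ B,
      deriv (fun s => u s x) t = (coefg hg hθ hgθ).L (u t) x := by
    intro t ht x hx
    rw [← lapBel_eq hg hθ hgθ ((hc2 t ht).contDiffAt (hB.mem_nhds hx))]
    exact sub_eq_zero.1 (pde t ht x hx)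
  have hK : IsCompact (frontier B) :=
    Metric.isCompact_of_isClosed_isBounded isClosed_frontier
      (hBb.closure.subset frontier_subset_closure)
  obtain ⟨M1, hM1, b1⟩ := exists_bound_on hK hw.continuous.continuousOn
  obtain ⟨M2, b2⟩ := (isCompact_Icc (a := (0:ℝ)) (b := T)).exists_bound_of_continuousOn
    (hg0.continuous_deriv_one).continuousOn
  have hdg : Differentiable ℝ g0 := hg0.differentiable one_ne_zero
  have hlip : ∀ s ∈ Ioo 0 T, ∀ t ∈ Ioo 0 T, s ≤ t → ∀ x ∈ frontier B,
      |u t x - u s x| ≤ (M2 * M1) * (t - s) := by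
    intro s hs t ht hst x hx
    have hM2 : 0 ≤ M2 := (norm_nonneg _).trans (b2 s (Ioo_subset_Icc_self hs))
    rw [hbd t ht x hx, hbd s hs x hx, ← sub_mul, abs_mul]
    have h3 := (convex_Icc (0:ℝ) T).norm_image_sub_le_of_norm_deriv_le (f := g0) (C := M2)
      (fun y _ => hdg y) (fun y hy => b2 y hy) (Ioo_subset_Icc_self hs) (Ioo_subset_Icc_self ht)
    rw [Real.norm_eq_abs, Real.norm_eq_abs, abs_of_nonneg (sub_nonneg.2 hst)] at h3
    calc _ ≤ (M2 * (t - s)) * M1 := mul_le_mul h3 (b1 x hx) (abs_nonneg _)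
          (mul_nonneg hM2 (sub_nonneg.2 hst))
      _ = _ := by ring
  have hβu : ∀ t ∈ Ioo 0 T, ∀ x ∈ frontier B, β ≤ β / α * |u t x| := by
    intro t ht x hx
    have h3 := h1 t ht x hx
    rw [← hbd t ht x hx] at h3
    calc β = β / α * α := by field_simp
      _ ≤ _ := by gcongr
  refine ⟨⟨r2, r4, r3, hc2, fun t ht x hx =>
    time_deriv (coefg hg hθ hgθ) hB hBb r2 r3 hc2 hpde hlip ht hx, hpde⟩, fun t ht x hx => ?_⟩
  have h3 := h2 t ht x hx
  have h4 : deriv (fun s => u s x) t = deriv (fun s => g0 s * w x) t := by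
    refine Filter.EventuallyEq.deriv_eq ?_
    filter_upwards [isOpen_Ioo.mem_nhds ht] with s hs using hbd s hs x hx
  have h5 : tangGrad ν (u t) x = tangGrad ν (fun y => g0 t * w y) x := by
    have ht' := Ioo_subset_Icc_self ht
    refine tang_eq hB hB4 hν (r1 t ht') ?_ ?_ (fun y hy => hbd t ht y hy) hx
    · exact r4.comp (f := fun y => (t, y)) (by fun_prop) fun y hy => ⟨ht', hy⟩
    · exact (hw.differentiable one_ne_zero).const_mul (g0 t)
  have h6 := hβu t ht x hx
  refine ⟨?_, normalDeriv ν (u t) x, ?_⟩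
  · beta_reduce
    rw [h4]
    have := norm_nonneg (tangGrad ν (fun y => g0 t * w y) x)
    linarith
  · change ‖tangGrad ν (u t) x‖ ≤ _
    rw [h5]
    have := abs_nonneg (deriv (fun s => g0 s * w x) t)
    linarith

lemma main_aux
    (g : Eucl (m + 1) → Matrix (Fin (m + 1)) (Fin (m + 1)) ℝ) (hg : MetricC3Bounded g)
    (θ : ℝ) (hθ : 0 < θ) (hgθ : UniformlyElliptic g θ)
    (B Ω : Set (Eucl (m + 1)))
    (hBop : IsOpen B) (hBconn : IsConnected B) (hBbdd : Bornology.IsBounded B)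
    (hBC4 : HasC4Boundary B)
    (hΩconn : IsConnected Ω) (hΩbdd : Bornology.IsBounded Ω)
    (hΩC4 : HasC4Boundary Ω)
    (hΩB : closure Ω ⊆ B)
    (νS νΓ : Eucl (m + 1) → Eucl (m + 1))
    (hνS : IsOutwardNormalField B νS) (hνΓ : IsOutwardNormalField Ω νΓ)
    (T : ℝ) (hT : 0 < T)
    (α β : ℝ) (hα : 0 < α) (hβ : 0 < β)
    (g₀ : ℝ → ℝ) (hg₀ : ContDiff ℝ 1 g₀) :
    ∃ C : ℝ, 0 < C ∧
      ∀ A₁ : Eucl (m + 1) → ℝ, ContDiff ℝ 1 A₁ →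
        (∀ t ∈ Ioo (0 : ℝ) T, ∀ x ∈ frontier B, α ≤ |g₀ t * A₁ x|) →
        (∀ t ∈ Ioo (0 : ℝ) T, ∀ x ∈ frontier B,
          |deriv (fun s => g₀ s * A₁ x) t| +
            ‖tangGrad νS (fun y => g₀ t * A₁ y) x‖ ≤ β) →
      ∀ u : ℝ → Eucl (m + 1) → ℝ, ParabolicReg T (closure B) u →
        (∀ t ∈ Ioo (0 : ℝ) T, ∀ x ∈ B,
          deriv (fun s => u s x) t - LapBel g (u t) x = 0) →
        (∀ t ∈ Ioo (0 : ℝ) T, ∀ x ∈ frontier B, u t x = g₀ t * A₁ x) →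
        Real.sqrt (∫ x in frontier B,
            ((A₁ x) ^ 2 + ‖tangGrad νS A₁ x‖ ^ 2) ∂μH[(m:ℝ)]) ≤
          C * (Real.sqrt (I2 μH[(m:ℝ)] T (frontier Ω) fun t x =>
                  ((u t x) ^ 2 + (deriv (fun s => u s x) t) ^ 2 +
                    ‖tangGrad νΓ (u t) x‖ ^ 2)) +
               Real.sqrt (I2 μH[(m:ℝ)] T (frontier Ω) fun t x =>
                  (normalDeriv νΓ (u t) x) ^ 2)) := by
  have hmB : MeasurableSet (frontier B) := isClosed_frontier.measurableSet
  by_cases hz : ∃ t ∈ Ioo 0 T, g₀ t = 0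
  · obtain ⟨t, ht, h0⟩ := hz
    refine ⟨1, one_pos, fun A₁ _ h1 _ u _ _ _ => ?_⟩
    have hem : frontier B = ∅ := by
      refine eq_empty_iff_forall_notMem.2 fun x hx => ?_
      have := h1 t ht x hx
      rw [h0, zero_mul, abs_zero] at this
      linarith
    rw [hem, setIntegral_empty, Real.sqrt_zero]
    positivity
  have h0 : ∀ t ∈ Ioo 0 T, g₀ t ≠ 0 := fun t ht h => hz ⟨t, ht, h⟩
  have hL : 0 ≤ β / α := by positivity
  have hne : (frontier Ω).Nonempty := by
    rw [nonempty_frontier_iff]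
    refine ⟨hΩconn.nonempty, fun h => ?_⟩
    rw [h] at hΩbdd
    exact NormedSpace.unbounded_univ ℝ (Eucl (m + 1)) hΩbdd
  obtain ⟨C, hC, H⟩ := abs_est
    (finStp (coefg hg hθ hgθ) (L := β / α) hT hBop hBbdd νS Ω)
    hBconn.isPreconnected hBC4 hνS hL (fun u ut h => h.2) (g0 := g₀) hg₀.continuous.continuousOn
    h0 hΩC4 hΩbdd hΩB (fun u ut _ => le_rfl) hne
  have hC' : 0 ≤ (1 + (β / α) ^ 2) * C := by positivity
  refine ⟨Real.sqrt ((1 + (β / α) ^ 2) * C) + 1, by positivity,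
    fun A₁ hA h1 h2 u hu pde hbd => ?_⟩
  have hadm := reg_adm hg hθ hgθ hBop hBbdd hBC4 hνS hα hβ hg₀ hA h1 h2 hu pde hbd
  have h3 : ∫ x in frontier B, A₁ x ^ 2 ∂μH[(m:ℝ)] ≤
      C * I2 μH[(m:ℝ)] T (frontier Ω) (nden T 0 u (fun t x => deriv (fun s => u s x) t)) :=
    H u _ hadm A₁ hA.continuous hbd
  rw [energy_split hBbdd hΩC4 hΩbdd hΩB hνΓ hadm.1] at h3
  have hmΩ : MeasurableSet (frontier Ω) := isClosed_frontier.measurableSet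
  have n1 : 0 ≤ I2 μH[(m:ℝ)] T (frontier Ω) (fun t x => (u t x) ^ 2 +
      (deriv (fun s => u s x) t) ^ 2 + ‖tangGrad νΓ (u t) x‖ ^ 2) :=
    I2_nonneg hmΩ fun t _ x _ => by positivity
  have n2 : 0 ≤ I2 μH[(m:ℝ)] T (frontier Ω) (fun t x => (normalDeriv νΓ (u t) x) ^ 2) :=
    I2_nonneg hmΩ fun t _ x _ => by positivity
  set J1 := I2 μH[(m:ℝ)] T (frontier Ω) (fun t x => (u t x) ^ 2 +
      (deriv (fun s => u s x) t) ^ 2 + ‖tangGrad νΓ (u t) x‖ ^ 2)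
  set J2 := I2 μH[(m:ℝ)] T (frontier Ω) (fun t x => (normalDeriv νΓ (u t) x) ^ 2)
  have hT2 : T / 2 ∈ Ioo 0 T := ⟨by linarith, by linarith⟩
  have h4 : ∀ x ∈ frontier B, ‖tangGrad νS A₁ x‖ ≤ β / α * |A₁ x| := by
    intro x hx
    have e1 := h2 _ hT2 x hx
    have e2 := h1 _ hT2 x hx
    rw [tang_smul _ (hA.differentiable one_ne_zero x), norm_smul, Real.norm_eq_abs] at e1
    rw [abs_mul] at e2
    have e3 := abs_pos.2 (h0 _ hT2)
    have e4 := abs_nonneg (deriv (fun s => g₀ s * A₁ x) (T / 2))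
    refine le_of_mul_le_mul_left (a := |g₀ (T / 2)|) ?_ e3
    calc _ ≤ β := by linarith
      _ = β / α * α := by field_simp
      _ ≤ β / α * (|g₀ (T / 2)| * |A₁ x|) := by gcongr
      _ = _ := by ring
  have hi := sq_intOn hBC4 hBbdd hA.continuous.continuousOn
  have h5 : ∫ x in frontier B, ((A₁ x) ^ 2 + ‖tangGrad νS A₁ x‖ ^ 2) ∂μH[(m:ℝ)] ≤
      (1 + (β / α) ^ 2) * ∫ x in frontier B, A₁ x ^ 2 ∂μH[(m:ℝ)] := by
    rw [← integral_const_mul]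
    refine integral_mono_of_nonneg (Filter.Eventually.of_forall fun x => by positivity)
      (hi.const_mul _) ?_
    filter_upwards [ae_restrict_mem hmB] with x hx
    have e1 := pow_le_pow_left₀ (norm_nonneg _) (h4 x hx) 2
    rw [mul_pow, sq_abs] at e1
    linarith
  have h6 : ∫ x in frontier B, ((A₁ x) ^ 2 + ‖tangGrad νS A₁ x‖ ^ 2) ∂μH[(m:ℝ)] ≤
      ((1 + (β / α) ^ 2) * C) * (J1 + J2) := by
    refine h5.trans ?_
    rw [mul_assoc]
    gcongr
  calc _ ≤ Real.sqrt (((1 + (β / α) ^ 2) * C) * (J1 + J2)) := Real.sqrt_le_sqrt h6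
    _ = Real.sqrt ((1 + (β / α) ^ 2) * C) * Real.sqrt (J1 + J2) := Real.sqrt_mul hC' _
    _ ≤ Real.sqrt ((1 + (β / α) ^ 2) * C) * (Real.sqrt J1 + Real.sqrt J2) := by
        gcongr
        rw [Real.sqrt_le_left (by positivity), add_sq, Real.sq_sqrt n1, Real.sq_sqrt n2]
        have : 0 ≤ 2 * Real.sqrt J1 * Real.sqrt J2 := by positivity
        linarith
    _ ≤ _ := by
        gcongr
        linarith

end final

/-- **Stability for separated boundary data (Corollary 4.2).** -/
theorem parabolic_stability_separated_data
    (n : ℕ) (hn : 2 ≤ n)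
    (g : Eucl n → Matrix (Fin n) (Fin n) ℝ) (hg : MetricC3Bounded g)
    (θ : ℝ) (hθ : 0 < θ) (hgθ : UniformlyElliptic g θ)
    (B Ω : Set (Eucl n))
    (hBop : IsOpen B) (hBconn : IsConnected B) (hBbdd : Bornology.IsBounded B)
    (hBC4 : HasC4Boundary B)
    (hΩop : IsOpen Ω) (hΩconn : IsConnected Ω) (hΩbdd : Bornology.IsBounded Ω)
    (hΩC4 : HasC4Boundary Ω)
    (hΩB : closure Ω ⊆ B)
    (νS νΓ : Eucl n → Eucl n)
    (hνS : IsOutwardNormalField B νS) (hνΓ : IsOutwardNormalField Ω νΓ)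
    (T : ℝ) (hT : 0 < T)
    (α β : ℝ) (hα : 0 < α) (hβ : 0 < β)
    (g₀ : ℝ → ℝ) (hg₀ : ContDiff ℝ 1 g₀) :
    ∃ C : ℝ, 0 < C ∧
      ∀ A₁ : Eucl n → ℝ, ContDiff ℝ 1 A₁ →
        (∀ t ∈ Ioo (0 : ℝ) T, ∀ x ∈ frontier B, α ≤ |g₀ t * A₁ x|) →
        (∀ t ∈ Ioo (0 : ℝ) T, ∀ x ∈ frontier B,
          |deriv (fun s => g₀ s * A₁ x) t| +
            ‖tangGrad νS (fun y => g₀ t * A₁ y) x‖ ≤ β) →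
      ∀ u : ℝ → Eucl n → ℝ, ParabolicReg T (closure B) u →
        (∀ t ∈ Ioo (0 : ℝ) T, ∀ x ∈ B,
          deriv (fun s => u s x) t - LapBel g (u t) x = 0) →
        (∀ t ∈ Ioo (0 : ℝ) T, ∀ x ∈ frontier B, u t x = g₀ t * A₁ x) →
        Real.sqrt (∫ x in frontier B,
            ((A₁ x) ^ 2 + ‖tangGrad νS A₁ x‖ ^ 2) ∂μH[(n : ℝ) - 1]) ≤
          C * (Real.sqrt (∫ t in Ioo (0 : ℝ) T, ∫ x in frontier Ω,
                  ((u t x) ^ 2 + (deriv (fun s => u s x) t) ^ 2 +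
                    ‖tangGrad νΓ (u t) x‖ ^ 2) ∂μH[(n : ℝ) - 1]) +
               Real.sqrt (∫ t in Ioo (0 : ℝ) T, ∫ x in frontier Ω,
                  (normalDeriv νΓ (u t) x) ^ 2 ∂μH[(n : ℝ) - 1])) := by
  obtain ⟨m, rfl⟩ : ∃ m, n = m + 1 := ⟨n - 1, by omega⟩
  have e : (((m + 1 : ℕ) : ℝ) - 1) = (m : ℝ) := by push_cast; ring
  rw [e]
  exact main_aux g hg θ hθ hgθ B Ω hBop hBconn hBbdd hBC4 hΩconn hΩbdd hΩC4 hΩB νS νΓ hνS hνΓ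
    T hT α β hα hβ g₀ hg₀
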